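/- Let k be an algebraically closed field of characteristic 0 and let d ≥ 2. Let F = (F₀,F₁,F₂) and G = (G₀,G₁,G₂) be triples of homogeneous polynomials of degree d in k[x,y,z] with no common zero in k³∖{0}, defining endomorphisms f₁ and f₂ of the projective plane P²_k of degree d. Suppose there exists a k-algebra automorphism φ of the rational function field k(x,y) such that f₁* ∘ φ = φ ∘ f₂*, where f_i* is the pullback k-algebra endomorphism of k(x,y) determined by f_i (this says exactly that f₁ and f₂ are conjugate by a birational self-map of P²_k). Then there exist a matrix M ∈ GL₃(k) and a constant c ∈ k^× such that M·(F₀(v),F₁(v),F₂(v)) = c·(G₀(Mv),G₁(Mv),G₂(Mv)) for all v ∈ k³; that is, f₁ and f₂ are conjugate by a linear automorphism of P²_k. -/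

import Mathlib

open Matrix MvPolynomial

section Homogeneous

variable {σ k : Type*} [Field k]

/-- The substitution `X i ↦ X i * t`. -/
noncomputable def gradingHom (σ k : Type*) [Field k] :
    MvPolynomial σ k →ₐ[k] Polynomial (MvPolynomial σ k) :=
  aeval fun i => Polynomial.C (X i) * Polynomial.X

theorem gradingHom_monomial (s : σ →₀ ℕ) (r : k) :
    gradingHom σ k (monomial s r) =
      Polynomial.C (monomial s r) * Polynomial.X ^ s.degree := by
  rw [gradingHom, aeval_monomial, monomial_eq, Finsupp.degree_apply, Finsupp.prod, Finsupp.prod]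
  simp only [mul_pow, Finset.prod_mul_distrib, Finset.prod_pow_eq_pow_sum, map_mul, map_prod,
    map_pow]
  rw [mul_assoc]
  rfl

theorem coeff_gradingHom (p : MvPolynomial σ k) (n : ℕ) :
    (gradingHom σ k p).coeff n = homogeneousComponent n p := by
  classical
  induction p using MvPolynomial.induction_on' with
  | monomial s r =>
    rw [gradingHom_monomial, Polynomial.coeff_C_mul_X_pow]
    split_ifs with h
    · subst h
      rw [homogeneousComponent_of_mem (isHomogeneous_monomial r rfl), if_pos rfl]
    · rw [homogeneousComponent_of_mem (isHomogeneous_monomial r rfl), if_neg]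
      exact h
  | add p q hp hq => simp [hp, hq]

theorem MvPolynomial.IsHomogeneous.gradingHom_eq {p : MvPolynomial σ k} {n : ℕ}
    (h : p.IsHomogeneous n) : gradingHom σ k p = Polynomial.C p * Polynomial.X ^ n := by
  ext1 m
  rw [coeff_gradingHom, homogeneousComponent_of_mem h, Polynomial.coeff_C_mul_X_pow]

theorem isHomogeneous_of_homogeneousComponent {p : MvPolynomial σ k} {n : ℕ}
    (h : ∀ m, m ≠ n → homogeneousComponent m p = 0) : p.IsHomogeneous n := by
  rw [← sum_homogeneousComponent p]
  refine IsHomogeneous.sum _ _ _ fun m _ => ?_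
  rcases eq_or_ne m n with rfl | hm
  · exact homogeneousComponent_isHomogeneous _ _
  · rw [h m hm]
    exact isHomogeneous_zero _ _ _

theorem isHomogeneous_of_mul {p q : MvPolynomial σ k} {n : ℕ}
    (h : (p * q).IsHomogeneous n) (h0 : p * q ≠ 0) : ∃ m, p.IsHomogeneous m := by
  have e := h.gradingHom_eq
  rw [map_mul] at e
  have hC : (Polynomial.C (p * q)) ≠ 0 := by simpa using h0
  have ne : gradingHom σ k p * gradingHom σ k q ≠ 0 := by
    rw [e]
    exact mul_ne_zero hC (pow_ne_zero _ Polynomial.X_ne_zero)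
  have h1 := Polynomial.natDegree_mul (left_ne_zero_of_mul ne) (right_ne_zero_of_mul ne)
  have h2 := Polynomial.natTrailingDegree_mul (left_ne_zero_of_mul ne) (right_ne_zero_of_mul ne)
  rw [e, Polynomial.natDegree_C_mul_X_pow n _ h0] at h1
  rw [e, Polynomial.C_mul_X_pow_eq_monomial, Polynomial.natTrailingDegree_monomial h0] at h2
  have h3 := Polynomial.natTrailingDegree_le_natDegree (gradingHom σ k p)
  have h4 := Polynomial.natTrailingDegree_le_natDegree (gradingHom σ k q)
  refine ⟨(gradingHom σ k p).natDegree, isHomogeneous_of_homogeneousComponent fun m hm => ?_⟩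
  rw [← coeff_gradingHom]
  rcases lt_or_gt_of_ne hm with hm | hm
  · exact Polynomial.coeff_eq_zero_of_lt_natTrailingDegree (by omega)
  · exact Polynomial.coeff_eq_zero_of_natDegree_lt hm

theorem isHomogeneous_of_dvd {p q : MvPolynomial σ k} {n : ℕ}
    (h : q.IsHomogeneous n) (h0 : q ≠ 0) (hpq : p ∣ q) : ∃ m, p.IsHomogeneous m := by
  obtain ⟨r, rfl⟩ := hpq
  exact isHomogeneous_of_mul h h0

theorem MvPolynomial.IsHomogeneous.of_mul_left {p q : MvPolynomial σ k} {m n : ℕ}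
    (hp : p.IsHomogeneous m) (h : (p * q).IsHomogeneous (m + n)) (hp0 : p ≠ 0) :
    q.IsHomogeneous n := by
  rcases eq_or_ne q 0 with rfl | hq
  · exact isHomogeneous_zero _ _ _
  obtain ⟨l, hl⟩ := isHomogeneous_of_mul (p := q) (q := p) (by rwa [mul_comm])
    (mul_ne_zero hq hp0)
  have := (hp.mul hl).inj_right h (mul_ne_zero hp0 hq)
  obtain rfl : l = n := by omega
  exact hl

theorem MvPolynomial.IsHomogeneous.exists_mul_eq {p q : MvPolynomial σ k} {m n : ℕ}
    (hp : p.IsHomogeneous m) (hq : q.IsHomogeneous n) (hq0 : q ≠ 0) (h : p ∣ q) :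
    ∃ r, q = p * r ∧ r.IsHomogeneous (n - m) ∧ m ≤ n := by
  obtain ⟨r, rfl⟩ := h
  obtain ⟨l, hl⟩ := isHomogeneous_of_mul (p := r) (q := p) (by rwa [mul_comm])
    (by rwa [mul_comm])
  have := (hp.mul hl).inj_right hq hq0
  obtain rfl : l = n - m := by omega
  exact ⟨r, rfl, hl, by omega⟩

theorem MvPolynomial.IsHomogeneous.exists_eq_C {p : MvPolynomial σ k}
    (hp : p.IsHomogeneous 0) : ∃ c : k, p = C c :=
  ⟨_, totalDegree_eq_zero_iff_eq_C.1 ((totalDegree_zero_iff_isHomogeneous σ).2 hp)⟩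

theorem MvPolynomial.IsHomogeneous.isUnit_of_zero {p : MvPolynomial σ k}
    (hp : p.IsHomogeneous 0) (h0 : p ≠ 0) : IsUnit p := by
  obtain ⟨c, rfl⟩ := hp.exists_eq_C
  rw [Ne, C_eq_zero] at h0
  exact (IsUnit.mk0 c h0).map C

theorem MvPolynomial.IsHomogeneous.zero_of_isUnit {p : MvPolynomial σ k} {n : ℕ}
    (hp : p.IsHomogeneous n) (h : IsUnit p) : n = 0 := by
  obtain ⟨r, hr, -, hn⟩ := hp.exists_mul_eq (isHomogeneous_one σ k) one_ne_zero h.dvd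
  omega

theorem MvPolynomial.IsHomogeneous.eq_C_of_dvd {p q : MvPolynomial σ k} {n : ℕ}
    (hp : p.IsHomogeneous n) (hq : q.IsHomogeneous n) (h : p ∣ q) : ∃ c : k, q = C c * p := by
  rcases eq_or_ne q 0 with rfl | hq0
  · exact ⟨0, by simp⟩
  obtain ⟨r, hr, hr', -⟩ := hp.exists_mul_eq hq hq0 h
  rw [Nat.sub_self] at hr'
  obtain ⟨c, rfl⟩ := hr'.exists_eq_C
  exact ⟨c, by rw [hr, mul_comm]⟩

theorem homogeneousComponent_mul_of_isHomogeneous {u f : MvPolynomial σ k} {a : ℕ}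
    (hf : f.IsHomogeneous a) (n : ℕ) :
    homogeneousComponent n (u * f) = if a ≤ n then homogeneousComponent (n - a) u * f else 0 := by
  rw [← coeff_gradingHom, ← coeff_gradingHom, map_mul, hf.gradingHom_eq, ← mul_assoc,
    Polynomial.coeff_mul_X_pow', Polynomial.coeff_mul_C]

theorem exists_homogeneous_combination {ι : Type*} {s : Finset ι} {f u : ι → MvPolynomial σ k}
    {a : ι → ℕ} {n : ℕ} (hf : ∀ i, (f i).IsHomogeneous (a i))
    (hT : (∑ i ∈ s, u i * f i).IsHomogeneous n) :
    ∃ w : ι → MvPolynomial σ k, (∀ i, (w i).IsHomogeneous (n - a i)) ∧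
      (∀ i, n < a i → w i = 0) ∧ ∑ i ∈ s, u i * f i = ∑ i ∈ s, w i * f i := by
  refine ⟨fun i => if a i ≤ n then homogeneousComponent (n - a i) (u i) else 0, fun i => ?_,
    fun i hi => if_neg (by omega), ?_⟩
  · dsimp only
    split_ifs
    · exact homogeneousComponent_isHomogeneous _ _
    · exact isHomogeneous_zero _ _ _
  · conv_lhs => rw [← homogeneousComponent_eq_self hT, map_sum]
    refine Finset.sum_congr rfl fun i _ => ?_
    rw [homogeneousComponent_mul_of_isHomogeneous (hf i), ite_mul, zero_mul]

end Homogeneous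

section Dimension

variable (k : Type*) [Field k]

theorem two_mul_finrank_homogeneousSubmodule (n : ℕ) :
    2 * Module.finrank k (homogeneousSubmodule (Fin 3) k n) = (n + 1) * (n + 2) := by
  have e : homogeneousSubmodule (Fin 3) k n =
      restrictSupport k ((Finset.univ.finsuppAntidiag n : Finset (Fin 3 →₀ ℕ)) :
        Set (Fin 3 →₀ ℕ)) := by
    rw [homogeneousSubmodule_eq_finsupp_supported, restrictSupport]
    congr 1
    ext s
    simp [Finsupp.degree_eq_sum, Finset.mem_finsuppAntidiag]
  rw [e, Module.finrank_eq_nat_card_basis (basisRestrictSupport k _), Nat.card_coe_set_eq,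
    Set.ncard_coe_finset, Finset.card_finsuppAntidiag_nat_eq_choose, Finset.card_univ,
    Fintype.card_fin, show 3 + n - 1 = n + 2 by omega, Nat.choose_symm_add, Nat.choose_two_right]
  have := Nat.even_mul_pred_self (n + 2)
  rw [show n + 2 - 1 = n + 1 by omega] at *
  rw [Nat.mul_div_cancel' this.two_dvd, mul_comm]

instance finite_homogeneousSubmodule (n : ℕ) :
    Module.Finite k (homogeneousSubmodule (Fin 3) k n) :=
  Module.Finite.iff_fg.2 (homogeneousSubmodule_fg _ _ n)

variable {k}

/-- The map `(u, v) ↦ u * f + v * g` on pairs of forms of degrees `m + b` and `m + a`. -/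
noncomputable def combinationMap (f g : MvPolynomial (Fin 3) k) (m a b : ℕ) :
    (homogeneousSubmodule (Fin 3) k (m + b) × homogeneousSubmodule (Fin 3) k (m + a)) →ₗ[k]
      MvPolynomial (Fin 3) k :=
  LinearMap.coprod (LinearMap.mulRight k f ∘ₗ Submodule.subtype _)
    (LinearMap.mulRight k g ∘ₗ Submodule.subtype _)

theorem combinationMap_apply (f g : MvPolynomial (Fin 3) k) (m a b : ℕ) (x) :
    combinationMap f g m a b x = x.1.1 * f + x.2.1 * g := rfl

theorem range_combinationMap_le {f g : MvPolynomial (Fin 3) k} {a b : ℕ}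
    (hf : f.IsHomogeneous a) (hg : g.IsHomogeneous b) (m : ℕ) :
    LinearMap.range (combinationMap f g m a b) ≤ homogeneousSubmodule (Fin 3) k (m + a + b) := by
  rintro _ ⟨x, rfl⟩
  rw [combinationMap_apply]
  refine IsHomogeneous.add ?_ ?_
  · have := IsHomogeneous.mul x.1.2 hf
    rwa [show m + b + a = m + a + b by ring] at this
  · exact IsHomogeneous.mul x.2.2 hg

theorem finrank_range_combinationMap (f g : MvPolynomial (Fin 3) k) (m a b : ℕ) :
    Module.finrank k (LinearMap.range (combinationMap f g m a b)) +
      Module.finrank k (LinearMap.ker (combinationMap f g m a b)) =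
      Module.finrank k (homogeneousSubmodule (Fin 3) k (m + b)) +
        Module.finrank k (homogeneousSubmodule (Fin 3) k (m + a)) := by
  rw [LinearMap.finrank_range_add_finrank_ker, Module.finrank_prod]

theorem finrank_range_combinationMap_le {f g : MvPolynomial (Fin 3) k} {a b : ℕ}
    (hf : f.IsHomogeneous a) (hg : g.IsHomogeneous b) (h0 : f ≠ 0 ∨ g ≠ 0) (m : ℕ) :
    Module.finrank k (LinearMap.range (combinationMap f g m a b)) + a * b ≤
      Module.finrank k (homogeneousSubmodule (Fin 3) k (m + a + b)) := by
  have h1 := finrank_range_combinationMap f g m a b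
  let φ : homogeneousSubmodule (Fin 3) k m →ₗ[k] LinearMap.ker (combinationMap f g m a b) :=
    { toFun := fun w => ⟨(⟨w.1 * g, IsHomogeneous.mul w.2 hg⟩,
        ⟨-(w.1 * f), (IsHomogeneous.mul w.2 hf).neg⟩), by
          rw [LinearMap.mem_ker, combinationMap_apply]; ring⟩
      map_add' := fun x y => by
        ext1; ext1 <;> ext1
        · exact add_mul x.1 y.1 g
        · change -((x.1 + y.1) * f) = -(x.1 * f) + -(y.1 * f)
          ring
      map_smul' := fun c x => by
        ext1; ext1 <;> ext1
        · exact smul_mul_assoc c x.1 g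
        · change -((c • x.1) * f) = c • -(x.1 * f)
          rw [smul_mul_assoc, smul_neg] }
  have h2 : Module.finrank k (homogeneousSubmodule (Fin 3) k m) ≤
      Module.finrank k (LinearMap.ker (combinationMap f g m a b)) := by
    refine LinearMap.finrank_le_finrank_of_injective (f := φ) ?_
    rw [injective_iff_map_eq_zero]
    intro w hw
    have e := congrArg Subtype.val hw
    have e1 : w.1 * g = 0 := congrArg (fun z => z.1.1) e
    have e2 : -(w.1 * f) = 0 := congrArg (fun z => z.2.1) e
    rw [neg_eq_zero] at e2
    ext1
    rcases h0 with h0 | h0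
    · exact (mul_eq_zero.1 e2).resolve_right h0
    · exact (mul_eq_zero.1 e1).resolve_right h0
  have d1 := two_mul_finrank_homogeneousSubmodule k m
  have d2 := two_mul_finrank_homogeneousSubmodule k (m + a)
  have d3 := two_mul_finrank_homogeneousSubmodule k (m + b)
  have d4 := two_mul_finrank_homogeneousSubmodule k (m + a + b)
  nlinarith

theorem le_finrank_range_combinationMap {f g : MvPolynomial (Fin 3) k} {a b : ℕ}
    (hg : g.IsHomogeneous b) (hg0 : g ≠ 0) (hfg : IsRelPrime f g) (m : ℕ) :
    Module.finrank k (homogeneousSubmodule (Fin 3) k (m + a + b)) ≤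
      Module.finrank k (LinearMap.range (combinationMap f g m a b)) + a * b := by
  have h1 := finrank_range_combinationMap f g m a b
  have key : ∀ x : homogeneousSubmodule (Fin 3) k (m + b) ×
      homogeneousSubmodule (Fin 3) k (m + a), combinationMap f g m a b x = 0 →
      ∃ r, r.IsHomogeneous m ∧ x.1.1 = g * r ∧ x.2.1 = -(f * r) := by
    intro x hx
    rw [combinationMap_apply] at hx
    have hd : g ∣ x.1.1 * f := ⟨-x.2.1, by linear_combination hx⟩
    obtain ⟨r, hr⟩ := hfg.symm.dvd_of_dvd_mul_right hd
    refine ⟨r, IsHomogeneous.of_mul_left (p := g) (q := r) hg ?_ hg0, hr, ?_⟩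
    · have h : x.1.1.IsHomogeneous (m + b) := x.1.2
      rw [← hr]
      convert h using 1
      ring
    · apply mul_right_cancel₀ hg0
      rw [hr] at hx
      linear_combination hx
  let ψ : LinearMap.ker (combinationMap f g m a b) →ₗ[k] MvPolynomial (Fin 3) k :=
    (Submodule.subtype _ ∘ₗ LinearMap.fst k _ _) ∘ₗ Submodule.subtype _
  have h2 : Module.finrank k (LinearMap.ker (combinationMap f g m a b)) ≤
      Module.finrank k (homogeneousSubmodule (Fin 3) k m) := by
    have hψ : Function.Injective ψ := by
      rw [injective_iff_map_eq_zero]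
      rintro ⟨x, hx⟩ e
      obtain ⟨r, -, e1, e2⟩ := key x hx
      change x.1.1 = 0 at e
      have : r = 0 := by
        rw [e1] at e
        exact (mul_eq_zero.1 e).resolve_left hg0
      subst this
      ext1; ext1 <;> ext1
      · exact e
      · simpa using e2
    rw [← LinearMap.finrank_range_of_inj hψ]
    have hle : LinearMap.range ψ ≤
        (homogeneousSubmodule (Fin 3) k m).map (LinearMap.mulLeft k g) := by
      rintro _ ⟨⟨x, hx⟩, rfl⟩
      obtain ⟨r, hr, e1, e2⟩ := key x hx
      exact ⟨r, hr, e1.symm⟩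
    exact (Submodule.finrank_mono hle).trans (Submodule.finrank_map_le _ _)
  have d1 := two_mul_finrank_homogeneousSubmodule k m
  have d2 := two_mul_finrank_homogeneousSubmodule k (m + a)
  have d3 := two_mul_finrank_homogeneousSubmodule k (m + b)
  have d4 := two_mul_finrank_homogeneousSubmodule k (m + a + b)
  nlinarith

end Dimension

section Nullstellensatz

variable {k : Type*} [Field k] [IsAlgClosed k]

theorem exists_X_pow_mem {σ : Type*} [Finite σ] (I : Ideal (MvPolynomial σ k))
    (h : ∀ v : σ → k, (∀ p ∈ I, eval v p = 0) → v = 0) :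
    ∃ N, ∀ i, (X i : MvPolynomial σ k) ^ N ∈ I := by
  have h1 : ∀ i, ∃ N, (X i : MvPolynomial σ k) ^ N ∈ I := by
    intro i
    have : (X i : MvPolynomial σ k) ∈ I.radical := by
      rw [← vanishingIdeal_zeroLocus_eq_radical (K := k), mem_vanishingIdeal_iff]
      intro v hv
      have := h v fun p hp => by simpa using hv p hp
      simp [this]
    exact this
  choose N hN using h1
  cases nonempty_fintype σ
  exact ⟨∑ i, N i, fun i => I.pow_mem_of_pow_mem (hN i)
    (Finset.single_le_sum (fun _ _ => Nat.zero_le _) (Finset.mem_univ i))⟩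

theorem exists_forall_isHomogeneous_mem (I : Ideal (MvPolynomial (Fin 3) k))
    (h : ∀ v : Fin 3 → k, (∀ p ∈ I, eval v p = 0) → v = 0) :
    ∃ N, ∀ n, N ≤ n → ∀ p : MvPolynomial (Fin 3) k, p.IsHomogeneous n → p ∈ I := by
  obtain ⟨N, hN⟩ := exists_X_pow_mem I h
  refine ⟨3 * N, fun n hn p hp => ?_⟩
  rw [← support_sum_monomial_coeff p]
  refine Ideal.sum_mem _ fun s hs => ?_
  have hs' : s.degree = n := by
    by_contra hne
    exact mem_support_iff.1 hs (hp.coeff_eq_zero hne)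
  rw [Finsupp.degree_eq_sum, Fin.sum_univ_three] at hs'
  have : ∃ i, N ≤ s i := by
    by_contra! hc
    have := hc 0
    have := hc 1
    have := hc 2
    omega
  obtain ⟨i, hi⟩ := this
  refine Ideal.mem_of_dvd _ ?_ (hN i)
  rw [X_pow_eq_monomial, monomial_dvd_monomial]
  exact ⟨Or.inr (by simpa using hi), one_dvd _⟩

theorem exists_common_zero {f g : MvPolynomial (Fin 3) k} {a b : ℕ}
    (hf : f.IsHomogeneous a) (hg : g.IsHomogeneous b) (ha : 0 < a) (hb : 0 < b) :
    ∃ v ≠ 0, eval v f = 0 ∧ eval v g = 0 := by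
  by_contra! hc
  have h0 : f ≠ 0 ∨ g ≠ 0 := by
    by_contra! h
    refine hc (fun _ => 1) ?_ ?_ ?_
    · intro h
      simpa using congrFun h 0
    · simp [h.1]
    · simp [h.2]
  obtain ⟨N, hN⟩ := exists_forall_isHomogeneous_mem (Ideal.span {f, g}) fun v hv => by
    by_contra hv0
    exact hc v hv0 (hv f (Ideal.subset_span (by simp))) (hv g (Ideal.subset_span (by simp)))
  have h1 : homogeneousSubmodule (Fin 3) k (N + a + b) ≤
      LinearMap.range (combinationMap f g N a b) := by
    intro p hp
    obtain ⟨u, v, rfl⟩ := Ideal.mem_span_pair.1 (hN _ (by omega) p hp)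
    obtain ⟨w, hw, -, e⟩ := exists_homogeneous_combination (s := Finset.univ) (f := ![f, g])
      (u := ![u, v]) (a := ![a, b]) (n := N + a + b) (by
        intro i; fin_cases i
        · exact hf
        · exact hg) (by simpa [Fin.sum_univ_two] using hp)
    simp only [Fin.sum_univ_two, cons_val_zero, cons_val_one] at e
    have w0 := hw 0
    have w1 := hw 1
    simp only [cons_val_zero, cons_val_one] at w0 w1
    rw [show N + a + b - a = N + b by omega] at w0
    rw [show N + a + b - b = N + a by omega] at w1
    exact ⟨(⟨w 0, w0⟩, ⟨w 1, w1⟩), e.symm⟩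
  have h2 := Submodule.finrank_mono h1
  have h3 := finrank_range_combinationMap_le hf hg h0 N
  have : 0 < a * b := Nat.mul_pos ha hb
  omega

end Nullstellensatz

section Elimination

variable {k : Type*} [Field k]

theorem exists_homogenize_eq_combination {f g : MvPolynomial (Fin 3) k} {a b : ℕ}
    (hf : f.IsHomogeneous a) (hg : g.IsHomogeneous b) (hg0 : g ≠ 0)
    (hfg : IsRelPrime f g) (i j : Fin 3) :
    ∃ (n : ℕ) (p : Polynomial k) (u v : MvPolynomial (Fin 3) k), p ≠ 0 ∧ p.natDegree ≤ n ∧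
      aeval ![X i, X j] (p.homogenize n) = u * f + v * g := by
  set n := a * b + a + b with hn
  let ψ : Polynomial.degreeLT k (n + 1) →ₗ[k] MvPolynomial (Fin 3) k :=
    (aeval ![X i, X j] : MvPolynomial (Fin 2) k →ₐ[k] _).toLinearMap ∘ₗ
      (Polynomial.homogenizeLM n) ∘ₗ Submodule.subtype _
  let W := LinearMap.range (combinationMap f g (a * b) a b)
  let χ : (Polynomial.degreeLT k (n + 1) × W) →ₗ[k] homogeneousSubmodule (Fin 3) k n :=
    LinearMap.codRestrict _ (LinearMap.coprod ψ (Submodule.subtype _)) (by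
      rintro ⟨p, w⟩
      refine IsHomogeneous.add ?_ (range_combinationMap_le hf hg (a * b) w.2)
      have := (Polynomial.isHomogeneous_homogenize (n := n) p.1).aeval (![X i, X j])
        (n := 1) (S := k) (τ := Fin 3) (by
          intro l; fin_cases l
          · exact isHomogeneous_X _ _
          · exact isHomogeneous_X _ _)
      rwa [one_mul] at this)
  have hd := le_finrank_range_combinationMap (a := a) hg hg0 hfg (a * b)
  have hlt : Module.finrank k (homogeneousSubmodule (Fin 3) k n) <
      Module.finrank k (Polynomial.degreeLT k (n + 1) × W) := by
    rw [Module.finrank_prod, (Polynomial.degreeLTEquiv k (n + 1)).finrank_eq]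
    simp only [Module.finrank_fin_fun]
    change _ ≤ Module.finrank k W + _ at hd
    rw [← hn] at hd
    nlinarith
  obtain ⟨⟨p, w⟩, hx, hx0⟩ := (Submodule.ne_bot_iff _).1 (LinearMap.ker_ne_bot_of_finrank_lt hlt)
  have e : ψ p + w.1 = 0 := by
    have := congrArg Subtype.val (show χ (p, w) = 0 from hx)
    exact this
  obtain ⟨⟨u, v⟩, huv⟩ := w.2
  rw [combinationMap_apply] at huv
  have hp0 : p.1 ≠ 0 := by
    rintro hp
    apply hx0
    have hp : p = 0 := Subtype.ext hp
    subst hp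
    rw [map_zero, zero_add] at e
    ext1
    · rfl
    · exact Subtype.ext e
  refine ⟨n, p.1, -u.1, -v.1, hp0, ?_, ?_⟩
  · have := Polynomial.mem_degreeLT.1 p.2
    exact Nat.lt_succ_iff.1 ((Polynomial.natDegree_lt_iff_degree_lt hp0).2 this)
  · change ψ p = _
    rw [← huv] at e
    linear_combination e

theorem exists_linear_dvd_of_dvd_homogenize [IsAlgClosed k] {R : Type*} [CommRing R] [Algebra k R]
    {π s t : R} (hπ : Prime π) (p : Polynomial k) (n : ℕ) (hp : p ≠ 0) (hn : p.natDegree ≤ n)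
    (h : π ∣ aeval ![s, t] (p.homogenize n)) :
    ∃ a b : k, (a ≠ 0 ∨ b ≠ 0) ∧ π ∣ a • s + b • t := by
  induction n generalizing p with
  | zero =>
    obtain ⟨c, rfl⟩ : ∃ c, p = Polynomial.C c := ⟨_, Polynomial.eq_C_of_natDegree_le_zero hn⟩
    have hc : c ≠ 0 := by simpa using hp
    rw [Polynomial.homogenize_C, pow_zero, mul_one, ← algebraMap_eq, AlgHom.commutes] at h
    exact absurd (isUnit_of_dvd_unit h ((IsUnit.mk0 c hc).map _)) hπ.not_isUnit
  | succ n ih =>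
    rcases Nat.lt_or_ge n p.natDegree with hlt | hle
    · obtain ⟨α, hα⟩ := IsAlgClosed.exists_root p (by
        intro h0
        have := Polynomial.natDegree_eq_zero_iff_degree_le_zero.2 h0.le
        omega)
      obtain ⟨q, rfl⟩ := Polynomial.dvd_iff_isRoot.2 hα
      have hq : q ≠ 0 := right_ne_zero_of_mul hp
      rw [Polynomial.natDegree_mul (Polynomial.X_sub_C_ne_zero α) hq,
        Polynomial.natDegree_X_sub_C] at hn
      have hqn : q.natDegree ≤ n := by omega
      rw [add_comm n 1, Polynomial.homogenize_mul _ _ (Polynomial.natDegree_X_sub_C_le α) hqn,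
        map_mul] at h
      rcases hπ.dvd_or_dvd h with h | h
      · refine ⟨1, -α, Or.inl one_ne_zero, ?_⟩
        rw [Polynomial.homogenize_sub, Polynomial.homogenize_X one_ne_zero,
          Polynomial.homogenize_C] at h
        simpa [Algebra.smul_def, sub_eq_add_neg] using h
      · exact ih q hq hqn h
    · have := Polynomial.homogenize_mul 1 p (m := 1) (n := n) (by simp) hle
      rw [one_mul, add_comm 1 n, Polynomial.homogenize_one, pow_one] at this
      rw [this, map_mul] at h
      rcases hπ.dvd_or_dvd h with h | h
      · exact ⟨0, 1, Or.inr one_ne_zero, by simpa using h⟩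
      · exact ih p hp hle h

end Elimination

section Jacobian

variable {k : Type*} [Field k]

theorem derivation_algHom_apply {R : Type*} [CommRing R] [Algebra k R] (D : Derivation k R R)
    (Φ : MvPolynomial (Fin 3) k →ₐ[k] R) (T : MvPolynomial (Fin 3) k) :
    D (Φ T) = ∑ l, Φ (pderiv l T) * D (Φ (X l)) := by
  induction T using MvPolynomial.induction_on with
  | C a => simp [← algebraMap_eq]
  | add p q hp hq => simp [hp, hq, add_mul, Finset.sum_add_distrib]
  | mul_X p i hp =>
    have : ∀ l, Φ (pderiv l (p * X i)) * D (Φ (X l)) =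
        Φ (X i) * (Φ (pderiv l p) * D (Φ (X l))) + if l = i then Φ p * D (Φ (X l)) else 0 := by
      intro l
      rw [pderiv_mul, map_add, map_mul, map_mul]
      split_ifs with h
      · subst h
        rw [pderiv_X_self, map_one]
        ring
      · rw [pderiv_X_of_ne (Ne.symm h), map_zero]
        ring
    rw [map_mul, Derivation.leibniz, hp, Finset.sum_congr rfl fun l _ => this l,
      Finset.sum_add_distrib, ← Finset.mul_sum]
    simp [add_comm]

/-- The Jacobian determinant of three polynomials in three variables. -/
noncomputable def jacobian (T : Fin 3 → MvPolynomial (Fin 3) k) : MvPolynomial (Fin 3) k :=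
  (Matrix.of fun i j => pderiv j (T i)).det

theorem jacobian_comp (Φ : MvPolynomial (Fin 3) k →ₐ[k] MvPolynomial (Fin 3) k)
    (T : Fin 3 → MvPolynomial (Fin 3) k) :
    jacobian (fun i => Φ (T i)) = Φ (jacobian T) * jacobian fun i => Φ (X i) := by
  rw [jacobian, jacobian, jacobian, AlgHom.map_det, ← det_mul]
  congr 1
  ext1 i j
  rw [Matrix.mul_apply]
  exact derivation_algHom_apply (pderiv j) Φ (T i)

theorem jacobian_eq (T : Fin 3 → MvPolynomial (Fin 3) k) :
    jacobian T = pderiv 0 (T 0) * pderiv 1 (T 1) * pderiv 2 (T 2)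
      - pderiv 0 (T 0) * pderiv 2 (T 1) * pderiv 1 (T 2)
      - pderiv 1 (T 0) * pderiv 0 (T 1) * pderiv 2 (T 2)
      + pderiv 1 (T 0) * pderiv 2 (T 1) * pderiv 0 (T 2)
      + pderiv 2 (T 0) * pderiv 0 (T 1) * pderiv 1 (T 2)
      - pderiv 2 (T 0) * pderiv 1 (T 1) * pderiv 0 (T 2) := by
  rw [jacobian, det_fin_three]
  simp

theorem isHomogeneous_jacobian {T : Fin 3 → MvPolynomial (Fin 3) k} {a b c : ℕ}
    (h0 : (T 0).IsHomogeneous a) (h1 : (T 1).IsHomogeneous b) (h2 : (T 2).IsHomogeneous c) :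
    (jacobian T).IsHomogeneous (a - 1 + (b - 1) + (c - 1)) := by
  rw [jacobian_eq]
  have m : ∀ i j l, (pderiv i (T 0) * pderiv j (T 1) * pderiv l (T 2)).IsHomogeneous
      (a - 1 + (b - 1) + (c - 1)) := fun i j l => (h0.pderiv.mul h1.pderiv).mul h2.pderiv
  exact (((((m _ _ _).sub (m _ _ _)).sub (m _ _ _)).add (m _ _ _)).add (m _ _ _)).sub (m _ _ _)

/-- `Φ` sends the variables to forms of degree `d`. -/
def IsFormMap (Φ : MvPolynomial (Fin 3) k →ₐ[k] MvPolynomial (Fin 3) k) (d : ℕ) : Prop :=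
  ∀ i, (Φ (X i)).IsHomogeneous d

/-- The forms `Φ (X i)` have no common zero outside the origin. -/
def IsRegularMap (Φ : MvPolynomial (Fin 3) k →ₐ[k] MvPolynomial (Fin 3) k) : Prop :=
  ∀ v : Fin 3 → k, v ≠ 0 → ∃ i, eval v (Φ (X i)) ≠ 0

theorem aeval_algHom_X (Φ : MvPolynomial (Fin 3) k →ₐ[k] MvPolynomial (Fin 3) k) :
    aeval (fun i => Φ (X i)) = Φ := (aeval_unique Φ).symm

theorem IsFormMap.apply {Φ : MvPolynomial (Fin 3) k →ₐ[k] MvPolynomial (Fin 3) k} {d : ℕ}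
    (h : IsFormMap Φ d) {T : MvPolynomial (Fin 3) k} {n : ℕ} (hT : T.IsHomogeneous n) :
    (Φ T).IsHomogeneous (d * n) := by
  rw [← aeval_algHom_X Φ]
  exact hT.aeval _ h

theorem eval_algHom_apply (Φ : MvPolynomial (Fin 3) k →ₐ[k] MvPolynomial (Fin 3) k)
    (v : Fin 3 → k) (T : MvPolynomial (Fin 3) k) :
    eval v (Φ T) = eval (fun i => eval v (Φ (X i))) T := by
  conv_lhs => rw [← aeval_algHom_X Φ]
  induction T using MvPolynomial.induction_on with
  | C a => simp
  | add p q hp hq => simp only [map_add, hp, hq]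
  | mul_X p i hp => simp only [map_mul, hp, aeval_X, eval_X]

theorem IsFormMap.isHomogeneous_jacobian
    {Φ : MvPolynomial (Fin 3) k →ₐ[k] MvPolynomial (Fin 3) k} {d : ℕ} (h : IsFormMap Φ d) :
    (jacobian fun i => Φ (X i)).IsHomogeneous (3 * (d - 1)) := by
  have := _root_.isHomogeneous_jacobian (T := fun i => Φ (X i)) (h 0) (h 1) (h 2)
  convert this using 1
  ring

theorem IsFormMap.isIntegral [IsAlgClosed k]
    {Φ : MvPolynomial (Fin 3) k →ₐ[k] MvPolynomial (Fin 3) k} {d : ℕ} (hd : 0 < d)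
    (h : IsFormMap Φ d) (hr : IsRegularMap Φ) (x : MvPolynomial (Fin 3) k) :
    IsIntegral Φ.range x := by
  obtain ⟨N, hN⟩ := exists_forall_isHomogeneous_mem (Ideal.span (Set.range fun i => Φ (X i)))
    fun v hv => by
      by_contra hv0
      obtain ⟨i, hi⟩ := hr v hv0
      exact hi (hv _ (Ideal.subset_span ⟨i, rfl⟩))
  classical
  let B : Set (MvPolynomial (Fin 3) k) :=
    ⋃ n ∈ Finset.range N, ((Finset.univ.finsuppAntidiag n : Finset (Fin 3 →₀ ℕ)).image
      fun s => (monomial s (1 : k)) : Finset _)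
  have hB : B.Finite := by
    refine Set.Finite.biUnion (Finset.finite_toSet _) fun n _ => Finset.finite_toSet _
  have key : ∀ n, ∀ p : MvPolynomial (Fin 3) k, p.IsHomogeneous n →
      p ∈ Submodule.span Φ.range B := by
    intro n
    induction n using Nat.strong_induction_on with
    | _ n ih =>
      intro p hp
      rcases lt_or_ge n N with hn | hn
      · rw [← support_sum_monomial_coeff p]
        refine Submodule.sum_mem _ fun s hs => ?_
        have hs' : s.degree = n := by
          by_contra hne
          exact mem_support_iff.1 hs (hp.coeff_eq_zero hne)
        have : monomial s (coeff s p) =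
            (⟨algebraMap k _ (coeff s p), Φ.range.algebraMap_mem _⟩ : Φ.range) •
              monomial s (1 : k) := by
          change _ = algebraMap k _ (coeff s p) * monomial s (1 : k)
          rw [algebraMap_eq, C_mul_monomial, mul_one]
        rw [this]
        refine Submodule.smul_mem _ _ (Submodule.subset_span ?_)
        refine Set.mem_biUnion (x := n) (by simpa using hn) ?_
        simp only [Finset.coe_image]
        refine ⟨s, ?_, rfl⟩
        simpa [Finset.mem_finsuppAntidiag, Finsupp.degree_eq_sum] using hs'
      · obtain ⟨c, hc⟩ := (Submodule.mem_span_range_iff_exists_fun _).1 (hN n hn p hp)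
        simp only [smul_eq_mul] at hc
        obtain ⟨w, hw, hw0, e⟩ := exists_homogeneous_combination (s := Finset.univ)
          (f := fun i => Φ (X i)) (u := c) (a := fun _ => d) (n := n) h (by rwa [hc])
        rw [← hc, e]
        refine Submodule.sum_mem _ fun i _ => ?_
        rcases lt_or_ge n d with hnd | hnd
        · rw [hw0 i hnd, zero_mul]
          exact zero_mem _
        · have := ih (n - d) (by omega) (w i) (hw i)
          have e2 : w i * Φ (X i) = (⟨Φ (X i), ⟨X i, rfl⟩⟩ : Φ.range) • w i := mul_comm _ _
          rw [e2]
          exact Submodule.smul_mem _ _ this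
  have top : Submodule.span Φ.range B = ⊤ := by
    rw [eq_top_iff]
    rintro p -
    rw [← sum_homogeneousComponent p]
    exact Submodule.sum_mem _ fun n _ => key n _ (homogeneousComponent_isHomogeneous _ _)
  have : Module.Finite Φ.range (MvPolynomial (Fin 3) k) :=
    ⟨hB.toFinset, by rw [hB.coe_toFinset, top]⟩
  exact Algebra.IsIntegral.isIntegral x

theorem IsFormMap.jacobian_ne_zero [IsAlgClosed k] [CharZero k]
    {Φ : MvPolynomial (Fin 3) k →ₐ[k] MvPolynomial (Fin 3) k} {d : ℕ} (hd : 0 < d)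
    (h : IsFormMap Φ d) (hr : IsRegularMap Φ) : jacobian (fun i => Φ (X i)) ≠ 0 := by
  intro hJ
  obtain ⟨u, hu, hu0⟩ := Matrix.exists_mulVec_eq_zero_iff.2 hJ
  let D := mkDerivation k u
  have hD : ∀ i, D (Φ (X i)) = 0 := by
    intro i
    have := congrFun hu0 i
    simp only [mulVec, dotProduct, of_apply, Pi.zero_apply] at this
    have e := derivation_algHom_apply D (AlgHom.id k _) (Φ (X i))
    simp only [AlgHom.id_apply] at e
    rw [e, ← this]
    simp [D, mkDerivation_X]
  have hD' : ∀ x ∈ Φ.range, D x = 0 := by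
    rintro _ ⟨T, rfl⟩
    change D (Φ T) = 0
    rw [derivation_algHom_apply]
    simp [hD]
  apply hu
  funext j
  have hX := h.isIntegral hd hr (X j)
  have hex : ∃ n, ∃ p : Polynomial Φ.range, p ≠ 0 ∧
      Polynomial.aeval (X j : MvPolynomial (Fin 3) k) p = 0 ∧
      p.natDegree = n := by
    obtain ⟨p, hp, hp0⟩ := hX
    exact ⟨_, p, hp.ne_zero, hp0, rfl⟩
  classical
  obtain ⟨p, hp0, hp, hpn⟩ := Nat.find_spec hex
  have hDp : ∀ q : Polynomial Φ.range,
      D (Polynomial.aeval (X j : MvPolynomial (Fin 3) k) q) =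
        Polynomial.aeval (X j : MvPolynomial (Fin 3) k) q.derivative * u j := by
    intro q
    induction q using Polynomial.induction_on' with
    | add p q hp hq => simp [hp, hq, add_mul]
    | monomial n a =>
      rw [Polynomial.aeval_monomial, Polynomial.derivative_monomial, Polynomial.aeval_monomial,
        Derivation.leibniz, Derivation.leibniz_pow]
      have : D (algebraMap Φ.range _ a) = 0 := hD' _ a.2
      rw [this]
      simp only [D, mkDerivation_X, smul_eq_mul, nsmul_eq_mul, map_mul, map_natCast]
      ring
  have e := hDp p
  rw [hp, map_zero, eq_comm, mul_eq_zero] at e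
  refine e.resolve_left fun e => ?_
  have hdeg : p.natDegree ≠ 0 := by
    intro h0
    obtain ⟨c, rfl⟩ : ∃ c, p = Polynomial.C c :=
      ⟨_, Polynomial.eq_C_of_natDegree_eq_zero h0⟩
    rw [Polynomial.aeval_C] at hp
    have : c = 0 := Subtype.ext hp
    exact hp0 (by simp [this])
  refine Nat.find_min hex (m := p.derivative.natDegree) ?_ ⟨p.derivative, ?_, e, rfl⟩
  · rw [← hpn]
    exact Polynomial.natDegree_derivative_lt hdeg
  · intro h0
    exact hdeg (Polynomial.derivative_eq_zero.1 h0)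

end Jacobian

section Injective

variable {k : Type*} [Field k]

theorem exists_pderiv_ne_zero [CharZero k] {P : MvPolynomial (Fin 3) k} {n : ℕ}
    (hP : P.IsHomogeneous n) (hn : 0 < n) (h0 : P ≠ 0) : ∃ l, pderiv l P ≠ 0 := by
  by_contra! h
  have := hP.sum_X_mul_pderiv
  simp only [h, mul_zero, Finset.sum_const_zero] at this
  rw [eq_comm, smul_eq_zero] at this
  exact this.elim hn.ne' h0

theorem eq_zero_of_algHom_eq_zero [CharZero k]
    {Φ : MvPolynomial (Fin 3) k →ₐ[k] MvPolynomial (Fin 3) k}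
    (hJ : jacobian (fun i => Φ (X i)) ≠ 0) {n : ℕ} :
    ∀ {P : MvPolynomial (Fin 3) k}, P.IsHomogeneous n → Φ P = 0 → P = 0 := by
  induction n with
  | zero =>
    intro P hP h
    obtain ⟨c, rfl⟩ := hP.exists_eq_C
    rw [← algebraMap_eq, AlgHom.commutes, algebraMap_eq] at h
    exact h
  | succ n ih =>
    intro P hP h
    by_contra h0
    obtain ⟨l, hl⟩ := exists_pderiv_ne_zero hP n.succ_pos h0
    apply hJ
    refine Matrix.exists_vecMul_eq_zero_iff.1 ⟨fun l => Φ (pderiv l P), fun h => ?_, ?_⟩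
    · exact hl (ih (by simpa using hP.pderiv (i := l)) (congrFun h l))
    · funext j
      have := derivation_algHom_apply (pderiv j) Φ P
      rw [h, map_zero] at this
      simpa [vecMul, dotProduct] using this.symm

theorem IsHomogeneous.pos_of_irreducible {P : MvPolynomial (Fin 3) k} {n : ℕ}
    (hP : P.IsHomogeneous n) (h : Irreducible P) : 0 < n := by
  rcases Nat.eq_zero_or_pos n with rfl | h'
  · exact absurd (hP.isUnit_of_zero h.ne_zero) h.not_isUnit
  · exact h'

end Injective

section Coprime

variable {k : Type*} [Field k] [IsAlgClosed k]

theorem exists_vector_dvd {f g : MvPolynomial (Fin 3) k} {a b : ℕ}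
    (hf : f.IsHomogeneous a) (hg : g.IsHomogeneous b) (hfg : IsRelPrime f g)
    {R : Type*} [CommRing R] [Algebra k R] {Φ : MvPolynomial (Fin 3) k →ₐ[k] R} {π : R}
    (hπ : Prime π) (hπf : π ∣ Φ f) (hπg : π ∣ Φ g) :
    ∃ w : Fin 3 → k, w ≠ 0 ∧ ∀ i j, π ∣ w i • Φ (X j) - w j • Φ (X i) := by
  rcases eq_or_ne g 0 with rfl | hg0
  · exact absurd (isUnit_of_dvd_unit hπf ((isRelPrime_zero_right.1 hfg).map Φ)) hπ.not_isUnit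
  have pair : ∀ i j, ∃ a b : k, (a ≠ 0 ∨ b ≠ 0) ∧ π ∣ a • Φ (X i) + b • Φ (X j) := by
    intro i j
    obtain ⟨n, p, u, v, hp, hn, e⟩ := exists_homogenize_eq_combination hf hg hg0 hfg i j
    refine exists_linear_dvd_of_dvd_homogenize hπ p n hp hn ?_
    have e2 : aeval ![Φ (X i), Φ (X j)] (p.homogenize n) =
        Φ (aeval ![X i, X j] (p.homogenize n)) := by
      have : aeval ![Φ (X i), Φ (X j)] = Φ.comp (aeval ![X i, X j]) := by
        refine MvPolynomial.algHom_ext fun l => ?_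
        fin_cases l <;> simp
      rw [this, AlgHom.comp_apply]
    rw [e2, e, map_add, map_mul, map_mul]
    exact dvd_add (hπf.mul_left _) (hπg.mul_left _)
  by_cases hall : ∀ i, π ∣ Φ (X i)
  · exact ⟨fun _ => 1, fun h => one_ne_zero (congrFun h 0), fun i j => by
      simpa using dvd_sub (hall j) (hall i)⟩
  push Not at hall
  obtain ⟨l, hl⟩ := hall
  have hw : ∀ j, ∃ c : k, π ∣ Φ (X j) - c • Φ (X l) := by
    intro j
    obtain ⟨a, b, hab, h⟩ := pair j l
    have ha : a ≠ 0 := by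
      rintro rfl
      have hb : b ≠ 0 := by simpa using hab
      rw [zero_smul, zero_add] at h
      refine hl ?_
      have := dvd_smul_of_dvd b⁻¹ h
      rwa [smul_smul, inv_mul_cancel₀ hb, one_smul] at this
    refine ⟨-(a⁻¹ * b), ?_⟩
    have := dvd_smul_of_dvd a⁻¹ h
    rwa [smul_add, smul_smul, smul_smul, inv_mul_cancel₀ ha, one_smul, ← sub_neg_eq_add,
      ← neg_smul] at this
  choose w hw using hw
  refine ⟨w, fun h => hl ?_, fun i j => ?_⟩
  · simpa [h] using hw l
  · have := dvd_sub (dvd_smul_of_dvd (w i) (hw j)) (dvd_smul_of_dvd (w j) (hw i))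
    convert this using 1
    rw [smul_sub, smul_sub, smul_smul, smul_smul, mul_comm (w j)]
    abel

/-- A regular form map contracts no curve. -/
theorem IsFormMap.isRelPrime_apply {f g : MvPolynomial (Fin 3) k} {a b d : ℕ}
    (hf : f.IsHomogeneous a) (hg : g.IsHomogeneous b) (hfg : IsRelPrime f g)
    {Φ : MvPolynomial (Fin 3) k →ₐ[k] MvPolynomial (Fin 3) k} (hd : 0 < d) (h : IsFormMap Φ d)
    (hr : IsRegularMap Φ) (hf0 : Φ f ≠ 0) : IsRelPrime (Φ f) (Φ g) := by
  refine WfDvdMonoid.isRelPrime_of_no_irreducible_factors (fun h => hf0 h.1) ?_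
  intro π hirr hπf hπg
  have hπ : Prime π := hirr.prime
  obtain ⟨m, hm⟩ := isHomogeneous_of_dvd (h.apply hf) hf0 hπf
  have hm0 : 0 < m := by
    rcases Nat.eq_zero_or_pos m with rfl | h
    · exact absurd (hm.isUnit_of_zero hπ.ne_zero) hπ.not_isUnit
    · exact h
  obtain ⟨w, hw, hdvd⟩ := exists_vector_dvd hf hg hfg hπ hπf hπg
  obtain ⟨l, hl⟩ := Function.ne_iff.1 hw
  obtain ⟨v, hv, hv1, hv2⟩ := exists_common_zero hm (h l) hm0 hd
  obtain ⟨j, hj⟩ := hr v hv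
  apply hj
  obtain ⟨q, hq⟩ := hdvd l j
  have := congrArg (eval v) hq
  rw [map_mul, hv1, zero_mul, map_sub, smul_eval, smul_eval, hv2, mul_zero, sub_zero] at this
  exact (mul_eq_zero.1 this).resolve_left hl

/-- A form map ramifies along the components of pulled back curves with multiplicities. -/
theorem IsFormMap.pow_dvd_jacobian [CharZero k] {P Q : MvPolynomial (Fin 3) k} {n d m : ℕ}
    {Φ : MvPolynomial (Fin 3) k →ₐ[k] MvPolynomial (Fin 3) k} (hd : 0 < d) (h : IsFormMap Φ d)
    (hr : IsRegularMap Φ) (hP : P.IsHomogeneous n) (hPi : Irreducible P) (hQ : Irreducible Q)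
    {c : k} (hm : 0 < m) (e : Φ P = C c * Q ^ m) :
    Q ^ (m - 1) ∣ jacobian fun i => Φ (X i) := by
  have hn : 0 < n := IsHomogeneous.pos_of_irreducible hP hPi
  obtain ⟨l, hl⟩ := exists_pderiv_ne_zero hP hn hPi.ne_zero
  have hP0 : Φ P ≠ 0 := fun h0 =>
    hPi.ne_zero (eq_zero_of_algHom_eq_zero (h.jacobian_ne_zero hd hr) hP h0)
  have hnd : ¬ P ∣ pderiv l P := by
    intro hdvd
    obtain ⟨r, -, -, hle⟩ := hP.exists_mul_eq hP.pderiv hl hdvd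
    omega
  have hrel := IsFormMap.isRelPrime_apply hP (hP.pderiv (i := l))
    (hPi.isRelPrime_iff_not_dvd.2 hnd) hd h hr hP0
  have hQl : ¬ Q ∣ Φ (pderiv l P) := fun hQ' =>
    hQ.not_isUnit (hrel (by rw [e]; exact (dvd_pow_self Q hm.ne').mul_left _) hQ')
  refine hQ.prime.pow_dvd_of_dvd_mul_left _ hQl ?_
  set J : Matrix (Fin 3) (Fin 3) (MvPolynomial (Fin 3) k) :=
    Matrix.of fun i j => pderiv j (Φ (X i)) with hJ
  have h1 : ∀ j, ((fun l => Φ (pderiv l P)) ᵥ* J) j = Q ^ (m - 1) *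
    (C c * (m : MvPolynomial (Fin 3) k) * pderiv j Q) := by
    intro j
    have := derivation_algHom_apply (pderiv j) Φ P
    rw [e, Derivation.leibniz, pderiv_C, smul_zero, add_zero, Derivation.leibniz_pow] at this
    simp only [vecMul, dotProduct, hJ, of_apply]
    rw [← this]
    simp only [smul_eq_mul, nsmul_eq_mul]
    ring
  have h2 : ((fun l => Φ (pderiv l P)) ᵥ* (J * J.adjugate)) l = Φ (pderiv l P) * J.det := by
    rw [mul_adjugate, vecMul_smul, vecMul_one]
    simp [mul_comm]
  change _ ∣ _ * J.det
  rw [← h2, ← vecMul_vecMul]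
  simp only [vecMul, dotProduct] at h1 ⊢
  refine Finset.dvd_sum fun j _ => ?_
  rw [h1]
  exact (dvd_mul_right _ _).mul_right _

end Coprime

section Dehomogenize

variable {k : Type*} [Field k]

theorem aeval_mul_left_of_isHomogeneous {σ R : Type*} [CommRing R] [Algebra k R]
    {T : MvPolynomial σ k} {n : ℕ} (hT : T.IsHomogeneous n) (c : R) (f : σ → R) :
    aeval (fun i => c * f i) T = c ^ n * aeval f T := by
  rw [aeval_def, aeval_def, eval₂_eq, eval₂_eq, Finset.mul_sum]
  refine Finset.sum_congr rfl fun s hs => ?_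
  have hs' : ∑ i ∈ s.support, s i = n := by
    rw [← Finsupp.degree_apply]
    by_contra hne
    exact mem_support_iff.1 hs (hT.coeff_eq_zero hne)
  simp only [mul_pow]
  rw [Finset.prod_mul_distrib, Finset.prod_pow_eq_pow_sum, hs']
  ring

/-- Evaluation of a form on the affine chart `X 2 = 1`, in the function field of the plane. -/
noncomputable def dehomogenize (k : Type*) [Field k] :
    MvPolynomial (Fin 3) k →ₐ[k] FractionRing (MvPolynomial (Fin 2) k) :=
  (IsScalarTower.toAlgHom k (MvPolynomial (Fin 2) k) _).comp (aeval ![X 0, X 1, 1])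

theorem dehomogenize_apply (T : MvPolynomial (Fin 3) k) :
    dehomogenize k T = algebraMap (MvPolynomial (Fin 2) k) _ (aeval ![X 0, X 1, 1] T) := rfl

theorem dehomogenize_X_two : dehomogenize k (X 2) = 1 := by
  simp [dehomogenize_apply]

theorem dehomogenize_eq_zero {T : MvPolynomial (Fin 3) k} {n : ℕ} (hT : T.IsHomogeneous n)
    (h : dehomogenize k T = 0) : T = 0 := by
  rw [dehomogenize_apply, FaithfulSMul.algebraMap_eq_zero_iff] at h
  let L := FractionRing (MvPolynomial (Fin 3) k)
  let x : Fin 3 → L := fun i => algebraMap (MvPolynomial (Fin 3) k) L (X i)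
  have hx : x 2 ≠ 0 := by simp [x]
  let ψ : MvPolynomial (Fin 2) k →ₐ[k] L := aeval ![x 0 / x 2, x 1 / x 2]
  have e : ψ.comp (aeval ![X 0, X 1, 1]) = aeval fun i => (x 2)⁻¹ * x i := by
    refine MvPolynomial.algHom_ext fun i => ?_
    fin_cases i
    · simp [ψ, div_eq_inv_mul]
    · simp [ψ, div_eq_inv_mul]
    · simpa [ψ] using (inv_mul_cancel₀ hx).symm
  have e1 := congrArg (fun f : MvPolynomial (Fin 3) k →ₐ[k] L => f T) e
  simp only [AlgHom.comp_apply] at e1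
  rw [h, map_zero, aeval_mul_left_of_isHomogeneous hT, eq_comm, mul_eq_zero] at e1
  have e2 : aeval x T = algebraMap _ L T := by
    have := aeval_algebraMap_apply L (X : Fin 3 → MvPolynomial (Fin 3) k) T
    rwa [aeval_X_left_apply] at this
  rw [e2] at e1
  simpa using e1.resolve_left (pow_ne_zero _ (inv_ne_zero hx))

theorem dehomogenize_injOn {T T' : MvPolynomial (Fin 3) k} {n : ℕ} (hT : T.IsHomogeneous n)
    (hT' : T'.IsHomogeneous n) (h : dehomogenize k T = dehomogenize k T') : T = T' :=
  sub_eq_zero.1 (dehomogenize_eq_zero (hT.sub hT') (by rw [map_sub, h, sub_self]))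

theorem exists_dehomogenize_eq (p : MvPolynomial (Fin 2) k) :
    ∃ N, ∀ n, N ≤ n → ∃ T : MvPolynomial (Fin 3) k, T.IsHomogeneous n ∧
      dehomogenize k T = algebraMap _ _ p := by
  induction p using MvPolynomial.induction_on with
  | C a =>
    refine ⟨0, fun n _ => ⟨C a * X 2 ^ n, ?_, ?_⟩⟩
    · simpa using (isHomogeneous_C (Fin 3) a).mul ((isHomogeneous_X k (2 : Fin 3)).pow n)
    · simp [dehomogenize_apply, algebraMap_eq]
  | add p q hp hq =>
    obtain ⟨N, hN⟩ := hp
    obtain ⟨N', hN'⟩ := hq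
    refine ⟨max N N', fun n hn => ?_⟩
    obtain ⟨T, hT, e⟩ := hN n (le_trans (le_max_left _ _) hn)
    obtain ⟨T', hT', e'⟩ := hN' n (le_trans (le_max_right _ _) hn)
    exact ⟨T + T', hT.add hT', by rw [map_add, map_add, e, e']⟩
  | mul_X p i hp =>
    obtain ⟨N, hN⟩ := hp
    refine ⟨N + 1, fun n hn => ?_⟩
    obtain ⟨T, hT, e⟩ := hN (n - 1) (by omega)
    refine ⟨T * X (i.castSucc), ?_, ?_⟩
    · have := hT.mul (isHomogeneous_X k i.castSucc)
      rwa [Nat.sub_add_cancel (by omega)] at this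
    · rw [map_mul, map_mul, e]
      congr 1
      fin_cases i <;> simp [dehomogenize_apply]

theorem dehomogenize_aeval (ψ : FractionRing (MvPolynomial (Fin 2) k) →ₐ[k]
      FractionRing (MvPolynomial (Fin 2) k)) {P : Fin 3 → MvPolynomial (Fin 3) k}
    (h2 : dehomogenize k (P 2) ≠ 0)
    (hψ : ∀ i, ψ (dehomogenize k (X i)) = dehomogenize k (P i) / dehomogenize k (P 2))
    {T : MvPolynomial (Fin 3) k} {n : ℕ} (hT : T.IsHomogeneous n) :
    dehomogenize k (aeval P T) = dehomogenize k (P 2) ^ n * ψ (dehomogenize k T) := by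
  have e : ψ (dehomogenize k T) =
      aeval (fun i => (dehomogenize k (P 2))⁻¹ * dehomogenize k (P i)) T := by
    rw [← AlgHom.comp_apply]
    congr 1
    refine MvPolynomial.algHom_ext fun i => ?_
    rw [AlgHom.comp_apply, hψ, aeval_X, div_eq_inv_mul]
  have e2 : dehomogenize k (aeval P T) = aeval (fun i => dehomogenize k (P i)) T := by
    rw [← AlgHom.comp_apply]
    congr 1
    refine MvPolynomial.algHom_ext fun i => ?_
    rw [AlgHom.comp_apply, aeval_X, aeval_X]
  rw [e, aeval_mul_left_of_isHomogeneous hT, e2, ← mul_assoc, ← mul_pow, mul_inv_cancel₀ h2,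
    one_pow, one_mul]

/-- The polynomials `P i` have no common irreducible factor. -/
def NoCommonFactor (P : Fin 3 → MvPolynomial (Fin 3) k) : Prop :=
  ∀ π, Irreducible π → ¬ ∀ i, π ∣ P i

theorem NoCommonFactor.dvd_of_dvd_mul {P : Fin 3 → MvPolynomial (Fin 3) k}
    (hP : NoCommonFactor P) {g h : MvPolynomial (Fin 3) k} (hg : g ≠ 0)
    (hd : ∀ i, g ∣ P i * h) : g ∣ h := by
  induction g using WfDvdMonoid.induction_on_irreducible generalizing h with
  | zero => exact absurd rfl hg
  | unit u hu => exact hu.dvd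
  | mul a π ha hπ ih =>
    have : π ∣ h := by
      by_contra hh
      refine hP π hπ fun i => ?_
      exact (hπ.prime.dvd_or_dvd ((dvd_mul_right π a).trans (hd i))).resolve_right hh
    obtain ⟨h', rfl⟩ := this
    refine mul_dvd_mul_left π (ih ha fun i => ?_)
    have := hd i
    rw [mul_left_comm] at this
    exact (mul_dvd_mul_iff_left hπ.ne_zero).1 this

theorem exists_forms_of_algHom (ψ : FractionRing (MvPolynomial (Fin 2) k) →ₐ[k]
      FractionRing (MvPolynomial (Fin 2) k)) :
    ∃ (e : ℕ) (H : Fin 3 → MvPolynomial (Fin 3) k), (∀ i, (H i).IsHomogeneous e) ∧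
      dehomogenize k (H 2) ≠ 0 ∧ NoCommonFactor H ∧
      ∀ i, ψ (dehomogenize k (X i)) = dehomogenize k (H i) / dehomogenize k (H 2) := by
  have hex : ∃ (e : ℕ) (H : Fin 3 → MvPolynomial (Fin 3) k), (∀ i, (H i).IsHomogeneous e) ∧
      dehomogenize k (H 2) ≠ 0 ∧
      ∀ i, ψ (dehomogenize k (X i)) = dehomogenize k (H i) / dehomogenize k (H 2) := by
    obtain ⟨c, hc⟩ := IsLocalization.exist_integer_multiples_of_finite
      (nonZeroDivisors (MvPolynomial (Fin 2) k)) fun i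
        => ψ (dehomogenize k (X i : MvPolynomial (Fin 3) k))
    choose a ha using hc
    choose N hN using fun i => exists_dehomogenize_eq (a i)
    choose T hT hTa using fun i => hN i (∑ j, N j) (Finset.single_le_sum (by simp) (by simp))
    have e2 : dehomogenize k (T 2) = algebraMap _ _ (c : MvPolynomial (Fin 2) k) := by
      rw [hTa, ha, dehomogenize_X_two, map_one, Algebra.smul_def, mul_one]
    have hc0 : algebraMap _ (FractionRing (MvPolynomial (Fin 2) k))
        (c : MvPolynomial (Fin 2) k) ≠ 0 := by
      simp
    refine ⟨_, T, hT, by rwa [e2], fun i => ?_⟩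
    rw [e2, hTa, ha, Algebra.smul_def, mul_div_cancel_left₀ _ hc0]
  classical
  obtain ⟨H, hH, h2, hψ⟩ := Nat.find_spec hex
  refine ⟨_, H, hH, h2, fun π hπ hdvd => ?_, hψ⟩
  choose Q hQ using hdvd
  have hH2 : H 2 ≠ 0 := fun h => h2 (by rw [h, map_zero])
  obtain ⟨m, hm⟩ := isHomogeneous_of_dvd (hH 2) hH2 (Dvd.intro _ (hQ 2).symm)
  obtain ⟨-, -, -, hle⟩ := hm.exists_mul_eq (hH 2) hH2 (Dvd.intro _ (hQ 2).symm)
  have hmpos : 0 < m := by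
    rcases Nat.eq_zero_or_pos m with rfl | h
    · exact absurd (hm.isUnit_of_zero hπ.ne_zero) hπ.not_isUnit
    · exact h
  have hπ0 : dehomogenize k π ≠ 0 := fun h => hπ.ne_zero (dehomogenize_eq_zero hm h)
  refine Nat.find_min hex (m := Nat.find hex - m) (by omega) ⟨Q, fun i => ?_, fun h => h2 ?_,
    fun i => ?_⟩
  · refine hm.of_mul_left ?_ hπ.ne_zero
    rw [← hQ, add_tsub_cancel_of_le hle]
    exact hH i
  · rw [hQ 2, map_mul, h, mul_zero]
  · rw [hψ, hQ i, hQ 2, map_mul, map_mul, mul_div_mul_left _ _ hπ0]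

end Dehomogenize

section Extraction

variable {k : Type*} [Field k]

/-- Two regular maps `Φ`, `Γ` of degree `d`, with coprime triples of forms `η`, `κ` conjugating one
to the other and inverse to each other up to the common factors `A`, `B`. All maps are recorded
through their action on polynomials. -/
structure BirConj (d : ℕ) (Φ Γ η κ : MvPolynomial (Fin 3) k →ₐ[k] MvPolynomial (Fin 3) k)
    (e e' : ℕ) (A B : MvPolynomial (Fin 3) k) : Prop where
  two_le : 2 ≤ d
  formΦ : IsFormMap Φ d
  formΓ : IsFormMap Γ d
  regΦ : IsRegularMap Φ
  regΓ : IsRegularMap Γ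
  formη : IsFormMap η e
  formκ : IsFormMap κ e'
  copη : NoCommonFactor fun i => η (X i)
  copκ : NoCommonFactor fun i => κ (X i)
  conj : ∀ T, Φ (η T) = η (Γ T)
  conj' : ∀ T, Γ (κ T) = κ (Φ T)
  comp : ∀ i, η (κ (X i)) = A * X i
  comp' : ∀ i, κ (η (X i)) = B * X i
  A_ne_zero : A ≠ 0
  B_ne_zero : B ≠ 0

theorem BirConj.symm {d : ℕ} {Φ Γ η κ : MvPolynomial (Fin 3) k →ₐ[k] MvPolynomial (Fin 3) k}
    {e e' : ℕ} {A B : MvPolynomial (Fin 3) k} (h : BirConj d Φ Γ η κ e e' A B) :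
    BirConj d Γ Φ κ η e' e B A :=
  ⟨h.two_le, h.formΓ, h.formΦ, h.regΓ, h.regΦ, h.formκ, h.formη, h.copκ, h.copη, h.conj', h.conj,
    h.comp', h.comp, h.B_ne_zero, h.A_ne_zero⟩

theorem IsRegularMap.ne_zero [IsAlgClosed k]
    {Φ : MvPolynomial (Fin 3) k →ₐ[k] MvPolynomial (Fin 3) k} {d : ℕ}
    (hd : 0 < d) (h : IsFormMap Φ d) (hr : IsRegularMap Φ) (i : Fin 3) : Φ (X i) ≠ 0 := by
  intro h0
  obtain ⟨v, hv, h1, h2⟩ := exists_common_zero (h (i + 1)) (h (i + 2)) hd hd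
  obtain ⟨j, hj⟩ := hr v hv
  have : j = i ∨ j = i + 1 ∨ j = i + 2 := by
    fin_cases i <;> fin_cases j <;> simp
  rcases this with rfl | rfl | rfl
  · exact hj (by rw [h0, map_zero])
  · exact hj h1
  · exact hj h2

theorem IsRegularMap.noCommonFactor_apply [IsAlgClosed k]
    {Γ η : MvPolynomial (Fin 3) k →ₐ[k] MvPolynomial (Fin 3) k} (hr : IsRegularMap Γ)
    (hη : NoCommonFactor fun i => η (X i)) : NoCommonFactor fun i => η (Γ (X i)) := by
  intro π hπ hdvd
  obtain ⟨N, hN⟩ := exists_X_pow_mem (Ideal.span (Set.range fun i => Γ (X i))) fun v hv => by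
    by_contra hv0
    obtain ⟨i, hi⟩ := hr v hv0
    exact hi (hv _ (Ideal.subset_span ⟨i, rfl⟩))
  refine hη π hπ fun i => hπ.prime.dvd_of_dvd_pow (n := N) ?_
  obtain ⟨c, hc⟩ := (Submodule.mem_span_range_iff_exists_fun _).1 (hN i)
  rw [← map_pow, ← hc, map_sum]
  refine Finset.dvd_sum fun j _ => ?_
  rw [smul_eq_mul, map_mul]
  exact (hdvd j).mul_left _

/-- The action on functions of a regular map given by forms. -/
def ActsBy (ψ : FractionRing (MvPolynomial (Fin 2) k) →ₐ[k] FractionRing (MvPolynomial (Fin 2) k))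
    (Φ : MvPolynomial (Fin 3) k →ₐ[k] MvPolynomial (Fin 3) k) : Prop :=
  dehomogenize k (Φ (X 2)) ≠ 0 ∧
    ∀ i, ψ (dehomogenize k (X i)) = dehomogenize k (Φ (X i)) / dehomogenize k (Φ (X 2))

theorem ActsBy.dehomogenize_apply
    {ψ : FractionRing (MvPolynomial (Fin 2) k) →ₐ[k] FractionRing (MvPolynomial (Fin 2) k)}
    {Φ : MvPolynomial (Fin 3) k →ₐ[k] MvPolynomial (Fin 3) k} (h : ActsBy ψ Φ)
    {T : MvPolynomial (Fin 3) k} {n : ℕ} (hT : T.IsHomogeneous n) :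
    dehomogenize k (Φ T) = dehomogenize k (Φ (X 2)) ^ n * ψ (dehomogenize k T) := by
  have := dehomogenize_aeval ψ (P := fun i => Φ (X i)) h.1 h.2 hT
  rwa [aeval_algHom_X] at this

theorem ActsBy.dehomogenize_ne_zero
    {ψ : FractionRing (MvPolynomial (Fin 2) k) →ₐ[k] FractionRing (MvPolynomial (Fin 2) k)}
    {Φ : MvPolynomial (Fin 3) k →ₐ[k] MvPolynomial (Fin 3) k} (h : ActsBy ψ Φ)
    {T : MvPolynomial (Fin 3) k} {n : ℕ} (hT : T.IsHomogeneous n)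
    (h0 : dehomogenize k T ≠ 0) : dehomogenize k (Φ T) ≠ 0 := by
  rw [h.dehomogenize_apply hT]
  refine mul_ne_zero (pow_ne_zero _ h.1) fun h1 => h0 ?_
  exact ψ.toRingHom.injective (h1.trans (map_zero ψ.toRingHom).symm)

theorem exists_conj_forms [IsAlgClosed k] {d : ℕ} (hd : 2 ≤ d)
    {Φ Γ : MvPolynomial (Fin 3) k →ₐ[k] MvPolynomial (Fin 3) k}
    (hΦ : IsFormMap Φ d) (hΓ : IsFormMap Γ d) (hΓr : IsRegularMap Γ)
    {φ₁ φ₂ ψ : FractionRing (MvPolynomial (Fin 2) k) →ₐ[k] FractionRing (MvPolynomial (Fin 2) k)}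
    (h₁ : ActsBy φ₁ Φ) (h₂ : ActsBy φ₂ Γ) (hconj : ∀ u, φ₁ (ψ u) = ψ (φ₂ u)) :
    ∃ (e : ℕ) (η : MvPolynomial (Fin 3) k →ₐ[k] MvPolynomial (Fin 3) k), IsFormMap η e ∧
      NoCommonFactor (fun i => η (X i)) ∧ ActsBy ψ η ∧ ∀ T, Φ (η T) = η (Γ T) := by
  obtain ⟨e, H, hH, hH2, hcop, hψ⟩ := exists_forms_of_algHom ψ
  set η₀ : MvPolynomial (Fin 3) k →ₐ[k] MvPolynomial (Fin 3) k := aeval H with hη₀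
  have hη₀X : ∀ i, η₀ (X i) = H i := fun i => aeval_X _ _
  have hη₀a : ActsBy ψ η₀ := by
    simp only [ActsBy, hη₀X]
    exact ⟨hH2, hψ⟩
  have hη₀f : IsFormMap η₀ e := by simpa only [IsFormMap, hη₀X] using hH
  have hcop' : NoCommonFactor fun i => η₀ (Γ (X i)) :=
    hΓr.noCommonFactor_apply (by simpa only [hη₀X] using hcop)
  have n1 := h₁.dehomogenize_ne_zero (hH 2) hH2
  have n2 := hη₀a.dehomogenize_ne_zero (hΓ 2) h₂.1
  have cross : ∀ i, Φ (H i) * η₀ (Γ (X 2)) = η₀ (Γ (X i)) * Φ (H 2) := by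
    intro i
    refine dehomogenize_injOn (n := d * e + e * d) ((hΦ.apply (hH i)).mul (hη₀f.apply (hΓ 2)))
      (by rw [add_comm]; exact (hη₀f.apply (hΓ i)).mul (hΦ.apply (hH 2))) ?_
    have := hconj (dehomogenize k (X i))
    have p1 := pow_ne_zero e h₁.1
    have p2 := pow_ne_zero d hη₀a.1
    rw [hψ, h₂.2, map_div₀, map_div₀] at this
    rw [map_mul, map_mul, h₁.dehomogenize_apply (hH i), h₁.dehomogenize_apply (hH 2),
      hη₀a.dehomogenize_apply (hΓ 2), hη₀a.dehomogenize_apply (hΓ i)]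
    rw [h₁.dehomogenize_apply (hH 2)] at n1
    rw [hη₀a.dehomogenize_apply (hΓ 2)] at n2
    have m1 := right_ne_zero_of_mul n1
    have m2 := right_ne_zero_of_mul n2
    rw [div_eq_div_iff m1 m2] at this
    linear_combination dehomogenize k (Φ (X 2)) ^ e * dehomogenize k (η₀ (X 2)) ^ d * this
  have z2 : η₀ (Γ (X 2)) ≠ 0 := fun h => n2 (by rw [h, map_zero])
  obtain ⟨c, hc⟩ := (hη₀f.apply (hΓ 2)).eq_C_of_dvd (by rw [mul_comm]; exact hΦ.apply (hH 2))
    (hcop'.dvd_of_dvd_mul z2 fun i => Dvd.intro_left _ (cross i))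
  have hc0 : c ≠ 0 := by
    rintro rfl
    exact n1 (by rw [hc]; simp)
  have hall : ∀ i, Φ (H i) = C c * η₀ (Γ (X i)) := by
    intro i
    have := cross i
    rw [hc] at this
    exact mul_right_cancel₀ z2 (by linear_combination this)
  obtain ⟨μ, hμ⟩ := IsAlgClosed.exists_pow_nat_eq c (n := d - 1) (by omega)
  have hμ0 : μ ≠ 0 := by
    rintro rfl
    rw [zero_pow (by omega)] at hμ
    exact hc0 hμ.symm
  have hCμ : IsUnit (C μ : MvPolynomial (Fin 3) k) := (IsUnit.mk0 μ hμ0).map C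
  set η : MvPolynomial (Fin 3) k →ₐ[k] MvPolynomial (Fin 3) k := aeval fun i => C μ * H i with hη
  have hηX : ∀ i, η (X i) = C μ * H i := fun i => aeval_X _ _
  have hdμ : dehomogenize k (C μ) ≠ 0 := (hCμ.map (dehomogenize k)).ne_zero
  refine ⟨e, η, fun i => ?_, fun π hπ hdvd => hcop π hπ fun i => ?_, ⟨?_, fun i => ?_⟩, ?_⟩
  · rw [hηX]
    simpa using (isHomogeneous_C _ μ).mul (hH i)
  · have := hdvd i
    simp only [hηX] at this
    exact (hCμ.dvd_mul_left).1 this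
  · rw [hηX, map_mul]
    exact mul_ne_zero hdμ hH2
  · rw [hηX, hηX, map_mul, map_mul, mul_div_mul_left _ _ hdμ, hψ]
  · have : Φ.comp η = η.comp Γ := by
      refine MvPolynomial.algHom_ext fun i => ?_
      rw [AlgHom.comp_apply, AlgHom.comp_apply, hηX, hη, aeval_mul_left_of_isHomogeneous (hΓ i),
        map_mul, hall, ← algebraMap_eq, AlgHom.commutes, algebraMap_eq, ← hμ]
      rw [← mul_assoc, ← C_mul, ← map_pow, ← pow_succ', Nat.sub_add_cancel (by omega)]
    exact fun T => DFunLike.congr_fun this T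

theorem exists_comp_eq {η κ : MvPolynomial (Fin 3) k →ₐ[k] MvPolynomial (Fin 3) k} {e e' : ℕ}
    (hη : IsFormMap η e) (hκ : IsFormMap κ e')
    {φ ψ : FractionRing (MvPolynomial (Fin 2) k) →ₐ[k] FractionRing (MvPolynomial (Fin 2) k)}
    (hφ : ActsBy φ η) (hψ : ActsBy ψ κ) (hinv : ∀ u, φ (ψ u) = u) :
    ∃ A ≠ 0, ∀ i, η (κ (X i)) = A * X i := by
  have z : dehomogenize k (η (κ (X 2))) ≠ 0 := hφ.dehomogenize_ne_zero (hκ 2) hψ.1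
  have cross : ∀ i, η (κ (X i)) * X 2 = η (κ (X 2)) * X i := by
    intro i
    refine dehomogenize_injOn (n := e * e' + 1) ((hη.apply (hκ i)).mul (isHomogeneous_X _ _))
      ((hη.apply (hκ 2)).mul (isHomogeneous_X _ _)) ?_
    have := hinv (dehomogenize k (X i))
    rw [hψ.2, map_div₀, div_eq_iff ((map_ne_zero φ).2 hψ.1)] at this
    rw [map_mul, map_mul, dehomogenize_X_two, mul_one, hφ.dehomogenize_apply (hκ i),
      hφ.dehomogenize_apply (hκ 2), this]
    ring
  have hX2 : Prime (X 2 : MvPolynomial (Fin 3) k) := X_prime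
  obtain ⟨A, hA⟩ : (X 2 : MvPolynomial (Fin 3) k) ∣ η (κ (X 2)) := by
    refine (hX2.dvd_or_dvd (Dvd.intro_left _ (cross 0))).resolve_right fun h => ?_
    rw [X_dvd_X] at h
    simp at h
  refine ⟨A, fun h => z ?_, fun i => mul_right_cancel₀ hX2.ne_zero ?_⟩
  · rw [hA, h, mul_zero, map_zero]
  · rw [cross, hA]
    ring

theorem exists_birConj [IsAlgClosed k] {d : ℕ} (hd : 2 ≤ d)
    {Φ Γ : MvPolynomial (Fin 3) k →ₐ[k] MvPolynomial (Fin 3) k}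
    (hΦ : IsFormMap Φ d) (hΓ : IsFormMap Γ d) (hΦr : IsRegularMap Φ) (hΓr : IsRegularMap Γ)
    {φ₁ φ₂ : FractionRing (MvPolynomial (Fin 2) k) →ₐ[k] FractionRing (MvPolynomial (Fin 2) k)}
    (φ : FractionRing (MvPolynomial (Fin 2) k) ≃ₐ[k] FractionRing (MvPolynomial (Fin 2) k))
    (h₁ : ActsBy φ₁ Φ) (h₂ : ActsBy φ₂ Γ) (hconj : ∀ u, φ₁ (φ u) = φ (φ₂ u)) :
    ∃ η κ e e' A B, BirConj d Φ Γ η κ e e' A B := by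
  obtain ⟨e, η, hη, hηc, hηa, hηconj⟩ := exists_conj_forms (ψ := φ.toAlgHom)
    hd hΦ hΓ hΓr h₁ h₂ hconj
  obtain ⟨e', κ, hκ, hκc, hκa, hκconj⟩ := exists_conj_forms (ψ := φ.symm.toAlgHom)
    hd hΓ hΦ hΦr h₂ h₁
    fun u => φ.injective (by
      have := hconj (φ.symm u)
      simp only [AlgEquiv.apply_symm_apply] at this
      simpa using this.symm)
  obtain ⟨A, hA, hAc⟩ := exists_comp_eq hη hκ hηa hκa fun u => by simp
  obtain ⟨B, hB, hBc⟩ := exists_comp_eq hκ hη hκa hηa fun u => by simp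
  exact ⟨η, κ, e, e', A, B, hd, hΦ, hΓ, hΦr, hΓr, hη, hκ, hηc, hκc, hηconj, hκconj, hAc, hBc, hA,
    hB⟩

end Extraction

/-- Polynomials in three variables. -/
abbrev Poly3 (k : Type*) [Field k] := MvPolynomial (Fin 3) k

/-- Substitutions in three variables. -/
abbrev Hom3 (k : Type*) [Field k] := Poly3 k →ₐ[k] Poly3 k

section Linear

variable {k : Type*} [Field k]

theorem Hom3.ext_X {Φ Γ : Hom3 k} (h : ∀ i, Φ (X i) = Γ (X i)) (T : Poly3 k) : Φ T = Γ T := by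
  rw [MvPolynomial.algHom_ext h]

theorem Hom3.map_C (Φ : Hom3 k) (c : k) : Φ (C c) = C c := by
  rw [← algebraMap_eq, AlgHom.commutes]

/-- Linear automorphisms of the polynomial ring. -/
structure IsLin (l : Poly3 k ≃ₐ[k] Poly3 k) : Prop where
  form : IsFormMap (l : Hom3 k) 1
  form_symm : IsFormMap (l.symm : Hom3 k) 1

theorem IsLin.symm {l : Poly3 k ≃ₐ[k] Poly3 k} (h : IsLin l) : IsLin l.symm :=
  ⟨h.form_symm, by simpa using h.form⟩

theorem IsLin.apply {l : Poly3 k ≃ₐ[k] Poly3 k} (h : IsLin l) {T : Poly3 k} {n : ℕ}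
    (hT : T.IsHomogeneous n) : (l T).IsHomogeneous n := by
  simpa using h.form.apply hT

theorem IsLin.trans {l m : Poly3 k ≃ₐ[k] Poly3 k} (h : IsLin l) (h' : IsLin m) :
    IsLin (l.trans m) :=
  ⟨fun i => h'.apply (h.form i), fun i => h.symm.apply (h'.symm.form i)⟩

/-- Two endomorphisms are conjugate by a linear automorphism. -/
def LinConj (Φ Γ : Hom3 k) : Prop :=
  ∃ l : Poly3 k ≃ₐ[k] Poly3 k, IsLin l ∧ ∀ T, Φ (l T) = l (Γ T)

theorem LinConj.symm {Φ Γ : Hom3 k} (h : LinConj Φ Γ) : LinConj Γ Φ := by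
  obtain ⟨l, hl, e⟩ := h
  refine ⟨l.symm, hl.symm, fun T => l.injective ?_⟩
  rw [← e, AlgEquiv.apply_symm_apply, AlgEquiv.apply_symm_apply]

/-- The conjugate of a substitution by an automorphism. -/
noncomputable def Hom3.conj (l m : Poly3 k ≃ₐ[k] Poly3 k) (Φ : Hom3 k) : Hom3 k :=
  (l : Hom3 k).comp (Φ.comp (m.symm : Hom3 k))

@[simp]
theorem Hom3.conj_apply (l m : Poly3 k ≃ₐ[k] Poly3 k) (Φ : Hom3 k) (T : Poly3 k) :
    Hom3.conj l m Φ T = l (Φ (m.symm T)) := rfl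

theorem IsFormMap.conj {Φ : Hom3 k} {d : ℕ} (h : IsFormMap Φ d) {l m : Poly3 k ≃ₐ[k] Poly3 k}
    (hl : IsLin l) (hm : IsLin m) : IsFormMap (Hom3.conj l m Φ) d := fun i => by
  rw [Hom3.conj_apply]
  have := hl.apply (h.apply (hm.form_symm i))
  rwa [mul_one] at this

theorem eval_zero_of_isHomogeneous {T : Poly3 k} {n : ℕ} (hT : T.IsHomogeneous n) (hn : 0 < n)
    {v : Fin 3 → k} (hv : v = 0) : eval v T = 0 := by
  have := aeval_mul_left_of_isHomogeneous hT (0 : k) v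
  rw [zero_pow hn.ne', zero_mul] at this
  rw [← this, hv]
  simp

theorem exists_eq_sum_of_isHomogeneous_one {T : Poly3 k} (hT : T.IsHomogeneous 1) :
    ∃ a : Fin 3 → k, T = ∑ i, C (a i) * X i := by
  choose a ha using fun i => (hT.pderiv (i := i)).exists_eq_C
  refine ⟨a, ?_⟩
  have := hT.sum_X_mul_pderiv
  rw [one_smul] at this
  rw [← this]
  exact Finset.sum_congr rfl fun i _ => by rw [ha, mul_comm]

theorem NoCommonFactor.conj {Φ : Hom3 k} (h : NoCommonFactor fun i => Φ (X i))
    {l m : Poly3 k ≃ₐ[k] Poly3 k} (hm : IsLin m) :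
    NoCommonFactor fun i => Hom3.conj l m Φ (X i) := by
  intro π hπ hdvd
  refine h (l.symm π) ((MulEquiv.irreducible_iff l.symm).2 hπ) fun i => ?_
  obtain ⟨a, ha⟩ := exists_eq_sum_of_isHomogeneous_one (hm.form i)
  have e : Φ (X i) = l.symm (Hom3.conj l m Φ (m (X i))) := by simp
  change l.symm π ∣ Φ (X i)
  rw [e]
  refine map_dvd l.symm ?_
  rw [show m (X i) = _ from ha, map_sum]
  refine Finset.dvd_sum fun j _ => ?_
  rw [map_mul]
  exact (hdvd j).mul_left _

theorem IsRegularMap.conj {Φ : Hom3 k} (h : IsRegularMap Φ) {l : Poly3 k ≃ₐ[k] Poly3 k}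
    (hl : IsLin l) : IsRegularMap (Hom3.conj l l Φ) := by
  intro v hv
  set w : Fin 3 → k := fun i => eval v (l (X i)) with hw
  have hev : ∀ T, eval v (l T) = eval w T := fun T => eval_algHom_apply (l : Hom3 k) v T
  have hw0 : w ≠ 0 := by
    intro h0
    apply hv
    funext i
    have h3 : eval w (l.symm (X i)) = 0 := eval_zero_of_isHomogeneous (hl.form_symm i) one_pos h0
    rw [← hev, AlgEquiv.apply_symm_apply, eval_X] at h3
    exact h3
  obtain ⟨j, hj⟩ := h w hw0
  by_contra! hall
  apply hj
  obtain ⟨a, ha⟩ := exists_eq_sum_of_isHomogeneous_one (hl.form j)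
  have e : eval w (Φ (X j)) = eval v (Hom3.conj l l Φ (l (X j))) := by simp [hev]
  rw [e, show l (X j) = _ from ha, map_sum, map_sum]
  refine Finset.sum_eq_zero fun i _ => ?_
  rw [map_mul, map_mul, hall, mul_zero]

theorem BirConj.conjugate {d : ℕ} {Φ Γ η κ : Hom3 k} {e e' : ℕ} {A B : Poly3 k}
    (h : BirConj d Φ Γ η κ e e' A B) {l m : Poly3 k ≃ₐ[k] Poly3 k} (hl : IsLin l) (hm : IsLin m) :
    BirConj d (Hom3.conj l l Φ) (Hom3.conj m m Γ) (Hom3.conj l m η) (Hom3.conj m l κ) e e'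
      (l A) (m B) where
  two_le := h.two_le
  formΦ := h.formΦ.conj hl hl
  formΓ := h.formΓ.conj hm hm
  regΦ := h.regΦ.conj hl
  regΓ := h.regΓ.conj hm
  formη := h.formη.conj hl hm
  formκ := h.formκ.conj hm hl
  copη := h.copη.conj hm
  copκ := h.copκ.conj hl
  conj T := by simp [h.conj]
  conj' T := by simp [h.conj']
  comp i := by
    obtain ⟨a, ha⟩ := exists_eq_sum_of_isHomogeneous_one (hl.form_symm i)
    have e : η (κ (l.symm (X i))) = A * l.symm (X i) := by
      rw [show l.symm (X i) = _ from ha]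
      simp only [map_sum, map_mul, Hom3.map_C, h.comp, Finset.mul_sum]
      exact Finset.sum_congr rfl fun j _ => by ring
    simp [e]
  comp' i := by
    obtain ⟨a, ha⟩ := exists_eq_sum_of_isHomogeneous_one (hm.form_symm i)
    have e : κ (η (m.symm (X i))) = B * m.symm (X i) := by
      rw [show m.symm (X i) = _ from ha]
      simp only [map_sum, map_mul, Hom3.map_C, h.comp', Finset.mul_sum]
      exact Finset.sum_congr rfl fun j _ => by ring
    simp [e]
  A_ne_zero := by simpa using h.A_ne_zero
  B_ne_zero := by simpa using h.B_ne_zero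

theorem linConj_conj (Φ : Hom3 k) {l : Poly3 k ≃ₐ[k] Poly3 k} (hl : IsLin l) :
    LinConj (Hom3.conj l l Φ) Φ := ⟨l, hl, fun T => by simp⟩

theorem LinConj.trans {Φ Γ Ψ : Hom3 k} (h : LinConj Φ Γ) (h' : LinConj Γ Ψ) : LinConj Φ Ψ := by
  obtain ⟨l, hl, e⟩ := h
  obtain ⟨m, hm, e'⟩ := h'
  exact ⟨m.trans l, hm.trans hl, fun T => by simp [e, e']⟩

theorem linConj_of_conj {Φ Γ : Hom3 k} {l m : Poly3 k ≃ₐ[k] Poly3 k} (hl : IsLin l)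
    (hm : IsLin m) (h : LinConj (Hom3.conj l l Φ) (Hom3.conj m m Γ)) : LinConj Φ Γ :=
  ((linConj_conj Φ hl).symm.trans h).trans (linConj_conj Γ hm)

/-- The linear substitution with matrix `M`. -/
noncomputable def linHom (M : Matrix (Fin 3) (Fin 3) k) : Hom3 k :=
  aeval fun i => ∑ j, C (M i j) * X j

theorem linHom_X (M : Matrix (Fin 3) (Fin 3) k) (i : Fin 3) :
    linHom M (X i) = ∑ j, C (M i j) * X j := aeval_X _ _

theorem isFormMap_linHom (M : Matrix (Fin 3) (Fin 3) k) : IsFormMap (linHom M) 1 := by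
  intro i
  rw [linHom_X]
  refine IsHomogeneous.sum _ _ _ fun j _ => ?_
  simpa using (isHomogeneous_C _ (M i j)).mul (isHomogeneous_X k j)

theorem linHom_comp (M N : Matrix (Fin 3) (Fin 3) k) :
    (linHom M).comp (linHom N) = linHom (N * M) := by
  refine MvPolynomial.algHom_ext fun i => ?_
  rw [AlgHom.comp_apply, linHom_X, linHom_X, map_sum]
  simp only [map_mul, Hom3.map_C, linHom_X, Matrix.mul_apply, map_sum, Finset.mul_sum,
    Finset.sum_mul]
  rw [Finset.sum_comm]
  exact Finset.sum_congr rfl fun _ _ => Finset.sum_congr rfl fun _ _ => by ring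

theorem linHom_one : linHom (1 : Matrix (Fin 3) (Fin 3) k) = AlgHom.id k _ := by
  refine MvPolynomial.algHom_ext fun i => ?_
  rw [linHom_X]
  simp [Matrix.one_apply]

theorem exists_isLin_of_jacobian_ne_zero {η : Hom3 k} (hη : IsFormMap η 1)
    (hJ : jacobian (fun i => η (X i)) ≠ 0) :
    ∃ l : Poly3 k ≃ₐ[k] Poly3 k, IsLin l ∧ ∀ T, l T = η T := by
  obtain ⟨M, hM⟩ : ∃ M : Matrix (Fin 3) (Fin 3) k, ∀ i, η (X i) = ∑ j, C (M i j) * X j := by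
    choose M hM using fun i => exists_eq_sum_of_isHomogeneous_one (hη i)
    exact ⟨Matrix.of M, hM⟩
  have e : η = linHom M := MvPolynomial.algHom_ext fun i => by rw [hM, linHom_X]
  have hdet : M.det ≠ 0 := by
    intro h0
    apply hJ
    have : (Matrix.of fun i j => pderiv j (η (X i))) =
        (C : k →+* Poly3 k).mapMatrix M := by
      ext1 i j
      simp only [of_apply, hM, RingHom.mapMatrix_apply, map_apply, map_sum]
      rw [Finset.sum_eq_single j]
      · simp
      · intro b _ hb
        simp [pderiv_X_of_ne hb]
      · simp
    rw [jacobian, this, ← RingHom.map_det, h0, map_zero]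
  have hu : IsUnit M.det := hdet.isUnit
  refine ⟨AlgEquiv.ofAlgHom (linHom M) (linHom M⁻¹) ?_ ?_,
    ⟨isFormMap_linHom M, isFormMap_linHom M⁻¹⟩, fun T => by rw [e]; rfl⟩
  · rw [linHom_comp, nonsing_inv_mul _ hu, linHom_one]
  · rw [linHom_comp, mul_nonsing_inv _ hu, linHom_one]

theorem jacobian_mul_X {A : Poly3 k} {n : ℕ} (hA : A.IsHomogeneous n) :
    jacobian (fun i => A * X i) = C (1 + n : k) * A ^ 3 := by
  have := hA.sum_X_mul_pderiv
  rw [Fin.sum_univ_three, nsmul_eq_mul] at this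
  rw [jacobian_eq]
  simp only [pderiv_mul, pderiv_X, Pi.single_apply]
  simp
  linear_combination A ^ 2 * this

end Linear

section BirConj

variable {k : Type*} [Field k] {d : ℕ} {Φ Γ η κ : Hom3 k} {e e' : ℕ} {A B : Poly3 k}

namespace BirConj

theorem η_ne_zero (h : BirConj d Φ Γ η κ e e' A B) (i : Fin 3) : η (X i) ≠ 0 := by
  intro h0
  have := h.comp' i
  rw [h0, map_zero, eq_comm, mul_eq_zero] at this
  exact this.elim h.B_ne_zero (X_ne_zero i)

theorem apply_comp (h : BirConj d Φ Γ η κ e e' A B) {T : Poly3 k} {n : ℕ}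
    (hT : T.IsHomogeneous n) : η (κ T) = A ^ n * T := by
  have : η.comp κ = aeval fun i => A * X i :=
    MvPolynomial.algHom_ext fun i => by rw [AlgHom.comp_apply, h.comp, aeval_X]
  rw [← AlgHom.comp_apply, this, aeval_mul_left_of_isHomogeneous hT, aeval_X_left_apply]

theorem isHomogeneous_A (h : BirConj d Φ Γ η κ e e' A B) : A.IsHomogeneous (e * e' - 1) := by
  have h1 := h.formη.apply (h.formκ 0)
  rw [h.comp 0] at h1
  have h2 : A * X 0 ≠ 0 := mul_ne_zero h.A_ne_zero (X_ne_zero 0)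
  obtain ⟨m, hm⟩ := isHomogeneous_of_dvd h1 h2 (dvd_mul_right A (X 0))
  have := (hm.mul (isHomogeneous_X k 0)).inj_right h1 h2
  rwa [show e * e' - 1 = m by omega]

theorem pos (h : BirConj d Φ Γ η κ e e' A B) : 0 < e * e' := by
  have h1 := h.formη.apply (h.formκ 0)
  rw [h.comp 0] at h1
  have h2 : A * X 0 ≠ 0 := mul_ne_zero h.A_ne_zero (X_ne_zero 0)
  have := (h.isHomogeneous_A.mul (isHomogeneous_X k 0)).inj_right h1 h2
  omega

theorem apply_A [IsAlgClosed k] (h : BirConj d Φ Γ η κ e e' A B) : Φ A = A ^ d := by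
  have h1 := h.conj (κ (X 0))
  rw [h.conj', h.comp, map_mul, h.apply_comp (h.formΦ 0)] at h1
  exact mul_right_cancel₀ (IsRegularMap.ne_zero (by have := h.two_le; omega) h.formΦ h.regΦ 0) h1

theorem apply_B (h : BirConj d Φ Γ η κ e e' A B) : η B = A ^ e := by
  have h1 := h.apply_comp (h.formη 0)
  rw [h.comp', map_mul] at h1
  exact mul_right_cancel₀ (h.η_ne_zero 0) h1

theorem jacobian_mul (h : BirConj d Φ Γ η κ e e' A B) :
    η (jacobian fun i => κ (X i)) * jacobian (fun i => η (X i)) = C ((e * e' : ℕ) : k) * A ^ 3 := by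
  have := jacobian_comp η fun i => κ (X i)
  simp only [h.comp, jacobian_mul_X h.isHomogeneous_A] at this
  rw [← this]
  congr 2
  rw [Nat.cast_sub h.pos]
  simp

theorem jacobian_ne_zero [CharZero k] (h : BirConj d Φ Γ η κ e e' A B) :
    jacobian (fun i => η (X i)) ≠ 0 := by
  intro h0
  have := h.jacobian_mul
  rw [h0, mul_zero, eq_comm, mul_eq_zero, C_eq_zero] at this
  exact this.elim (Nat.cast_ne_zero.2 h.pos.ne') (pow_ne_zero _ h.A_ne_zero)

theorem linConj_of_eq_one [CharZero k] (h : BirConj d Φ Γ η κ 1 e' A B) : LinConj Φ Γ := by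
  obtain ⟨l, hl, e⟩ := exists_isLin_of_jacobian_ne_zero h.formη h.jacobian_ne_zero
  exact ⟨l, hl, fun T => by rw [e, e, h.conj]⟩

end BirConj

end BirConj

section Factors

variable {k : Type*} [Field k]

/-- A system of representatives of the irreducible factors of `A`, of degrees `δ`. -/
structure FactorBasis {ι : Type*} (A : Poly3 k) (P : ι → Poly3 k) (δ : ι → ℕ) : Prop where
  irr : ∀ i, Irreducible (P i)
  hom : ∀ i, (P i).IsHomogeneous (δ i)
  inj : ∀ i j, P i ∣ P j → i = j
  dvd : ∀ i, P i ∣ A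
  cover : ∀ Q, Irreducible Q → Q ∣ A → ∃ i, Associated Q (P i)

theorem exists_factorBasis {A : Poly3 k} {n : ℕ} (hA : A.IsHomogeneous n) (hA0 : A ≠ 0) :
    ∃ (r : ℕ) (P : Fin r → Poly3 k) (δ : Fin r → ℕ), FactorBasis A P δ := by
  classical
  let s : Finset (Associates (Poly3 k)) :=
    ((UniqueFactorizationMonoid.factors A).map Associates.mk).toFinset
  let P : Fin s.card → Poly3 k := fun i => Quot.out (s.equivFin.symm i).1
  have hP : ∀ i, Associates.mk (P i) = (s.equivFin.symm i).1 := fun i => Associates.quot_out _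
  have hs : ∀ i, ∃ Q ∈ UniqueFactorizationMonoid.factors A, Associated Q (P i) := by
    intro i
    have h1 := (s.equivFin.symm i).2
    rw [← hP, Multiset.mem_toFinset, Multiset.mem_map] at h1
    obtain ⟨Q, hQ, e⟩ := h1
    exact ⟨Q, hQ, Associates.mk_eq_mk_iff_associated.1 e⟩
  have irr : ∀ i, Irreducible (P i) := fun i => by
    obtain ⟨Q, hQ, e⟩ := hs i
    exact e.irreducible (UniqueFactorizationMonoid.irreducible_of_factor Q hQ)
  have dvd : ∀ i, P i ∣ A := fun i => by
    obtain ⟨Q, hQ, e⟩ := hs i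
    exact e.dvd_iff_dvd_left.1 (UniqueFactorizationMonoid.dvd_of_mem_factors hQ)
  choose δ hδ using fun i => isHomogeneous_of_dvd hA hA0 (dvd i)
  refine ⟨s.card, P, δ, irr, hδ, fun i j hij => ?_, dvd, fun Q hQ hQA => ?_⟩
  · have := Associates.mk_eq_mk_iff_associated.2 ((irr i).associated_of_dvd (irr j) hij)
    rw [hP, hP] at this
    exact s.equivFin.symm.injective (Subtype.ext this)
  · obtain ⟨R, hR, e⟩ := UniqueFactorizationMonoid.exists_mem_factors_of_dvd hA0 hQ hQA
    have hm : Associates.mk R ∈ s := Multiset.mem_toFinset.2 (Multiset.mem_map_of_mem _ hR)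
    refine ⟨s.equivFin ⟨_, hm⟩, e.trans (Associates.mk_eq_mk_iff_associated.1 ?_)⟩
    rw [hP, Equiv.symm_apply_apply]

theorem MvPolynomial.exists_C_of_isUnit {σ : Type*} {u : MvPolynomial σ k} (hu : IsUnit u) :
    ∃ c : k, c ≠ 0 ∧ u = C c := by
  obtain ⟨c, hc, e⟩ := MvPolynomial.isUnit_iff_eq_C_of_isReduced.1 hu
  exact ⟨c, hc.ne_zero, e⟩

variable {ι : Type*} {A : Poly3 k} {P : ι → Poly3 k} {δ : ι → ℕ}

namespace FactorBasis

theorem pos (h : FactorBasis A P δ) (i : ι) : 0 < δ i :=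
  IsHomogeneous.pos_of_irreducible (h.hom i) (h.irr i)

theorem conj (h : FactorBasis A P δ) {l : Poly3 k ≃ₐ[k] Poly3 k} (hl : IsLin l) :
    FactorBasis (l A) (fun i => l (P i)) δ where
  irr i := (MulEquiv.irreducible_iff l).2 (h.irr i)
  hom i := hl.apply (h.hom i)
  inj i j hij := h.inj i j ((map_dvd_iff l).1 hij)
  dvd i := map_dvd l (h.dvd i)
  cover Q hQ hQA := by
    obtain ⟨i, u, hu⟩ := h.cover (l.symm Q) ((MulEquiv.irreducible_iff l.symm).2 hQ) <| by
      have := map_dvd l.symm hQA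
      rwa [AlgEquiv.symm_apply_apply] at this
    refine ⟨i, Units.map (l : Poly3 k →* Poly3 k) u, ?_⟩
    rw [← hu, map_mul, AlgEquiv.apply_symm_apply]
    rfl

variable [Fintype ι]

theorem eq_prod (h : FactorBasis A P δ) {T : Poly3 k} (h0 : T ≠ 0)
    (hT : ∀ Q, Irreducible Q → Q ∣ T → Q ∣ A) :
    ∃ (c : k) (n : ι → ℕ), c ≠ 0 ∧ T = C c * ∏ i, P i ^ n i := by
  classical
  induction T using WfDvdMonoid.induction_on_irreducible with
  | zero => exact absurd rfl h0
  | unit u hu =>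
    obtain ⟨c, hc, rfl⟩ := exists_C_of_isUnit hu
    exact ⟨c, 0, hc, by simp⟩
  | mul a q ha hq ih =>
    obtain ⟨c, n, hc, e⟩ := ih ha fun Q hQ hQa => hT Q hQ (hQa.mul_left q)
    obtain ⟨j, u, hu⟩ := h.cover q hq (hT q hq (dvd_mul_right q a))
    obtain ⟨b, hb, hub⟩ := exists_C_of_isUnit (u⁻¹).isUnit
    refine ⟨b * c, n + Pi.single j 1, mul_ne_zero hb hc, ?_⟩
    have hq' : q = P j * C b := by rw [← hu, mul_assoc, ← hub]; simp
    simp only [Pi.add_apply, pow_add, Finset.prod_mul_distrib]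
    rw [Finset.prod_eq_single (f := fun i => P i ^ (Pi.single j 1 : ι → ℕ) i) j
      (fun i _ hi => by simp [Pi.single_eq_of_ne hi]) (by simp), Pi.single_eq_same, pow_one,
      e, hq', C_mul]
    ring

theorem le_of_prod_dvd (h : FactorBasis A P δ) {a b : ι → ℕ} {c : k} (hc : c ≠ 0)
    (hd : ∏ i, P i ^ a i ∣ C c * ∏ i, P i ^ b i) : a ≤ b := by
  classical
  intro i
  have hp : Prime (P i) := (h.irr i).prime
  have h1 : P i ^ a i ∣ C c * ∏ i, P i ^ b i :=
    (Finset.dvd_prod_of_mem (fun i => P i ^ a i) (Finset.mem_univ i)).trans hd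
  rw [← Finset.mul_prod_erase _ _ (Finset.mem_univ i), mul_left_comm, mul_comm] at h1
  have hn : ¬ P i ∣ C c * ∏ j ∈ Finset.univ.erase i, P j ^ b j := by
    intro hdv
    rcases hp.dvd_or_dvd hdv with h2 | h2
    · exact hp.not_isUnit (isUnit_of_dvd_unit h2 ((IsUnit.mk0 c hc).map C))
    · obtain ⟨j, hj, h3⟩ := (hp.dvd_finsetProd_iff _).1 h2
      exact (Finset.mem_erase.1 hj).1 (h.inj i j (hp.dvd_of_dvd_pow h3)).symm
  have h2 := hp.pow_dvd_of_dvd_mul_left _ hn h1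
  exact (pow_dvd_pow_iff hp.ne_zero hp.not_isUnit).1 h2

theorem isHomogeneous_prod (h : FactorBasis A P δ) (c : k) (n : ι → ℕ) :
    (C c * ∏ i, P i ^ n i).IsHomogeneous (∑ i, δ i * n i) := by
  simpa using (isHomogeneous_C _ c).mul
    (IsHomogeneous.prod Finset.univ _ _ fun i _ => (h.hom i).pow (n i))

end FactorBasis

/-- The data of the action of `Φ` on the irreducible curves `P i`, permuted by `σ`. -/
structure PermutesFactors (d : ℕ) (Φ : Hom3 k) (P : ι → Poly3 k) (δ : ι → ℕ)
    (σ : Equiv.Perm ι) (m : ι → ℕ) (c : ι → k) : Prop where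
  ne_zero : ∀ i, c i ≠ 0
  apply : ∀ i, Φ (P i) = C (c i) * P (σ i) ^ m i
  deg : ∀ i, δ (σ i) * m i = d * δ i

theorem FactorBasis.exists_permutesFactors [Fintype ι] [IsAlgClosed k] [CharZero k]
    (h : FactorBasis A P δ) {d : ℕ} (hd : 0 < d) {Φ : Hom3 k} (hΦ : IsFormMap Φ d)
    (hr : IsRegularMap Φ) (hA : Φ A = A ^ d) :
    ∃ σ m c, PermutesFactors d Φ P δ σ m c := by
  classical
  have hJ := hΦ.jacobian_ne_zero hd hr
  have ne : ∀ i, Φ (P i) ≠ 0 := fun i h0 =>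
    (h.irr i).ne_zero (eq_zero_of_algHom_eq_zero hJ (h.hom i) h0)
  have hdvd : ∀ i Q, Irreducible Q → Q ∣ Φ (P i) → Q ∣ A := fun i Q hQ hQi =>
    hQ.prime.dvd_of_dvd_pow (hA ▸ hQi.trans (map_dvd Φ (h.dvd i)))
  choose c n hc hn using fun i => h.eq_prod (ne i) (hdvd i)
  have hdeg : ∀ i, ∑ j, δ j * n i j = d * δ i := fun i => by
    have := hΦ.apply (h.hom i)
    rw [hn] at this
    exact (h.isHomogeneous_prod _ _).inj_right this (by rw [← hn]; exact ne i)
  have hex : ∀ i, ∃ j, n i j ≠ 0 := fun i => by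
    by_contra! h0
    have := hdeg i
    rw [Finset.sum_eq_zero fun j _ => by rw [h0, mul_zero]] at this
    exact (Nat.mul_pos hd (h.pos i)).ne this
  choose s hs using hex
  have hdv : ∀ i j, n i j ≠ 0 → P j ∣ Φ (P i) := fun i j hij => by
    rw [hn]
    exact ((dvd_pow_self _ hij).trans
      (Finset.dvd_prod_of_mem (fun j => P j ^ n i j) (Finset.mem_univ j))).mul_left _
  have huniq : ∀ i i' j, n i j ≠ 0 → n i' j ≠ 0 → i = i' := fun i i' j h1 h2 => by
    by_contra hne
    have hrel : IsRelPrime (P i) (P i') :=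
      ((h.irr i).isRelPrime_iff_not_dvd).2 fun h3 => hne (h.inj _ _ h3)
    exact (h.irr j).not_isUnit (hΦ.isRelPrime_apply (h.hom i) (h.hom i') hrel hd hr (ne i)
      (hdv i j h1) (hdv i' j h2))
  have hinj : Function.Injective s := fun i i' e => huniq i i' (s i) (hs i) (e ▸ hs i')
  have hbij : Function.Bijective s := Finite.injective_iff_bijective.1 hinj
  have hz : ∀ i j, j ≠ s i → n i j = 0 := fun i j hj => by
    by_contra h0
    obtain ⟨i', rfl⟩ := hbij.2 j
    exact hj (congrArg s (huniq i' i (s i') (hs i') h0))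
  refine ⟨Equiv.ofBijective s hbij, fun i => n i (s i), c, hc, fun i => ?_, fun i => ?_⟩
  · rw [hn, Finset.prod_eq_single (s i) (fun j _ hj => by rw [hz i j hj, pow_zero]) (by simp)]
    rfl
  · rw [← hdeg, Finset.sum_eq_single (s i) (fun j _ hj => by rw [hz i j hj, mul_zero]) (by simp)]
    rfl

theorem PermutesFactors.prod_dvd_jacobian [Fintype ι] [IsAlgClosed k] [CharZero k]
    (h : FactorBasis A P δ) {d : ℕ} (hd : 2 ≤ d) {Φ : Hom3 k} (hΦ : IsFormMap Φ d)
    (hr : IsRegularMap Φ) {σ : Equiv.Perm ι} {m : ι → ℕ} {c : ι → k}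
    (hσ : PermutesFactors d Φ P δ σ m c) :
    ∏ i, P (σ i) ^ (m i - 1) ∣ jacobian (fun i => Φ (X i)) ∧
      (∏ i, P (σ i) ^ (m i - 1)).IsHomogeneous ((d - 1) * ∑ i, δ i) := by
  have hm : ∀ i, 0 < m i := fun i => by
    refine Nat.pos_of_ne_zero fun h0 => ?_
    have := hσ.deg i
    rw [h0, mul_zero] at this
    exact (Nat.mul_pos (by omega) (h.pos i)).ne this
  constructor
  · refine Finset.prod_dvd_of_isRelPrime (fun i _ j _ hij => ?_) fun i _ =>
      hΦ.pow_dvd_jacobian (by omega) hr (h.hom i) (h.irr i) (h.irr _) (hm i) (hσ.apply i)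
    refine IsRelPrime.pow (((h.irr _).isRelPrime_iff_not_dvd).2 fun h3 => hij ?_)
    exact σ.injective (h.inj _ _ h3)
  · have := IsHomogeneous.prod Finset.univ (fun i => P (σ i) ^ (m i - 1)) _
      fun i _ => (h.hom (σ i)).pow (m i - 1)
    convert this using 1
    have h1 : ∑ i, δ (σ i) = ∑ i, δ i := Equiv.sum_comp σ δ
    have h2 : ∑ i, δ (σ i) * (m i - 1) + ∑ i, δ (σ i) = d * ∑ i, δ i := by
      rw [← Finset.sum_add_distrib, Finset.mul_sum]
      refine Finset.sum_congr rfl fun i _ => ?_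
      rw [← hσ.deg i]
      conv_rhs => rw [← Nat.sub_add_cancel (hm i)]
      ring
    rw [Nat.sub_mul, one_mul]
    omega

theorem PermutesFactors.sum_le [Fintype ι] [IsAlgClosed k] [CharZero k]
    (h : FactorBasis A P δ) {d : ℕ} (hd : 2 ≤ d) {Φ : Hom3 k} (hΦ : IsFormMap Φ d)
    (hr : IsRegularMap Φ) {σ : Equiv.Perm ι} {m : ι → ℕ} {c : ι → k}
    (hσ : PermutesFactors d Φ P δ σ m c) : ∑ i, δ i ≤ 3 := by
  obtain ⟨h1, h2⟩ := hσ.prod_dvd_jacobian h hd hΦ hr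
  obtain ⟨-, -, -, h3⟩ := h2.exists_mul_eq hΦ.isHomogeneous_jacobian
    (hΦ.jacobian_ne_zero (by omega) hr) h1
  rw [mul_comm 3] at h3
  exact Nat.le_of_mul_le_mul_left h3 (by omega)

/-- The exponents of the pullbacks of the irreducible factors of `B`. -/
theorem BirConj.exists_exponents {ι' : Type*} [Fintype ι] [Fintype ι'] [CharZero k]
    {d : ℕ} {Φ Γ η κ : Hom3 k} {e e' : ℕ} {B : Poly3 k} {Q : ι' → Poly3 k} {ε : ι' → ℕ}
    (h : BirConj d Φ Γ η κ e e' A B) (hP : FactorBasis A P δ) (hQ : FactorBasis B Q ε) :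
    ∃ (b : ι' → k) (N : ι' → ι → ℕ), (∀ j, b j ≠ 0) ∧ (∀ j, η (Q j) = C (b j) * ∏ i, P i ^ N j i) ∧
      (∀ j, ∑ i, δ i * N j i = e * ε j) ∧
      LinearIndependent ℤ fun j i => (N j i : ℤ) := by
  have hJ := h.jacobian_ne_zero
  have ne : ∀ i, η (Q i) ≠ 0 := fun i h0 =>
    (hQ.irr i).ne_zero (eq_zero_of_algHom_eq_zero hJ (hQ.hom i) h0)
  choose b N hb hN using fun j => hP.eq_prod (ne j) fun R hR hRj =>
    hR.prime.dvd_of_dvd_pow (h.apply_B ▸ hRj.trans (map_dvd η (hQ.dvd j)))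
  have hdeg : ∀ j, ∑ i, δ i * N j i = e * ε j := fun j => by
    have := h.formη.apply (hQ.hom j)
    rw [hN] at this
    exact (hP.isHomogeneous_prod _ _).inj_right this (by rw [← hN]; exact ne j)
  refine ⟨b, N, hb, hN, hdeg, ?_⟩
  have he : 0 < e := Nat.pos_of_mul_pos_right h.pos
  rw [Fintype.linearIndependent_iff]
  intro g hg
  have happ : ∀ n : ι' → ℕ, η (∏ j, Q j ^ n j) =
      C (∏ j, b j ^ n j) * ∏ i, P i ^ (∑ j, n j * N j i) := fun n => by
    simp only [map_prod, map_pow, hN, mul_pow, Finset.prod_mul_distrib, ← Finset.prod_pow,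
      ← Finset.prod_pow_eq_pow_sum, ← pow_mul]
    rw [Finset.prod_comm]
    simp only [mul_comm]
  set p : ι' → ℕ := fun j => (g j).toNat with hp
  set q : ι' → ℕ := fun j => (-g j).toNat with hq
  have hgpq : ∀ j, g j = p j - q j := fun j => by simp only [hp, hq]; omega
  have hsum : ∀ i, ∑ j, p j * N j i = ∑ j, q j * N j i := fun i => by
    have := congrFun hg i
    simp only [Finset.sum_apply, Pi.smul_apply, smul_eq_mul, Pi.zero_apply, hgpq, sub_mul,
      Finset.sum_sub_distrib, sub_eq_zero] at this
    exact_mod_cast this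
  have hdpq : ∑ j, ε j * p j = ∑ j, ε j * q j := by
    have h1 : ∀ n : ι' → ℕ, e * ∑ j, ε j * n j = ∑ i, δ i * ∑ j, n j * N j i := fun n => by
      simp only [Finset.mul_sum]
      rw [Finset.sum_comm]
      refine Finset.sum_congr rfl fun j _ => ?_
      rw [← mul_assoc, ← hdeg, Finset.sum_mul]
      exact Finset.sum_congr rfl fun i _ => by ring
    refine Nat.eq_of_mul_eq_mul_left he ?_
    rw [h1, h1]
    simp only [hsum]
  have hu : ∏ j, b j ^ q j ≠ 0 := Finset.prod_ne_zero_iff.2 fun j _ => pow_ne_zero _ (hb j)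
  have hv : ∏ j, b j ^ p j ≠ 0 := Finset.prod_ne_zero_iff.2 fun j _ => pow_ne_zero _ (hb j)
  have hzero : C (∏ j, b j ^ q j) * ∏ j, Q j ^ p j - C (∏ j, b j ^ p j) * ∏ j, Q j ^ q j = 0 := by
    refine eq_zero_of_algHom_eq_zero hJ (n := ∑ j, ε j * p j)
      ((hQ.isHomogeneous_prod _ _).sub (hdpq ▸ hQ.isHomogeneous_prod _ _)) ?_
    rw [map_sub, map_mul, map_mul, Hom3.map_C, Hom3.map_C, happ, happ]
    simp only [hsum]
    ring
  rw [sub_eq_zero] at hzero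
  have hle : p ≤ q := hQ.le_of_prod_dvd hv (hzero ▸ dvd_mul_left _ _)
  have hge : q ≤ p := hQ.le_of_prod_dvd hu (hzero ▸ dvd_mul_left _ _)
  intro j
  rw [hgpq, le_antisymm hle hge, sub_self]

theorem BirConj.card_le {ι' : Type*} [Fintype ι] [Fintype ι'] [CharZero k]
    {d : ℕ} {Φ Γ η κ : Hom3 k} {e e' : ℕ} {B : Poly3 k} {Q : ι' → Poly3 k} {ε : ι' → ℕ}
    (h : BirConj d Φ Γ η κ e e' A B) (hP : FactorBasis A P δ) (hQ : FactorBasis B Q ε) :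
    Fintype.card ι' ≤ Fintype.card ι := by
  obtain ⟨-, N, -, -, -, hN⟩ := h.exists_exponents hP hQ
  simpa using hN.fintype_card_le_finrank

end Factors

section CoeffHomogeneous

variable {k : Type*} [Field k]

/-- A ring homomorphism `θ : R → R[X]` with `θ r |_{X = 1} = r` describes a grading; divisors of
homogeneous elements are homogeneous. -/
theorem Polynomial.eq_monomial_of_mul {R : Type*} [CommRing R] [IsDomain R]
    (θ : R →+* Polynomial R) (hθ : ∀ r, (θ r).eval 1 = r) {p q : R} {n : ℕ}
    (h : θ (p * q) = Polynomial.monomial n (p * q)) (h0 : p * q ≠ 0) :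
    ∃ i j, i + j = n ∧ θ p = Polynomial.monomial i p ∧ θ q = Polynomial.monomial j q := by
  have key : ∀ r, (θ r).natDegree = (θ r).natTrailingDegree →
      θ r = Polynomial.monomial (θ r).natDegree r := by
    intro r hr
    obtain ⟨a, ha⟩ : ∃ a, θ r = Polynomial.monomial (θ r).natDegree a := by
      refine ⟨(θ r).coeff (θ r).natDegree, ?_⟩
      ext m
      rw [Polynomial.coeff_monomial]
      split_ifs with hm
      · rw [hm]
      · rcases lt_or_gt_of_ne hm with hm | hm
        · exact Polynomial.coeff_eq_zero_of_natDegree_lt hm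
        · exact Polynomial.coeff_eq_zero_of_lt_natTrailingDegree (by omega)
    have := hθ r
    rw [ha, Polynomial.eval_monomial, one_pow, mul_one] at this
    rwa [this] at ha
  have e := h
  rw [map_mul] at e
  have ne : θ p * θ q ≠ 0 := by
    rw [e]
    simpa using h0
  have h1 := Polynomial.natDegree_mul (left_ne_zero_of_mul ne) (right_ne_zero_of_mul ne)
  have h2 := Polynomial.natTrailingDegree_mul (left_ne_zero_of_mul ne) (right_ne_zero_of_mul ne)
  rw [e, Polynomial.natDegree_monomial_eq n h0] at h1
  rw [e, Polynomial.natTrailingDegree_monomial h0] at h2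
  have h3 := Polynomial.natTrailingDegree_le_natDegree (θ p)
  have h4 := Polynomial.natTrailingDegree_le_natDegree (θ q)
  exact ⟨_, _, h1.symm, key p (by omega), key q (by omega)⟩

/-- The grading of `k[X₀,X₁,X₂][u]` by the degree of the coefficients. -/
noncomputable def coeffGrading (k : Type*) [Field k] :
    Polynomial (Poly3 k) →+* Polynomial (Polynomial (Poly3 k)) :=
  Polynomial.eval₂RingHom (R := Poly3 k) (S := Polynomial (Polynomial (Poly3 k)))
    (((Polynomial.mapRingHom Polynomial.C :
      Polynomial (Poly3 k) →+* Polynomial (Polynomial (Poly3 k)))).comp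
        (gradingHom (Fin 3) k : Poly3 k →+* Polynomial (Poly3 k)))
    (Polynomial.C Polynomial.X)

theorem coeffGrading_C (p : Poly3 k) :
    coeffGrading k (Polynomial.C p) = (gradingHom (Fin 3) k p).map Polynomial.C := by
  simp [coeffGrading]

theorem coeffGrading_X : coeffGrading k Polynomial.X = Polynomial.C Polynomial.X := by
  simp [coeffGrading]

theorem coeffGrading_eval_one (f : Polynomial (Poly3 k)) : (coeffGrading k f).eval 1 = f := by
  have h : ∀ p : Poly3 k, (gradingHom (Fin 3) k p).eval 1 = p := by
    intro p
    have : ((Polynomial.aeval (R := Poly3 k) 1).restrictScalars k).comp (gradingHom (Fin 3) k) =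
        AlgHom.id k _ := by
      refine MvPolynomial.algHom_ext fun i => ?_
      simp [gradingHom]
    exact congrArg (fun φ => φ p) this
  induction f using Polynomial.induction_on' with
  | add p q hp hq => simp [hp, hq]
  | monomial n a =>
    rw [← Polynomial.C_mul_X_pow_eq_monomial, map_mul, map_pow, coeffGrading_C, coeffGrading_X,
      Polynomial.eval_mul, Polynomial.eval_pow, Polynomial.eval_C]
    congr 1
    have := Polynomial.eval_map_apply (f := (Polynomial.C : Poly3 k →+* _))
      (p := gradingHom (Fin 3) k a) 1
    rw [map_one] at this
    rw [this, h]

theorem coeff_coeff_coeffGrading (f : Polynomial (Poly3 k)) (n l : ℕ) :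
    ((coeffGrading k f).coeff n).coeff l = homogeneousComponent n (f.coeff l) := by
  induction f using Polynomial.induction_on' with
  | add p q hp hq => simp [hp, hq]
  | monomial m a =>
    rw [← Polynomial.C_mul_X_pow_eq_monomial, map_mul, map_pow, coeffGrading_C, coeffGrading_X,
      ← map_pow, Polynomial.coeff_mul_C, Polynomial.coeff_map, Polynomial.coeff_C_mul_X_pow,
      Polynomial.coeff_C_mul_X_pow, coeff_gradingHom]
    split_ifs <;> simp

theorem coeffGrading_eq_monomial {f : Polynomial (Poly3 k)} {n : ℕ} :
    coeffGrading k f = Polynomial.monomial n f ↔ ∀ l, (f.coeff l).IsHomogeneous n := by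
  constructor
  · intro h l
    refine isHomogeneous_of_homogeneousComponent fun m hm => ?_
    rw [← coeff_coeff_coeffGrading, h, Polynomial.coeff_monomial, if_neg hm.symm,
      Polynomial.coeff_zero]
  · intro h
    ext1 m
    ext1 l
    rw [coeff_coeff_coeffGrading, homogeneousComponent_of_mem (h l), Polynomial.coeff_monomial]
    simp only [eq_comm (a := m)]
    split_ifs <;> simp

theorem isHomogeneous_coeff_of_mul {f g : Polynomial (Poly3 k)} {n : ℕ}
    (h : ∀ l, ((f * g).coeff l).IsHomogeneous n) (h0 : f * g ≠ 0) :
    ∃ i j, i + j = n ∧ (∀ l, (f.coeff l).IsHomogeneous i) ∧ ∀ l, (g.coeff l).IsHomogeneous j := by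
  simp only [← coeffGrading_eq_monomial] at h ⊢
  exact Polynomial.eq_monomial_of_mul _ coeffGrading_eval_one h h0

theorem isHomogeneous_coeff_aeval {T : Poly3 k} {n : ℕ} (hT : T.IsHomogeneous n)
    {f : Fin 3 → Polynomial (Poly3 k)} (hf : ∀ i l, ((f i).coeff l).IsHomogeneous 1) (l : ℕ) :
    ((aeval f T).coeff l).IsHomogeneous n := by
  revert l
  simp only [← coeffGrading_eq_monomial] at hf ⊢
  let θ : Polynomial (Poly3 k) →ₐ[k] Polynomial (Polynomial (Poly3 k)) :=
    { coeffGrading k with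
      commutes' := fun r => by
        change coeffGrading k (algebraMap k _ r) = _
        rw [IsScalarTower.algebraMap_apply k (Poly3 k) (Polynomial (Poly3 k)),
          Polynomial.algebraMap_eq, coeffGrading_C, MvPolynomial.algebraMap_eq]
        simp only [gradingHom, algHom_C]
        rw [IsScalarTower.algebraMap_apply k (Poly3 k) (Polynomial (Poly3 k)),
          IsScalarTower.algebraMap_apply k (Poly3 k) (Polynomial (Polynomial (Poly3 k))),
          Polynomial.algebraMap_eq, Polynomial.map_C]
        rfl }
  change θ (aeval f T) = _
  have : θ (aeval f T) = aeval (fun i => Polynomial.X * Polynomial.C (f i)) T := by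
    have : θ.comp (aeval f) = aeval (fun i => Polynomial.X * Polynomial.C (f i)) := by
      refine MvPolynomial.algHom_ext fun i => ?_
      rw [AlgHom.comp_apply, aeval_X, aeval_X]
      change coeffGrading k (f i) = _
      rw [hf, Polynomial.X_mul_C, ← pow_one (Polynomial.X : Polynomial (Polynomial (Poly3 k))),
        Polynomial.C_mul_X_pow_eq_monomial]
    exact congrArg (fun φ => φ T) this
  rw [this, aeval_mul_left_of_isHomogeneous hT (Polynomial.X : Polynomial (Polynomial (Poly3 k)))
    fun i => Polynomial.C (f i), ← Polynomial.C_mul_X_pow_eq_monomial,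
    Polynomial.X_pow_mul]
  congr 1
  have : (aeval fun i => Polynomial.C (f i)) =
      (Polynomial.CAlgHom (A := Polynomial (Poly3 k)) (R := k)).comp (aeval f) :=
    MvPolynomial.algHom_ext fun i => by simp
  rw [this]
  rfl

/-- The top coefficient of a form evaluated at polynomials of bounded degree. -/
theorem natDegree_aeval_le_and_coeff {R : Type*} [CommRing R] [Algebra k R] {T : Poly3 k} {n : ℕ}
    (hT : T.IsHomogeneous n) {f : Fin 3 → Polynomial R} {a : ℕ} (hf : ∀ i, (f i).natDegree ≤ a) :
    (aeval f T).natDegree ≤ a * n ∧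
      (aeval f T).coeff (a * n) = aeval (fun i => (f i).coeff a) T := by
  have key : ∀ m : Fin 3 →₀ ℕ, (m.prod fun i e => f i ^ e).natDegree ≤ a * m.degree ∧
      (m.prod fun i e => f i ^ e).coeff (a * m.degree) =
        m.prod fun i e => (f i).coeff a ^ e := by
    intro m
    rw [Finsupp.prod_fintype _ _ (by simp), Finsupp.prod_fintype _ _ (by simp),
      Fin.prod_univ_three, Fin.prod_univ_three, Finsupp.degree_eq_sum, Fin.sum_univ_three]
    have h : ∀ i, (f i ^ m i).natDegree ≤ m i * a := fun i =>
      Polynomial.natDegree_pow_le_of_le (m i) (hf i)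
    have h' : ∀ i, (f i ^ m i).coeff (m i * a) = (f i).coeff a ^ m i := fun i =>
      Polynomial.coeff_pow_of_natDegree_le (hf i)
    have h01 := Polynomial.natDegree_mul_le_of_le (h 0) (h 1)
    have e : a * (m 0 + m 1 + m 2) = m 0 * a + m 1 * a + m 2 * a := by ring
    rw [e]
    refine ⟨Polynomial.natDegree_mul_le_of_le h01 (h 2), ?_⟩
    rw [Polynomial.coeff_mul_add_eq_of_natDegree_le h01 (h 2),
      Polynomial.coeff_mul_add_eq_of_natDegree_le (h 0) (h 1), h', h', h']
  have key2 : ∀ m ∈ T.support, m.degree = n := fun m hm => by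
    by_contra hne
    exact mem_support_iff.1 hm (hT.coeff_eq_zero hne)
  constructor
  · rw [aeval_def, eval₂_eq]
    refine Polynomial.natDegree_sum_le_of_forall_le _ _ fun m hm => ?_
    rw [IsScalarTower.algebraMap_apply k R (Polynomial R), Polynomial.algebraMap_eq]
    have := (key m).1
    rw [key2 m hm] at this
    exact (Polynomial.natDegree_C_mul_le _ _).trans this
  · rw [aeval_def, eval₂_eq, Polynomial.finsetSum_coeff, aeval_def, eval₂_eq]
    refine Finset.sum_congr rfl fun m hm => ?_
    rw [IsScalarTower.algebraMap_apply k R (Polynomial R), Polynomial.algebraMap_eq,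
      Polynomial.coeff_C_mul]
    have := (key m).2
    rw [key2 m hm] at this
    exact congrArg _ this

end CoeffHomogeneous

section Conic

variable {k : Type*} [Field k]

theorem isHomogeneous_resultant {f g : Polynomial (Poly3 k)} {i j : ℕ}
    (hf : ∀ l, (f.coeff l).IsHomogeneous i) (hg : ∀ l, (g.coeff l).IsHomogeneous i) :
    (Polynomial.resultant f g j j).IsHomogeneous ((j + j) * i) := by
  rw [Polynomial.resultant, Matrix.det_apply]
  refine IsHomogeneous.sum _ _ _ fun σ _ => ?_
  have h : ∀ a b, (Polynomial.sylvester f g j j a b).IsHomogeneous i := by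
    intro a b
    rw [Polynomial.sylvester, Matrix.of_apply]
    refine Fin.addCases (fun b => ?_) (fun b => ?_) b
    · rw [Fin.addCases_left]
      split_ifs
      exacts [hg _, isHomogeneous_zero _ _ _]
    · rw [Fin.addCases_right]
      split_ifs
      exacts [hf _, isHomogeneous_zero _ _ _]
  have hp := IsHomogeneous.prod Finset.univ
    (fun a => Polynomial.sylvester f g j j (σ a) a) (fun _ => i) fun a _ => h _ _
  rw [Finset.sum_const, Finset.card_univ, Fintype.card_fin, smul_eq_mul] at hp
  rcases Int.units_eq_one_or (Equiv.Perm.sign σ) with hs | hs <;> rw [hs]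
  · simpa using hp
  · simpa using hp.neg

theorem Polynomial.exists_root_of_resultant_eq_zero [IsAlgClosed k] {f g : Polynomial k} {j : ℕ}
    (hf : f.natDegree ≤ j) (hg : g.natDegree ≤ j)
    (h : Polynomial.resultant f g j j = 0) :
    (f.coeff j = 0 ∧ g.coeff j = 0) ∨ ∃ u, f.eval u = 0 ∧ g.eval u = 0 := by
  have main : ∀ {f g : Polynomial k}, f.natDegree ≤ j → g.natDegree ≤ j →
      Polynomial.resultant f g j j = 0 → f.coeff j ≠ 0 → ∃ u, f.eval u = 0 ∧ g.eval u = 0 := by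
    intro f g hf hg h h0
    have hf' : f.natDegree = j := le_antisymm hf (Polynomial.le_natDegree_of_ne_zero h0)
    obtain ⟨c, hc⟩ := Nat.exists_eq_add_of_le hg
    have e := Polynomial.resultant_add_right_deg f g j g.natDegree c le_rfl
    rw [← hc, h, zero_eq_mul] at e
    have e' := e.resolve_left (pow_ne_zero _ h0)
    nth_rewrite 1 [← hf'] at e'
    have := (Polynomial.resultant_eq_zero_iff.1 e').2
    rw [Polynomial.isCoprime_iff_aeval_ne_zero_of_isAlgClosed k k] at this
    push Not at this
    simpa using this
  by_cases h1 : f.coeff j = 0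
  · by_cases h2 : g.coeff j = 0
    · exact Or.inl ⟨h1, h2⟩
    · rw [Polynomial.resultant_comm, mul_eq_zero] at h
      obtain ⟨u, hu, hu'⟩ := main hg hf (h.resolve_left (pow_ne_zero _ (by simp))) h2
      exact Or.inr ⟨u, hu', hu⟩
  · exact Or.inr (main hf hg h h1)

theorem exists_common_zero_bihomogeneous [IsAlgClosed k] {f g : Polynomial (Poly3 k)} {i j : ℕ}
    (hf : ∀ l, (f.coeff l).IsHomogeneous i) (hg : ∀ l, (g.coeff l).IsHomogeneous i)
    (hf' : f.natDegree ≤ j) (hg' : g.natDegree ≤ j) (hi : 0 < i) (hj : 0 < j) :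
    ∃ v : Fin 3 → k, v ≠ 0 ∧ v 2 = 0 ∧ ((eval v (f.coeff j) = 0 ∧ eval v (g.coeff j) = 0) ∨
      ∃ u, (f.map (eval v)).eval u = 0 ∧ (g.map (eval v)).eval u = 0) := by
  obtain ⟨v, hv, h0, h2⟩ := exists_common_zero (isHomogeneous_resultant (j := j) hf hg)
    (isHomogeneous_X k 2) (by positivity) one_pos
  rw [eval_X] at h2
  rw [← Polynomial.resultant_map_map] at h0
  refine ⟨v, hv, h2, ?_⟩
  have := Polynomial.exists_root_of_resultant_eq_zero
    (Polynomial.natDegree_map_le.trans hf') (Polynomial.natDegree_map_le.trans hg') h0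
  simpa only [Polynomial.coeff_map] using this

/-- The `d`-th powers of the linear forms vanishing at the points of a line span more than a
pencil. -/
theorem not_pencil [CharZero k] {d : ℕ} (hd : 2 ≤ d) {U V : Poly3 k} {x y : ℕ → k} {c : k}
    (hc : c ≠ 0)
    (h : ∀ l, C (x l) * U + C (y l) * V =
      ((Polynomial.C (C c) * (Polynomial.C (X 0) - Polynomial.C (X 1) * Polynomial.X) ^ d :
        Polynomial (Poly3 k))).coeff l) : False := by
  have hco : ∀ l, ((Polynomial.C (C c) * (Polynomial.C (X 0) -
      Polynomial.C (X 1) * Polynomial.X) ^ d : Polynomial (Poly3 k))).coeff l =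
        C (c * (-1) ^ l * (d.choose l : k)) * (X 0 ^ (d - l) * X 1 ^ l) := by
    intro l
    have e : (Polynomial.C (X 0) - Polynomial.C (X 1) * Polynomial.X : Polynomial (Poly3 k)) =
        ((Polynomial.X + Polynomial.C (X 0) : Polynomial (Poly3 k))).comp
          (Polynomial.C (-X 1) * Polynomial.X) := by
      simp
      ring
    rw [e, ← Polynomial.pow_comp, Polynomial.coeff_C_mul, Polynomial.comp_C_mul_X_coeff,
      Polynomial.coeff_X_add_C_pow]
    simp only [map_mul, map_pow, map_neg, map_one, map_natCast]
    rw [neg_pow]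
    ring
  simp only [hco] at h
  have hl : ∀ l ≤ d, c * (-1) ^ l * (d.choose l : k) ≠ 0 := fun l hl =>
    mul_ne_zero (mul_ne_zero hc (pow_ne_zero _ (by simp)))
      (Nat.cast_ne_zero.2 (Nat.choose_pos hl).ne')
  obtain ⟨r, hr, hr'⟩ : ∃ r ≠ 0, !![x 0, x 1, x d; y 0, y 1, y d; 0, 0, 0] *ᵥ r = 0 :=
    Matrix.exists_mulVec_eq_zero_iff.2 (by simp [Matrix.det_fin_three])
  have hx : x 0 * r 0 + x 1 * r 1 + x d * r 2 = 0 := by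
    simpa [Matrix.mulVec, dotProduct, Fin.sum_univ_three] using congrFun hr' 0
  have hy : y 0 * r 0 + y 1 * r 1 + y d * r 2 = 0 := by
    simpa [Matrix.mulVec, dotProduct, Fin.sum_univ_three] using congrFun hr' 1
  have key : ∀ s t : k, c * r 0 * s ^ d - c * d * r 1 * (s ^ (d - 1) * t) +
      c * (-1) ^ d * r 2 * t ^ d = 0 := by
    intro s t
    have h0 := congrArg (eval ![s, t, 0]) (h 0)
    have h1 := congrArg (eval ![s, t, 0]) (h 1)
    have h2 := congrArg (eval ![s, t, 0]) (h d)
    simp only [map_add, map_mul, map_pow, eval_C, eval_X, Nat.choose_zero_right,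
      Nat.choose_one_right, Nat.choose_self, Nat.sub_self, Nat.sub_zero, pow_zero, pow_one,
      Nat.cast_one, mul_one, one_mul, Matrix.cons_val_zero, Matrix.cons_val_one] at h0 h1 h2
    linear_combination (eval ![s, t, 0] U) * hx + (eval ![s, t, 0] V) * hy - r 0 * h0 - r 1 * h1 -
      r 2 * h2
  have hd1 : d - 1 ≠ 0 := by omega
  have hd0 : d ≠ 0 := by omega
  have r0 : r 0 = 0 := by simpa [hd0, hc] using key 1 0
  have r2 : r 2 = 0 := by simpa [hd0, hd1, hc] using key 0 1
  have r1 : r 1 = 0 := by simpa [hd0, hc, r0, r2] using key 1 1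
  refine hr (funext fun i => ?_)
  fin_cases i
  exacts [r0, r1, r2]

end Conic

section Conic

variable {k : Type*} [Field k]

/-- The parametrisation of the plane by pairs of points of the conic `4 X₀ X₂ = X₁ ^ 2`, in the
chart where the second point is finite. -/
noncomputable def conicCover (k : Type*) [Field k] : Poly3 k →ₐ[k] Polynomial (Poly3 k) :=
  aeval ![Polynomial.C (X 0) * Polynomial.X,
    Polynomial.C (X 0) + Polynomial.C (X 1) * Polynomial.X, Polynomial.C (X 1)]

theorem eval_conicCover (T : Poly3 k) (v : Fin 3 → k) (u : k) :
    ((conicCover k T).map (eval v)).eval u = eval ![v 0 * u, v 0 + v 1 * u, v 1] T := by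
  induction T using MvPolynomial.induction_on with
  | C a =>
    rw [algHom_C, IsScalarTower.algebraMap_apply k (Poly3 k) (Polynomial (Poly3 k)),
      Polynomial.algebraMap_eq, MvPolynomial.algebraMap_eq]
    simp
  | add p q hp hq => simp only [map_add, Polynomial.map_add, Polynomial.eval_add, hp, hq]
  | mul_X p i hp =>
    simp only [map_mul, Polynomial.map_mul, Polynomial.eval_mul, hp, eval_X]
    congr 1
    fin_cases i <;> simp [conicCover]

theorem natDegree_conicCover_le {T : Poly3 k} {n : ℕ} (hT : T.IsHomogeneous n) :
    (conicCover k T).natDegree ≤ n ∧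
      ∀ v, eval v ((conicCover k T).coeff n) = eval ![v 0, v 1, 0] T := by
  have := natDegree_aeval_le_and_coeff hT (a := 1)
    (f := ![Polynomial.C (X 0) * Polynomial.X,
      Polynomial.C (X 0) + Polynomial.C (X 1) * Polynomial.X, (Polynomial.C (X 1) :
        Polynomial (Poly3 k))]) (by
      intro i
      fin_cases i
      · exact Polynomial.natDegree_C_mul_le _ _ |>.trans Polynomial.natDegree_X_le
      · exact Polynomial.natDegree_add_le_of_degree_le (by simp)
          ((Polynomial.natDegree_C_mul_le _ _).trans Polynomial.natDegree_X_le)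
      · simp)
  rw [one_mul] at this
  refine ⟨this.1, fun v => ?_⟩
  rw [conicCover, this.2, eval_algHom_apply]
  congr 2
  funext i
  fin_cases i <;> simp

theorem isHomogeneous_coeff_conicCover {T : Poly3 k} {n : ℕ} (hT : T.IsHomogeneous n) (l : ℕ) :
    ((conicCover k T).coeff l).IsHomogeneous n := by
  refine isHomogeneous_coeff_aeval hT (fun i l => ?_) l
  fin_cases i
  · simp only [Fin.zero_eta, cons_val_zero, Polynomial.coeff_C_mul_X]
    split_ifs
    exacts [isHomogeneous_X _ _, isHomogeneous_zero _ _ _]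
  · simp only [Fin.mk_one, cons_val_one, cons_val_zero, Polynomial.coeff_add,
      Polynomial.coeff_C_mul_X, Polynomial.coeff_C]
    refine IsHomogeneous.add ?_ ?_ <;> split_ifs
    exacts [isHomogeneous_X _ _, isHomogeneous_zero _ _ _, isHomogeneous_X _ _,
      isHomogeneous_zero _ _ _]
  · simp only [Fin.reduceFinMk, cons_val, Polynomial.coeff_C]
    split_ifs
    exacts [isHomogeneous_X _ _, isHomogeneous_zero _ _ _]

theorem eval_eq_zero_of_conicCover_eq_zero [CharZero k] {T : Poly3 k} {n : ℕ}
    (hT : T.IsHomogeneous n) (h : conicCover k T = 0) {v : Fin 3 → k}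
    (hv : 4 * v 0 * v 2 = v 1 ^ 2) : eval v T = 0 := by
  have h2 : (2 : k) ≠ 0 := two_ne_zero
  by_cases h0 : v 2 = 0
  · have h1 : v 1 = 0 := by
      rw [h0, mul_zero] at hv
      exact pow_eq_zero_iff two_ne_zero |>.1 hv.symm
    have := (natDegree_conicCover_le hT).2 v
    rw [h, Polynomial.coeff_zero, map_zero] at this
    rw [this]
    congr 2
    funext i
    fin_cases i <;> simp [h0, h1]
  · have := eval_conicCover T ![v 1 / 2, v 2, 0] (v 1 / (2 * v 2))
    rw [h, Polynomial.map_zero, Polynomial.eval_zero] at this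
    rw [this]
    congr 2
    funext i
    fin_cases i
    · simp
      field_simp
      linear_combination hv
    · simp
      field_simp
      ring
    · simp

theorem not_invariant_conic [IsAlgClosed k] [CharZero k] {Φ : Hom3 k} {d : ℕ} (hd : 2 ≤ d)
    (h : IsFormMap Φ d) (hr : IsRegularMap Φ) {c : k} (hc : c ≠ 0)
    (hP : Φ (C 4 * X 0 * X 2 - X 1 ^ 2) = C c * (C 4 * X 0 * X 2 - X 1 ^ 2) ^ d) : False := by
  have hF : ∀ v, 4 * eval v (Φ (X 0)) * eval v (Φ (X 2)) - eval v (Φ (X 1)) ^ 2 =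
      c * (4 * v 0 * v 2 - v 1 ^ 2) ^ d := by
    intro v
    have := congrArg (eval v) hP
    simpa [Hom3.map_C] using this
  have hne : ∀ i j : Fin 3, (i = 0 ∧ j = 2) ∨ (i = 2 ∧ j = 0) →
      conicCover k (Φ (X i)) ≠ 0 := by
    intro i j hij h0
    obtain ⟨v, hv, hv1, hv2⟩ := exists_common_zero (f := C 4 * X 0 * X 2 - X 1 ^ 2) (a := 2)
      (g := Φ (X j)) (by
        exact (((isHomogeneous_C _ _).mul (isHomogeneous_X k 0)).mul (isHomogeneous_X k 2)).sub
          ((isHomogeneous_X k 1).pow 2)) (h j) two_pos (by omega)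
    have hv' : 4 * v 0 * v 2 = v 1 ^ 2 := by simpa [sub_eq_zero] using hv1
    have hi := eval_eq_zero_of_conicCover_eq_zero (h i) h0 hv'
    obtain ⟨m, hm⟩ := hr v hv
    have e := hF v
    rw [hv', sub_self, zero_pow (by omega), mul_zero] at e
    obtain ⟨rfl, rfl⟩ | ⟨rfl, rfl⟩ := hij
    · fin_cases m
      · exact hm hi
      · exact hm (by simpa [hi] using e)
      · exact hm hv2
    · fin_cases m
      · exact hm hv2
      · exact hm (by simpa [hi] using e)
      · exact hm hi
  obtain ⟨γ, hγ⟩ := IsAlgClosed.exists_pow_nat_eq (-c * (-1) ^ d) (n := 2) two_pos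
  have hγ0 : γ ≠ 0 := by
    rintro rfl
    simp [hc] at hγ
  set a := conicCover k (Φ (X 0)) with ha
  set b := conicCover k (Φ (X 1)) with hb
  set e := conicCover k (Φ (X 2)) with he
  set W : Polynomial (Poly3 k) := Polynomial.C (X 0) - Polynomial.C (X 1) * Polynomial.X with hW
  set g : Polynomial (Poly3 k) := Polynomial.C (C γ) with hg
  have hC : ∀ x : k, conicCover k (C x) = Polynomial.C (C x) := by
    intro x
    rw [algHom_C, IsScalarTower.algebraMap_apply k (Poly3 k) (Polynomial (Poly3 k)),
      Polynomial.algebraMap_eq, MvPolynomial.algebraMap_eq]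
  have k4 : (4 : k) ≠ 0 := by norm_num
  have hC4 : Polynomial.C (C 4 : Poly3 k) = 4 := by
    rw [map_ofNat C 4, map_ofNat Polynomial.C 4]
  have eW : conicCover k (C 4 * X 0 * X 2 - X 1 ^ 2) = -W ^ 2 := by
    simp only [map_sub, map_mul, map_pow, hC, hC4]
    simp [conicCover, hW]
    ring
  have main : a * (4 * e) = (b + g * W ^ d) * (b - g * W ^ d) := by
    have e1 := congrArg (conicCover k) hP
    have e2 : g ^ 2 = -Polynomial.C (C c) * (-1) ^ d := by
      rw [hg, ← map_pow, ← map_pow, hγ]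
      simp only [map_mul, map_neg, map_pow, map_one]
    rw [map_mul (conicCover k), map_pow (conicCover k), eW, hC] at e1
    simp only [map_sub, map_mul, map_pow, Hom3.map_C, hC, hC4, ← ha, ← hb, ← he] at e1
    rw [neg_pow (W ^ 2), ← pow_mul] at e1
    ring_nf at e1 ⊢
    linear_combination e1 + W ^ (d * 2) * e2
  have h4 : (4 : Polynomial (Poly3 k)) ≠ 0 := by
    rw [← hC4, Ne, Polynomial.C_eq_zero, C_eq_zero]
    exact k4
  have ha0 : a ≠ 0 := hne 0 2 (by simp)
  have he0 : 4 * e ≠ 0 := mul_ne_zero h4 (hne 2 0 (by simp))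
  have hbpm := main ▸ mul_ne_zero ha0 he0
  obtain ⟨α, a', hα, ha', eα⟩ := exists_dvd_and_dvd_of_dvd_mul (Dvd.intro _ main)
  obtain ⟨β', hβ⟩ := hα
  obtain ⟨c', hc'⟩ := ha'
  have hec : 4 * e = β' * c' := by
    refine mul_left_cancel₀ ha0 ?_
    rw [main, hβ, hc', eα]
    ring
  have h2C : (Polynomial.C (C 2 : Poly3 k)) = 2 := by
    rw [map_ofNat C 2, map_ofNat Polynomial.C 2]
  have h2 : (2 : Polynomial (Poly3 k)) ≠ 0 := by
    rw [← h2C, Ne, Polynomial.C_eq_zero, C_eq_zero]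
    exact (two_ne_zero : (2 : k) ≠ 0)
  have hreg : ∀ (v : Fin 3 → k) (u : k), v ≠ 0 → v 2 = 0 →
      ¬ ((a.map (eval v)).eval u = 0 ∧ ((2 * b).map (eval v)).eval u = 0 ∧
        ((4 * e).map (eval v)).eval u = 0) := by
    rintro v u hv hv2 ⟨h0, h1, h2⟩
    rw [← hC4] at h2
    rw [← h2C] at h1
    simp only [Polynomial.map_mul, Polynomial.map_C, Polynomial.eval_mul, Polynomial.eval_C,
      eval_C, mul_eq_zero, (two_ne_zero : (2 : k) ≠ 0), k4,
      false_or] at h0 h1 h2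
    rw [ha, eval_conicCover] at h0
    rw [hb, eval_conicCover] at h1
    rw [he, eval_conicCover] at h2
    obtain ⟨m, hm⟩ := hr ![v 0 * u, v 0 + v 1 * u, v 1] fun h0 => hv <| by
      have h3 := congrFun h0 1
      have h4 : v 1 = 0 := congrFun h0 2
      simp only [cons_val_one, cons_val_zero, Pi.zero_apply, h4, zero_mul, add_zero] at h3
      funext i
      fin_cases i
      exacts [h3, h4, hv2]
    fin_cases m
    exacts [hm h0, hm h1, hm h2]
  have hregtop : ∀ v : Fin 3 → k, v ≠ 0 → v 2 = 0 →
      ¬ (eval v (a.coeff d) = 0 ∧ eval v ((2 * b).coeff d) = 0 ∧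
        eval v ((4 * e).coeff d) = 0) := by
    rintro v hv hv2 ⟨h0, h1, h2⟩
    rw [← hC4] at h2
    rw [← h2C] at h1
    simp only [Polynomial.coeff_C_mul, map_mul, eval_C, mul_eq_zero, (two_ne_zero : (2 : k) ≠ 0),
      k4, false_or] at h1 h2
    rw [ha, (natDegree_conicCover_le (h 0)).2] at h0
    rw [hb, (natDegree_conicCover_le (h 1)).2] at h1
    rw [he, (natDegree_conicCover_le (h 2)).2] at h2
    obtain ⟨m, hm⟩ := hr ![v 0, v 1, 0] fun h0 => hv <| by
      have h3 : v 0 = 0 := congrFun h0 0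
      have h4 : v 1 = 0 := congrFun h0 1
      funext i
      fin_cases i
      exacts [h3, h4, hv2]
    fin_cases m
    exacts [hm h0, hm h1, hm h2]
  have claim : ∀ {α a' β' c' : Polynomial (Poly3 k)} {i j j' : ℕ}, a = α * a' →
      4 * e = β' * c' → 2 * b = α * β' + a' * c' → (∀ l, (α.coeff l).IsHomogeneous i) →
      (∀ l, (c'.coeff l).IsHomogeneous i) → α.natDegree ≤ j → c'.natDegree ≤ j →
      a'.natDegree ≤ j' → β'.natDegree ≤ j' → j + j' = d → i = 0 ∨ j = 0 := by
    intro α a' β' c' i j j' h1 h2 h3 h4 h5 h6 h7 h8 h9 h10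
    by_contra! hij
    obtain ⟨v, hv, hv2, ⟨hv3, hv4⟩ | ⟨u, hv3, hv4⟩⟩ := exists_common_zero_bihomogeneous h4 h5 h6 h7
      (Nat.pos_of_ne_zero hij.1) (Nat.pos_of_ne_zero hij.2)
    · refine hregtop v hv hv2 ⟨?_, ?_, ?_⟩
      · rw [h1, ← h10, Polynomial.coeff_mul_add_eq_of_natDegree_le h6 h8, map_mul, hv3, zero_mul]
      · rw [h3, Polynomial.coeff_add, ← h10, Polynomial.coeff_mul_add_eq_of_natDegree_le h6 h9,
          add_comm j, Polynomial.coeff_mul_add_eq_of_natDegree_le h8 h7, map_add, map_mul, map_mul,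
          hv3, hv4, zero_mul, mul_zero, add_zero]
      · rw [h2, ← h10, add_comm j, Polynomial.coeff_mul_add_eq_of_natDegree_le h9 h7, map_mul, hv4,
          mul_zero]
    · refine hreg v u hv hv2 ⟨?_, ?_, ?_⟩
      · rw [h1, Polynomial.map_mul, Polynomial.eval_mul, hv3, zero_mul]
      · rw [h3, Polynomial.map_add, Polynomial.map_mul, Polynomial.map_mul, Polynomial.eval_add,
          Polynomial.eval_mul, Polynomial.eval_mul, hv3, hv4, zero_mul, mul_zero, add_zero]
      · rw [h2, Polynomial.map_mul, Polynomial.eval_mul, hv4, mul_zero]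
  have huniq : ∀ {f : Polynomial (Poly3 k)} {i j : ℕ}, f ≠ 0 → (∀ l, (f.coeff l).IsHomogeneous i) →
      (∀ l, (f.coeff l).IsHomogeneous j) → i = j := by
    intro f i j hf h1 h2
    obtain ⟨l, hl⟩ : ∃ l, f.coeff l ≠ 0 := by
      by_contra! h0
      exact hf (Polynomial.ext fun l => by rw [h0, Polynomial.coeff_zero])
    exact (h1 l).inj_right (h2 l) hl
  have hWhom : ∀ l, ((g * W ^ d).coeff l).IsHomogeneous d := by
    have : g * W ^ d = aeval (fun _ => W) (C γ * X 0 ^ d : Poly3 k) := by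
      rw [map_mul, map_pow, aeval_X, algHom_C,
        IsScalarTower.algebraMap_apply k (Poly3 k) (Polynomial (Poly3 k)),
        Polynomial.algebraMap_eq, MvPolynomial.algebraMap_eq]
    intro l
    rw [this]
    refine isHomogeneous_coeff_aeval (by
      simpa using (isHomogeneous_C _ γ).mul ((isHomogeneous_X k (0 : Fin 3)).pow d))
        (fun _ l => ?_) l
    rw [hW, Polynomial.coeff_sub, Polynomial.coeff_C_mul_X, Polynomial.coeff_C]
    refine IsHomogeneous.sub ?_ ?_ <;> split_ifs
    exacts [isHomogeneous_X _ _, isHomogeneous_zero _ _ _, isHomogeneous_X _ _,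
      isHomogeneous_zero _ _ _]
  have hWdeg : (g * W ^ d).natDegree ≤ d := by
    refine (Polynomial.natDegree_C_mul_le _ _).trans ?_
    refine (Polynomial.natDegree_pow_le_of_le d (?_ : W.natDegree ≤ 1)).trans (mul_one d).le
    exact (Polynomial.natDegree_sub_le _ _).trans (max_le (by simp)
      ((Polynomial.natDegree_C_mul_le _ _).trans Polynomial.natDegree_X_le))
  have hba : ∀ l, (b.coeff l).IsHomogeneous d := fun l => isHomogeneous_coeff_conicCover (h 1) l
  have hbdeg : b.natDegree ≤ d := (natDegree_conicCover_le (h 1)).1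
  have hedeg : (4 * e).natDegree ≤ d := by
    rw [← hC4]
    exact (Polynomial.natDegree_C_mul_le _ _).trans (natDegree_conicCover_le (h 2)).1
  have hadeg : a.natDegree ≤ d := (natDegree_conicCover_le (h 0)).1
  obtain ⟨i, i', hii, hαi, hai⟩ := isHomogeneous_coeff_of_mul (f := α) (g := a') (n := d)
    (fun l => eα ▸ isHomogeneous_coeff_conicCover (h 0) l) (eα ▸ ha0)
  have hbp0 := left_ne_zero_of_mul hbpm
  have hbm0 := right_ne_zero_of_mul hbpm
  obtain ⟨i₁, j₁, hij₁, hα₁, hβ₁⟩ := isHomogeneous_coeff_of_mul (f := α) (g := β') (n := d)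
    (fun l => by
      rw [← hβ, Polynomial.coeff_add]
      exact (hba l).add (hWhom l)) (hβ ▸ hbp0)
  obtain ⟨i₂, j₂, hij₂, ha₂, hc₂⟩ := isHomogeneous_coeff_of_mul (f := a') (g := c') (n := d)
    (fun l => by
      rw [← hc', Polynomial.coeff_sub]
      exact (hba l).sub (hWhom l)) (hc' ▸ hbm0)
  have hα0 : α ≠ 0 := left_ne_zero_of_mul (eα ▸ ha0)
  have ha'0 : a' ≠ 0 := right_ne_zero_of_mul (eα ▸ ha0)
  have hβ0 : β' ≠ 0 := right_ne_zero_of_mul (hβ ▸ hbp0)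
  have hc0 : c' ≠ 0 := right_ne_zero_of_mul (hc' ▸ hbm0)
  obtain rfl := huniq hα0 hαi hα₁
  obtain rfl := huniq ha'0 hai ha₂
  obtain rfl : j₁ = i' := by omega
  obtain rfl : j₂ = i := by omega
  have d1 : α.natDegree + a'.natDegree ≤ d := by
    rw [← Polynomial.natDegree_mul hα0 ha'0, ← eα]
    exact hadeg
  have d2 : α.natDegree + β'.natDegree ≤ d := by
    rw [← Polynomial.natDegree_mul hα0 hβ0, ← hβ]
    exact Polynomial.natDegree_add_le_of_degree_le hbdeg hWdeg
  have d3 : a'.natDegree + c'.natDegree ≤ d := by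
    rw [← Polynomial.natDegree_mul ha'0 hc0, ← hc']
    exact (Polynomial.natDegree_sub_le _ _).trans (max_le hbdeg hWdeg)
  have d4 : β'.natDegree + c'.natDegree ≤ d := by
    rw [← Polynomial.natDegree_mul hβ0 hc0, ← hec]
    exact hedeg
  obtain ⟨j, j', hjj, dα, dc, da, dβ⟩ : ∃ j j', j + j' = d ∧ α.natDegree ≤ j ∧ c'.natDegree ≤ j ∧
      a'.natDegree ≤ j' ∧ β'.natDegree ≤ j' :=
    ⟨max α.natDegree c'.natDegree, d - max α.natDegree c'.natDegree, by omega, by omega, by omega,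
      by omega, by omega⟩
  have e2b : 2 * b = α * β' + a' * c' := by
    rw [← hβ, ← hc']
    ring
  have h1 := claim eα hec e2b hαi hc₂ dα dc da dβ hjj
  have h2 := claim (eα.trans (mul_comm _ _)) (hec.trans (mul_comm _ _)) (e2b.trans (add_comm _ _))
    hai hβ₁ da dβ dα dc (by omega)
  have hdiff : α * β' - a' * c' = Polynomial.C (C (2 * γ)) * W ^ d := by
    rw [← hβ, ← hc', map_mul, map_mul, h2C]
    ring
  have h2γ : 2 * γ ≠ 0 := mul_ne_zero two_ne_zero hγ0
  rcases h1 with rfl | rfl <;> rcases h2 with rfl | rfl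
  · omega
  · obtain ⟨a₀, rfl⟩ := Polynomial.natDegree_eq_zero.1 (Nat.le_zero.1 da)
    obtain ⟨β₀, rfl⟩ := Polynomial.natDegree_eq_zero.1 (Nat.le_zero.1 dβ)
    choose x hx using fun l => (hαi l).exists_eq_C
    choose y hy using fun l => (hc₂ l).exists_eq_C
    refine not_pencil hd (U := β₀) (V := -a₀) (x := x) (y := y) h2γ fun l => ?_
    rw [← hdiff, Polynomial.coeff_sub, Polynomial.coeff_mul_C, Polynomial.coeff_C_mul, hx, hy]
    ring
  · obtain ⟨α₀, rfl⟩ := Polynomial.natDegree_eq_zero.1 (Nat.le_zero.1 dα)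
    obtain ⟨c₀, rfl⟩ := Polynomial.natDegree_eq_zero.1 (Nat.le_zero.1 dc)
    choose x hx using fun l => (hβ₁ l).exists_eq_C
    choose y hy using fun l => (hai l).exists_eq_C
    refine not_pencil hd (U := α₀) (V := -c₀) (x := x) (y := y) h2γ fun l => ?_
    rw [← hdiff, Polynomial.coeff_sub, Polynomial.coeff_mul_C, Polynomial.coeff_C_mul, hx, hy]
    ring
  · omega

end Conic

section NormalForms

variable {k : Type*} [Field k]

theorem algEquiv_C (l : Poly3 k ≃ₐ[k] Poly3 k) (c : k) : l (C c) = C c :=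
  l.commutes c

theorem exists_isLin_of_det_ne_zero {M : Matrix (Fin 3) (Fin 3) k} (hM : M.det ≠ 0) :
    ∃ l : Poly3 k ≃ₐ[k] Poly3 k, IsLin l ∧ ∀ i, l (X i) = ∑ j, C (M i j) * X j := by
  obtain ⟨l, hl, hl'⟩ := exists_isLin_of_jacobian_ne_zero (isFormMap_linHom M) (by
    simp only [linHom_X]
    have : (Matrix.of fun i j => pderiv j (∑ l, C (M i l) * X l)) =
        (C : k →+* Poly3 k).mapMatrix M := by
      ext1 i j
      simp only [of_apply, RingHom.mapMatrix_apply, map_apply, map_sum]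
      rw [Finset.sum_eq_single j]
      · simp
      · intro b _ hb
        simp [pderiv_X_of_ne hb]
      · simp
    rw [jacobian, this, ← RingHom.map_det]
    simpa using hM)
  exact ⟨l, hl, fun i => by rw [hl', linHom_X]⟩

/-- Any point can be moved to a coordinate vertex. -/
theorem exists_isLin_eval {v : Fin 3 → k} (hv : v ≠ 0) (j : Fin 3) :
    ∃ l : Poly3 k ≃ₐ[k] Poly3 k, IsLin l ∧ ∀ T, eval (Pi.single j 1) (l T) = eval v T := by
  obtain ⟨M, hM, hMj⟩ : ∃ M : Matrix (Fin 3) (Fin 3) k, M.det ≠ 0 ∧ ∀ i, M i j = v i := by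
    obtain ⟨i, hi⟩ := Function.ne_iff.1 hv
    refine ⟨(Matrix.of fun a b => if Equiv.swap i j a = b then 1 else 0).updateCol j v, ?_,
      fun a => by simp⟩
    fin_cases i <;> fin_cases j <;>
      simp [Matrix.det_fin_three, Equiv.swap_apply_def] <;> simpa using hi
  obtain ⟨l, hl, hl'⟩ := exists_isLin_of_det_ne_zero hM
  refine ⟨l, hl, fun T => ?_⟩
  rw [← AlgEquiv.coe_toAlgHom, eval_algHom_apply]
  congr 2
  funext i
  rw [AlgEquiv.coe_toAlgHom, hl', map_sum, Finset.sum_eq_single j]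
  · simp [hMj]
  · intro b _ hb
    simp [hb]
  · simp

theorem exists_eq_of_isHomogeneous_two [CharZero k] {T : Poly3 k} (hT : T.IsHomogeneous 2) :
    ∃ a b c p q r : k, T = C a * X 0 ^ 2 + C b * X 0 * X 1 + C c * X 1 ^ 2 +
      (C p * X 0 + C q * X 1) * X 2 + C r * X 2 ^ 2 := by
  choose M hM using fun i => exists_eq_sum_of_isHomogeneous_one (hT.pderiv (i := i))
  have h := hT.sum_X_mul_pderiv
  have h2 : C (2⁻¹ : k) * 2 = (1 : Poly3 k) := by
    rw [← map_ofNat C 2, ← map_mul, inv_mul_cancel₀ two_ne_zero, map_one]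
  refine ⟨2⁻¹ * M 0 0, 2⁻¹ * (M 0 1 + M 1 0), 2⁻¹ * M 1 1, 2⁻¹ * (M 0 2 + M 2 0),
    2⁻¹ * (M 1 2 + M 2 1), 2⁻¹ * M 2 2, ?_⟩
  simp only [hM, Fin.sum_univ_three, nsmul_eq_mul, Nat.cast_ofNat] at h
  simp only [map_mul, map_add]
  linear_combination -T * h2 - C (2⁻¹ : k) * h

theorem not_irreducible_mul {A B : Poly3 k} {m n : ℕ} (hA : A.IsHomogeneous m)
    (hB : B.IsHomogeneous n) (hm : m ≠ 0) (hn : n ≠ 0) : ¬ Irreducible (A * B) := fun h => by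
  rcases h.isUnit_or_isUnit rfl with h | h
  · exact hm (hA.zero_of_isUnit h)
  · exact hn (hB.zero_of_isUnit h)

theorem isHomogeneous_linear (a b c : k) :
    (C a * X 0 + C b * X 1 + C c * X 2 : Poly3 k).IsHomogeneous 1 := by
  have h : ∀ (x : k) (i : Fin 3), (C x * X i : Poly3 k).IsHomogeneous 1 := fun x i => by
    simpa using (isHomogeneous_C _ x).mul (isHomogeneous_X k i)
  exact ((h _ _).add (h _ _)).add (h _ _)

/-- Binary quadratic forms are products of linear forms. -/
theorem exists_mul_eq_binary [IsAlgClosed k] (a b c : k) : ∃ A B : Poly3 k, A.IsHomogeneous 1 ∧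
    B.IsHomogeneous 1 ∧ C a * X 0 ^ 2 + C b * X 0 * X 1 + C c * X 1 ^ 2 = A * B := by
  by_cases ha : a = 0
  · refine ⟨X 1, _, isHomogeneous_X _ _, isHomogeneous_linear b c 0, ?_⟩
    simp [ha]
    ring
  · obtain ⟨r, hr⟩ := IsAlgClosed.exists_root
      (Polynomial.C a * Polynomial.X ^ 2 + Polynomial.C b * Polynomial.X + Polynomial.C c)
      (by rw [Polynomial.degree_quadratic ha]; decide)
    have hr' : a * r ^ 2 + b * r + c = 0 := by simpa using hr
    refine ⟨_, _, isHomogeneous_linear 1 (-r) 0, isHomogeneous_linear a (b + a * r) 0, ?_⟩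
    have : C a * C r ^ 2 + C b * C r + C c = (0 : Poly3 k) := by
      rw [← map_pow, ← map_mul, ← map_mul, ← map_add, ← map_add, hr', map_zero]
    simp only [map_one, map_neg, map_add, map_mul, map_zero]
    linear_combination X 1 ^ 2 * this

/-- An irreducible conic is projectively equivalent to `4 X₀ X₂ = X₁ ^ 2`. -/
theorem exists_isLin_conic [IsAlgClosed k] [CharZero k] {P : Poly3 k} (hP : P.IsHomogeneous 2)
    (hi : Irreducible P) : ∃ l : Poly3 k ≃ₐ[k] Poly3 k, IsLin l ∧
      l (C 4 * X 0 * X 2 - X 1 ^ 2) = P := by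
  have main : ∀ {P : Poly3 k}, P.IsHomogeneous 2 → Irreducible P →
      eval (Pi.single 2 1) P = 0 → ∃ l : Poly3 k ≃ₐ[k] Poly3 k, IsLin l ∧
        l (C 4 * X 0 * X 2 - X 1 ^ 2) = P := by
    intro P hP hi h0
    obtain ⟨a, b, c, p, q, r, e⟩ := exists_eq_of_isHomogeneous_two hP
    have hr : r = 0 := by simpa [e] using h0
    have h4 : (4 : k) ≠ 0 := by norm_num
    have hC4 : C (4⁻¹ : k) * C 4 = (1 : Poly3 k) := by
      rw [← map_mul, inv_mul_cancel₀ h4, map_one]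
    obtain ⟨s, hs⟩ : ∃ s : k → k, ∀ c, s c ^ 2 = -c :=
      ⟨fun c => (IsAlgClosed.exists_pow_nat_eq (-c) two_pos).choose,
        fun c => (IsAlgClosed.exists_pow_nat_eq (-c) two_pos).choose_spec⟩
    have hsC : ∀ c, C (s c) ^ 2 = -(C c : Poly3 k) := fun c => by
      rw [← map_pow, hs, map_neg]
    have hs0 : ∀ {c}, c ≠ 0 → s c ≠ 0 := fun {c} hc h => hc (by simpa [h] using (hs c).symm)
    subst hr
    simp only [map_zero, zero_mul, add_zero] at e
    by_cases hp : p = 0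
    · subst hp
      by_cases hq : q = 0
      · subst hq
        obtain ⟨A, B, hA, hB, h⟩ := exists_mul_eq_binary a b c
        refine absurd hi ?_
        rw [e]
        simpa [h] using not_irreducible_mul hA hB one_ne_zero one_ne_zero
      · have hdec : P = X 1 * (C b * X 0 + C c * X 1 + C q * X 2) + C a * X 0 ^ 2 := by
          rw [e, map_zero]
          ring
        have ha : a ≠ 0 := fun ha => by
          rw [hdec, ha, map_zero, zero_mul, add_zero] at hi
          exact not_irreducible_mul (isHomogeneous_X _ _) (isHomogeneous_linear b c q)
            one_ne_zero one_ne_zero hi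
        obtain ⟨l, hl, hl'⟩ := exists_isLin_of_det_ne_zero
          (M := !![0, 4⁻¹, 0; s a, 0, 0; b, c, q]) (by
            simp [Matrix.det_fin_three, hq, hs0 ha])
        refine ⟨l, hl, ?_⟩
        rw [hdec]
        simp only [map_sub, map_mul, map_pow, hl', Fin.sum_univ_three, algEquiv_C]
        simp
        linear_combination (X 1 * (C b * X 0 + C c * X 1 + C q * X 2)) * hC4 - X 0 ^ 2 * hsC a
    · obtain ⟨u, hu⟩ : ∃ u, u = a / p := ⟨_, rfl⟩
      obtain ⟨v, hv⟩ : ∃ v, v = (b - u * q) / p := ⟨_, rfl⟩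
      have hu' : p * u = a := by rw [hu]; field_simp
      have hv' : p * v + u * q = b := by rw [hv]; field_simp; ring
      have hdec : P = (C p * X 0 + C q * X 1 + C 0 * X 2) * (C u * X 0 + C v * X 1 + C 1 * X 2) +
          C (c - q * v) * X 1 ^ 2 := by
        rw [e, ← hu', ← hv']
        simp only [map_mul, map_add, map_sub, map_one, map_zero]
        ring
      have hc : c - q * v ≠ 0 := fun hc => by
        refine not_irreducible_mul (isHomogeneous_linear p q 0) (isHomogeneous_linear u v 1)
          one_ne_zero one_ne_zero ?_
        have : P = (C p * X 0 + C q * X 1 + C 0 * X 2) *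
            (C u * X 0 + C v * X 1 + C 1 * X 2) := by
          rw [hdec, hc]
          simp
        rwa [← this]
      obtain ⟨l, hl, hl'⟩ := exists_isLin_of_det_ne_zero
        (M := !![4⁻¹ * p, 4⁻¹ * q, 0; 0, s (c - q * v), 0; u, v, 1]) (by
          simp [Matrix.det_fin_three, hp, hs0 hc])
      refine ⟨l, hl, ?_⟩
      rw [hdec]
      have hh : C (s (c - q * v)) ^ 2 = C q * C v - (C c : Poly3 k) := by
        rw [hsC, map_sub, map_mul, neg_sub]
      simp only [map_sub, map_mul, map_pow, hl', Fin.sum_univ_three, algEquiv_C]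
      simp
      linear_combination ((C p * X 0 + C q * X 1) * (C u * X 0 + C v * X 1 + X 2)) * hC4 -
        X 1 ^ 2 * hh
  obtain ⟨v, hv, h0, -⟩ := exists_common_zero hP (isHomogeneous_X k (0 : Fin 3)) two_pos one_pos
  obtain ⟨l, hl, hl'⟩ := exists_isLin_eval hv 2
  obtain ⟨m, hm, hmP⟩ := main (hl.apply hP) (by simpa using hi.map l) (by rw [hl', h0])
  exact ⟨m.trans l.symm, hm.trans hl.symm, by simp [hmP]⟩

/-- An irreducible conic is never totally invariant. -/
theorem false_of_apply_conic [IsAlgClosed k] [CharZero k] {Φ : Hom3 k} {d : ℕ} (hd : 2 ≤ d)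
    (h : IsFormMap Φ d) (hr : IsRegularMap Φ) {P : Poly3 k} (hP : P.IsHomogeneous 2)
    (hi : Irreducible P) {c : k} (hc : c ≠ 0) (hΦ : Φ P = C c * P ^ d) : False := by
  obtain ⟨l, hl, rfl⟩ := exists_isLin_conic hP hi
  have hl' := hl.symm
  refine not_invariant_conic hd (h.conj hl' hl') (hr.conj hl') hc ?_
  rw [Hom3.conj_apply, AlgEquiv.symm_symm, hΦ, map_mul, map_pow, AlgEquiv.symm_apply_apply,
    algEquiv_C]

end NormalForms

section Lines

variable {k : Type*} [Field k]

theorem exists_isLin_pair {P Q : Poly3 k} (hP : P.IsHomogeneous 1) (hQ : Q.IsHomogeneous 1)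
    (hP0 : P ≠ 0) (h : ¬ P ∣ Q) : ∃ l : Poly3 k ≃ₐ[k] Poly3 k, IsLin l ∧ l (X 1) = P ∧
      l (X 2) = Q := by
  obtain ⟨a, rfl⟩ := exists_eq_sum_of_isHomogeneous_one hP
  obtain ⟨b, rfl⟩ := exists_eq_sum_of_isHomogeneous_one hQ
  have key : ∃ u : Fin 3 → k, (Matrix.of ![u, a, b]).det ≠ 0 := by
    by_contra! hdet
    have h0 := hdet (Pi.single 0 1)
    have h1 := hdet (Pi.single 1 1)
    have h2 := hdet (Pi.single 2 1)
    simp [Matrix.det_fin_three] at h0 h1 h2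
    have hab : ∀ i j, a i * b j = a j * b i := by
      intro i j
      fin_cases i <;> fin_cases j <;> simp <;> grind
    have ⟨i, hi⟩ : ∃ i, a i ≠ 0 := by
      by_contra! ha
      exact hP0 (by simp [ha])
    refine h ⟨C (b i / a i), ?_⟩
    rw [Finset.sum_mul]
    refine Finset.sum_congr rfl fun j _ => ?_
    rw [mul_right_comm, ← map_mul]
    congr 2
    rw [mul_div_assoc', hab, mul_comm]
    field_simp
  obtain ⟨u, hu⟩ := key
  obtain ⟨l, hl, hl'⟩ := exists_isLin_of_det_ne_zero hu
  exact ⟨l, hl, by simp [hl'], by simp [hl']⟩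

theorem exists_perm_three (τ : Equiv.Perm (Fin 3)) : ∃ ρ : Equiv.Perm (Fin 3),
    (∀ i, τ i = i) ∨ (τ (ρ 0) = ρ 1 ∧ τ (ρ 1) = ρ 0 ∧ τ (ρ 2) = ρ 2) ∨
      (τ (ρ 0) = ρ 1 ∧ τ (ρ 1) = ρ 2 ∧ τ (ρ 2) = ρ 0) := by
  revert τ
  decide

theorem exists_conj_perm_three (σ τ : Equiv.Perm (Fin 3)) (h : ∀ n : ℕ, σ ^ n = 1 ↔ τ ^ n = 1) :
    ∃ ρ : Equiv.Perm (Fin 3), ∀ i, σ (ρ i) = ρ (τ i) := by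
  have h1 := h 1
  have h2 := h 2
  clear h
  revert σ τ
  decide

/-- Rescaling of monomial maps. -/
theorem exists_rescaling [IsAlgClosed k] {d : ℕ} (hd : 2 ≤ d) (τ : Equiv.Perm (Fin 3))
    {b : Fin 3 → k} (hb : ∀ i, b i ≠ 0) :
    ∃ t : Fin 3 → k, (∀ i, t i ≠ 0) ∧ ∀ i, t i = b i * t (τ i) ^ d := by
  have key : ∀ (c : k) (n : ℕ), c ≠ 0 → 2 ≤ n → ∃ t, t ≠ 0 ∧ t = c * t ^ n := by
    intro c n hc hn
    obtain ⟨t, ht⟩ := IsAlgClosed.exists_pow_nat_eq c⁻¹ (show 0 < n - 1 by omega)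
    refine ⟨t, fun h => ?_, ?_⟩
    · rw [h, zero_pow (by omega)] at ht
      exact inv_ne_zero hc ht.symm
    · rw [show n = n - 1 + 1 by omega, pow_succ, ht, mul_inv_cancel_left₀ hc]
  obtain ⟨ρ, h⟩ := exists_perm_three τ
  have key2 : ∀ s : Fin 3 → k, (∀ i, s i ≠ 0) →
      (∀ i, s i = b (ρ i) * s (ρ.symm (τ (ρ i))) ^ d) →
      ∃ t : Fin 3 → k, (∀ i, t i ≠ 0) ∧ ∀ i, t i = b i * t (τ i) ^ d := fun s hs h =>
    ⟨s ∘ ρ.symm, fun i => hs _, fun i => by simpa using h (ρ.symm i)⟩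
  rcases h with h | ⟨h0, h1, h2⟩ | ⟨h0, h1, h2⟩
  · choose t ht ht' using fun i => key (b i) d (hb i) hd
    exact ⟨t, ht, fun i => by rw [h, ← ht']⟩
  · obtain ⟨s, hs, hs'⟩ := key (b (ρ 0) * b (ρ 1) ^ d) (d * d)
      (mul_ne_zero (hb _) (pow_ne_zero _ (hb _))) (by nlinarith)
    obtain ⟨u, hu, hu'⟩ := key (b (ρ 2)) d (hb _) hd
    refine key2 ![s, b (ρ 1) * s ^ d, u] (fun i => ?_) fun i => ?_
    · fin_cases i <;> simp [hs, hu, hb]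
    · fin_cases i
      · simp [h0, mul_pow, ← pow_mul, ← mul_assoc, ← hs']
      · simp [h1]
      · simp [h2, ← hu']
  · obtain ⟨s, hs, hs'⟩ := key (b (ρ 0) * b (ρ 1) ^ d * b (ρ 2) ^ (d * d)) (d * d * d)
      (by simp [hb]) (by nlinarith [mul_le_mul hd hd (by omega) (by omega)])
    refine key2 ![s, b (ρ 1) * (b (ρ 2) * s ^ d) ^ d, b (ρ 2) * s ^ d] (fun i => ?_) fun i => ?_
    · fin_cases i <;> simp [hs, hb]
    · fin_cases i
      · simp only [Fin.zero_eta, h0, Equiv.symm_apply_apply]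
        simp
        conv_lhs => rw [hs']
        ring
      · simp [h1]
      · simp [h2]

/-- Three totally invariant lines are never concurrent. -/
theorem PermutesFactors.exists_isLin [CharZero k] {A : Poly3 k}
    {P : Fin 3 → Poly3 k} (h : FactorBasis A P fun _ => 1) {d : ℕ} (hd : 2 ≤ d) {Φ : Hom3 k}
    {σ : Equiv.Perm (Fin 3)} {m : Fin 3 → ℕ} {c : Fin 3 → k}
    (hσ : PermutesFactors d Φ P (fun _ => 1) σ m c) :
    ∃ l : Poly3 k ≃ₐ[k] Poly3 k, IsLin l ∧ ∀ i, l (X i) = P i := by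
  choose M hM using fun i => exists_eq_sum_of_isHomogeneous_one (h.hom i)
  have hm : ∀ i, m i = d := fun i => by simpa using hσ.deg i
  by_cases hdet : (Matrix.of M).det = 0
  · exfalso
    obtain ⟨w, hw0, hw⟩ := Matrix.exists_vecMul_eq_zero_iff.2 hdet
    have hrel : ∑ i, C (w i) * P i = 0 := by
      simp only [hM, Finset.mul_sum, ← mul_assoc, ← map_mul]
      rw [Finset.sum_comm]
      simp only [← Finset.sum_mul, ← map_sum]
      refine Finset.sum_eq_zero fun j _ => ?_
      have : ∑ i, w i * M i j = 0 := by simpa [Matrix.vecMul, dotProduct] using congrFun hw j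
      rw [this, map_zero, zero_mul]
    have hpow : ∑ i, C (w (σ.symm i) * c (σ.symm i)) * P i ^ d = 0 := by
      rw [← Equiv.sum_comp σ]
      have := congrArg Φ hrel
      simpa [Hom3.map_C, hσ.apply, hm, ← mul_assoc] using this
    have hw1 : ∀ i, w i ≠ 0 := by
      intro i hi
      obtain ⟨j, hj⟩ := Function.ne_iff.1 hw0
      have hij : i ≠ j := fun e => hj (e ▸ hi)
      obtain ⟨n, hin, hnj, hu⟩ : ∃ n, i ≠ n ∧ n ≠ j ∧ Finset.univ = {i, j, n} := by
        clear * - hij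
        revert i j
        decide
      rw [hu, Finset.sum_insert (by simp [hij, hin]), Finset.sum_pair hnj.symm, hi, map_zero,
        zero_mul, zero_add] at hrel
      refine hnj (h.inj n j ?_)
      rw [← ((IsUnit.mk0 _ hj).map C).dvd_mul_left]
      exact ⟨-C (w n), by linear_combination hrel⟩
    obtain ⟨b, hb, hpow⟩ : ∃ b : Fin 3 → k, (∀ i, b i ≠ 0) ∧ ∑ i, C (b i) * P i ^ d = 0 :=
      ⟨_, fun i => mul_ne_zero (hw1 _) (hσ.ne_zero _), hpow⟩
    obtain ⟨l, hl, hl1, hl2⟩ := exists_isLin_pair (h.hom 1) (h.hom 2) (h.irr 1).ne_zero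
      fun hd => by simpa using h.inj _ _ hd
    have hP0 : P 0 = l (C (-(w 1 / w 0)) * X 1 + C (-(w 2 / w 0)) * X 2) := by
      have : C (w 0)⁻¹ * C (w 0) = (1 : Poly3 k) := by
        rw [← map_mul, inv_mul_cancel₀ (hw1 0), map_one]
      simp only [map_add, map_mul, hl1, hl2, algEquiv_C, map_neg, div_eq_mul_inv]
      rw [Fin.sum_univ_three] at hrel
      linear_combination -P 0 * this + C (w 0)⁻¹ * hrel
    obtain ⟨α, hα⟩ : ∃ α, α = -(w 1 / w 0) := ⟨_, rfl⟩
    obtain ⟨β, hβ⟩ : ∃ β, β = -(w 2 / w 0) := ⟨_, rfl⟩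
    have hα0 : α ≠ 0 := by simp [hα, hw1]
    have hβ0 : β ≠ 0 := by simp [hβ, hw1]
    rw [← hα, ← hβ] at hP0
    have hX : C (b 0) * (C α * X 1 + C β * X 2) ^ d + C (b 1) * X 1 ^ d + C (b 2) * X 2 ^ d =
        (0 : Poly3 k) := l.injective <| by
      rw [Fin.sum_univ_three, hP0] at hpow
      simpa [hl1, hl2, algEquiv_C] using hpow
    have h1 := congrArg (pderiv 1) hX
    have h2 : X 1 ∣ (C α * X 1 + C β * X 2 : Poly3 k) ^ (d - 1) := by
      have hu : IsUnit (C (b 0 * d * α) : Poly3 k) :=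
        (IsUnit.mk0 _ (by simp [hb, hα0, show d ≠ 0 by omega])).map C
      rw [← hu.dvd_mul_left]
      refine ⟨-C (b 1 * d) * X 1 ^ (d - 2), ?_⟩
      obtain ⟨n, rfl⟩ := Nat.exists_eq_add_of_le' hd
      have h2 : C 2 = (2 : Poly3 k) := map_ofNat C 2
      simp at h1 ⊢
      rw [h2]
      linear_combination h1
    have h3 := (X_prime (i := (1 : Fin 3))).dvd_of_dvd_pow h2
    obtain ⟨g, hg⟩ := h3
    have := congrArg (eval (Pi.single 2 1)) hg
    simp [hβ0] at this
  · obtain ⟨l, hl, hl'⟩ := exists_isLin_of_det_ne_zero hdet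
    exact ⟨l, hl, fun i => by simp [hl', hM]⟩

/-- A diagonal map is a linear automorphism up to a permutation of the variables. -/
theorem exists_isLin_monomial {t : Fin 3 → k} (ht : ∀ i, t i ≠ 0) (ρ : Equiv.Perm (Fin 3)) :
    ∃ l : Poly3 k ≃ₐ[k] Poly3 k, IsLin l ∧ ∀ i, l (X i) = C (t i) * X (ρ i) := by
  obtain ⟨l, hl, hl'⟩ := exists_isLin_of_det_ne_zero
    (M := Matrix.diagonal t * ρ.toPEquiv.toMatrix) (by
      rw [Matrix.det_mul, Matrix.det_diagonal, Matrix.det_permutation]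
      exact mul_ne_zero (Finset.prod_ne_zero_iff.2 fun i _ => ht i)
        (by rcases Int.units_eq_one_or (Equiv.Perm.sign ρ) with h | h <;> simp [h]))
  refine ⟨l, hl, fun i => ?_⟩
  rw [hl', Finset.sum_eq_single (ρ i)]
  · simp [PEquiv.toMatrix_apply]
  · intro j _ hj
    simp [PEquiv.toMatrix_apply, hj.symm]
  · simp

theorem BirConj.linConj_of_coordinates [IsAlgClosed k] [CharZero k] {d : ℕ} {Φ Γ η κ : Hom3 k}
    {e e' : ℕ} {A B : Poly3 k} (h : BirConj d Φ Γ η κ e e' A B)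
    (hP : FactorBasis A (fun i : Fin 3 => X i) fun _ => 1)
    (hQ : FactorBasis B (fun i : Fin 3 => X i) fun _ => 1) : LinConj Φ Γ := by
  have hd : 0 < d := by have := h.two_le; omega
  obtain ⟨σ, m, c, hσ⟩ := hP.exists_permutesFactors hd h.formΦ h.regΦ h.apply_A
  obtain ⟨τ, m', c', hτ⟩ := hQ.exists_permutesFactors hd h.formΓ h.regΓ h.symm.apply_A
  have hm : ∀ i, m i = d := fun i => by simpa using hσ.deg i
  have hm' : ∀ i, m' i = d := fun i => by simpa using hτ.deg i
  obtain ⟨b, N, hb, hN, -, hLI⟩ := h.exists_exponents hP hQ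
  have hNe : ∀ j i, N (τ j) (σ i) = N j i := by
    intro j
    have e1 := h.conj (X j)
    have e2 : Φ (η (X j)) = C (b j * ∏ i, c i ^ N j i) *
        ∏ i, X i ^ (d * N j (σ.symm i)) := by
      rw [hN, map_mul, map_prod, Hom3.map_C, ← Equiv.prod_comp σ (fun i => X i ^ _)]
      simp only [map_pow, hσ.apply, mul_pow, Finset.prod_mul_distrib, map_mul, map_prod, hm,
        ← pow_mul, Equiv.symm_apply_apply, mul_assoc]
    have e3 : η (Γ (X j)) = C (c' j * b (τ j) ^ d) * ∏ i, X i ^ (d * N (τ j) i) := by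
      rw [hτ.apply, map_mul, map_pow, hN, Hom3.map_C, hm', mul_pow, ← Finset.prod_pow]
      simp only [← pow_mul, map_mul, map_pow, mul_assoc, mul_comm d]
    rw [e2, e3] at e1
    have u1 : b j * ∏ i, c i ^ N j i ≠ 0 :=
      mul_ne_zero (hb _) (Finset.prod_ne_zero_iff.2 fun i _ => pow_ne_zero _ (hσ.ne_zero i))
    have u2 : c' j * b (τ j) ^ d ≠ 0 := mul_ne_zero (hτ.ne_zero j) (pow_ne_zero _ (hb _))
    have l1 := hP.le_of_prod_dvd (a := fun i => d * N j (σ.symm i))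
      (b := fun i => d * N (τ j) i) u2 (by rw [← e1]; exact dvd_mul_left _ _)
    have l2 := hP.le_of_prod_dvd (a := fun i => d * N (τ j) i)
      (b := fun i => d * N j (σ.symm i)) u1 (by rw [e1]; exact dvd_mul_left _ _)
    intro i
    have := congrFun (le_antisymm l1 l2) (σ i)
    simp only [Equiv.symm_apply_apply] at this
    exact (Nat.eq_of_mul_eq_mul_left hd this).symm
  have hpow : ∀ (n : ℕ) j i, N ((τ ^ n) j) ((σ ^ n) i) = N j i := by
    intro n
    induction n with
    | zero => simp
    | succ n ih => intro j i; rw [pow_succ', pow_succ', Equiv.Perm.mul_apply,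
        Equiv.Perm.mul_apply, hNe, ih]
  have hdet : (Matrix.of fun j i => (N j i : ℤ)).det ≠ 0 := by
    intro h0
    obtain ⟨w, hw0, hw⟩ := Matrix.exists_vecMul_eq_zero_iff.2 h0
    refine hw0 (funext fun i => Fintype.linearIndependent_iff.1 hLI w ?_ i)
    rw [← hw]
    ext i
    simp [Matrix.vecMul, dotProduct]
  obtain ⟨ρ, hρ⟩ := exists_conj_perm_three σ τ fun n => by
    constructor
    · intro hn
      ext1 j
      by_contra hne
      refine hdet (Matrix.det_zero_of_row_eq hne ?_)
      ext i
      have := hpow n j i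
      simp [hn] at this
      simp [this]
    · intro hn
      ext1 i
      by_contra hne
      refine hdet (Matrix.det_zero_of_column_eq hne fun j => ?_)
      have := hpow n j i
      simp [hn] at this
      simp [this]
  obtain ⟨t, ht, ht'⟩ := exists_rescaling h.two_le τ (b := fun i => c' i / c (ρ i))
    fun i => div_ne_zero (hτ.ne_zero i) (hσ.ne_zero _)
  obtain ⟨l, hl, hl'⟩ := exists_isLin_monomial ht ρ
  refine ⟨l, hl, fun T => Hom3.ext_X (Φ := Φ.comp l) (Γ := (l : Hom3 k).comp Γ) (fun i => ?_) T⟩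
  simp only [AlgHom.comp_apply, AlgEquiv.coe_toAlgHom, hl', hτ.apply, map_mul, map_pow, hσ.apply,
    Hom3.map_C, hm, hm', hρ]
  have := ht' i
  have h3 : t i * c (ρ i) = c' i * t (τ i) ^ d := by
    conv_lhs => rw [this]
    field_simp [hσ.ne_zero (ρ i)]
  rw [← mul_assoc, ← map_mul, h3]
  simp only [map_mul, map_pow]
  ring

theorem FactorBasis.of_eq {ι : Type*} {A : Poly3 k} {P : ι → Poly3 k} {δ : ι → ℕ}
    (h : FactorBasis A P δ) {l : Poly3 k ≃ₐ[k] Poly3 k} (hl : IsLin l) {Q : ι → Poly3 k}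
    (hQ : ∀ i, l (Q i) = P i) : FactorBasis (l.symm A) Q δ := by
  have : Q = fun i => l.symm (P i) := funext fun i => by rw [← hQ, AlgEquiv.symm_apply_apply]
  rw [this]
  exact h.conj hl.symm

/-- The case of three totally invariant lines. -/
theorem BirConj.linConj_of_three [IsAlgClosed k] [CharZero k] {d : ℕ} {Φ Γ η κ : Hom3 k}
    {e e' : ℕ} {A B : Poly3 k} (h : BirConj d Φ Γ η κ e e' A B) {P Q : Fin 3 → Poly3 k}
    (hP : FactorBasis A P fun _ => 1) (hQ : FactorBasis B Q fun _ => 1) : LinConj Φ Γ := by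
  have hd : 0 < d := by have := h.two_le; omega
  obtain ⟨σ, m, c, hσ⟩ := hP.exists_permutesFactors hd h.formΦ h.regΦ h.apply_A
  obtain ⟨τ, m', c', hτ⟩ := hQ.exists_permutesFactors hd h.formΓ h.regΓ h.symm.apply_A
  obtain ⟨l, hl, hlP⟩ := hσ.exists_isLin hP h.two_le
  obtain ⟨l', hl', hlQ⟩ := hτ.exists_isLin hQ h.two_le
  exact linConj_of_conj hl.symm hl'.symm ((h.conjugate hl.symm hl'.symm).linConj_of_coordinates
    (hP.of_eq hl hlP) (hQ.of_eq hl' hlQ))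

end Lines

section TwoLines

variable {k : Type*} [Field k]

theorem eval_single_pderiv {T : Poly3 k} {n : ℕ} (hT : T.IsHomogeneous n) (i : Fin 3) :
    eval (Pi.single i 1) (pderiv i T) = n * eval (Pi.single i 1) T := by
  have := congrArg (eval (Pi.single i 1)) hT.sum_X_mul_pderiv
  rw [map_sum, Finset.sum_eq_single i] at this
  · simpa using this
  · intro j _ hj
    simp [hj]
  · simp

theorem isHomogeneous_iterate_pderiv {T : Poly3 k} {n : ℕ} (hT : T.IsHomogeneous n) (i : Fin 3)
    (m : ℕ) : ((pderiv i)^[m] T).IsHomogeneous (n - m) := by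
  induction m with
  | zero => simpa using hT
  | succ m ih =>
    rw [Function.iterate_succ_apply']
    exact ih.pderiv

theorem eval_single_iterate_pderiv [CharZero k] {T : Poly3 k} {n : ℕ} (hT : T.IsHomogeneous n)
    (i : Fin 3) (h : eval (Pi.single i 1) T ≠ 0) {m : ℕ} (hm : m ≤ n) :
    eval (Pi.single i 1) ((pderiv i)^[m] T) ≠ 0 := by
  induction m with
  | zero => simpa using h
  | succ m ih =>
    rw [Function.iterate_succ_apply', eval_single_pderiv (isHomogeneous_iterate_pderiv hT i m)]
    exact mul_ne_zero (by simp; omega) (ih (by omega))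

/-- The chain rule for substitutions triangular with respect to the first variable. -/
theorem pderiv_zero_apply {Φ : Hom3 k} (h1 : pderiv 0 (Φ (X 1)) = 0)
    (h2 : pderiv 0 (Φ (X 2)) = 0) (T : Poly3 k) :
    pderiv 0 (Φ T) = pderiv 0 (Φ (X 0)) * Φ (pderiv 0 T) := by
  rw [derivation_algHom_apply, Fin.sum_univ_three, h1, h2]
  ring

theorem iterate_pderiv_zero_apply {Φ : Hom3 k} (h1 : pderiv 0 (Φ (X 1)) = 0)
    (h2 : pderiv 0 (Φ (X 2)) = 0) (h0 : pderiv 0 (pderiv 0 (Φ (X 0))) = 0) (T : Poly3 k)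
    (n : ℕ) : (pderiv 0)^[n] (Φ T) = pderiv 0 (Φ (X 0)) ^ n * Φ ((pderiv 0)^[n] T) := by
  induction n with
  | zero => simp
  | succ n ih =>
    rw [Function.iterate_succ_apply', ih, Derivation.leibniz, Derivation.leibniz_pow, h0,
      pderiv_zero_apply h1 h2 ((pderiv 0)^[n] T), Function.iterate_succ_apply']
    simp only [smul_eq_mul, mul_zero, smul_zero, add_zero]
    ring

theorem iterate_pderiv_mul {i : Fin 3} {S : Poly3 k} (hS : pderiv i S = 0) (T : Poly3 k) (n : ℕ) :
    (pderiv i)^[n] (S * T) = S * (pderiv i)^[n] T := by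
  induction n with
  | zero => rfl
  | succ n ih =>
    rw [Function.iterate_succ_apply', ih, Derivation.leibniz, hS, Function.iterate_succ_apply']
    simp

theorem iterate_pderiv_eq_zero {i : Fin 3} {T : Poly3 k} (h : pderiv i T = 0) {n : ℕ}
    (hn : 0 < n) : (pderiv i)^[n] T = 0 := by
  obtain ⟨m, rfl⟩ := Nat.exists_eq_succ_of_ne_zero hn.ne'
  rw [Function.iterate_succ_apply, h, iterate_map_zero]

/-- Killing the subleading coefficient of a triangular map. -/
theorem exists_isLin_tschirnhaus [CharZero k] {Φ : Hom3 k} {d : ℕ} (hd : 2 ≤ d)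
    (h : IsFormMap Φ d) (h0 : eval (Pi.single 0 1) (Φ (X 0)) ≠ 0)
    (h1 : pderiv 0 (Φ (X 1)) = 0) (h2 : pderiv 0 (Φ (X 2)) = 0) :
    ∃ l : Poly3 k ≃ₐ[k] Poly3 k, IsLin l ∧ l (X 1) = X 1 ∧ l (X 2) = X 2 ∧
      ∃ s, s ≠ 0 ∧ (pderiv 0)^[d - 1] (Hom3.conj l.symm l.symm Φ (X 0)) = C s * X 0 := by
  obtain ⟨a, ha⟩ := exists_eq_sum_of_isHomogeneous_one (T := (pderiv 0)^[d - 1] (Φ (X 0))) (by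
    have := isHomogeneous_iterate_pderiv (h 0) 0 (d - 1)
    rwa [show d - (d - 1) = 1 by omega] at this)
  have ha0 : a 0 ≠ 0 := by
    have := eval_single_iterate_pderiv (h 0) 0 h0 (Nat.sub_le d 1)
    rw [ha, map_sum, Finset.sum_eq_single 0 (by intro j _ hj; simp [hj]) (by simp)] at this
    simpa using this
  obtain ⟨l, hl, hl'⟩ := exists_isLin_of_det_ne_zero
    (M := Matrix.of ![a, Pi.single 1 1, Pi.single 2 1]) (by simp [Matrix.det_fin_three, ha0])
  have hX0 : l (X 0) = (pderiv 0)^[d - 1] (Φ (X 0)) := by rw [hl', ha]; simp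
  have hX1 : l (X 1) = X 1 := by
    rw [hl', Finset.sum_eq_single 1 (by intro j _ hj; simp [hj]) (by simp)]; simp
  have hX2 : l (X 2) = X 2 := by
    rw [hl', Finset.sum_eq_single 2 (by intro j _ hj; simp [hj]) (by simp)]; simp
  have hp0 : pderiv 0 (l (X 0)) = C (a 0) := by
    rw [hX0, ha, Fin.sum_univ_three]; simp
  refine ⟨l, hl, hX1, hX2, a 0 * (a 0)⁻¹ ^ (d - 1),
    mul_ne_zero ha0 (pow_ne_zero _ (inv_ne_zero ha0)),
    l.injective ?_⟩
  have key := iterate_pderiv_zero_apply (Φ := (l : Hom3 k)) (by simp [hX1]) (by simp [hX2])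
    (by simp [hp0]) (Hom3.conj l.symm l.symm Φ (X 0)) (d - 1)
  simp only [AlgEquiv.coe_toAlgHom, Hom3.conj_apply, AlgEquiv.symm_symm, hp0,
    AlgEquiv.apply_symm_apply] at key
  have key2 : (pderiv 0)^[d - 1] (Φ (l (X 0))) = C (a 0) * l (X 0) := by
    rw [hl' 0, Fin.sum_univ_three]
    simp only [Matrix.of_apply, Matrix.cons_val_zero, map_add, map_mul, Hom3.map_C,
      iterate_map_add, iterate_pderiv_mul pderiv_C,
      iterate_pderiv_eq_zero h1 (show 0 < d - 1 by omega),
      iterate_pderiv_eq_zero h2 (show 0 < d - 1 by omega), ← hX0]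
    rw [hl' 0, Fin.sum_univ_three]
    simp
  rw [key2] at key
  rw [map_mul, algEquiv_C, Hom3.conj_apply, AlgEquiv.symm_symm]
  have hC : C (a 0)⁻¹ ^ (d - 1) * C (a 0) ^ (d - 1) = (1 : Poly3 k) := by
    rw [← mul_pow, ← map_mul, inv_mul_cancel₀ ha0, map_one, one_pow]
  rw [map_mul, map_pow]
  linear_combination (-C (a 0)⁻¹ ^ (d - 1)) * key -
    (l ((pderiv 0)^[d - 1] (l.symm (Φ (l (X 0)))))) * hC

end TwoLines

section MonomialSubstitution

variable {k : Type*} [Field k]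

theorem coeff_monomial_substitution {Φ : Hom3 k} {c : Fin 3 → k} {w : Fin 3 → Fin 3 →₀ ℕ}
    (hΦ : ∀ i, Φ (X i) = monomial (w i) (c i)) {T : Poly3 k} {m : Fin 3 →₀ ℕ}
    (hinj : ∀ m' ∈ T.support, ∑ i, m' i • w i = ∑ i, m i • w i → m' = m) :
    coeff (∑ i, m i • w i) (Φ T) = coeff m T * ∏ i, c i ^ m i := by
  classical
  have key : ∀ (m' : Fin 3 →₀ ℕ) (a : k),
      Φ (monomial m' a) = monomial (∑ i, m' i • w i) (a * ∏ i, c i ^ m' i) := by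
    intro m' a
    rw [monomial_eq, map_mul, Hom3.map_C, monomial_sum_index, Finsupp.prod_fintype _ _ fun i =>
      pow_zero _, map_prod, map_mul, map_prod, mul_assoc, ← Finset.prod_mul_distrib]
    congr 1
    refine Finset.prod_congr rfl fun i _ => ?_
    rw [map_pow, hΦ, monomial_pow, C_mul_monomial, mul_one]
  conv_lhs => rw [T.as_sum, map_sum, coeff_sum]
  simp only [key, coeff_monomial]
  by_cases hm : m ∈ T.support
  · rw [Finset.sum_eq_single m]
    · simp
    · intro m' h' hne
      rw [if_neg fun e => hne (hinj m' h' e)]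
    · simp [hm]
  · rw [notMem_support_iff.1 hm, zero_mul]
    refine Finset.sum_eq_zero fun m' h' => ?_
    rw [if_neg fun e => hm (hinj m' h' e ▸ h')]

theorem linConj_of_diagonal [IsAlgClosed k] {d : ℕ} (hd : 2 ≤ d) {Φ Γ : Hom3 k}
    {f g : Fin 3 → k} (hf : ∀ i, f i ≠ 0) (hg : ∀ i, g i ≠ 0)
    (hΦ : ∀ i, Φ (X i) = C (f i) * X i ^ d) (hΓ : ∀ i, Γ (X i) = C (g i) * X i ^ d) :
    LinConj Φ Γ := by
  obtain ⟨t, ht, ht'⟩ := exists_rescaling hd 1 (b := fun i => g i / f i)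
    fun i => div_ne_zero (hg i) (hf i)
  obtain ⟨l, hl, hl'⟩ := exists_isLin_monomial ht 1
  refine ⟨l, hl, fun T => Hom3.ext_X (Φ := Φ.comp l) (Γ := (l : Hom3 k).comp Γ) (fun i => ?_) T⟩
  have h3 : t i * f i = g i * t i ^ d := by
    conv_lhs => rw [ht' i]
    have := hf i
    field_simp
    simp
  simp only [AlgHom.comp_apply, AlgEquiv.coe_toAlgHom, hl', hΓ, map_mul, map_pow, hΦ, Hom3.map_C,
    Equiv.Perm.coe_one, id_eq]
  rw [← mul_assoc, ← map_mul, h3]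
  simp only [map_mul, map_pow]
  ring

/-- Maps which are conjugate by an explicit monomial quadratic or higher degree map are linearly
conjugate. -/
theorem linConj_of_monomial [IsAlgClosed k] {d n : ℕ} (hd : 2 ≤ d) (hn : 1 ≤ n) {Φ Γ η : Hom3 k}
    (hΓ : IsFormMap Γ d) (hΦ0 : Φ (X 0) ≠ 0) (hΓ0 : Γ (X 0) ≠ 0)
    (conj : ∀ T, Φ (η T) = η (Γ T))
    {c f g : Fin 3 → k} (hc : ∀ i, c i ≠ 0) (hf : ∀ i, f i ≠ 0) (hg : ∀ i, g i ≠ 0)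
    (hη0 : η (X 0) = C (c 0) * (X 1 ^ n * X 0)) (hη1 : η (X 1) = C (c 1) * (X 1 * X 2 ^ n))
    (hη2 : η (X 2) = C (c 2) * X 2 ^ (n + 1))
    (hΦ1 : Φ (X 1) = C (f 1) * X 1 ^ d) (hΦ2 : Φ (X 2) = C (f 2) * X 2 ^ d)
    (hΓ1 : Γ (X 1) = C (g 1) * X 1 ^ d) (hΓ2 : Γ (X 2) = C (g 2) * X 2 ^ d) : LinConj Φ Γ := by
  have e0 : C (c 0 * f 1 ^ n) * (X 1 ^ (d * n) * Φ (X 0)) = η (Γ (X 0)) := by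
    rw [← conj, hη0]
    simp only [map_mul, map_pow, hΦ1, Hom3.map_C]
    ring
  have hη0' : η (X 0) = monomial (Finsupp.single 1 n + Finsupp.single 0 1) (c 0) := by
    rw [hη0, X_pow_eq_monomial, show (X 0 : Poly3 k) = monomial (Finsupp.single 0 1) 1 from rfl,
      monomial_mul, C_mul_monomial, one_mul, mul_one]
  have hη1' : η (X 1) = monomial (Finsupp.single 1 1 + Finsupp.single 2 n) (c 1) := by
    rw [hη1, X_pow_eq_monomial, show (X 1 : Poly3 k) = monomial (Finsupp.single 1 1) 1 from rfl,
      monomial_mul, C_mul_monomial, one_mul, mul_one]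
  have hη2' : η (X 2) = monomial (Finsupp.single 2 (n + 1)) (c 2) := by
    rw [hη2, X_pow_eq_monomial, C_mul_monomial, mul_one]
  have hcoeff : ∀ m : Fin 3 →₀ ℕ, coeff m (Γ (X 0)) ≠ 0 → n * (m 1 + m 2) ≤ m 1 := by
    intro m hm
    have hdeg : m 0 + m 1 + m 2 = d := by
      have := hΓ 0 hm
      rw [Finsupp.weight_apply, Finsupp.sum_fintype _ _ (by simp), Fin.sum_univ_three] at this
      simpa using this
    obtain ⟨w, hw⟩ : ∃ w : Fin 3 → Fin 3 →₀ ℕ, w = ![Finsupp.single 1 n + Finsupp.single 0 1,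
      Finsupp.single 1 1 + Finsupp.single 2 n, Finsupp.single 2 (n + 1)] := ⟨_, rfl⟩
    have hs : ∀ m : Fin 3 →₀ ℕ, (∑ i, m i • w i) 0 = m 0 ∧ (∑ i, m i • w i) 1 = m 0 * n + m 1 ∧
        (∑ i, m i • w i) 2 = m 1 * n + m 2 * (n + 1) := by
      intro m
      simp [Fin.sum_univ_three, hw, mul_add]
    have := coeff_monomial_substitution (Φ := η) (c := c) (w := w) (T := Γ (X 0)) (m := m)
      (fun i => by
        subst hw
        fin_cases i
        · exact hη0'
        · exact hη1'
        · exact hη2')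
      (fun m' _ h => by
        have h0 := (hs m').1
        have h1 := (hs m').2.1
        have h2 := (hs m').2.2
        rw [h] at h0 h1 h2
        rw [(hs m).1] at h0
        rw [(hs m).2.1, ← h0] at h1
        have h1' : m 1 = m' 1 := by omega
        rw [(hs m).2.2, ← h1'] at h2
        have h2' : m 2 = m' 2 := Nat.eq_of_mul_eq_mul_right (Nat.succ_pos n)
          (Nat.add_left_cancel h2)
        ext i
        fin_cases i
        · exact h0.symm
        · exact h1'.symm
        · exact h2'.symm)
    rw [← e0, coeff_C_mul, X_pow_eq_monomial, coeff_monomial_mul', mul_ite, mul_zero] at this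
    have hne : coeff m (Γ (X 0)) * ∏ i, c i ^ m i ≠ 0 :=
      mul_ne_zero hm (Finset.prod_ne_zero_iff.2 fun i _ => pow_ne_zero _ (hc i))
    split_ifs at this with hle
    · have := hle 1
      rw [(hs m).2.1, Finsupp.single_eq_same, ← hdeg] at this
      nlinarith
    · exact absurd this.symm hne
  have hinj : ∀ {p q : Poly3 k}, (X 1 : Poly3 k) ^ (d * n) * p = X 1 ^ (d * n) * q → p = q :=
    mul_left_cancel₀ (pow_ne_zero _ (X_ne_zero 1))
  obtain rfl | hn := hn.eq_or_lt
  · have hv : (2 : Fin 3) ∉ (Γ (X 0)).vars := by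
      rw [mem_vars_iff_mem_support]
      rintro ⟨m, hm, hm2⟩
      have := hcoeff m (mem_support_iff.1 hm)
      exact Finsupp.mem_support_iff.1 hm2 (by omega)
    have hsub : ∀ Ψ Ψ' : Hom3 k, Ψ (X 0) = Ψ' (X 0) → Ψ (X 1) = Ψ' (X 1) →
        Ψ (Γ (X 0)) = Ψ' (Γ (X 0)) := by
      intro Ψ Ψ' h0 h1
      refine hom_congr_vars (f₁ := (Ψ : Poly3 k →+* Poly3 k)) (f₂ := Ψ') (by ext; simp)
        (fun i hi _ => ?_) rfl
      fin_cases i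
      · exact h0
      · exact h1
      · exact absurd hi hv
    have e1 : C (c 0 * f 1) * Φ (X 0) = aeval ![C (c 0) * X 0, C (c 1) * X 2, 0] (Γ (X 0)) := by
      apply hinj
      rw [hsub η (aeval fun i => X 1 * ![C (c 0) * X 0, C (c 1) * X 2, 0] i)
        (by simp [hη0, mul_left_comm]) (by simp [hη1, mul_left_comm]),
        aeval_mul_left_of_isHomogeneous (hΓ 0)] at e0
      simp only [mul_one, pow_one] at e0 ⊢
      rw [mul_left_comm, e0]
    have e2 : f 1 * f 2 = g 1 * c 1 ^ (d - 1) := by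
      have := conj (X 1)
      simp only [hη1, hΓ1, map_mul, map_pow, hΦ1, hΦ2, Hom3.map_C, pow_one] at this
      have := congrArg (eval 1) this
      simp only [map_mul, map_pow, eval_C, eval_X, Pi.one_apply, one_pow, mul_one] at this
      refine mul_left_cancel₀ (hc 1) ?_
      rw [this, mul_left_comm, ← pow_succ', show d - 1 + 1 = d by omega]
    have key : ∀ a : k, a ≠ 0 → ∃ t, t ≠ 0 ∧ t ^ (d - 1) = a := fun a ha => by
      obtain ⟨t, ht⟩ := IsAlgClosed.exists_pow_nat_eq a (show 0 < d - 1 by omega)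
      exact ⟨t, fun h => ha (by rw [← ht, h, zero_pow (by omega)]), ht⟩
    obtain ⟨s, hs, hs'⟩ := key (f 1)⁻¹ (inv_ne_zero (hf 1))
    obtain ⟨ρ, hρ, hρ'⟩ := key (f 1 / g 2) (div_ne_zero (hf 1) (hg 2))
    obtain ⟨l, hl, hl'⟩ := exists_isLin_monomial (t := ![s * c 0, s * c 1, ρ]) (fun i => by
      fin_cases i <;> simp [hs, hc, hρ]) (Equiv.swap 1 2)
    have hl0 : l (X 0) = C (s * c 0) * X 0 := by
      simpa [Equiv.swap_apply_of_ne_of_ne] using hl' 0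
    have hl1 : l (X 1) = C (s * c 1) * X 2 := by simpa using hl' 1
    have hl2 : l (X 2) = C ρ * X 1 := by simpa using hl' 2
    refine ⟨l, hl, fun T => Hom3.ext_X (Φ := Φ.comp l) (Γ := (l : Hom3 k).comp Γ) (fun i => ?_) T⟩
    simp only [AlgHom.comp_apply, AlgEquiv.coe_toAlgHom]
    fin_cases i
    · have := hsub l (aeval fun i => C s * ![C (c 0) * X 0, C (c 1) * X 2, 0] i)
        (by simp [hl0, mul_assoc]) (by simp [hl1, mul_assoc])
      simp only [Fin.zero_eta]
      rw [aeval_mul_left_of_isHomogeneous (hΓ 0), ← e1] at this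
      rw [show l (Γ (X 0)) = _ from this, hl0, map_mul, Hom3.map_C, ← mul_assoc, ← map_pow,
        ← map_mul]
      congr 2
      rw [show d = d - 1 + 1 by omega, pow_succ, hs']
      field_simp [hf 1]
    · simp only [Fin.mk_one]
      rw [hl1, hΓ1]
      simp only [map_mul, map_pow, hΦ2, Hom3.map_C, algEquiv_C, hl1]
      simp only [← map_mul, ← map_pow, mul_pow, ← mul_assoc]
      congr 2
      rw [show d = d - 1 + 1 by omega, pow_succ, pow_succ, hs']
      have := hf 1
      field_simp
      linear_combination c 1 * e2
    · simp only [Fin.reduceFinMk]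
      rw [hl2, hΓ2]
      simp only [map_mul, map_pow, hΦ1, Hom3.map_C, algEquiv_C, hl2]
      simp only [← map_mul, ← map_pow, mul_pow, ← mul_assoc]
      congr 2
      rw [show d = d - 1 + 1 by omega, pow_succ, hρ']
      have := hg 2
      field_simp
  · obtain ⟨g0, hg0⟩ : ∃ g0, Γ (X 0) = C g0 * X 0 ^ d := by
      refine ⟨coeff (Finsupp.single 0 d) (Γ (X 0)), ?_⟩
      ext m
      rw [X_pow_eq_monomial, C_mul_monomial, coeff_monomial]
      split_ifs with h
      · rw [h, mul_one]
      · by_contra hm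
        have h1 := hcoeff m hm
        have h2 : m 1 = 0 ∧ m 2 = 0 := by constructor <;> nlinarith
        have := hΓ 0 hm
        rw [Finsupp.weight_apply, Finsupp.sum_fintype _ _ (by simp), Fin.sum_univ_three] at this
        refine h (Finsupp.ext fun i => ?_)
        fin_cases i
        · simpa [h2] using this.symm
        · simp [h2]
        · simp [h2]
    obtain ⟨f0, hf0⟩ : ∃ f0, Φ (X 0) = C f0 * X 0 ^ d := by
      refine ⟨(c 0 * f 1 ^ n)⁻¹ * (g0 * c 0 ^ d), hinj ?_⟩
      have hu : C (c 0 * f 1 ^ n)⁻¹ * C (c 0 * f 1 ^ n) = (1 : Poly3 k) := by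
        rw [← map_mul, inv_mul_cancel₀ (mul_ne_zero (hc 0) (pow_ne_zero _ (hf 1))), map_one]
      rw [hg0, map_mul η, map_pow η, hη0, Hom3.map_C] at e0
      rw [map_mul, map_mul, map_pow]
      linear_combination C (c 0 * f 1 ^ n)⁻¹ * e0 - X 1 ^ (d * n) * Φ (X 0) * hu
    refine linConj_of_diagonal hd (f := ![f0, f 1, f 2]) (g := ![g0, g 1, g 2]) ?_ ?_ ?_ ?_
    · intro i
      fin_cases i
      · rintro rfl
        exact hΦ0 (by simpa using hf0)
      · exact hf 1
      · exact hf 2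
    · intro i
      fin_cases i
      · rintro rfl
        exact hΓ0 (by simpa using hg0)
      · exact hg 1
      · exact hg 2
    · intro i
      fin_cases i
      · exact hf0
      · exact hΦ1
      · exact hΦ2
    · intro i
      fin_cases i
      · exact hg0
      · exact hΓ1
      · exact hΓ2

end MonomialSubstitution

section TwoLines

variable {k : Type*} [Field k]

/-- The coordinate lines in a totally invariant pair of lines are permuted. -/
theorem FactorBasis.exists_apply_X_succ [IsAlgClosed k] [CharZero k] {A : Poly3 k}
    (hP : FactorBasis A (fun i : Fin 2 => X i.succ) fun _ => 1) {d : ℕ} (hd : 0 < d) {Φ : Hom3 k}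
    (hΦ : IsFormMap Φ d) (hr : IsRegularMap Φ) (hA : Φ A = A ^ d) :
    ∃ (σ : Equiv.Perm (Fin 2)) (c : Fin 2 → k), (∀ i, c i ≠ 0) ∧
      ∀ i, Φ (X i.succ) = C (c i) * X (σ i).succ ^ d := by
  obtain ⟨σ, m, c, hσ⟩ := hP.exists_permutesFactors hd hΦ hr hA
  exact ⟨σ, c, hσ.ne_zero, fun i => by rw [hσ.apply, show m i = d by simpa using hσ.deg i]⟩

theorem not_X_dvd_C_mul_X_pow {i j : Fin 3} (hij : i ≠ j) {c : k} (hc : c ≠ 0) (n : ℕ) :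
    ¬ (X i : Poly3 k) ∣ C c * X j ^ n := by
  rw [((IsUnit.mk0 _ hc).map C).dvd_mul_left]
  intro h
  have := (X_prime (i := i)).dvd_of_dvd_pow h
  obtain ⟨g, hg⟩ := this
  have := congrArg (eval (Pi.single j 1)) hg
  simp [hij] at this

theorem BirConj.linConj_of_tschirnhaus [IsAlgClosed k] [CharZero k] {d : ℕ} {Φ Γ η κ : Hom3 k}
    {e e' : ℕ} {A B : Poly3 k} (h : BirConj d Φ Γ η κ e e' A B)
    (hP : FactorBasis A (fun i : Fin 2 => X i.succ) fun _ => 1)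
    (hQ : FactorBasis B (fun i : Fin 2 => X i.succ) fun _ => 1) {a b : ℕ} (hab : a ≤ b)
    (he : a + b + 1 = e) (he2 : 2 ≤ e) {c₁ c₂ : k} (hc₁ : c₁ ≠ 0) (hc₂ : c₂ ≠ 0)
    (hη₁ : η (X 1) = C c₁ * (X 1 ^ (a + 1) * X 2 ^ b))
    (hη₂ : η (X 2) = C c₂ * (X 1 ^ a * X 2 ^ (b + 1))) {s s' : k} (hs : s ≠ 0) (hs' : s' ≠ 0)
    (hΦ₀ : (pderiv 0)^[d - 1] (Φ (X 0)) = C s * X 0)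
    (hΓ₀ : (pderiv 0)^[d - 1] (Γ (X 0)) = C s' * X 0) : LinConj Φ Γ := by
  have hd : 0 < d := by have := h.two_le; omega
  obtain ⟨σ, f, hf, hσ⟩ := hP.exists_apply_X_succ hd h.formΦ h.regΦ h.apply_A
  obtain ⟨τ, g, hg, hτ⟩ := hQ.exists_apply_X_succ hd h.formΓ h.regΓ h.symm.apply_A
  have hΦ : ∀ i : Fin 2, pderiv 0 (Φ (X i.succ)) = 0 := fun i => by
    rw [hσ, pderiv_C_mul, pderiv_pow, pderiv_X_of_ne (Fin.succ_ne_zero _)]; simp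
  have hη : ∀ i : Fin 2, pderiv 0 (η (X i.succ)) = 0 := by
    intro i
    fin_cases i
    · change pderiv 0 (η (X 1)) = 0
      rw [hη₁]; simp
    · change pderiv 0 (η (X 2)) = 0
      rw [hη₂]; simp
  obtain ⟨u, hu⟩ : ∃ u, u = pderiv 0 (η (X 0)) := ⟨_, rfl⟩
  have huJ : u ∣ jacobian fun i => η (X i) := by
    rw [jacobian_eq, show pderiv 0 (η (X 1)) = 0 from hη 0, show pderiv 0 (η (X 2)) = 0 from hη 1,
      ← hu]
    exact ⟨pderiv 1 (η (X 1)) * pderiv 2 (η (X 2)) - pderiv 2 (η (X 1)) * pderiv 1 (η (X 2)),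
      by ring⟩
  have hu0 : u ≠ 0 := fun h0 => h.jacobian_ne_zero (zero_dvd_iff.1 (h0 ▸ huJ))
  obtain ⟨c, n, hc, hun⟩ := hP.eq_prod hu0 fun Q hQ hQu => by
    have h1 : Q ∣ C ((e * e' : ℕ) : k) * A ^ 3 := by
      rw [← h.jacobian_mul]
      exact (hQu.trans huJ).mul_left _
    rw [((IsUnit.mk0 _ (Nat.cast_ne_zero.2 h.pos.ne')).map C).dvd_mul_left] at h1
    exact hQ.prime.dvd_of_dvd_pow h1
  obtain ⟨p, q, hpq⟩ : ∃ p q, u = C c * (X 1 ^ p * X 2 ^ q) :=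
    ⟨n 0, n 1, by rw [hun, Fin.prod_univ_two]; rfl⟩
  have hdeg : p + q = e - 1 := by
    have h1 : u.IsHomogeneous (e - 1) := hu ▸ (h.formη 0).pderiv
    have h2 : u.IsHomogeneous (p + q) := by
      rw [hpq]
      simpa using (isHomogeneous_C (Fin 3) c).mul
        (((isHomogeneous_X k 1).pow p).mul ((isHomogeneous_X k 2).pow q))
    exact h2.inj_right h1 hu0
  have hu' : pderiv 0 u = 0 := by rw [hpq]; simp
  obtain ⟨v, hv⟩ : ∃ v, η (X 0) = u * X 0 + v := ⟨η (X 0) - u * X 0, by ring⟩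
  have hv0 : pderiv 0 v = 0 := by
    have := congrArg (pderiv 0) hv
    rw [← hu] at this
    simp [hu'] at this
    exact this
  have hΦu : ∀ {T}, pderiv 0 T = 0 → pderiv 0 (Φ T) = 0 := fun {T} hT => by
    rw [pderiv_zero_apply (hΦ 0) (hΦ 1), hT, map_zero, mul_zero]
  have e1 : Φ u * (C s * X 0) = C s' * u ^ (d - 1) * (u * X 0 + v) := by
    have h1 := congrArg (pderiv 0)^[d - 1] (h.conj (X 0))
    rw [iterate_pderiv_zero_apply (hη 0) (hη 1) (by rw [← hu, hu']), hΓ₀, ← hu, map_mul η,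
      Hom3.map_C, hv, map_add, map_mul, iterate_map_add, iterate_pderiv_mul (hΦu hu'), hΦ₀,
      iterate_pderiv_eq_zero (hΦu hv0) (by have := h.two_le; omega), add_zero] at h1
    rw [h1]
    ring
  have e2 : Φ u * C s = C s' * u ^ d := by
    have h1 := congrArg (pderiv 0) e1
    have h2 : pderiv 0 (u ^ (d - 1)) = 0 := by rw [Derivation.leibniz_pow, hu']; simp
    simp only [Derivation.leibniz, map_add, hΦu hu', hu', hv0, h2, pderiv_C, pderiv_X_self,
      smul_eq_mul, mul_zero, add_zero, mul_one] at h1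
    rw [h1, show d = d - 1 + 1 by omega, pow_succ, Nat.add_sub_cancel, mul_assoc]
  have hv' : v = 0 := by
    have h1 : C s' * u ^ (d - 1) * v = 0 := by
      have h2 : u ^ d = u ^ (d - 1) * u := by rw [← pow_succ, show d - 1 + 1 = d by omega]
      linear_combination X 0 * e2 - e1 + C s' * X 0 * h2
    exact (mul_eq_zero.1 h1).resolve_left (mul_ne_zero (C_ne_zero.2 hs') (pow_ne_zero _ hu0))
  rw [hv', add_zero] at hv
  have hq : q = 0 := by
    by_contra hq
    refine h.copη (X 2) X_prime.irreducible fun i => ?_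
    fin_cases i
    · change X 2 ∣ η (X 0)
      rw [hv, hpq]
      exact (((dvd_pow_self _ hq).mul_left _).mul_left _).mul_right _
    · change X 2 ∣ η (X 1)
      rw [hη₁]
      exact ((dvd_pow_self _ (by omega)).mul_left _).mul_left _
    · change X 2 ∣ η (X 2)
      rw [hη₂]
      exact ((dvd_pow_self _ (by omega)).mul_left _).mul_left _
  have ha : a = 0 := by
    by_contra ha
    refine h.copη (X 1) X_prime.irreducible fun i => ?_
    fin_cases i
    · change X 1 ∣ η (X 0)
      rw [hv, hpq]
      exact (((dvd_pow_self _ (by omega)).mul_right _).mul_left _).mul_right _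
    · change X 1 ∣ η (X 1)
      rw [hη₁]
      exact ((dvd_pow_self _ (by omega)).mul_right _).mul_left _
    · change X 1 ∣ η (X 2)
      rw [hη₂]
      exact ((dvd_pow_self _ ha).mul_right _).mul_left _
  subst hq ha
  obtain rfl : p = b := by omega
  simp only [pow_zero, mul_one, one_mul, zero_add, pow_one] at hpq hη₁ hη₂
  have key : ∀ π : Equiv.Perm (Fin 2), π 0 ≠ 1 → ∀ i, π i = i := by decide
  have hσ1 := key σ fun hσ0 => by
    have h1 : (X 1 : Poly3 k) ∣ Φ u * C s := by
      rw [e2, hpq]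
      exact (dvd_pow ((dvd_pow_self _ (by omega)).mul_left _) (by omega)).mul_left _
    rw [((IsUnit.mk0 _ hs).map C).dvd_mul_right, hpq, map_mul, map_pow, Hom3.map_C,
      ((IsUnit.mk0 _ hc).map C).dvd_mul_left] at h1
    have h2 := X_prime.dvd_of_dvd_pow h1
    rw [show Φ (X 1) = _ from hσ 0, hσ0] at h2
    exact not_X_dvd_C_mul_X_pow (by decide) (hf 0) d h2
  have hτ1 := key τ fun hτ0 => by
    have h1 : (X 1 : Poly3 k) ∣ η (Γ (X 1)) := by
      rw [← h.conj, hη₁, map_mul, map_mul, show Φ (X 1) = _ from hσ 0, hσ1]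
      exact (((dvd_pow_self _ (by omega)).mul_left _).mul_right _).mul_left _
    rw [show Γ (X 1) = _ from hτ 0, hτ0, map_mul, Hom3.map_C,
      ((IsUnit.mk0 _ (hg 0)).map C).dvd_mul_left, map_pow] at h1
    have h2 := X_prime.dvd_of_dvd_pow h1
    rw [show η (Fin.succ 1 |> X) = _ from hη₂] at h2
    exact not_X_dvd_C_mul_X_pow (by decide) hc₂ _ h2
  simp only [hσ1] at hσ
  simp only [hτ1] at hτ
  exact linConj_of_monomial h.two_le (show 1 ≤ p by omega) h.formΓ
    (IsRegularMap.ne_zero hd h.formΦ h.regΦ 0) (IsRegularMap.ne_zero hd h.formΓ h.regΓ 0) h.conj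
    (c := ![c, c₁, c₂]) (f := Fin.cons 1 f) (g := Fin.cons 1 g)
    (by intro i; fin_cases i <;> simp [hc, hc₁, hc₂])
    (fun i => by refine Fin.cases ?_ ?_ i <;> simp [hf])
    (fun i => by refine Fin.cases ?_ ?_ i <;> simp [hg])
    (by rw [hv, hpq, mul_assoc]; rfl) hη₁ hη₂ (hσ 0) (hσ 1) (hτ 0) (hτ 1)

theorem BirConj.linConj_of_two_coordinates [IsAlgClosed k] [CharZero k] {d : ℕ} {Φ Γ η κ : Hom3 k}
    {e e' : ℕ} {A B : Poly3 k} (h : BirConj d Φ Γ η κ e e' A B)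
    (hP : FactorBasis A (fun i : Fin 2 => X i.succ) fun _ => 1)
    (hQ : FactorBasis B (fun i : Fin 2 => X i.succ) fun _ => 1) {a b : ℕ} (hab : a ≤ b)
    (he : a + b + 1 = e) (he2 : 2 ≤ e) {c₁ c₂ : k} (hc₁ : c₁ ≠ 0) (hc₂ : c₂ ≠ 0)
    (hη₁ : η (X 1) = C c₁ * (X 1 ^ (a + 1) * X 2 ^ b))
    (hη₂ : η (X 2) = C c₂ * (X 1 ^ a * X 2 ^ (b + 1))) : LinConj Φ Γ := by
  have key : ∀ {Φ : Hom3 k} {A : Poly3 k} (_ : FactorBasis A (fun i : Fin 2 => X i.succ) fun _ => 1)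
      (_ : IsFormMap Φ d) (_ : IsRegularMap Φ) (_ : Φ A = A ^ d),
      ∃ l : Poly3 k ≃ₐ[k] Poly3 k, IsLin l ∧ l (X 1) = X 1 ∧ l (X 2) = X 2 ∧
        ∃ s, s ≠ 0 ∧ (pderiv 0)^[d - 1] (Hom3.conj l.symm l.symm Φ (X 0)) = C s * X 0 := by
    intro Φ A hP hΦ hr hA
    have hd : 0 < d := by have := h.two_le; omega
    obtain ⟨σ, f, -, hσ⟩ := hP.exists_apply_X_succ hd hΦ hr hA
    have h1 : ∀ i : Fin 2, pderiv 0 (Φ (X i.succ)) = 0 := fun i => by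
      rw [hσ, pderiv_C_mul, pderiv_pow, pderiv_X_of_ne (Fin.succ_ne_zero _)]; simp
    have h2 : ∀ i : Fin 2, eval (Pi.single 0 1) (Φ (X i.succ)) = 0 := fun i => by
      rw [hσ]; simp [hd.ne']
    refine exists_isLin_tschirnhaus h.two_le hΦ ?_ (h1 0) (h1 1)
    obtain ⟨i, hi⟩ := hr (Pi.single 0 1) (by simp)
    induction i using Fin.cases with
    | zero => exact hi
    | succ i => exact absurd (h2 i) hi
  obtain ⟨l, hl, hl1, hl2, s, hs, hs'⟩ := key hP h.formΦ h.regΦ h.apply_A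
  obtain ⟨m, hm, hm1, hm2, t, ht, ht'⟩ := key hQ h.formΓ h.regΓ h.symm.apply_A
  have hl1' : l.symm (X 1) = X 1 := by rw [AlgEquiv.symm_apply_eq, hl1]
  have hl2' : l.symm (X 2) = X 2 := by rw [AlgEquiv.symm_apply_eq, hl2]
  refine linConj_of_conj hl.symm hm.symm ((h.conjugate hl.symm hm.symm).linConj_of_tschirnhaus
    (hP.of_eq hl fun i => ?_) (hQ.of_eq hm fun i => ?_) hab he he2 hc₁ hc₂ ?_ ?_ hs ht hs' ht')
  · fin_cases i
    exacts [hl1, hl2]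
  · fin_cases i
    exacts [hm1, hm2]
  · simp [hm1, hη₁, hl1', hl2', algEquiv_C]
  · simp [hm2, hη₂, hl1', hl2', algEquiv_C]

theorem FactorBasis.reindex {ι ι' : Type*} {A : Poly3 k} {P : ι → Poly3 k} {δ : ι → ℕ}
    (h : FactorBasis A P δ) (π : ι' ≃ ι) : FactorBasis A (P ∘ π) (δ ∘ π) where
  irr i := h.irr _
  hom i := h.hom _
  inj i j hij := π.injective (h.inj _ _ hij)
  dvd i := h.dvd _
  cover Q hQ hQA := by
    obtain ⟨i, hi⟩ := h.cover Q hQ hQA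
    exact ⟨π.symm i, by simpa using hi⟩

/-- The case of two totally invariant lines. -/
theorem BirConj.linConj_of_two [IsAlgClosed k] [CharZero k] {d : ℕ} {Φ Γ η κ : Hom3 k}
    {e e' : ℕ} {A B : Poly3 k} (h : BirConj d Φ Γ η κ e e' A B) (he : 2 ≤ e) {P Q : Fin 2 → Poly3 k}
    (hP : FactorBasis A P fun _ => 1) (hQ : FactorBasis B Q fun _ => 1) : LinConj Φ Γ := by
  obtain ⟨b, N, hb, hN, hNs, -⟩ := h.exists_exponents hP hQ
  obtain ⟨b', N', hb', hN', hNs', -⟩ := h.symm.exists_exponents hQ hP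
  obtain ⟨c, a, hc, hA⟩ := hP.eq_prod h.A_ne_zero fun _ _ h => h
  have hprod : ∀ i l, N' i 0 * N 0 l + N' i 1 * N 1 l = a l + if i = l then 1 else 0 := by
    intro i
    have e1 := h.apply_comp (hP.hom i)
    have e2 : η (κ (P i)) = C (b' i * (b 0 ^ N' i 0 * b 1 ^ N' i 1)) *
        ∏ l, P l ^ (N' i 0 * N 0 l + N' i 1 * N 1 l) := by
      rw [hN', map_mul, Hom3.map_C, Fin.prod_univ_two, map_mul, map_pow, map_pow, hN, hN]
      simp only [Fin.prod_univ_two, map_mul, map_pow]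
      ring
    have e3 : A ^ 1 * P i = C c * ∏ l, P l ^ (a l + if i = l then 1 else 0) := by
      simp only [pow_add, Finset.prod_mul_distrib, pow_ite, pow_one, pow_zero,
        Finset.prod_ite_eq, Finset.mem_univ, if_true]
      rw [← mul_assoc, ← hA]
    rw [e2, e3] at e1
    have u1 : b' i * (b 0 ^ N' i 0 * b 1 ^ N' i 1) ≠ 0 := by simp [hb, hb']
    have l1 := hP.le_of_prod_dvd (a := fun l => N' i 0 * N 0 l + N' i 1 * N 1 l)
      (b := fun l => a l + if i = l then 1 else 0) hc (by rw [← e1]; exact dvd_mul_left _ _)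
    have l2 := hP.le_of_prod_dvd (a := fun l => a l + if i = l then 1 else 0)
      (b := fun l => N' i 0 * N 0 l + N' i 1 * N 1 l) u1 (by rw [e1]; exact dvd_mul_left _ _)
    exact congrFun (le_antisymm l1 l2)
  simp only [Fin.sum_univ_two, one_mul, mul_one] at hNs hNs'
  have hx : ((N' 0 0 : ℤ) - N' 1 0) * (N 0 0 - N 1 0) = 1 := by
    have h1 := hprod 0 0
    have h2 := hprod 1 0
    have h3 := hNs' 0
    have h4 := hNs' 1
    simp at h1 h2
    zify at h1 h2 h3 h4
    linear_combination h1 - h2 - N 1 0 * (h3 - h4)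
  obtain ⟨π, ρ, h1, h2, h3⟩ : ∃ π ρ : Equiv.Perm (Fin 2), N (ρ 0) (π 0) = N (ρ 1) (π 0) + 1 ∧
      N (ρ 1) (π 1) = N (ρ 0) (π 1) + 1 ∧ N (ρ 1) (π 0) ≤ N (ρ 0) (π 1) := by
    have h3 := hNs 0
    have h4 := hNs 1
    rcases Int.eq_one_or_neg_one_of_mul_eq_one' hx with ⟨-, h⟩ | ⟨-, h⟩
    · rcases le_total (N 1 0) (N 0 1) with hle | hle
      · exact ⟨1, 1, by simp; omega, by simp; omega, by simpa using hle⟩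
      · exact ⟨Equiv.swap 0 1, Equiv.swap 0 1, by simp; omega, by simp; omega, by simpa using hle⟩
    · rcases le_total (N 0 0) (N 1 1) with hle | hle
      · exact ⟨1, Equiv.swap 0 1, by simp; omega, by simp; omega, by simpa using hle⟩
      · exact ⟨Equiv.swap 0 1, 1, by simp; omega, by simp; omega, by simpa using hle⟩
  have key : ∀ {A : Poly3 k} {P : Fin 2 → Poly3 k} (_ : FactorBasis A P fun _ => 1)
      (π : Equiv.Perm (Fin 2)), ∃ l : Poly3 k ≃ₐ[k] Poly3 k, IsLin l ∧
        ∀ i : Fin 2, l (X i.succ) = P (π i) := by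
    intro A P hP π
    obtain ⟨l, hl, hl1, hl2⟩ := exists_isLin_pair (hP.hom (π 0)) (hP.hom (π 1)) (hP.irr _).ne_zero
      fun hd => by simpa using hP.inj _ _ hd
    refine ⟨l, hl, fun i => ?_⟩
    fin_cases i
    exacts [hl1, hl2]
  obtain ⟨l, hl, hlP⟩ := key hP π
  obtain ⟨m, hm, hmQ⟩ := key hQ ρ
  have hlP' : ∀ i, l.symm (P (π i)) = X i.succ := fun i => by rw [AlgEquiv.symm_apply_eq, hlP]
  have hη : ∀ j : Fin 2, Hom3.conj l.symm m.symm η (X j.succ) =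
      C (b (ρ j)) * (X 1 ^ N (ρ j) (π 0) * X 2 ^ N (ρ j) (π 1)) := by
    intro j
    rw [Hom3.conj_apply, AlgEquiv.symm_symm, hmQ, hN, ← Equiv.prod_comp π, Fin.prod_univ_two,
      map_mul, algEquiv_C, map_mul, map_pow, map_pow, hlP', hlP']
    rfl
  have hsum : N (ρ 0) (π 0) + N (ρ 0) (π 1) = e := by
    rw [← hNs (ρ 0), ← Fin.sum_univ_two (f := fun i => N (ρ 0) (π i)),
      ← Fin.sum_univ_two (f := N (ρ 0)), Equiv.sum_comp π (N (ρ 0))]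
  refine linConj_of_conj hl.symm hm.symm
    ((h.conjugate hl.symm hm.symm).linConj_of_two_coordinates
      ((hP.reindex π).of_eq hl hlP) ((hQ.reindex ρ).of_eq hm hmQ) h3 (by omega) he
      (hb (ρ 0)) (hb (ρ 1)) ?_ ?_)
  · rw [← h1]
    exact hη 0
  · rw [← h2]
    exact hη 1

end TwoLines

section Valencies

variable {k : Type*} [Field k]

theorem IsFormMap.comp {Φ Γ : Hom3 k} {d e : ℕ} (hΦ : IsFormMap Φ d) (hΓ : IsFormMap Γ e) :
    IsFormMap (Φ.comp Γ) (d * e) := fun i => by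
  simpa using hΦ.apply (hΓ i)

theorem IsRegularMap.comp {Φ Γ : Hom3 k} (hΦ : IsRegularMap Φ) (hΓ : IsRegularMap Γ) :
    IsRegularMap (Φ.comp Γ) := fun v hv => by
  obtain ⟨i, hi⟩ := hΦ v hv
  obtain ⟨j, hj⟩ := hΓ (fun i => eval v (Φ (X i))) fun h0 => hi (congrFun h0 i)
  exact ⟨j, by rwa [AlgHom.comp_apply, eval_algHom_apply]⟩

/-- No irreducible factor of the critical divisor of a birational conjugacy is a conic. -/
theorem PermutesFactors.ne_two [IsAlgClosed k] [CharZero k] {ι : Type*} [Fintype ι]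
    {A : Poly3 k} {P : ι → Poly3 k} {δ : ι → ℕ}
    (h : FactorBasis A P δ) {d : ℕ} (hd : 2 ≤ d) {Φ : Hom3 k} (hΦ : IsFormMap Φ d)
    (hr : IsRegularMap Φ) {σ : Equiv.Perm ι} {m : ι → ℕ} {c : ι → k}
    (hσ : PermutesFactors d Φ P δ σ m c) (i : ι) : δ i ≠ 2 := by
  classical
  intro hi
  by_cases hii : σ i = i
  · have h1 := hσ.deg i
    have h2 := hσ.apply i
    rw [hii, hi, mul_comm] at h1
    rw [hii, Nat.eq_of_mul_eq_mul_right two_pos h1] at h2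
    exact false_of_apply_conic hd hΦ hr (hi ▸ h.hom i) (h.irr i) (hσ.ne_zero i) h2
  have hpos : ∀ j, 1 ≤ δ j := h.pos
  have hji : σ (σ i) = i := by
    by_contra hne
    have hne' : σ (σ i) ≠ σ i := fun h0 => hii (σ.injective h0)
    have hsum : ∑ j ∈ {i, σ i, σ (σ i)}, δ j ≤ ∑ j, δ j :=
      Finset.sum_le_sum_of_subset (Finset.subset_univ _)
    rw [Finset.sum_insert (by simp [Ne.symm hii, Ne.symm hne]),
      Finset.sum_pair (Ne.symm hne')] at hsum
    have := hσ.sum_le h hd hΦ hr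
    have := hpos (σ i)
    have := hpos (σ (σ i))
    omega
  have h1 := hσ.deg i
  have h2 := hσ.deg (σ i)
  rw [hji] at h2
  have h3 : m (σ i) * m i = d * d := by
    have : δ i * (m (σ i) * m i) = δ i * (d * d) := by
      rw [← mul_assoc, h2, mul_assoc, h1]; ring
    exact Nat.eq_of_mul_eq_mul_left (hpos i) this
  have h4 : (Φ.comp Φ) (P i) = C (c i * c (σ i) ^ m i) * P i ^ (d * d) := by
    rw [AlgHom.comp_apply, hσ.apply i, map_mul, map_pow, hσ.apply (σ i), hji, Hom3.map_C,
      mul_pow, ← pow_mul, h3, map_mul, map_pow, mul_assoc]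
  exact false_of_apply_conic (by nlinarith) (hΦ.comp hΦ) (hr.comp hr) (hi ▸ h.hom i) (h.irr i)
    (mul_ne_zero (hσ.ne_zero i) (pow_ne_zero _ (hσ.ne_zero _))) h4

end Valencies

section Contraction

variable {k : Type*} [Field k] {d : ℕ} {Φ Γ η κ : Hom3 k} {e e' : ℕ} {A B : Poly3 k}

theorem aeval_C_eq_C_eval (q : Fin 3 → k) (T : Poly3 k) :
    aeval (fun j => (C (q j) : Poly3 k)) T = C (eval q T) := by
  induction T using MvPolynomial.induction_on <;> simp_all

/-- An irreducible factor of `A` is contracted by `η` to a point. -/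
theorem BirConj.exists_point [IsAlgClosed k] (h : BirConj d Φ Γ η κ e e' A B) {P : Poly3 k}
    (hP : Irreducible P) (hPA : P ∣ A) :
    ∃ q : Fin 3 → k, q ≠ 0 ∧ ∀ i j, P ∣ C (q i) * η (X j) - C (q j) * η (X i) := by
  have hdvd : ∀ i, P ∣ η (κ (X i)) := fun i => by
    rw [h.comp]; exact hPA.mul_right _
  have h0 : κ (X 0) ≠ 0 := by
    intro h0
    have := h.comp 0
    rw [h0, map_zero] at this
    exact mul_ne_zero h.A_ne_zero (X_ne_zero 0) this.symm
  have key : ∀ T : Poly3 k, T ≠ 0 → P ∣ η T → ∃ π, Irreducible π ∧ π ∣ T ∧ P ∣ η π := by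
    intro T
    induction T using WfDvdMonoid.induction_on_irreducible with
    | zero => simp
    | unit u hu => exact fun _ h1 => (hP.not_isUnit (isUnit_of_dvd_unit h1 (hu.map η))).elim
    | mul T π hT hπ ih =>
      intro _ h1
      rw [map_mul] at h1
      rcases hP.prime.dvd_or_dvd h1 with h1 | h1
      · exact ⟨π, hπ, dvd_mul_right _ _, h1⟩
      · obtain ⟨π', h2, h3, h4⟩ := ih hT h1
        exact ⟨π', h2, h3.mul_left _, h4⟩
  obtain ⟨π, hπ, hπ0, hPπ⟩ := key _ h0 (hdvd 0)
  obtain ⟨m, hm⟩ := isHomogeneous_of_dvd (h.formκ 0) h0 hπ0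
  obtain ⟨j, hj⟩ := not_forall.1 (h.copκ π hπ)
  obtain ⟨q, hq, hq'⟩ := exists_vector_dvd hm (h.formκ j)
    ((hπ.isRelPrime_iff_not_dvd).2 hj) hP.prime hPπ (hdvd j)
  exact ⟨q, hq, fun i j => by simpa [smul_eq_C_mul] using hq' i j⟩

theorem BirConj.dvd_apply_iff (h : BirConj d Φ Γ η κ e e' A B) {P : Poly3 k}
    (hP : Irreducible P) {q : Fin 3 → k} (hq : q ≠ 0)
    (hq' : ∀ i j, P ∣ C (q i) * η (X j) - C (q j) * η (X i)) {T : Poly3 k} {n : ℕ}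
    (hT : T.IsHomogeneous n) : P ∣ η T ↔ eval q T = 0 := by
  obtain ⟨i, hi⟩ := Function.ne_iff.1 hq
  have hPi : ¬ P ∣ η (X i) := by
    intro h1
    refine h.copη P hP fun j => ?_
    have h2 := (dvd_sub_left (h1.mul_left (C (q j)))).1 (hq' i j)
    exact (((IsUnit.mk0 _ hi).map C).dvd_mul_left).1 h2
  have key : P ∣ C (q i) ^ n * η T - C (eval q T) * η (X i) ^ n := by
    have e1 : C (q i) ^ n * η T = aeval (fun j => C (q i) * η (X j)) T := by
      rw [aeval_mul_left_of_isHomogeneous hT, aeval_algHom_X]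
    have e2 : C (eval q T) * η (X i) ^ n = aeval (fun j => η (X i) * C (q j)) T := by
      rw [aeval_mul_left_of_isHomogeneous hT, mul_comm]
      rw [aeval_C_eq_C_eval]
    rw [e1, e2, ← Ideal.mem_span_singleton, ← Ideal.Quotient.eq]
    have : ∀ f : Fin 3 → Poly3 k, Ideal.Quotient.mk (Ideal.span {P}) (aeval f T) =
        aeval (fun j => Ideal.Quotient.mk (Ideal.span {P}) (f j)) T := fun f => by
      rw [← Ideal.Quotient.mkₐ_eq_mk k, ← AlgHom.comp_apply, comp_aeval]
    rw [this, this]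
    congr 2
    funext j
    rw [Ideal.Quotient.eq, Ideal.mem_span_singleton, mul_comm (η (X i))]
    exact hq' i j
  have hu : P ∣ C (q i) ^ n * η T ↔ P ∣ η T := by
    rw [← map_pow]; exact ((IsUnit.mk0 _ (pow_ne_zero n hi)).map C).dvd_mul_left
  constructor
  · intro h1
    by_contra h2
    have h3 := (dvd_sub_right (hu.2 h1)).1 key
    rw [((IsUnit.mk0 _ h2).map C).dvd_mul_left] at h3
    exact hPi (hP.prime.dvd_of_dvd_pow h3)
  · intro h1
    rw [h1, C_0, zero_mul, sub_zero] at key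
    exact hu.1 key

end Contraction

section Lines

variable {k : Type*} [Field k]

/-- A curve of degree `b` containing every curve through the image of a parametrised rational curve
of degree `≤ a` satisfies `b ≤ a`. -/
theorem le_of_parametrization {γ : Fin 3 → Polynomial k} {a b : ℕ}
    (hγ : ∀ i, (γ i).natDegree ≤ a) {D : Poly3 k} (hD : D.IsHomogeneous b)
    (hdvd : ∀ n (T : Poly3 k), T.IsHomogeneous n → aeval γ T = 0 → D ∣ T) : b ≤ a := by
  have key : ∀ N, (N + b + 1) * (N + b + 2) ≤ 2 * (a * (N + b) + 1) + (N + 1) * (N + 2) := by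
    intro N
    let f : homogeneousSubmodule (Fin 3) k (N + b) →ₗ[k] (Fin (a * (N + b) + 1) → k) :=
      (LinearMap.pi fun i : Fin (a * (N + b) + 1) =>
        (Polynomial.lcoeff k i).comp (aeval γ).toLinearMap).comp
        (Submodule.subtype _)
    let g : homogeneousSubmodule (Fin 3) k N →ₗ[k] homogeneousSubmodule (Fin 3) k (N + b) :=
      ((LinearMap.mulRight k D).comp (Submodule.subtype _)).codRestrict _ fun T =>
        ((mem_homogeneousSubmodule _ _).1 T.2).mul hD
    have hfg : LinearMap.ker f ≤ LinearMap.range g := by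
      rintro ⟨T, hT⟩ h0
      rw [mem_homogeneousSubmodule] at hT
      have hT0 : aeval γ T = 0 := by
        ext i
        by_cases hi : i < a * (N + b) + 1
        · exact congrFun h0 ⟨i, hi⟩
        · exact Polynomial.coeff_eq_zero_of_natDegree_lt
            (((natDegree_aeval_le_and_coeff hT hγ).1).trans_lt (by omega))
      by_cases hTz : T = 0
      · subst hTz; exact ⟨0, Subtype.ext (by simp)⟩
      obtain ⟨U, rfl, hU, -⟩ := hD.exists_mul_eq hT hTz (hdvd _ T hT hT0)
      rw [Nat.add_sub_cancel] at hU
      exact ⟨⟨U, hU⟩, Subtype.ext (mul_comm _ _)⟩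
    have h1 := LinearMap.finrank_range_add_finrank_ker f
    have h2 : Module.finrank k (LinearMap.range f) ≤ a * (N + b) + 1 := by
      simpa using Submodule.finrank_le (LinearMap.range f)
    have h3 := (Submodule.finrank_mono hfg).trans (LinearMap.finrank_range_le g)
    have h4 := two_mul_finrank_homogeneousSubmodule k N
    have h5 := two_mul_finrank_homogeneousSubmodule k (N + b)
    omega
  by_contra! hab
  obtain ⟨c, rfl⟩ := Nat.exists_eq_add_of_lt hab
  have h1 := key (a * (a + c + 1) + 1)
  have h2 : (a * (a + c + 1) + 1 + (a + c + 1) + 1) * (a * (a + c + 1) + 1 + (a + c + 1) + 2) =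
      2 * (a * (a * (a + c + 1) + 1 + (a + c + 1)) + 1) +
        (a * (a + c + 1) + 1 + 1) * (a * (a + c + 1) + 1 + 2) +
        (2 * c * (a * (a + c + 1) + 1) + (a + c + 1) * (a + c + 1) + 3 * (a + c + 1)) := by ring
  have h3 : 0 < (a + c + 1) * (a + c + 1) := by positivity
  omega

/-- The parametrisation of a coordinate line by an affine coordinate. -/
noncomputable def lineMap (k : Type*) [Field k] (i j : Fin 3) : Poly3 k →ₐ[k] Polynomial k :=
  aeval fun s => if s = i then 0 else if s = j then 1 else Polynomial.X

theorem natDegree_lineMap_le {T : Poly3 k} {n : ℕ} (hT : T.IsHomogeneous n) (i j : Fin 3) :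
    (lineMap k i j T).natDegree ≤ n := by
  rw [← one_mul n]
  exact (natDegree_aeval_le_and_coeff hT fun s => by split_ifs <;> simp).1

theorem eval_lineMap (i j : Fin 3) (c : k) (T : Poly3 k) :
    (lineMap k i j T).eval c = eval (fun s => if s = i then 0 else if s = j then 1 else c) T := by
  induction T using MvPolynomial.induction_on with
  | C a => simp [lineMap, ← algebraMap_eq]
  | add p q hp hq => simp [hp, hq]
  | mul_X p s hp =>
    rw [map_mul, Polynomial.eval_mul, hp, map_mul, eval_X]
    congr 1
    simp only [lineMap, aeval_X]
    split_ifs <;> simp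

theorem X_dvd_of_forall_eval [Infinite k] {i : Fin 3} {T : Poly3 k}
    (h : ∀ v : Fin 3 → k, v i = 0 → eval v T = 0) : X i ∣ T := by
  let ρ : Hom3 k := aeval fun s => if s = i then 0 else X s
  have h1 : X i ∣ T - ρ T := by
    clear h
    induction T using MvPolynomial.induction_on with
    | C a => rw [Hom3.map_C, sub_self]; exact dvd_zero _
    | add p q hp hq =>
      rw [map_add, add_sub_add_comm]; exact dvd_add hp hq
    | mul_X p s hp =>
      have : p * X s - ρ (p * X s) = (p - ρ p) * X s + ρ p * (X s - ρ (X s)) := by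
        rw [map_mul]; ring
      rw [this]
      refine dvd_add (hp.mul_right _) (Dvd.dvd.mul_left ?_ _)
      simp only [ρ, aeval_X]
      split_ifs with hs
      · rw [sub_zero, hs]
      · rw [sub_self]; exact dvd_zero _
  have h2 : ρ T = 0 := by
    refine MvPolynomial.funext fun v => ?_
    rw [eval_algHom_apply, map_zero]
    exact h _ (by simp [ρ])
  rwa [h2, sub_zero] at h1

theorem X_dvd_of_lineMap_eq_zero [Infinite k] {i j : Fin 3} (hij : i ≠ j) {T : Poly3 k} {n : ℕ}
    (hT : T.IsHomogeneous n) (h : lineMap k i j T = 0) : X i ∣ T := by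
  have : X i ∣ X j * T := by
    refine X_dvd_of_forall_eval fun v hv => ?_
    rw [map_mul, eval_X]
    by_cases hj : v j = 0
    · rw [hj, zero_mul]
    obtain ⟨l, hl⟩ : ∃ l : Fin 3, ∀ s, s = i ∨ s = j ∨ s = l := by
      clear hv hj h hT T
      revert i j; decide
    have h1 := eval_lineMap i j (v l / v j) T
    rw [h, Polynomial.eval_zero] at h1
    have h2 : v = fun s => v j * if s = i then 0 else if s = j then 1 else v l / v j := by
      funext s
      split_ifs with h3 h4
      · rw [h3, hv, mul_zero]
      · rw [h4, mul_one]
      · rw [((hl s).resolve_left h3).resolve_left h4, mul_div_cancel₀ _ hj]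
    suffices eval v T = 0 by rw [this, mul_zero]
    rw [h2]
    have := aeval_mul_left_of_isHomogeneous hT (v j)
      (fun s => if s = i then 0 else if s = j then 1 else v l / v j)
    rw [← coe_aeval_eq_eval] at h1 ⊢
    exact this.trans ((congrArg (v j ^ n * ·) h1.symm).trans (mul_zero _))
  refine ((X_prime (i := i)).dvd_or_dvd this).resolve_left fun h0 => ?_
  exact hij (by simpa using h0)

end Lines

section Contraction

variable {k : Type*} [Field k] {d : ℕ} {Φ Γ η κ : Hom3 k} {e e' : ℕ} {A B : Poly3 k}

theorem BirConj.apply_dvd_of_dvd_apply (h : BirConj d Φ Γ η κ e e' A B) {P : Fin 1 → Poly3 k}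
    {δ : Fin 1 → ℕ} (hP : FactorBasis A P δ) {m : Poly3 k} (hm : ¬ P 0 ∣ η m)
    {T : Poly3 k} {n : ℕ} (hT : T.IsHomogeneous n) (hmT : m ∣ κ T) : η m ∣ T := by
  have h1 : η m ∣ A ^ n * T := by
    rw [← h.apply_comp hT]; exact map_dvd η hmT
  refine IsRelPrime.dvd_of_dvd_mul_left ?_ h1
  refine WfDvdMonoid.isRelPrime_of_no_irreducible_factors
    (fun h0 => hm (by rw [h0.1]; exact dvd_zero _)) fun π hπ h2 h3 => ?_
  obtain ⟨i, hi⟩ := hP.cover π hπ (hπ.prime.dvd_of_dvd_pow h3)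
  rw [Subsingleton.elim i 0] at hi
  exact hm (hi.symm.dvd.trans h2)

theorem BirConj.le_degree [IsAlgClosed k] (h : BirConj d Φ Γ η κ e e' A B)
    {P : Fin 1 → Poly3 k} {δ : Fin 1 → ℕ} (hP : FactorBasis A P δ) : e ≤ e' := by
  obtain ⟨q, hq, hq'⟩ := h.exists_point (hP.irr 0) (hP.dvd 0)
  obtain ⟨i, hi⟩ := Function.ne_iff.1 hq
  have hPi : ¬ P 0 ∣ η (X i) := by
    rw [h.dvd_apply_iff (hP.irr 0) hq hq' (isHomogeneous_X k i), eval_X]; exact hi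
  obtain ⟨j, hj⟩ : ∃ j, i ≠ j := ⟨i + 1, by simp⟩
  refine le_of_parametrization (γ := fun s => lineMap k i j (κ (X s)))
    (fun s => natDegree_lineMap_le (h.formκ s) i j) (h.formη i)
    fun n T hT h0 => ?_
  refine h.apply_dvd_of_dvd_apply hP hPi hT
    (X_dvd_of_lineMap_eq_zero hj (h.formκ.apply hT) ?_)
  rw [← h0, ← AlgHom.comp_apply (lineMap k i j) κ]
  exact DFunLike.congr_fun (aeval_unique ((lineMap k i j).comp κ)) T

/-- The point to which `κ` contracts the divisor of `B` is the only base point of `η`. -/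
theorem BirConj.exists_smul_of_eval_eq_zero [IsAlgClosed k] (h : BirConj d Φ Γ η κ e e' A B)
    {P Q : Fin 1 → Poly3 k} {δ ε : Fin 1 → ℕ} (hP : FactorBasis A P δ) (hQ : FactorBasis B Q ε)
    {p : Fin 3 → k} (hp : p ≠ 0) (hp' : ∀ i j, Q 0 ∣ C (p i) * κ (X j) - C (p j) * κ (X i))
    {v : Fin 3 → k} (hv : v ≠ 0) (h0 : ∀ i, eval v (η (X i)) = 0) : ∃ c : k, p = c • v := by
  obtain ⟨l, hl, hlv⟩ := exists_isLin_eval hv 0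
  by_contra! hpv
  obtain ⟨i, hi, hpi⟩ : ∃ i, i ≠ 0 ∧ eval p (l.symm (X i)) ≠ 0 := by
    by_contra! hall
    refine hpv (eval p (l.symm (X 0))) ?_
    have h1 : ∀ T, eval p (l.symm T) =
        eval (fun i => if i = 0 then eval p (l.symm (X 0)) else 0) T := by
      intro T
      refine (eval_algHom_apply (l.symm : Hom3 k) p T).trans ?_
      congr 2
      funext i
      split_ifs with hi
      · subst hi; rfl
      · exact hall i hi
    funext i
    have h2 := h1 (l (X i))
    have h3 := hlv (X i)
    obtain ⟨a, ha⟩ := exists_eq_sum_of_isHomogeneous_one (hl.apply (isHomogeneous_X k i))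
    rw [AlgEquiv.symm_apply_apply, eval_X] at h2
    rw [h2, Pi.smul_apply, smul_eq_mul, ← eval_X (R := k) (f := v) i, ← h3, ha]
    simp [Fin.sum_univ_three, mul_comm]
  have hκ : ¬ Q 0 ∣ κ (l.symm (X i)) := by
    rwa [h.symm.dvd_apply_iff (hQ.irr 0) hp hp' (n := 1) (by simpa using hl.form_symm i)]
  have hz : ∀ T, (lineMap k i 0 (l T)).eval 0 = eval v T := fun T => by
    rw [eval_lineMap, ← hlv]
    congr 2
    funext s
    by_cases hs : s = 0
    · simp [hs, Ne.symm hi]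
    · simp [hs]
  have hdvd : ∀ s, Polynomial.X ∣ lineMap k i 0 (l (η (X s))) := fun s => by
    rw [Polynomial.X_dvd_iff, Polynomial.coeff_zero_eq_eval_zero, hz, h0]
  choose γ hγ using hdvd
  have hγd : ∀ s, (γ s).natDegree ≤ e - 1 := fun s => by
    by_cases hs : γ s = 0
    · simp [hs]
    have h1 := natDegree_lineMap_le (n := e) (by simpa using hl.apply (h.formη s)) i 0
      (T := l (η (X s)))
    rw [hγ, Polynomial.natDegree_X_mul hs] at h1
    omega
  have h1 : e' ≤ e - 1 := by
    refine le_of_parametrization hγd (D := κ (l.symm (X i)))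
      (by simpa using h.formκ.apply (hl.form_symm i))
      fun n T hT hT0 => ?_
    refine h.symm.apply_dvd_of_dvd_apply hQ hκ hT ?_
    have h2 : lineMap k i 0 (l (η T)) = 0 := by
      have h3 : lineMap k i 0 (l (η T)) = aeval (fun s => Polynomial.X * γ s) T := by
        simp_rw [← hγ]
        exact DFunLike.congr_fun (aeval_unique (((lineMap k i 0).comp (l : Hom3 k)).comp η)) T
      rw [h3, aeval_mul_left_of_isHomogeneous hT, hT0, mul_zero]
    have h3 := X_dvd_of_lineMap_eq_zero hi (n := e * n)
      (by simpa using hl.apply (h.formη.apply hT)) h2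
    simpa using map_dvd l.symm h3
  have h2 := h.le_degree hP
  have h3 := h.pos
  have : e ≠ 0 := fun h0 => by simp [h0] at h3
  omega

end Contraction

section Weights

variable {k : Type*} [Field k]

theorem Polynomial.coeff_prod_of_natDegree_le' {R ι : Type*} [CommRing R] (s : Finset ι)
    (f : ι → Polynomial R) (n : ι → ℕ) (h : ∀ i, (f i).natDegree ≤ n i) :
    (∏ i ∈ s, f i).natDegree ≤ ∑ i ∈ s, n i ∧
      (∏ i ∈ s, f i).coeff (∑ i ∈ s, n i) = ∏ i ∈ s, (f i).coeff (n i) := by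
  classical
  induction s using Finset.induction_on with
  | empty => simp
  | insert a s ha ih =>
    simp only [Finset.prod_insert ha, Finset.sum_insert ha]
    exact ⟨Polynomial.natDegree_mul_le_of_le (h a) ih.1, by
      rw [Polynomial.coeff_mul_add_eq_of_natDegree_le (h a) ih.1, ih.2]⟩

theorem natDegree_aeval_le_of_weight {R : Type*} [CommRing R] [Algebra k R] {T : Poly3 k}
    {s : Fin 3 → ℕ} {N : ℕ} {f : Fin 3 → Polynomial R} (hf : ∀ i, (f i).natDegree ≤ s i)
    (hT : ∀ m ∈ T.support, m 0 * s 0 + m 1 * s 1 + m 2 * s 2 ≤ N) :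
    (aeval f T).natDegree ≤ N ∧ (aeval f T).coeff N =
      ∑ m ∈ T.support with m 0 * s 0 + m 1 * s 1 + m 2 * s 2 = N,
        coeff m T • ((f 0).coeff (s 0) ^ m 0 * (f 1).coeff (s 1) ^ m 1 *
          (f 2).coeff (s 2) ^ m 2) := by
  have key : ∀ m : Fin 3 →₀ ℕ,
      (∏ i, f i ^ m i).natDegree ≤ m 0 * s 0 + m 1 * s 1 + m 2 * s 2 ∧
      (∏ i, f i ^ m i).coeff (m 0 * s 0 + m 1 * s 1 + m 2 * s 2) =
        (f 0).coeff (s 0) ^ m 0 * (f 1).coeff (s 1) ^ m 1 * (f 2).coeff (s 2) ^ m 2 := by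
    intro m
    have h1 : ∀ i, ((f i) ^ m i).natDegree ≤ m i * s i := fun i =>
      Polynomial.natDegree_pow_le_of_le _ (hf i)
    have h2 := Polynomial.coeff_prod_of_natDegree_le' Finset.univ (fun i => f i ^ m i)
      (fun i => m i * s i) h1
    simp only [Fin.sum_univ_three, Fin.prod_univ_three,
      Polynomial.coeff_pow_of_natDegree_le (hf _)] at h2 ⊢
    exact h2
  have hs : aeval f T = ∑ m ∈ T.support, coeff m T • ∏ i, f i ^ m i := by
    rw [aeval_def, eval₂_eq']
    exact Finset.sum_congr rfl fun m _ => (Algebra.smul_def _ _).symm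
  rw [hs]
  constructor
  · refine Polynomial.natDegree_sum_le_of_forall_le _ _ fun m hm => ?_
    exact (Polynomial.natDegree_smul_le _ _).trans ((key m).1.trans (hT m hm))
  · rw [Polynomial.finsetSum_coeff, Finset.sum_filter]
    refine Finset.sum_congr rfl fun m hm => ?_
    rw [Polynomial.coeff_smul]
    split_ifs with hN
    · rw [← hN, (key m).2]
    · rw [Polynomial.coeff_eq_zero_of_natDegree_lt, smul_zero]
      exact (key m).1.trans_lt (lt_of_le_of_ne (hT m hm) hN)

theorem Polynomial.eq_C_mul_X_sub_C_pow [IsAlgClosed k] {f : Polynomial k} {r : k}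
    (h : ∀ s, f.IsRoot s → s = r) :
    f = Polynomial.C f.leadingCoeff * (Polynomial.X - Polynomial.C r) ^ f.natDegree := by
  by_cases hf : f = 0
  · simp [hf]
  have h1 := (IsAlgClosed.splits f).eq_prod_roots
  have h2 : f.roots = Multiset.replicate f.roots.card r :=
    Multiset.eq_replicate.2 ⟨rfl, fun s hs => h s (Polynomial.isRoot_of_mem_roots hs)⟩
  have h3 : f.roots.card = f.natDegree := (IsAlgClosed.splits f).natDegree_eq_card_roots.symm
  rw [h2, Multiset.map_replicate, Multiset.prod_replicate, h3] at h1
  exact h1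

/-- A polynomial whose zero set is totally invariant under a polynomial of degree at least two
has a single zero. -/
theorem Polynomial.exists_eq_C_mul_X_sub_C_pow [IsAlgClosed k] [CharZero k]
    {f α : Polynomial k} {d : ℕ} (hd : 2 ≤ d) (hα : α.natDegree = d) {g : k} (hg : g ≠ 0)
    (h : f.comp α = Polynomial.C g * f ^ d) :
    ∃ r, f = Polynomial.C f.leadingCoeff * (Polynomial.X - Polynomial.C r) ^ f.natDegree := by
  classical
  by_cases hf : f = 0
  · exact ⟨0, by simp [hf]⟩
  have hα0 : α ≠ 0 := by rintro rfl; rw [Polynomial.natDegree_zero] at hα; omega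
  have hroot : ∀ r, f.IsRoot r ↔ f.IsRoot (α.eval r) := fun r => by
    have := congrArg (Polynomial.eval r) h
    rw [Polynomial.eval_comp, Polynomial.eval_mul, Polynomial.eval_C, Polynomial.eval_pow] at this
    rw [Polynomial.IsRoot, Polynomial.IsRoot, this]
    simp [hg, show d ≠ 0 by omega]
  have hsurj : ∀ c, ∃ r, α.eval r = c := fun c => by
    obtain ⟨r, hr⟩ := IsAlgClosed.exists_root (α - Polynomial.C c) (by
      intro h0
      have := Polynomial.natDegree_eq_zero_iff_degree_le_zero.2 h0.le
      rw [Polynomial.natDegree_sub_C] at this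
      omega)
    exact ⟨r, by simpa [sub_eq_zero] using hr⟩
  have hinj : Set.InjOn (fun r => α.eval r) {r | f.IsRoot r} := by
    have hfin : Set.Finite {r | f.IsRoot r} := by
      convert (f.roots.toFinset : Finset k).finite_toSet using 1
      ext r; simp [hf]
    refine hfin.injOn_of_encard_image_eq (congrArg Set.encard ?_)
    ext c
    constructor
    · rintro ⟨r, hr, rfl⟩; exact (hroot r).1 hr
    · intro hc
      obtain ⟨r, rfl⟩ := hsurj c
      exact ⟨r, (hroot r).2 hc, rfl⟩
  have hpow : ∀ r, f.IsRoot r → α - Polynomial.C (α.eval r) =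
      Polynomial.C α.leadingCoeff * (Polynomial.X - Polynomial.C r) ^ d := by
    intro r hr
    have h1 := Polynomial.eq_C_mul_X_sub_C_pow (f := α - Polynomial.C (α.eval r)) (r := r)
      fun s hs => by
        have hs' : α.eval s = α.eval r := by simpa [sub_eq_zero] using hs
        exact hinj ((hroot s).2 (hs' ▸ (hroot r).1 hr)) hr hs'
    rwa [Polynomial.natDegree_sub_C, hα, Polynomial.leadingCoeff,
      Polynomial.natDegree_sub_C, Polynomial.coeff_sub, Polynomial.coeff_C_of_ne_zero (by omega),
      sub_zero, ← Polynomial.leadingCoeff] at h1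
  have huniq : ∀ r s, f.IsRoot r → f.IsRoot s → s = r := by
    intro r s hr hs
    have h1 := congrArg (fun p => (Polynomial.derivative p).eval s)
      ((sub_eq_iff_eq_add.1 (hpow r hr)).symm.trans (sub_eq_iff_eq_add.1 (hpow s hs)))
    have hlc : α.leadingCoeff ≠ 0 := Polynomial.leadingCoeff_ne_zero.2 hα0
    simp only [Polynomial.derivative_add, Polynomial.derivative_C, Polynomial.derivative_mul,
      Polynomial.derivative_X_sub_C_pow, Polynomial.eval_mul,
      Polynomial.eval_pow, Polynomial.eval_sub, Polynomial.eval_X, Polynomial.eval_C,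
      sub_self, zero_pow (show d - 1 ≠ 0 by omega), zero_mul, zero_add,
      add_zero, mul_zero, mul_eq_zero, hlc, false_or, Nat.cast_eq_zero,
      show d ≠ 0 by omega] at h1
    exact sub_eq_zero.1 (pow_eq_zero_iff (by omega) |>.1 h1)
  by_cases hr : ∃ r, f.IsRoot r
  · obtain ⟨r, hr⟩ := hr
    exact ⟨r, Polynomial.eq_C_mul_X_sub_C_pow fun s => huniq r s hr⟩
  · exact ⟨0, Polynomial.eq_C_mul_X_sub_C_pow fun s hs => (hr ⟨s, hs⟩).elim⟩

end Weights

section WeightMap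

variable {k : Type*} [Field k]

/-- Differentiation of the coefficients of a polynomial with polynomial coefficients. -/
noncomputable def coeffDerivation (k : Type*) [Field k] :
    Derivation k (Polynomial (Polynomial k)) (Polynomial (Polynomial k)) :=
  (PolynomialModule.equivPolynomialSelf (R := Polynomial k)).toLinearMap.compDer
    ((Polynomial.derivative' (R := k)).mapCoeffs)

theorem coeff_coeffDerivation (f : Polynomial (Polynomial k)) (n : ℕ) :
    (coeffDerivation k f).coeff n = Polynomial.derivative (f.coeff n) := rfl

/-- The derivation `τ d/dτ`. -/
noncomputable def eulerDerivation (k : Type*) [Field k] :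
    Derivation k (Polynomial (Polynomial k)) (Polynomial (Polynomial k)) :=
  (Polynomial.X : Polynomial (Polynomial k)) •
    (Polynomial.derivative' (R := Polynomial k)).restrictScalars k

theorem eulerDerivation_apply (f : Polynomial (Polynomial k)) :
    eulerDerivation k f = Polynomial.X * Polynomial.derivative f := rfl

theorem Polynomial.coeff_X_mul_derivative {R : Type*} [CommRing R] (f : Polynomial R) (n : ℕ) :
    (Polynomial.X * Polynomial.derivative f).coeff n = n * f.coeff n := by
  cases n with
  | zero => simp
  | succ n => rw [Polynomial.coeff_X_mul, Polynomial.coeff_derivative]; push_cast; ring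

theorem coeff_eulerDerivation (f : Polynomial (Polynomial k)) (n : ℕ) :
    (eulerDerivation k f).coeff n = n * f.coeff n :=
  Polynomial.coeff_X_mul_derivative f n

theorem natDegree_eulerDerivation_le {f : Polynomial (Polynomial k)} {N : ℕ}
    (hf : f.natDegree ≤ N) : (eulerDerivation k f).natDegree ≤ N := by
  rw [Polynomial.natDegree_le_iff_coeff_eq_zero] at hf ⊢
  intro n hn
  rw [coeff_eulerDerivation, hf n hn, mul_zero]

theorem natDegree_coeffDerivation_le {f : Polynomial (Polynomial k)} {N : ℕ}
    (hf : f.natDegree ≤ N) : (coeffDerivation k f).natDegree ≤ N := by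
  rw [Polynomial.natDegree_le_iff_coeff_eq_zero] at hf ⊢
  intro n hn
  rw [coeff_coeffDerivation, hf n hn, map_zero]

/-- The substitution `X₀ ↦ τᵃ`, `X₁ ↦ Y τᵇ`, `X₂ ↦ 1`. -/
noncomputable def weightMap (k : Type*) [Field k] (a b : ℕ) :
    Poly3 k →ₐ[k] Polynomial (Polynomial k) :=
  aeval ![Polynomial.X ^ a, Polynomial.C Polynomial.X * Polynomial.X ^ b, 1]

theorem weightMap_X_zero (a b : ℕ) : weightMap k a b (X 0) = Polynomial.X ^ a := by
  simp [weightMap]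

theorem weightMap_X_one (a b : ℕ) :
    weightMap k a b (X 1) = Polynomial.C Polynomial.X * Polynomial.X ^ b := by
  simp [weightMap]

theorem weightMap_X_two (a b : ℕ) : weightMap k a b (X 2) = 1 := by
  simp [weightMap]

theorem weightMap_C (a b : ℕ) (c : k) :
    weightMap k a b (C c) = Polynomial.C (Polynomial.C c) := by
  rw [weightMap, aeval_C]; rfl

theorem wronskian_weightMap [CharZero k] {f g : Poly3 k} {a b N : ℕ} (hN : 0 < N)
    (hab : a + b < N + N)
    (hf : (weightMap k a b f).natDegree ≤ N) (hg : (weightMap k a b g).natDegree ≤ N)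
    {r : Polynomial k}
    (hD : weightMap k a b (pderiv 0 f * pderiv 1 g - pderiv 1 f * pderiv 0 g) = Polynomial.C r) :
    (weightMap k a b f).coeff N * Polynomial.derivative ((weightMap k a b g).coeff N) =
      Polynomial.derivative ((weightMap k a b f).coeff N) * (weightMap k a b g).coeff N := by
  set ψ := weightMap k a b with hψ
  have e0 : ∀ T, eulerDerivation k (ψ T) = ψ (pderiv 0 T) *
    ((a : Polynomial (Polynomial k)) * Polynomial.X ^ a) +
      ψ (pderiv 1 T) *
      ((b : Polynomial (Polynomial k)) * Polynomial.C Polynomial.X * Polynomial.X ^ b) := by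
    intro T
    have h0 : ∀ n : ℕ, eulerDerivation k (Polynomial.X ^ n) =
        (n : Polynomial (Polynomial k)) * Polynomial.X ^ n := by
      intro n
      ext1 m
      rw [coeff_eulerDerivation]
      simp only [Polynomial.coeff_X_pow, ← Polynomial.C_eq_natCast, Polynomial.coeff_C_mul]
      split_ifs with hm <;> simp [hm]
    have h1 : eulerDerivation k (Polynomial.C Polynomial.X * Polynomial.X ^ b) =
        (b : Polynomial (Polynomial k)) * Polynomial.C Polynomial.X * Polynomial.X ^ b := by
      rw [Derivation.leibniz, h0, eulerDerivation_apply (Polynomial.C _), Polynomial.derivative_C,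
        mul_zero, smul_zero, add_zero, smul_eq_mul]
      ring
    rw [derivation_algHom_apply, Fin.sum_univ_three, weightMap_X_zero, weightMap_X_one,
      weightMap_X_two, h0, h1, Derivation.map_one_eq_zero, mul_zero, add_zero]
  have e1 : ∀ T, coeffDerivation k (ψ T) = ψ (pderiv 1 T) * Polynomial.X ^ b := by
    intro T
    have h0 : ∀ n : ℕ, coeffDerivation k (Polynomial.X ^ n) = 0 := by
      intro n
      ext1 m
      rw [coeff_coeffDerivation, Polynomial.coeff_X_pow]
      split_ifs <;> simp
    have h1 : coeffDerivation k (Polynomial.C Polynomial.X * Polynomial.X ^ b) =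
        Polynomial.X ^ b := by
      have : coeffDerivation k (Polynomial.C Polynomial.X) = 1 := by
        ext1 m
        rw [coeff_coeffDerivation, Polynomial.coeff_C, Polynomial.coeff_one]
        split_ifs <;> simp
      rw [Derivation.leibniz, h0, this, smul_zero, zero_add, smul_eq_mul, mul_one]
    rw [derivation_algHom_apply, Fin.sum_univ_three, weightMap_X_zero, weightMap_X_one,
      weightMap_X_two, h0, h1, Derivation.map_one_eq_zero, mul_zero, mul_zero, zero_add, add_zero]
  have key : eulerDerivation k (ψ f) * coeffDerivation k (ψ g) -
      coeffDerivation k (ψ f) * eulerDerivation k (ψ g) =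
        Polynomial.C (a * r) * Polynomial.X ^ (a + b) := by
    have : Polynomial.C (a * r) = (a : Polynomial (Polynomial k)) * Polynomial.C r := by simp
    rw [this, ← hD, e0, e0, e1, e1, map_sub, map_mul, map_mul]
    ring
  have hc := congrArg (fun p => Polynomial.coeff p (N + N)) key
  simp only [Polynomial.coeff_sub] at hc
  rw [Polynomial.coeff_mul_add_eq_of_natDegree_le (natDegree_eulerDerivation_le hf)
      (natDegree_coeffDerivation_le hg),
    Polynomial.coeff_mul_add_eq_of_natDegree_le (natDegree_coeffDerivation_le hf)
      (natDegree_eulerDerivation_le hg), Polynomial.coeff_C_mul_X_pow, if_neg (by omega),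
    coeff_eulerDerivation, coeff_eulerDerivation, coeff_coeffDerivation, coeff_coeffDerivation,
    sub_eq_zero] at hc
  have hN0 : (N : Polynomial k) ≠ 0 := Nat.cast_ne_zero.2 hN.ne'
  exact mul_left_cancel₀ hN0 (by linear_combination hc)

/-- Two polynomials with vanishing Wronskian and distinct degrees. -/
theorem Polynomial.eq_zero_of_wronskian [CharZero k] {f g : Polynomial k} {e : ℕ}
    (hf : f.natDegree ≤ e) (hfe : f.coeff e ≠ 0) (hg : g.natDegree < e)
    (h : f * Polynomial.derivative g = Polynomial.derivative f * g) : g = 0 := by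
  by_contra hg0
  have hd : ∀ p : Polynomial k, ∀ n, p.natDegree ≤ n →
      (Polynomial.X * Polynomial.derivative p).natDegree ≤ n := fun p n hp => by
    rw [Polynomial.natDegree_le_iff_coeff_eq_zero] at hp ⊢
    intro m hm
    rw [Polynomial.coeff_X_mul_derivative, hp m hm, mul_zero]
  have h1 : f * (Polynomial.X * Polynomial.derivative g) =
      (Polynomial.X * Polynomial.derivative f) * g := by linear_combination Polynomial.X * h
  have h2 := Polynomial.ext_iff.1 h1 (e + g.natDegree)
  rw [Polynomial.coeff_mul_add_eq_of_natDegree_le hf (hd g _ le_rfl),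
    Polynomial.coeff_mul_add_eq_of_natDegree_le (hd f _ hf) le_rfl,
    Polynomial.coeff_X_mul_derivative, Polynomial.coeff_X_mul_derivative] at h2
  have h3 : g.coeff g.natDegree ≠ 0 := Polynomial.leadingCoeff_ne_zero.2 hg0
  have h4 : ((g.natDegree : k) - e) = 0 := by
    apply mul_left_cancel₀ (mul_ne_zero hfe h3)
    linear_combination h2
  exact hg.ne (Nat.cast_injective (sub_eq_zero.1 h4))

end WeightMap

section ContractedLine

variable {k : Type*} [Field k]

theorem MvPolynomial.IsHomogeneous.sum_apply_of_mem_support {T : Poly3 k} {n : ℕ}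
    (hT : T.IsHomogeneous n) {m : Fin 3 →₀ ℕ} (hm : m ∈ T.support) : m 0 + m 1 + m 2 = n := by
  have := hT (mem_support_iff.1 hm)
  rw [Finsupp.weight_apply, Finsupp.sum_fintype _ _ (by simp), Fin.sum_univ_three] at this
  simpa using this

theorem weightMap_bound {a b N : ℕ} {T : Poly3 k}
    (hT : ∀ m ∈ T.support, m 0 * a + m 1 * b ≤ N) :
    (weightMap k a b T).natDegree ≤ N ∧ (weightMap k a b T).coeff N =
      ∑ m ∈ T.support with m 0 * a + m 1 * b = N, coeff m T • Polynomial.X ^ m 1 := by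
  have := natDegree_aeval_le_of_weight (R := Polynomial k) (s := ![a, b, 0]) (N := N) (T := T)
    (f := ![Polynomial.X ^ a, Polynomial.C Polynomial.X * Polynomial.X ^ b, 1])
    (by
      intro i
      fin_cases i
      · simp
      · exact (Polynomial.natDegree_C_mul_le _ _).trans (by simp)
      · simp)
    (by simpa using hT)
  simpa [weightMap] using this

theorem coeff_coeff_weightMap {a b N n : ℕ} (ha : 0 < a) {T : Poly3 k}
    (hT : ∀ m ∈ T.support, m 0 * a + m 1 * b ≤ N) (hTn : T.IsHomogeneous n)
    {m : Fin 3 →₀ ℕ} (hm : m 0 + m 1 + m 2 = n) (hmN : m 0 * a + m 1 * b = N) :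
    ((weightMap k a b T).coeff N).coeff (m 1) = coeff m T := by
  rw [(weightMap_bound hT).2, Polynomial.finsetSum_coeff, Finset.sum_eq_single m]
  · simp
  · intro m' hm' hne
    rw [Finset.mem_filter] at hm'
    have h1 := hTn.sum_apply_of_mem_support hm'.1
    rw [Polynomial.coeff_smul, Polynomial.coeff_X_pow, if_neg, smul_zero]
    intro h2
    refine hne ?_
    have h3 : m' 0 = m 0 := by
      have : m' 0 * a = m 0 * a := by
        have := hm'.2
        rw [← h2] at this
        omega
      exact Nat.eq_of_mul_eq_mul_right ha this
    ext i
    fin_cases i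
    · exact h3
    · exact h2.symm
    · change m' 2 = m 2; omega
  · intro h
    rw [Polynomial.coeff_smul]
    have : coeff m T = 0 := by
      by_contra h0
      exact h (Finset.mem_filter.2 ⟨mem_support_iff.2 h0, hmN⟩)
    rw [this, zero_smul]

theorem natDegree_coeff_weightMap_le {a b N j : ℕ} {T : Poly3 k}
    (hT : ∀ m ∈ T.support, m 0 * a + m 1 * b ≤ N) (hj : ∀ m ∈ T.support, m 1 ≤ j) :
    ((weightMap k a b T).coeff N).natDegree ≤ j := by
  rw [(weightMap_bound hT).2]
  refine Polynomial.natDegree_sum_le_of_forall_le _ _ fun m hm => ?_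
  exact (Polynomial.natDegree_smul_le _ _).trans
    (by simpa using hj m (Finset.mem_filter.1 hm).1)

/-- The edge of the Newton polygon issuing from the monomial `X₁ᵉ`. -/
theorem exists_weights {s : Finset (Fin 3 →₀ ℕ)} {e : ℕ} (hs : ∀ m ∈ s, m 0 + m 1 + m 2 = e)
    (h2 : ∀ m ∈ s, 0 < m 0 → 0 < m 2) (h0 : ∃ m ∈ s, 0 < m 0) :
    ∃ a b, 0 < b ∧ b < a ∧ (∀ m ∈ s, m 0 * a + m 1 * b ≤ b * e) ∧
      ∃ m ∈ s, 0 < m 0 ∧ m 0 * a + m 1 * b = b * e := by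
  obtain ⟨m₀, hm₀, hm₀'⟩ := h0
  obtain ⟨m, hm, hmin⟩ := Finset.exists_min_image (s.filter fun m => 0 < m 0)
    (fun m => ((e : ℚ) - m 1) / m 0) ⟨m₀, Finset.mem_filter.2 ⟨hm₀, hm₀'⟩⟩
  rw [Finset.mem_filter] at hm
  have hme := hs m hm.1
  have hm2 := h2 m hm.1 hm.2
  refine ⟨e - m 1, m 0, hm.2, by omega, fun m' hm' => ?_, m, hm.1, hm.2, ?_⟩
  · have hme' := hs m' hm'
    rcases (m' 0).eq_zero_or_pos with h | h
    · rw [h, zero_mul, zero_add, mul_comm]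
      exact Nat.mul_le_mul_left _ (by omega)
    · have := hmin m' (Finset.mem_filter.2 ⟨hm', h⟩)
      rw [div_le_div_iff₀ (by exact_mod_cast hm.2) (by exact_mod_cast h)] at this
      zify [show m 1 ≤ e by omega]
      have h3 : ((e : ℤ) - m 1) * m' 0 ≤ (e - m' 1) * m 0 := by exact_mod_cast this
      linarith
  · zify [show m 1 ≤ e by omega]
    ring

theorem natDegree_weightMap_form {a b d : ℕ} (hb : 0 < b) (hba : b < a) {T : Poly3 k}
    (hT : T.IsHomogeneous d) : (weightMap k a b T).natDegree ≤ a * d ∧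
      (weightMap k a b T).coeff (a * d) = Polynomial.C (coeff (Finsupp.single 0 d) T) := by
  have ha : 0 < a := hb.trans hba
  have hle : ∀ m ∈ T.support, m 0 * a + m 1 * b ≤ a * d := fun m hm => by
    have := hT.sum_apply_of_mem_support hm
    nlinarith [Nat.zero_le (m 1), Nat.zero_le (m 2)]
  have h0 : ∀ m ∈ T.support, m 1 ≤ d := fun m hm => by
    have := hT.sum_apply_of_mem_support hm; omega
  refine ⟨(weightMap_bound hle).1, ?_⟩
  have hc := coeff_coeff_weightMap ha hle hT (m := Finsupp.single 0 d)
    (by simp) (by simp [mul_comm])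
  rw [Finsupp.single_eq_of_ne (by decide)] at hc
  rw [← hc]
  refine Polynomial.eq_C_of_natDegree_eq_zero (Nat.le_zero.1 ?_)
  rw [(weightMap_bound hle).2]
  refine Polynomial.natDegree_sum_le_of_forall_le _ _ fun m hm => ?_
  rw [Finset.mem_filter] at hm
  have h1 := hT.sum_apply_of_mem_support hm.1
  have h2 : m 1 = 0 := by
    by_contra h
    have : 0 < m 1 := Nat.pos_of_ne_zero h
    nlinarith [Nat.zero_le (m 2), hm.2, mul_lt_mul_of_pos_left hba this]
  exact (Polynomial.natDegree_smul_le _ _).trans (by simp [h2])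

theorem le_natDegree_aeval_of_lt {a b d e : ℕ} {T : Poly3 k}
    (hmax : ∀ m ∈ T.support, m 0 * a + m 1 * b ≤ b * e) (hT : T.IsHomogeneous e)
    (hc : coeff (Finsupp.single 1 e) T ≠ 0) {F : Fin 3 → Polynomial (Polynomial k)}
    (hF0 : (F 0).natDegree ≤ a * d) (hF2 : (F 2).natDegree = 0)
    (hlt : b * d < (F 1).natDegree) : (F 1).natDegree * e ≤ (aeval F T).natDegree := by
  have hstrict : ∀ m ∈ T.support, m 0 ≠ 0 →
      m 0 * (a * d) + m 1 * (F 1).natDegree < (F 1).natDegree * e := by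
    intro m hm hm0
    have h3 := hmax m hm
    have h4 := hT.sum_apply_of_mem_support hm
    obtain ⟨r, hr⟩ : ∃ r, e = m 1 + r := ⟨m 0 + m 2, by omega⟩
    have h5 : m 0 * a ≤ b * r := by rw [hr] at h3; nlinarith
    have hr0 : 0 < r := by omega
    have h6 : m 0 * (a * d) ≤ b * d * r := by nlinarith
    have h7 : b * d * r < (F 1).natDegree * r := Nat.mul_lt_mul_of_pos_right hlt hr0
    rw [hr]
    nlinarith
  have hW := natDegree_aeval_le_of_weight (R := Polynomial k)
    (s := ![a * d, (F 1).natDegree, 0]) (N := (F 1).natDegree * e) (T := T) (f := F)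
    (by
      intro i
      fin_cases i
      · exact hF0
      · exact le_rfl
      · simp [hF2])
    (fun m hm => by
      simp only [Matrix.cons_val, mul_zero, add_zero]
      by_cases hm0 : m 0 = 0
      · have := hT.sum_apply_of_mem_support hm
        rw [hm0, zero_mul, zero_add, mul_comm]
        exact Nat.mul_le_mul_left _ (by omega)
      · exact (hstrict m hm hm0).le)
  have hlead : (aeval F T).coeff ((F 1).natDegree * e) ≠ 0 := by
    rw [hW.2, Finset.sum_eq_single (Finsupp.single 1 e)]
    · have hne : (F 1).leadingCoeff ≠ 0 := by
        rw [Polynomial.leadingCoeff_ne_zero]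
        intro h
        rw [h, Polynomial.natDegree_zero] at hlt
        omega
      refine smul_ne_zero hc ?_
      simpa using pow_ne_zero e hne
    · intro m hm hne
      rw [Finset.mem_filter] at hm
      have := hT.sum_apply_of_mem_support hm.1
      have hm2 := hm.2
      simp only [Matrix.cons_val, mul_zero, add_zero] at hm2
      refine (hne ?_).elim
      have hm0 : m 0 = 0 := by
        by_contra hm0
        exact (hstrict m hm.1 hm0).ne hm2
      have hm1 : m 1 = e := by
        rw [hm0, zero_mul, zero_add, mul_comm] at hm2
        exact Nat.eq_of_mul_eq_mul_left (by omega) hm2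
      ext i
      fin_cases i
      · simpa using hm0
      · simpa using hm1
      · change m 2 = _
        simp; omega
    · intro h
      refine (h (Finset.mem_filter.2 ⟨mem_support_iff.2 hc, ?_⟩)).elim
      simp [mul_comm]
  exact Polynomial.le_natDegree_of_ne_zero hlead

set_option maxHeartbeats 1000000 in
theorem false_of_contracted_line [IsAlgClosed k] [CharZero k] {Φ Γ η : Hom3 k} {d e : ℕ}
    (hd : 2 ≤ d) (he : 2 ≤ e) (hΦ : IsFormMap Φ d) (hΓ : IsFormMap Γ d) (hη : IsFormMap η e)
    (hconj : Φ (η (X 0)) = η (Γ (X 0))) {b₀ c c' C' : k} (hb₀ : b₀ ≠ 0) (hc : c ≠ 0)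
    (hc' : c' ≠ 0) (hC' : C' ≠ 0) (h2 : η (X 2) = C b₀ * X 2 ^ e) (h1 : X 2 ∣ η (X 1))
    (h0 : X 2 ∣ η (X 0) - C c * X 1 ^ e)
    (hJ : jacobian (fun i => η (X i)) = C C' * X 2 ^ (3 * (e - 1)))
    (hΦ2 : Φ (X 2) = C c' * X 2 ^ d) (hf : coeff (Finsupp.single 0 d) (Φ (X 0)) ≠ 0)
    (hg : coeff (Finsupp.single 0 d) (Γ (X 0)) ≠ 0) : False := by
  classical
  set H0 := η (X 0) with hH0
  set H1 := η (X 1) with hH1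
  set f₀ := coeff (Finsupp.single 0 d) (Φ (X 0)) with hf₀
  set g₀ := coeff (Finsupp.single 0 d) (Γ (X 0)) with hg₀
  have hX2 : ∀ T : Poly3 k, X 2 ∣ T → ∀ m ∈ T.support, 0 < m 2 := by
    intro T hT m hm
    by_contra hm2
    obtain ⟨r, rfl⟩ := hT
    rw [mem_support_iff, coeff_X_mul', if_neg (by simpa using hm2)] at hm
    exact hm rfl
  have hsupp0 : ∀ m ∈ H0.support, 0 < m 2 ∨ m = Finsupp.single 1 e := by
    intro m hm
    by_cases hme : m = Finsupp.single 1 e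
    · exact Or.inr hme
    · refine Or.inl (hX2 _ h0 m ?_)
      rw [mem_support_iff] at hm ⊢
      rwa [coeff_sub, coeff_C_mul, coeff_X_pow, if_neg (Ne.symm hme), mul_zero, sub_zero]
  have hcoeff : coeff (Finsupp.single 1 e) H0 = c := by
    by_contra hne
    have : Finsupp.single 1 e ∈ (H0 - C c * X 1 ^ e).support := by
      rw [mem_support_iff, coeff_sub, coeff_C_mul, coeff_X_pow, if_pos rfl, mul_one]
      exact sub_ne_zero.2 hne
    simpa using hX2 _ h0 _ this
  have hsupp1 := hX2 _ h1
  set D := pderiv 0 H0 * pderiv 1 H1 - pderiv 1 H0 * pderiv 0 H1 with hD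
  have hJD : D * (C (b₀ * e) * X 2 ^ (e - 1)) = C C' * X 2 ^ (3 * (e - 1)) := by
    rw [← hJ, jacobian_eq, h2]
    simp only [pderiv_C_mul, pderiv_pow, pderiv_X_self, ← hH0, ← hH1,
      pderiv_X_of_ne (show (2 : Fin 3) ≠ 0 by decide),
      pderiv_X_of_ne (show (2 : Fin 3) ≠ 1 by decide)]
    simp [hD]
    ring
  have hD0 : D ≠ 0 := by
    intro h
    rw [h, zero_mul] at hJD
    exact mul_ne_zero (C_ne_zero.2 hC') (pow_ne_zero _ (X_ne_zero 2)) hJD.symm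
  obtain ⟨a, b, hb, hba, hmax, m₁, hm₁, hm₁0, hm₁e⟩ := exists_weights
    (s := H0.support ∪ H1.support) (e := e)
    (fun m hm => by
      rcases Finset.mem_union.1 hm with hm | hm
      · exact (hη 0).sum_apply_of_mem_support hm
      · exact (hη 1).sum_apply_of_mem_support hm)
    (fun m hm hm0 => by
      rcases Finset.mem_union.1 hm with hm | hm
      · rcases hsupp0 m hm with h | rfl
        · exact h
        · simp at hm0
      · exact hsupp1 m hm)
    (by
      by_contra! h
      have hp : ∀ T : Poly3 k, (∀ m ∈ T.support, m 0 ≤ 0) → pderiv 0 T = 0 := by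
        intro T hT
        refine pderiv_eq_zero_of_notMem_vars fun h => ?_
        obtain ⟨m, hm, hm0⟩ := (mem_vars_iff_mem_support 0).1 h
        exact (Finsupp.mem_support_iff.1 hm0) (Nat.le_zero.1 (hT m hm))
      refine hD0 ?_
      rw [hD, hp H0 fun m hm => h m (Finset.mem_union_left _ hm),
        hp H1 fun m hm => h m (Finset.mem_union_right _ hm), zero_mul, mul_zero, sub_zero])
  have hmax0 : ∀ m ∈ H0.support, m 0 * a + m 1 * b ≤ b * e :=
    fun m hm => hmax m (Finset.mem_union_left _ hm)
  have hmax1 : ∀ m ∈ H1.support, m 0 * a + m 1 * b ≤ b * e :=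
    fun m hm => hmax m (Finset.mem_union_right _ hm)
  set ψ := weightMap k a b with hψ
  set l0 := (ψ H0).coeff (b * e) with hl0
  set l1 := (ψ H1).coeff (b * e) with hl1
  have hl0e : l0.coeff e = c := by
    have := coeff_coeff_weightMap (by omega : 0 < a) hmax0 (hη 0) (m := Finsupp.single 1 e)
      (by simp) (by simp [mul_comm])
    rw [hcoeff] at this
    simpa using this
  have hl0deg : l0.natDegree ≤ e := natDegree_coeff_weightMap_le hmax0 fun m hm => by
    have := (hη 0).sum_apply_of_mem_support hm; omega
  have hl0' : l0.coeff (e - 1) = 0 := by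
    rw [hl0, (weightMap_bound hmax0).2, Polynomial.finsetSum_coeff]
    refine Finset.sum_eq_zero fun m hm => ?_
    rw [Finset.mem_filter] at hm
    rw [Polynomial.coeff_smul, Polynomial.coeff_X_pow, if_neg, smul_zero]
    intro hm1
    have : m 0 * a = b := by
      have := hm.2
      obtain ⟨e, rfl⟩ : ∃ e', e = e' + 1 := ⟨e - 1, by omega⟩
      rw [← hm1, Nat.add_sub_cancel] at this
      nlinarith
    rcases (m 0).eq_zero_or_pos with h | h
    · rw [h] at this; omega
    · nlinarith
  have hl1deg : l1.natDegree < e := by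
    have : l1.natDegree ≤ e - 1 := natDegree_coeff_weightMap_le hmax1 fun m hm => by
      have := (hη 1).sum_apply_of_mem_support hm
      have := hsupp1 m hm
      omega
    omega
  have hψD : ψ D = Polynomial.C (Polynomial.C (C' / (b₀ * e))) := by
    have h := congrArg ψ hJD
    rw [map_mul ψ, map_mul ψ (C (b₀ * e)), map_mul ψ (C C'), map_pow ψ, map_pow ψ,
      show ψ (X 2) = 1 from weightMap_X_two a b, one_pow, one_pow, mul_one, mul_one,
      show ∀ c, ψ (C c) = _ from weightMap_C a b, show ∀ c, ψ (C c) = _ from weightMap_C a b] at h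
    have he0 : b₀ * (e : k) ≠ 0 := mul_ne_zero hb₀ (Nat.cast_ne_zero.2 (by omega))
    have h' : Polynomial.C (Polynomial.C (b₀ * (e : k))) ≠ 0 := by simpa using he0
    refine mul_right_cancel₀ h' (h.trans ?_)
    rw [← map_mul, ← map_mul, div_mul_cancel₀ _ he0]
  have hl1z : l1 = 0 := by
    refine Polynomial.eq_zero_of_wronskian hl0deg (hl0e.symm ▸ hc) hl1deg ?_
    refine wronskian_weightMap (by positivity) ?_ (weightMap_bound hmax0).1
      (weightMap_bound hmax1).1 hψD
    nlinarith
  set F : Fin 3 → Polynomial (Polynomial k) := fun i => ψ (Φ (X i)) with hF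
  have hΦT : ∀ T, ψ (Φ T) = aeval F T := fun T =>
    DFunLike.congr_fun (aeval_unique (ψ.comp Φ)) T
  have hηT : ∀ T, ψ (η T) = aeval (fun i => ψ (η (X i))) T := fun T =>
    DFunLike.congr_fun (aeval_unique (ψ.comp η)) T
  have hF0 := natDegree_weightMap_form hb hba (hΦ 0)
  have hF2 : F 2 = Polynomial.C (Polynomial.C c') := by
    simp only [hF, hΦ2, map_mul, map_pow, hψ, weightMap_X_two, weightMap_C, one_pow, mul_one]
  have hη2 : ψ (η (X 2)) = Polynomial.C (Polynomial.C b₀) := by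
    simp only [h2, map_mul, map_pow, hψ, weightMap_X_two, weightMap_C, one_pow, mul_one]
  have hG := natDegree_aeval_le_of_weight (R := Polynomial k) (s := ![b * e, b * e, 0])
    (N := b * e * d) (T := Γ (X 0)) (f := fun i => ψ (η (X i)))
    (by
      intro i
      fin_cases i
      · exact (weightMap_bound hmax0).1
      · exact (weightMap_bound hmax1).1
      · simp [hη2])
    (fun m hm => by
      have := (hΓ 0).sum_apply_of_mem_support hm
      simp only [Matrix.cons_val]
      rw [mul_zero, add_zero, ← add_mul, mul_comm]
      exact Nat.mul_le_mul_left _ (by omega))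
  rw [← hηT, ← hconj, hΦT] at hG
  have hGsum : (aeval F H0).coeff (b * e * d) = Polynomial.C g₀ * l0 ^ d := by
    rw [hG.2, Finset.sum_eq_single (Finsupp.single 0 d)]
    · simp [Polynomial.smul_eq_C_mul, hl0, hg₀, hH0]
    · intro m hm hne
      rw [Finset.mem_filter] at hm
      have := (hΓ 0).sum_apply_of_mem_support hm.1
      have hm2 := hm.2
      simp only [Matrix.cons_val] at hm2 ⊢
      have hbe : 0 < b * e := by positivity
      have hm1 : m 1 ≠ 0 := by
        intro hm1
        refine hne ?_
        have : m 0 = d := by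
          rw [hm1, zero_mul, mul_zero, add_zero, add_zero, mul_comm] at hm2
          exact Nat.eq_of_mul_eq_mul_left hbe hm2
        ext i
        fin_cases i
        · simpa using this
        · simpa using hm1
        · change m 2 = _
          simp; omega
      change _ • (_ * l1 ^ m 1 * _) = 0
      rw [hl1z, zero_pow hm1, mul_zero, zero_mul, smul_zero]
    · intro h
      have hz : coeff (Finsupp.single 0 d) (Γ (X 0)) = 0 := by
        by_contra h0
        refine h (Finset.mem_filter.2 ⟨mem_support_iff.2 h0, ?_⟩)
        simp [mul_comm]
      exact (hg hz).elim
  have hF1 : (F 1).natDegree ≤ b * d := by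
    by_contra! hlt
    have := le_natDegree_aeval_of_lt hmax0 (hη 0) (by rwa [hcoeff]) hF0.1 (by simp [hF2]) hlt
    nlinarith [hG.1]
  have hW := natDegree_aeval_le_of_weight (R := Polynomial k)
    (s := ![a * d, b * d, 0]) (N := b * e * d) (T := H0) (f := F)
    (by
      intro i
      fin_cases i
      · exact hF0.1
      · exact hF1
      · simp [hF2])
    (fun m hm => by
      simp only [Matrix.cons_val, mul_zero, add_zero]
      nlinarith [Nat.mul_le_mul_right d (hmax0 m hm)])
  obtain ⟨φ, hφ⟩ := IsAlgClosed.exists_pow_nat_eq f₀ (hb.trans hba)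
  obtain ⟨γ, hγ⟩ := IsAlgClosed.exists_pow_nat_eq c' (hb.trans hba)
  have hφ0 : φ ≠ 0 := by rintro rfl; rw [zero_pow (by omega)] at hφ; exact hf hφ.symm
  have hγ0 : γ ≠ 0 := by rintro rfl; rw [zero_pow (by omega)] at hγ; exact hc' hγ.symm
  set lam := φ ^ b * γ ^ (a - b) with hlam
  have hlam0 : lam ≠ 0 := mul_ne_zero (pow_ne_zero _ hφ0) (pow_ne_zero _ hγ0)
  set α := Polynomial.C lam⁻¹ * (F 1).coeff (b * d) with hα
  have hα' : (F 1).coeff (b * d) = Polynomial.C lam * α := by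
    rw [hα, ← mul_assoc, ← map_mul, mul_inv_cancel₀ hlam0, map_one, one_mul]
  have hcomp : (aeval F H0).coeff (b * e * d) = Polynomial.C (lam ^ e) * l0.comp α := by
    rw [hW.2, hl0, (weightMap_bound hmax0).2, Polynomial.comp, Polynomial.eval₂_finsetSum,
      Finset.mul_sum]
    refine Finset.sum_congr ?_ fun m hm => ?_
    · refine Finset.filter_congr fun m _ => ?_
      simp only [Matrix.cons_val, mul_zero, add_zero]
      rw [show m 0 * (a * d) + m 1 * (b * d) = (m 0 * a + m 1 * b) * d by ring]
      exact Nat.mul_left_inj (by omega)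
    · rw [Finset.mem_filter] at hm
      have h3 := (hη 0).sum_apply_of_mem_support hm.1
      obtain ⟨r, hr⟩ : ∃ r, e = m 1 + r := ⟨m 0 + m 2, by omega⟩
      obtain ⟨s, hs⟩ : ∃ s, a = b + s := ⟨a - b, by omega⟩
      have h4 : a * m 0 = b * r := by have := hm.2; rw [hr] at this; nlinarith
      have h5 : a * m 2 = s * r := by
        have : r = m 0 + m 2 := by omega
        rw [this] at h4 ⊢
        rw [hs] at h4 ⊢
        nlinarith
      have h6 : f₀ ^ m 0 * c' ^ m 2 = lam ^ r := by
        rw [← hφ, ← hγ, ← pow_mul, ← pow_mul, h4, h5, hlam, show a - b = s by omega, mul_pow,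
          ← pow_mul, ← pow_mul]
      simp only [Matrix.cons_val]
      rw [show (F 0).coeff (a * d) = Polynomial.C f₀ from hF0.2, hα', hF2,
        Polynomial.coeff_C_zero, Polynomial.smul_eq_C_mul, Polynomial.smul_eq_C_mul,
        Polynomial.eval₂_mul, Polynomial.eval₂_C, Polynomial.eval₂_pow, Polynomial.eval₂_X,
        mul_pow, hr, pow_add lam, ← h6]
      simp only [map_mul, map_pow]
      ring
  have hfinal : l0.comp α = Polynomial.C (g₀ * (lam ^ e)⁻¹) * l0 ^ d := by
    have h3 : Polynomial.C (lam ^ e) ≠ 0 := by simpa using fun h => (hlam0 h).elim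
    refine mul_left_cancel₀ h3 ?_
    rw [← hcomp, hGsum, ← mul_assoc, ← map_mul, mul_left_comm,
      mul_inv_cancel₀ (pow_ne_zero _ hlam0), mul_one]
  have hl0n : l0.natDegree = e :=
    le_antisymm hl0deg (Polynomial.le_natDegree_of_ne_zero (hl0e.symm ▸ hc))
  have hg' : g₀ * (lam ^ e)⁻¹ ≠ 0 := mul_ne_zero hg (inv_ne_zero (pow_ne_zero _ hlam0))
  have hαd : α.natDegree = d := by
    have := congrArg Polynomial.natDegree hfinal
    rw [Polynomial.natDegree_comp, Polynomial.natDegree_C_mul hg', Polynomial.natDegree_pow,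
      hl0n, mul_comm] at this
    exact Nat.eq_of_mul_eq_mul_right (by omega) this
  obtain ⟨r, hr⟩ := Polynomial.exists_eq_C_mul_X_sub_C_pow hd hαd hg' hfinal
  rw [hl0n, Polynomial.leadingCoeff, hl0n, hl0e] at hr
  have hr0 : r = 0 := by
    have h3 := hl0'
    rw [hr, Polynomial.coeff_C_mul, sub_eq_add_neg, ← Polynomial.C_neg,
      Polynomial.coeff_X_add_C_pow,
      show e - (e - 1) = 1 by omega, ← Nat.choose_symm (by omega),
      show e - (e - 1) = 1 by omega] at h3
    simpa [hc, show e ≠ 0 by omega] using h3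
  rw [hr0, map_zero, sub_zero] at hr
  have hm₁1 : m₁ 1 ≠ e := fun h => by rw [h, mul_comm (b : ℕ)] at hm₁e; nlinarith
  rcases Finset.mem_union.1 hm₁ with hm | hm
  · have := coeff_coeff_weightMap (by omega : 0 < a) hmax0 (hη 0)
      ((hη 0).sum_apply_of_mem_support hm) hm₁e
    rw [← hψ, ← hl0, hr, Polynomial.coeff_C_mul_X_pow, if_neg hm₁1] at this
    exact mem_support_iff.1 hm this.symm
  · have := coeff_coeff_weightMap (by omega : 0 < a) hmax1 (hη 1)
      ((hη 1).sum_apply_of_mem_support hm) hm₁e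
    rw [← hψ, ← hl1, hl1z, Polynomial.coeff_zero] at this
    exact mem_support_iff.1 hm this.symm

end ContractedLine

section SingleFactor

variable {k : Type*} [Field k]

theorem MvPolynomial.IsHomogeneous.eval_piSingle {T : Poly3 k} {n : ℕ} (hT : T.IsHomogeneous n)
    (i : Fin 3) : eval (Pi.single i 1) T = coeff (Finsupp.single i n) T := by
  rw [eval_eq', Finset.sum_eq_single (Finsupp.single i n)]
  · rw [Finset.prod_eq_one, mul_one]
    intro j _
    by_cases hj : j = i
    · simp [hj]
    · simp [Finsupp.single_eq_of_ne hj]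
  · intro m hm hne
    obtain ⟨j, hj, hj'⟩ : ∃ j, j ≠ i ∧ m j ≠ 0 := by
      by_contra! h
      refine hne ?_
      have h1 := hT.sum_apply_of_mem_support hm
      ext j
      by_cases hj : j = i
      · subst hj
        rw [Finsupp.single_eq_same]
        have hs : ∑ l, m l = m j := Finset.sum_eq_single j (fun l _ hl => h l hl) (by simp)
        rw [Fin.sum_univ_three] at hs
        omega
      · rw [h j hj, Finsupp.single_eq_of_ne hj]
    rw [Finset.prod_eq_zero (Finset.mem_univ j) (by simp [hj, hj']), mul_zero]
  · intro h
    rw [notMem_support_iff.1 h, zero_mul]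

/-- A flag consisting of a point on a line has a coordinate normal form. -/
theorem exists_isLin_flag {v : Fin 3 → k} (hv : v ≠ 0) {L : Poly3 k} (hL : L.IsHomogeneous 1)
    (hL0 : L ≠ 0) (hvL : eval v L = 0) : ∃ l : Poly3 k ≃ₐ[k] Poly3 k, IsLin l ∧ l L = X 2 ∧
      ∀ T, eval (Pi.single 0 1) (l T) = eval v T := by
  obtain ⟨l, hl, hlv⟩ := exists_isLin_eval hv 0
  obtain ⟨a, ha⟩ := exists_eq_sum_of_isHomogeneous_one (T := l L) (by simpa using hl.form.apply hL)
  have ha0 : a 0 = 0 := by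
    have := hlv L
    rw [hvL, ha] at this
    simpa [Fin.sum_univ_three] using this
  obtain ⟨M, hM, hM0, hM1⟩ : ∃ M : Matrix (Fin 3) (Fin 3) k, M.det ≠ 0 ∧
      (∀ i, M i 0 = Pi.single (M := fun _ => k) 0 1 i) ∧ M 2 = a := by
    by_cases h2 : a 2 = 0
    · have h1 : a 1 ≠ 0 := by
        intro h1
        refine hL0 (l.injective ?_)
        rw [map_zero, ha]
        simp [Fin.sum_univ_three, ha0, h1, h2]
      refine ⟨!![1, 0, 0; 0, 0, 1; 0, a 1, a 2], by simp [det_fin_three, h1], fun i => ?_, ?_⟩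
      · fin_cases i <;> simp
      · ext i; fin_cases i <;> simp [ha0]
    · refine ⟨!![1, 0, 0; 0, 1, 0; 0, a 1, a 2], by simp [det_fin_three, h2], fun i => ?_, ?_⟩
      · fin_cases i <;> simp
      · ext i; fin_cases i <;> simp [ha0]
  obtain ⟨m, hm, hm'⟩ := exists_isLin_of_det_ne_zero hM
  have hme : ∀ T, eval (Pi.single 0 1) (m T) = eval (Pi.single 0 1) T := by
    intro T
    refine (eval_algHom_apply (m : Hom3 k) _ T).trans ?_
    congr 2
    funext i
    rw [AlgEquiv.coe_toAlgHom, hm', ← hM0]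
    simp [Fin.sum_univ_three]
  refine ⟨l.trans m.symm, hl.trans hm.symm, ?_, fun T => ?_⟩
  · rw [AlgEquiv.trans_apply, AlgEquiv.symm_apply_eq, hm', ha, hM1]
  · rw [AlgEquiv.trans_apply, ← hme, AlgEquiv.apply_symm_apply, hlv]

variable {d : ℕ} {Φ Γ η κ : Hom3 k} {e e' : ℕ} {A B : Poly3 k}

theorem BirConj.exists_jacobian_eq [CharZero k] (h : BirConj d Φ Γ η κ e e' A B)
    {P : Fin 1 → Poly3 k} {δ : Fin 1 → ℕ} (hP : FactorBasis A P δ) :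
    ∃ c n, c ≠ 0 ∧ jacobian (fun i => η (X i)) = C c * P 0 ^ n ∧ δ 0 * n = 3 * (e - 1) := by
  obtain ⟨c, n, hc, hn⟩ := hP.eq_prod h.jacobian_ne_zero fun Q hQ hQJ => by
    have h1 : Q ∣ C ((e * e' : ℕ) : k) * A ^ 3 := h.jacobian_mul ▸ hQJ.mul_left _
    have h2 : ((e * e' : ℕ) : k) ≠ 0 := Nat.cast_ne_zero.2 h.pos.ne'
    exact hQ.prime.dvd_of_dvd_pow ((((IsUnit.mk0 _ h2).map C).dvd_mul_left).1 h1)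
  rw [Fin.prod_univ_one] at hn
  refine ⟨c, n 0, hc, hn, ?_⟩
  have h1 : (C c * P 0 ^ n 0).IsHomogeneous (0 + δ 0 * n 0) :=
    (isHomogeneous_C _ _).mul ((hP.hom 0).pow _)
  have h2 := h.formη.isHomogeneous_jacobian
  rw [hn] at h2
  have := h1.inj_right h2 (hn ▸ h.jacobian_ne_zero)
  omega

theorem BirConj.exists_normal_form [IsAlgClosed k] [CharZero k] (h : BirConj d Φ Γ η κ e e' A B)
    (he : 0 < e) (hP : FactorBasis A (fun _ : Fin 1 => X 2) fun _ => 1)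
    (hQ : FactorBasis B (fun _ : Fin 1 => X 2) fun _ => 1)
    (hη : ∀ i, X 2 ∣ η (X i) ↔ i ≠ 0) (hκ : ∀ i, X 2 ∣ κ (X i) ↔ i ≠ 0) :
    (∃ c, c ≠ 0 ∧ X 2 ∣ η (X 0) - C c * X 1 ^ e) ∧ coeff (Finsupp.single 0 d) (Φ (X 0)) ≠ 0 := by
  have hbase : ∀ v : Fin 3 → k, v ≠ 0 → (∀ i, eval v (η (X i)) = 0) →
      ∃ c : k, Pi.single 0 1 = c • v := fun v hv h0 => by
    refine h.exists_smul_of_eval_eq_zero hP hQ (by simp) (fun i j => ?_) hv h0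
    have hz : ∀ i j : Fin 3, X 2 ∣ C (Pi.single (M := fun _ => k) 0 1 i) * κ (X j) ∨
        (i = 0 ∧ j = 0) := by
      intro i j
      by_cases hi : i = 0
      · by_cases hj : j = 0
        · exact Or.inr ⟨hi, hj⟩
        · exact Or.inl (((hκ j).2 hj).mul_left _)
      · simp [hi]
    rcases hz i j with h1 | ⟨rfl, rfl⟩
    · rcases hz j i with h2 | ⟨rfl, rfl⟩
      · exact dvd_sub h1 h2
      · simp
    · simp
  have hdvd : ∀ v : Fin 3 → k, v 2 = 0 → ∀ i, i ≠ 0 → eval v (η (X i)) = 0 := fun v hv i hi => by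
    obtain ⟨r, hr⟩ := (hη i).2 hi
    rw [hr, map_mul, eval_X, hv, zero_mul]
  have hH0 : ∃ c, c ≠ 0 ∧ X 2 ∣ η (X 0) - C c * X 1 ^ e := by
    obtain ⟨c, hc⟩ : ∃ c, lineMap k 2 1 (η (X 0)) = Polynomial.C c := by
      refine ⟨_, Polynomial.eq_C_of_natDegree_eq_zero ?_⟩
      by_contra hne
      obtain ⟨t, ht⟩ := IsAlgClosed.exists_root (lineMap k 2 1 (η (X 0))) fun h0 =>
        hne (Nat.le_zero.1 (Polynomial.natDegree_le_of_degree_le h0.le))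
      rw [Polynomial.IsRoot, eval_lineMap] at ht
      obtain ⟨c, hc⟩ := hbase (fun s => if s = 2 then 0 else if s = 1 then 1 else t)
        (fun h0 => by simpa using congrFun h0 1) fun i => by
          by_cases hi : i = 0
          · rw [hi, ht]
          · exact hdvd _ (by simp) i hi
      have h1 : c = 0 := by simpa using (congrFun hc 1).symm
      simpa [h1] using congrFun hc 0
    refine ⟨c, ?_, X_dvd_of_lineMap_eq_zero (show (2 : Fin 3) ≠ 1 by decide)
      ((h.formη 0).sub (by simpa using (isHomogeneous_C _ c).mul ((isHomogeneous_X k 1).pow e))) ?_⟩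
    · rintro rfl
      exact (hη 0).1 (X_dvd_of_lineMap_eq_zero (show (2 : Fin 3) ≠ 1 by decide) (h.formη 0)
        (by rw [hc, map_zero])) rfl
    · rw [map_sub, hc, map_mul, map_pow]
      simp [lineMap, Polynomial.C_eq_algebraMap]
  refine ⟨hH0, ?_⟩
  have hp : ∀ i, eval (Pi.single 0 1) (η (X i)) = 0 := fun i => by
    by_cases hi : i = 0
    · obtain ⟨c, -, r, hr⟩ := hH0
      rw [hi, sub_eq_iff_eq_add.1 hr]
      simp [he.ne']
    · exact hdvd _ (by simp) i hi
  have hd : 0 < d := by have := h.two_le; omega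
  obtain ⟨c, hc⟩ := hbase (fun i => eval (Pi.single 0 1) (Φ (X i)))
    (fun h0 => by
      obtain ⟨i, hi⟩ := h.regΦ (Pi.single 0 1) (by simp)
      exact hi (congrFun h0 i))
    (fun i => by
      rw [← eval_algHom_apply, h.conj, eval_algHom_apply, funext hp]
      exact eval_zero_of_isHomogeneous (h.formΓ i) hd rfl)
  rw [← (h.formΦ 0).eval_piSingle]
  intro h0
  have := congrFun hc 0
  simp [h0] at this

theorem BirConj.false_of_line_normal_form [IsAlgClosed k] [CharZero k]
    (h : BirConj d Φ Γ η κ e e' A B) (he : 2 ≤ e)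
    (hP : FactorBasis A (fun _ : Fin 1 => X 2) fun _ => 1)
    (hQ : FactorBasis B (fun _ : Fin 1 => X 2) fun _ => 1)
    (hη : ∀ i, X 2 ∣ η (X i) ↔ i ≠ 0) (hκ : ∀ i, X 2 ∣ κ (X i) ↔ i ≠ 0) : False := by
  have hd := h.two_le
  obtain ⟨⟨c, hc, h0⟩, hf⟩ := h.exists_normal_form (by omega) hP hQ hη hκ
  have hg := (h.symm.exists_normal_form (Nat.pos_of_mul_pos_left h.pos) hQ hP hκ hη).2
  obtain ⟨b, N, hb, hN, hN', -⟩ := h.exists_exponents hP hQ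
  obtain ⟨σ, m, c', hσ⟩ := hP.exists_permutesFactors (by omega) h.formΦ h.regΦ h.apply_A
  obtain ⟨C', n, hC', hJ, hn⟩ := h.exists_jacobian_eq hP
  have hN0 : N 0 0 = e := by simpa using hN' 0
  have hm0 : m 0 = d := by simpa using hσ.deg 0
  refine false_of_contracted_line hd he h.formΦ h.formΓ h.formη (h.conj _) (hb 0) hc
    (hσ.ne_zero 0) hC' ?_ ((hη 1).2 (by decide)) h0 ?_ ?_ hf hg
  · simpa [hN0] using hN 0
  · rw [hJ, ← hn, one_mul]
  · simpa [hm0] using hσ.apply 0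

/-- A single contracted line on each side is impossible. -/
theorem BirConj.false_of_line [IsAlgClosed k] [CharZero k]
    (h : BirConj d Φ Γ η κ e e' A B) (he : 2 ≤ e) {P Q : Fin 1 → Poly3 k}
    (hP : FactorBasis A P fun _ => 1) (hQ : FactorBasis B Q fun _ => 1) : False := by
  obtain ⟨q, hq, hq'⟩ := h.exists_point (hP.irr 0) (hP.dvd 0)
  obtain ⟨p, hp, hp'⟩ := h.symm.exists_point (hQ.irr 0) (hQ.dvd 0)
  have hqQ : eval q (Q 0) = 0 := by
    obtain ⟨b, N, hb, hN, hN', -⟩ := h.exists_exponents hP hQ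
    have hN0 : N 0 0 = e := by simpa using hN' 0
    rw [← h.dvd_apply_iff (hP.irr 0) hq hq' (hQ.hom 0), hN, Fin.prod_univ_one, hN0]
    exact (dvd_pow_self _ (by omega)).mul_left _
  have hpP : eval p (P 0) = 0 := by
    obtain ⟨b, N, hb, hN, hN', -⟩ := h.symm.exists_exponents hQ hP
    have hN0 : N 0 0 = e' := by simpa using hN' 0
    rw [← h.symm.dvd_apply_iff (hQ.irr 0) hp hp' (hP.hom 0), hN, Fin.prod_univ_one, hN0]
    exact (dvd_pow_self _ (Nat.pos_of_mul_pos_left h.pos).ne').mul_left _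
  obtain ⟨l, hl, hlP, hlp⟩ := exists_isLin_flag hp (hP.hom 0) (hP.irr 0).ne_zero hpP
  obtain ⟨m, hm, hmQ, hmq⟩ := exists_isLin_flag hq (hQ.hom 0) (hQ.irr 0).ne_zero hqQ
  have hcoord : ∀ i, eval (Pi.single (M := fun _ => k) 0 1) (X (R := k) (σ := Fin 3) i) =
    0 ↔ i ≠ 0 := by
    intro i; simp [Pi.single_apply]
  have hP' := hP.conj hl
  have hQ' := hQ.conj hm
  rw [show (fun i => l (P i)) = fun _ => X 2 from funext fun i => by
    rw [Subsingleton.elim i 0, hlP]] at hP'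
  rw [show (fun i => m (Q i)) = fun _ => X 2 from funext fun i => by
    rw [Subsingleton.elim i 0, hmQ]] at hQ'
  refine (h.conjugate hl hm).false_of_line_normal_form he hP' hQ' (fun i => ?_) fun i => ?_
  · rw [Hom3.conj_apply, ← hlP, map_dvd_iff,
      h.dvd_apply_iff (hP.irr 0) hq hq'
        (show (m.symm (X i)).IsHomogeneous 1 from hm.symm.form i), ← hmq, AlgEquiv.apply_symm_apply,
        hcoord]
  · rw [Hom3.conj_apply, ← hmQ, map_dvd_iff,
      h.symm.dvd_apply_iff (hQ.irr 0) hp hp'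
        (show (l.symm (X i)).IsHomogeneous 1 from hl.symm.form i), ← hlp, AlgEquiv.apply_symm_apply,
      hcoord]

end SingleFactor

section CubicCurves

variable {k : Type*} [Field k]

theorem Polynomial.exists_eq_C_mul_of_wronskian [CharZero k] {f g : Polynomial k} (hf : f ≠ 0)
    (h : f * Polynomial.derivative g = Polynomial.derivative f * g) :
    ∃ c, g = Polynomial.C c * f := by
  have hlc : f.coeff f.natDegree ≠ 0 := Polynomial.leadingCoeff_ne_zero.2 hf
  have hgf : g.natDegree ≤ f.natDegree := by
    by_contra! hlt
    refine hf (Polynomial.eq_zero_of_wronskian (f := g) le_rfl ?_ hlt ?_)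
    · refine Polynomial.leadingCoeff_ne_zero.2 ?_
      rintro rfl
      simp at hlt
    · rw [mul_comm, ← h, mul_comm]
  refine ⟨g.coeff f.natDegree / f.coeff f.natDegree, ?_⟩
  set c := g.coeff f.natDegree / f.coeff f.natDegree with hc
  have hr : (g - Polynomial.C c * f).natDegree ≤ f.natDegree :=
    (Polynomial.natDegree_sub_le _ _).trans (max_le hgf (Polynomial.natDegree_C_mul_le _ _))
  have hr0 : (g - Polynomial.C c * f).coeff f.natDegree = 0 := by
    rw [Polynomial.coeff_sub, Polynomial.coeff_C_mul, hc, div_mul_cancel₀ _ hlc, sub_self]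
  rw [← sub_eq_zero]
  by_cases h0 : f.natDegree = 0
  · rw [h0] at hr hr0
    rw [Polynomial.eq_C_of_natDegree_le_zero hr, hr0, map_zero]
  · refine Polynomial.eq_zero_of_wronskian le_rfl hlc (lt_of_le_of_ne hr fun he => ?_) ?_
    · rw [← he, Polynomial.coeff_natDegree, Polynomial.leadingCoeff_eq_zero] at hr0
      rw [hr0] at he
      exact h0 (by simpa using he.symm)
    · simp only [Polynomial.derivative_sub, Polynomial.derivative_C_mul]
      linear_combination h

/-- The substitution of `0` for the first variable. -/
noncomputable def dropFirst (k : Type*) [Field k] : Hom3 k :=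
  aeval fun i => if i = 0 then 0 else X i

theorem dropFirst_X (i : Fin 3) : dropFirst k (X i) = if i = 0 then 0 else X i := by
  simp [dropFirst]

theorem aeval_of_dropFirst {R : Type*} [CommRing R] [Algebra k R] {g : Poly3 k}
    (hg : dropFirst k g = g) (f : Fin 3 → R) :
    aeval f g = aeval (fun i => if i = 0 then 0 else f i) g := by
  have h : (aeval f).comp (dropFirst k) = aeval (R := k) fun i => if i = 0 then 0 else f i := by
    refine MvPolynomial.algHom_ext fun i => ?_
    rw [AlgHom.comp_apply, dropFirst_X, aeval_X]
    split_ifs <;> simp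
  rw [← h, AlgHom.comp_apply, hg]

theorem aeval_of_dropFirst_mul {R : Type*} [CommRing R] [Algebra k R] {g : Poly3 k} {n : ℕ}
    (hg : dropFirst k g = g) (hgn : g.IsHomogeneous n) {f : Fin 3 → R} {a u v : R}
    (h1 : f 1 = a * u) (h2 : f 2 = a * v) : aeval f g = a ^ n * aeval ![0, u, v] g := by
  rw [aeval_of_dropFirst hg, ← aeval_mul_left_of_isHomogeneous hgn]
  congr 1
  refine MvPolynomial.algHom_ext fun i => ?_
  fin_cases i <;> simp [h1, h2]

/-- The Wronskian along a parametrized plane curve. -/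
theorem wronskian_of_curve {P : Poly3 k} {n : ℕ} (hP : P.IsHomogeneous n)
    {ν : Fin 3 → Polynomial k} (hν : aeval ν P = 0) {f g : Poly3 k} {d : ℕ}
    (hf : f.IsHomogeneous d) (hg : g.IsHomogeneous d) :
    aeval ν (pderiv 0 P) * ((d : Polynomial k) * (aeval ν f * Polynomial.derivative (aeval ν g) -
      Polynomial.derivative (aeval ν f) * aeval ν g)) =
    (ν 1 * Polynomial.derivative (ν 2) - ν 2 * Polynomial.derivative (ν 1)) *
      aeval ν (jacobian ![P, f, g]) := by
  have hD : ∀ T : Poly3 k, Polynomial.derivative (aeval ν T) =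
      ∑ l, aeval ν (pderiv l T) * Polynomial.derivative (ν l) := fun T => by
    have := derivation_algHom_apply (Polynomial.derivative' (R := k)) (aeval ν) T
    simpa using this
  have hE : ∀ (T : Poly3 k) (n : ℕ), T.IsHomogeneous n →
      ∑ l, ν l * aeval ν (pderiv l T) = n * aeval ν T := fun T n hT => by
    have := congrArg (aeval ν) hT.sum_X_mul_pderiv
    simpa using this
  have e1 := hE P n hP
  have e2 := hD P
  rw [hν] at e1 e2
  simp only [mul_zero, map_zero] at e1 e2
  have e3 := hE f d hf
  have e4 := hE g d hg
  have e5 := hD f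
  have e6 := hD g
  rw [jacobian_eq]
  simp only [Fin.sum_univ_three] at e1 e2 e3 e4 e5 e6
  rw [e5, e6, mul_sub, ← mul_assoc, mul_comm _ (aeval ν g), ← mul_assoc, ← e3, ← e4]
  simp only [cons_val_zero, cons_val_one, cons_val, map_add, map_sub, map_mul]
  generalize aeval ν (pderiv 0 P) = p0 at *
  generalize aeval ν (pderiv 1 P) = p1 at *
  generalize aeval ν (pderiv 2 P) = p2 at *
  generalize aeval ν (pderiv 0 f) = f0 at *
  generalize aeval ν (pderiv 1 f) = f1 at *
  generalize aeval ν (pderiv 2 f) = f2 at *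
  generalize aeval ν (pderiv 0 g) = g0 at *
  generalize aeval ν (pderiv 1 g) = g1 at *
  generalize aeval ν (pderiv 2 g) = g2 at *
  generalize Polynomial.derivative (ν 0) = w0 at *
  generalize Polynomial.derivative (ν 1) = w1 at *
  generalize Polynomial.derivative (ν 2) = w2 at *
  generalize ν 0 = u0 at *
  generalize ν 1 = u1 at *
  generalize ν 2 = u2 at *
  linear_combination (-(f2 * g0 - f0 * g2) * w2 + (f0 * g1 - f1 * g0) * w1) * e1 -
    ((f2 * g0 - f0 * g2) * u2 - (f0 * g1 - f1 * g0) * u1) * e2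

theorem aeval_C_pi (v : Fin 3 → k) (T : Poly3 k) :
    aeval (fun i => Polynomial.C (v i)) T = Polynomial.C (eval v T) := by
  induction T using MvPolynomial.induction_on with
  | C a => simp [Polynomial.C_eq_algebraMap]
  | add p q hp hq => simp [hp, hq]
  | mul_X p i hp => simp [hp]

theorem eq_zero_of_aeval_eq_zero {g : Poly3 k} {n : ℕ} (hg : dropFirst k g = g)
    (hgn : g.IsHomogeneous n) {f : Fin 3 → Polynomial k} {i : Fin 3} (hi : i ≠ 0)
    (hgi : eval (Pi.single i 1) g ≠ 0) (hf : aeval f g = 0)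
    (h0 : ∀ j, j ≠ 0 → j ≠ i → f j = 0) : f i = 0 := by
  have h : aeval f g = f i ^ n * Polynomial.C (eval (Pi.single i 1) g) := by
    rw [aeval_of_dropFirst hg, ← aeval_C_pi, ← aeval_mul_left_of_isHomogeneous hgn]
    congr 1
    refine MvPolynomial.algHom_ext fun j => ?_
    rw [aeval_X, aeval_X]
    by_cases hj : j = i
    · subst hj
      simp [hi]
    · by_cases hj0 : j = 0
      · simp [hj0, hi.symm]
      · simp [hj0, hj, h0 j hj0 hj]
  rw [hf, eq_comm, mul_eq_zero] at h
  rcases h with h | h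
  · exact eq_zero_of_pow_eq_zero h
  · exact absurd (Polynomial.C_eq_zero.1 h) hgi

theorem Polynomial.natDegree_eq_zero_of_forall_eval_ne_zero [IsAlgClosed k] {f : Polynomial k}
    (h : ∀ t, f.eval t ≠ 0) : f.natDegree = 0 := by
  by_contra hne
  obtain ⟨t, ht⟩ := IsAlgClosed.exists_root f fun h0 =>
    hne (Nat.le_zero.1 (Polynomial.natDegree_le_of_degree_le h0.le))
  exact h t ht

theorem false_of_eq_zero [IsAlgClosed k] {d : ℕ} (hd : 0 < d) {f : Fin 3 → Polynomial k}
    (h1 : f 1 = 0) (h2 : f 2 = 0) (hz : ∀ t, ∃ i, (f i).eval t ≠ 0)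
    (hc : ∃ i, (f i).coeff (3 * d) ≠ 0) : False := by
  have h0 := Polynomial.natDegree_eq_zero_of_forall_eval_ne_zero (f := f 0) fun t => by
    obtain ⟨i, hi⟩ := hz t
    fin_cases i
    · exact hi
    · simp [h1] at hi
    · simp [h2] at hi
  obtain ⟨i, hi⟩ := hc
  fin_cases i
  · exact hi (Polynomial.coeff_eq_zero_of_natDegree_lt (by simp [h0]; omega))
  · simp [h1] at hi
  · simp [h2] at hi

theorem false_of_cuspidal [IsAlgClosed k] [CharZero k] {d : ℕ} (hd : 2 ≤ d) {g : Poly3 k}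
    (hg : dropFirst k g = g) (hg3 : g.IsHomogeneous 3) {f : Fin 3 → Polynomial k} {κ : k}
    (hf : f 0 * f 1 ^ 2 + aeval f g = 0) (hg2 : eval (Pi.single 2 1) g ≠ 0)
    (hw : (d : Polynomial k) * (f 1 * Polynomial.derivative (f 2) -
      Polynomial.derivative (f 1) * f 2) = Polynomial.C κ * f 1 ^ 2)
    (hz : ∀ t, ∃ i, (f i).eval t ≠ 0) (hc : ∃ i, (f i).coeff (3 * d) ≠ 0) : False := by
  have hd0 : (d : k) ≠ 0 := Nat.cast_ne_zero.2 (by omega)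
  by_cases h1 : f 1 = 0
  · have h2 := eq_zero_of_aeval_eq_zero hg hg3 (i := 2) (by decide) (by simpa using hg2)
      (by simpa [h1] using hf) (fun i hi hi2 => by
        obtain rfl : i = 1 := by omega
        exact h1)
    exact false_of_eq_zero (by omega) h1 h2 hz hc
  obtain ⟨c, hc'⟩ := Polynomial.exists_eq_C_mul_of_wronskian (f := f 1)
    (g := f 2 - Polynomial.C (κ / d) * Polynomial.X * f 1) h1 (by
      have h3 : (d : Polynomial k) * Polynomial.C (κ / d) = Polynomial.C κ := by
        rw [← map_natCast (Polynomial.C (R := k)), ← map_mul, mul_div_cancel₀ _ hd0]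
      have h4 : (d : Polynomial k) ≠ 0 := Nat.cast_ne_zero.2 (by omega)
      refine mul_left_cancel₀ h4 ?_
      simp only [Polynomial.derivative_sub, Polynomial.derivative_mul, Polynomial.derivative_C,
        Polynomial.derivative_X]
      linear_combination hw - f 1 ^ 2 * h3)
  obtain ⟨m, hm, hm1⟩ : ∃ m : Polynomial k, f 2 = f 1 * m ∧ m.natDegree ≤ 1 := by
    refine ⟨Polynomial.C (κ / d) * Polynomial.X + Polynomial.C c, by linear_combination hc', ?_⟩
    exact Polynomial.natDegree_linear_le
  have h0 : f 0 = -(f 1 * aeval ![0, 1, m] g) := by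
    rw [aeval_of_dropFirst_mul hg hg3 (mul_one (f 1)).symm hm] at hf
    have : f 1 ^ 2 * (f 0 + f 1 * aeval ![0, 1, m] g) = 0 := by linear_combination hf
    rcases mul_eq_zero.1 this with h | h
    · exact absurd (pow_eq_zero_iff two_ne_zero |>.1 h) h1
    · exact eq_neg_of_add_eq_zero_left h
  have hu := Polynomial.natDegree_eq_zero_of_forall_eval_ne_zero (f := f 1) fun t ht => by
    obtain ⟨i, hi⟩ := hz t
    fin_cases i <;> simp [h0, hm, ht] at hi
  have hdeg := (natDegree_aeval_le_and_coeff hg3 (f := ![0, 1, m]) (a := 1) (by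
    intro i; fin_cases i <;> simp [hm1])).1
  obtain ⟨i, hi⟩ := hc
  refine hi (Polynomial.coeff_eq_zero_of_natDegree_lt (lt_of_le_of_lt (b := 3) ?_ (by omega)))
  fin_cases i
  · simp only [Fin.zero_eta, h0, Polynomial.natDegree_neg]
    exact Polynomial.natDegree_mul_le.trans (by omega)
  · simp [hu]
  · simp only [Fin.reduceFinMk, hm]
    exact Polynomial.natDegree_mul_le.trans (by omega)

theorem nodal_of_wronskian [IsAlgClosed k] [CharZero k] {d : ℕ} (hd : 2 ≤ d) {g : Poly3 k}
    (hg : dropFirst k g = g) (hg3 : g.IsHomogeneous 3) {a b c : Polynomial k} {κ : k}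
    (hab : a.natDegree ≤ b.natDegree) (ha : a ≠ 0)
    (hf : c * (a * b) + aeval ![c, a, b] g = 0) (hg1 : eval (Pi.single 1 1) g ≠ 0)
    (hg2 : eval (Pi.single 2 1) g ≠ 0)
    (hw : (d : Polynomial k) * Polynomial.X * (a * Polynomial.derivative b -
      Polynomial.derivative a * b) = Polynomial.C κ * (a * b))
    (hz : ∀ t, a.eval t = 0 → b.eval t = 0 → c.eval t ≠ 0)
    (hcd : c.natDegree ≤ 3 * d)
    (hc : c.coeff (3 * d) ≠ 0 ∨ a.coeff (3 * d) ≠ 0 ∨ b.coeff (3 * d) ≠ 0) :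
    κ = d ^ 2 ∧ a.eval 0 = 0 ∧ b.eval 0 = 0 := by
  have hd0 : (d : Polynomial k) ≠ 0 := Nat.cast_ne_zero.2 (by omega)
  have hb : b ≠ 0 := by
    rintro rfl
    refine ha (eq_zero_of_aeval_eq_zero hg hg3 (f := ![c, a, 0]) (i := 1) (by decide) hg1
      (by simpa using hf) fun j hj0 hj1 => ?_)
    obtain rfl : j = 2 := by omega
    rfl
  obtain ⟨n, hn⟩ := Nat.exists_eq_add_of_le hab
  have hκ : κ = d * n := by
    have hXd : ∀ p : Polynomial k, (Polynomial.X * Polynomial.derivative p).natDegree ≤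
        p.natDegree := fun p => by
      rw [Polynomial.natDegree_le_iff_coeff_eq_zero]
      intro m hm
      rw [Polynomial.coeff_X_mul_derivative, Polynomial.coeff_eq_zero_of_natDegree_lt hm, mul_zero]
    have h1 := congrArg (fun p => Polynomial.coeff p (a.natDegree + b.natDegree)) hw
    simp only [show (d : Polynomial k) * Polynomial.X * (a * Polynomial.derivative b -
      Polynomial.derivative a * b) = Polynomial.C (d : k) * (a * (Polynomial.X *
        Polynomial.derivative b) - (Polynomial.X * Polynomial.derivative a) * b) by
        rw [map_natCast]; ring, Polynomial.coeff_C_mul, Polynomial.coeff_sub] at h1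
    rw [Polynomial.coeff_mul_add_eq_of_natDegree_le le_rfl (hXd b),
      Polynomial.coeff_mul_add_eq_of_natDegree_le (hXd a) le_rfl,
      Polynomial.coeff_mul_add_eq_of_natDegree_le le_rfl le_rfl,
      Polynomial.coeff_X_mul_derivative, Polynomial.coeff_X_mul_derivative, hn] at h1
    have h2 : a.coeff a.natDegree * b.coeff (a.natDegree + n) ≠ 0 := by
      rw [← hn]
      exact mul_ne_zero (Polynomial.leadingCoeff_ne_zero.2 ha)
        (Polynomial.leadingCoeff_ne_zero.2 hb)
    refine mul_right_cancel₀ h2 ?_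
    push_cast at h1
    linear_combination -h1
  obtain ⟨γ, hγ⟩ : ∃ γ, b = Polynomial.C γ * (Polynomial.X ^ n * a) := by
    refine Polynomial.exists_eq_C_mul_of_wronskian (mul_ne_zero (by simp) ha) ?_
    have h1 : Polynomial.X * Polynomial.derivative (Polynomial.X ^ n : Polynomial k) =
        (n : Polynomial k) * Polynomial.X ^ n := by
      rcases n with _ | n
      · simp
      · rw [Polynomial.derivative_X_pow]
        simp
        ring
    refine mul_left_cancel₀ (mul_ne_zero hd0 Polynomial.X_ne_zero) ?_
    rw [hκ, map_mul, map_natCast, map_natCast] at hw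
    rw [Polynomial.derivative_mul]
    linear_combination Polynomial.X ^ n * hw - d * a * b * h1
  have hγ0 : γ ≠ 0 := by
    rintro rfl
    exact hb (by simp [hγ])
  set G := aeval ![0, 1, Polynomial.C γ * Polynomial.X ^ n] g with hG
  have hcG : c * Polynomial.C γ * Polynomial.X ^ n = -(a * G) := by
    rw [aeval_of_dropFirst_mul hg hg3 (f := ![c, a, b]) (a := a) (u := 1)
      (v := Polynomial.C γ * Polynomial.X ^ n) (by simp) (by simp [hγ]; ring), ← hG] at hf
    refine mul_left_cancel₀ (pow_ne_zero 2 ha) ?_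
    linear_combination hf - c * a * hγ
  obtain ⟨a₁, ha₁⟩ : Polynomial.X ^ n ∣ a := by
    rcases Nat.eq_zero_or_pos n with rfl | hn0
    · simp
    · have hG0 : ¬ Polynomial.X ∣ G := by
        rw [Polynomial.X_dvd_iff, Polynomial.coeff_zero_eq_eval_zero]
        have h1 : G.eval 0 = eval (Pi.single 1 1) g := by
          have := DFunLike.congr_fun (aeval_unique ((Polynomial.aeval (0 : k)).comp
            (aeval (R := k) ![0, 1, Polynomial.C γ * Polynomial.X ^ n]))) g
          rw [hG, ← Polynomial.coe_aeval_eq_eval]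
          refine this.trans ?_
          rw [← coe_aeval_eq_eval]
          refine congrArg (fun v => aeval v g) (funext fun i => ?_)
          fin_cases i <;> simp [hn0.ne']
        rwa [h1]
      refine Polynomial.prime_X.pow_dvd_of_dvd_mul_right n hG0 ?_
      rw [← dvd_neg, ← hcG]
      exact dvd_mul_left _ _
  have hc₁ : c * Polynomial.C γ = -(a₁ * G) := by
    refine mul_right_cancel₀ (pow_ne_zero n Polynomial.X_ne_zero) (hcG.trans ?_)
    rw [ha₁]
    ring
  have ha₁0 := Polynomial.natDegree_eq_zero_of_forall_eval_ne_zero (f := a₁) fun t ht => by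
    refine hz t (by simp [ha₁, ht]) (by simp [hγ, ha₁, ht]) ?_
    simpa [ht, hγ0] using congrArg (Polynomial.eval t) hc₁
  have hGd := natDegree_aeval_le_and_coeff hg3 (f := ![0, 1, Polynomial.C γ * Polynomial.X ^ n])
    (a := n) (by
      intro i
      fin_cases i
      · simp
      · simp
      · exact Polynomial.natDegree_C_mul_X_pow_le _ _)
  rw [← hG] at hGd
  have hcdeg : c.natDegree = G.natDegree := by
    have h1 := congrArg Polynomial.natDegree hc₁
    have h2 : a₁ ≠ 0 := by
      rintro rfl
      exact ha (by simp [ha₁])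
    rw [Polynomial.natDegree_mul_C hγ0, Polynomial.natDegree_neg] at h1
    obtain ⟨s, hs⟩ : ∃ s, a₁ = Polynomial.C s := ⟨_, Polynomial.eq_C_of_natDegree_eq_zero ha₁0⟩
    rw [hs, Polynomial.natDegree_C_mul (by rintro rfl; exact h2 (by simp [hs]))] at h1
    exact h1
  have hadeg : a.natDegree ≤ n := by
    rw [ha₁]
    refine Polynomial.natDegree_mul_le.trans ?_
    simp [ha₁0]
  have hdn : d ≤ n := by
    by_contra! hlt
    have hz0 : ∀ p : Polynomial k, p.natDegree ≤ 3 * n → p.coeff (3 * d) = 0 := fun p hp =>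
      Polynomial.coeff_eq_zero_of_natDegree_lt (by omega)
    rcases hc with h | h | h
    · exact h (hz0 _ (by rw [hcdeg]; have := hGd.1; omega))
    · exact h (hz0 _ (by omega))
    · exact h (hz0 _ (by omega))
  have hnd : n ≤ d := by
    have h1 : G.coeff (n * 3) ≠ 0 := by
      rw [hGd.2]
      have h3 : (aeval fun i => (![0, 1, Polynomial.C γ * Polynomial.X ^ n] i).coeff n) g =
          γ ^ 3 * eval (Pi.single 2 1) g := by
        rw [← coe_aeval_eq_eval, RingHom.coe_coe, ← aeval_mul_left_of_isHomogeneous hg3]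
        refine congrArg (fun v => aeval v g) (funext fun i => ?_)
        fin_cases i
        · simp
        · simp [Polynomial.coeff_one]; omega
        · simp
      rw [h3]
      exact mul_ne_zero (pow_ne_zero _ hγ0) hg2
    have := Polynomial.le_natDegree_of_ne_zero h1
    omega
  obtain rfl : n = d := le_antisymm hnd hdn
  have hn0 : n ≠ 0 := by omega
  refine ⟨by rw [hκ, sq], by simp [ha₁, hn0], by simp [hγ, hn0]⟩

end CubicCurves

section LeadingMonomials

variable {k : Type*} [Field k]

theorem coeff_X_mul_pderiv (i : Fin 3) (f : Poly3 k) (m : Fin 3 →₀ ℕ) :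
    coeff m (X i * pderiv i f) = m i * coeff m f := by
  induction f using MvPolynomial.induction_on' with
  | monomial u a =>
    rw [X_mul_pderiv_monomial, nsmul_eq_mul, ← map_natCast (C (R := k) (σ := Fin 3)), coeff_C_mul,
      coeff_monomial]
    split_ifs with h
    · rw [h]
    · simp
  | add p q hp hq => rw [map_add, mul_add, coeff_add, hp, hq, coeff_add, mul_add]

theorem degree_X_mul_pderiv_le {o : MonomialOrder (Fin 3)} {i : Fin 3} {f : Poly3 k}
    {m : Fin 3 →₀ ℕ} (h : o.toSyn (o.degree f) ≤ o.toSyn m) :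
    o.toSyn (o.degree (X i * pderiv i f)) ≤ o.toSyn m := by
  rw [o.degree_le_iff] at h ⊢
  intro c hc
  rw [mem_support_iff, coeff_X_mul_pderiv] at hc
  exact h c (mem_support_iff.2 (right_ne_zero_of_mul hc))

/-- The leading coefficient of a Jacobian determinant, in terms of leading monomials. -/
theorem coeff_mul_jacobian {o : MonomialOrder (Fin 3)} {f g h : Poly3 k} {α β γ : Fin 3 →₀ ℕ}
    (hf : o.toSyn (o.degree f) ≤ o.toSyn α) (hg : o.toSyn (o.degree g) ≤ o.toSyn β)
    (hh : o.toSyn (o.degree h) ≤ o.toSyn γ) :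
    coeff (α + β + γ) (X 0 * X 1 * X 2 * jacobian ![f, g, h]) =
      (α 0 * (β 1 * γ 2 - β 2 * γ 1) - α 1 * (β 0 * γ 2 - β 2 * γ 0) +
        α 2 * (β 0 * γ 1 - β 1 * γ 0)) * (coeff α f * coeff β g * coeff γ h) := by
  have key : ∀ i j l : Fin 3, coeff (α + β + γ) (X i * pderiv i f * (X j * pderiv j g) *
      (X l * pderiv l h)) = α i * β j * γ l * (coeff α f * coeff β g * coeff γ h) := by
    intro i j l
    have h1 : o.toSyn (o.degree (X i * pderiv i f * (X j * pderiv j g))) ≤ o.toSyn (α + β) := by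
      refine o.degree_mul_le.trans ?_
      rw [map_add, map_add]
      exact add_le_add (degree_X_mul_pderiv_le hf) (degree_X_mul_pderiv_le hg)
    rw [o.coeff_mul_of_add_of_degree_le h1 (degree_X_mul_pderiv_le hh),
      o.coeff_mul_of_add_of_degree_le (degree_X_mul_pderiv_le hf) (degree_X_mul_pderiv_le hg),
      coeff_X_mul_pderiv, coeff_X_mul_pderiv, coeff_X_mul_pderiv]
    ring
  have h1 : X 0 * X 1 * X 2 * jacobian ![f, g, h] =
      X 0 * pderiv 0 f * (X 1 * pderiv 1 g) * (X 2 * pderiv 2 h)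
      - X 0 * pderiv 0 f * (X 2 * pderiv 2 g) * (X 1 * pderiv 1 h)
      - X 1 * pderiv 1 f * (X 0 * pderiv 0 g) * (X 2 * pderiv 2 h)
      + X 1 * pderiv 1 f * (X 2 * pderiv 2 g) * (X 0 * pderiv 0 h)
      + X 2 * pderiv 2 f * (X 0 * pderiv 0 g) * (X 1 * pderiv 1 h)
      - X 2 * pderiv 2 f * (X 1 * pderiv 1 g) * (X 0 * pderiv 0 h) := by
    rw [jacobian_eq]
    simp only [cons_val_zero, cons_val_one, cons_val]
    ring
  rw [h1]
  simp only [coeff_sub, coeff_add, key]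
  ring

theorem eq_single_of_det {d : ℕ} (hd : 0 < d) {a0 a1 a2 b0 b1 b2 : ℤ} (ha0 : 0 ≤ a0)
    (ha1 : 0 ≤ a1) (ha2 : 0 ≤ a2) (hb0 : 0 ≤ b0) (hb1 : 0 ≤ b1) (hb2 : 0 ≤ b2)
    (ha : a0 + a1 + a2 = d) (hb : b0 + b1 + b2 = d) (had : a0 ≠ d) (hbd : b0 ≠ d)
    (h : a0 * (b1 - b2) - a1 * (b0 - b2) + a2 * (b0 - b1) = d ^ 2) : b2 = d := by
  have h1 : a0 * (d - (b1 - b2)) + a1 * (d - (b2 - b0)) + a2 * (d - (b0 - b1)) = 0 := by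
    linear_combination (d : ℤ) * ha - h
  have e0 : 0 ≤ a0 * (d - (b1 - b2)) := mul_nonneg ha0 (by omega)
  have e1 : 0 ≤ a1 * (d - (b2 - b0)) := mul_nonneg ha1 (by omega)
  have e2 : 0 ≤ a2 * (d - (b0 - b1)) := mul_nonneg ha2 (by omega)
  have z0 : a0 * (d - (b1 - b2)) = 0 := by omega
  have z1 : a1 * (d - (b2 - b0)) = 0 := by omega
  have z2 : a2 * (d - (b0 - b1)) = 0 := by omega
  rw [mul_eq_zero] at z0 z1 z2
  omega

theorem eq_C_mul_X_two_pow {d : ℕ} {f : Poly3 k} (hf : f.IsHomogeneous d)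
    (h : MonomialOrder.lex.degree f 2 = d) : ∃ c, f = C c * X 2 ^ d := by
  refine ⟨coeff (Finsupp.single 2 d) f, ?_⟩
  ext m
  rw [coeff_C_mul, X_pow_eq_monomial, coeff_monomial]
  split_ifs with hm
  · rw [← hm, mul_one]
  · rw [mul_zero]
    by_contra hne
    have h1 := MonomialOrder.lex.le_degree (mem_support_iff.2 hne)
    have h2 := hf.sum_apply_of_mem_support (mem_support_iff.2 hne)
    have h3 := hf.sum_apply_of_mem_support (MonomialOrder.lex.degree_mem_support
      (show f ≠ 0 by rintro rfl; simp at hne))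
    rw [MonomialOrder.lex_le_iff, le_iff_eq_or_lt, Finsupp.Lex.lt_iff] at h1
    have h4 : m 0 = 0 ∧ m 1 = 0 := by
      rcases h1 with h1 | ⟨i, hi, hlt⟩
      · have h5 := toLex.injective h1
        rw [h5]
        omega
      · change ∀ j, j < i → m j = MonomialOrder.lex.degree f j at hi
        change m i < MonomialOrder.lex.degree f i at hlt
        have h5 : i = 2 := by
          fin_cases i
          · simp at hlt; omega
          · simp at hlt; omega
          · rfl
        subst h5
        rw [hi 0 (by decide), hi 1 (by decide)]
        omega
    refine hm (Finsupp.ext fun i => ?_)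
    fin_cases i <;> simp [h4] 
    omega

theorem exists_eq_X_two_pow [CharZero k] {d : ℕ} (hd : 0 < d) {f₁ f₂ g : Poly3 k}
    (hf₁ : f₁.IsHomogeneous d) (hf₂ : f₂.IsHomogeneous d) (h₁ : f₁ ≠ 0) (h₂ : f₂ ≠ 0)
    (hc₁ : coeff (Finsupp.single 0 d) f₁ = 0) (hc₂ : coeff (Finsupp.single 0 d) f₂ = 0)
    (hg : ∀ m ∈ g.support, m 0 = 0) {κ : k} (hκ : κ = d ^ 2 ∨ κ = -d ^ 2)
    (hJ : jacobian ![X 0 * X 1 * X 2 + g, f₁, f₂] = C κ * (f₁ * f₂)) :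
    ∃ c, f₁ = C c * X 2 ^ d ∨ f₂ = C c * X 2 ^ d := by
  set o : MonomialOrder (Fin 3) := MonomialOrder.lex
  obtain ⟨ε, hε⟩ : ∃ ε : Fin 3 →₀ ℕ, ∀ i, ε i = 1 := ⟨Finsupp.equivFunOnFinite.symm 1, fun i => rfl⟩
  have hX : (X 0 * X 1 * X 2 : Poly3 k) = monomial ε 1 := by
    rw [X, X, X, monomial_mul, monomial_mul]
    congr 2
    · ext i; fin_cases i <;> simp [hε]
    · simp
  have hg0 : coeff ε g = 0 := by
    by_contra hne
    have := hg ε (mem_support_iff.2 hne)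
    rw [hε] at this
    omega
  have hP : coeff ε (X 0 * X 1 * X 2 + g) = 1 := by
    rw [coeff_add, hg0, hX, coeff_monomial, if_pos rfl, add_zero]
  have hX' : o.toSyn (o.degree (X 0 * X 1 * X 2 : Poly3 k)) ≤ o.toSyn ε := by
    rw [hX]
    exact o.degree_monomial_le 1
  have hPd : o.toSyn (o.degree (X 0 * X 1 * X 2 + g)) ≤ o.toSyn ε := by
    refine o.degree_add_le.trans (sup_le hX' ?_)
    rw [o.degree_le_iff]
    intro m hm
    rw [MonomialOrder.lex_le_iff]
    refine le_of_lt (Finsupp.Lex.lt_iff.2 ⟨0, fun j hj => absurd hj (by simp), ?_⟩)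
    change m 0 < ε 0
    rw [hg m hm, hε]
    exact one_pos
  have e1 := coeff_mul_jacobian hPd (le_refl (o.toSyn (o.degree f₁)))
    (le_refl (o.toSyn (o.degree f₂)))
  rw [hJ, hP, show X 0 * X 1 * X 2 * (C κ * (f₁ * f₂)) = C κ * (X 0 * X 1 * X 2 * f₁ * f₂) by ring,
    coeff_C_mul, o.coeff_mul_of_add_of_degree_le (a := ε + o.degree f₁) ?_ le_rfl,
    o.coeff_mul_of_add_of_degree_le hX' le_rfl, hX, coeff_monomial, if_pos rfl] at e1
  swap
  · refine o.degree_mul_le.trans ?_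
    rw [map_add, map_add]
    gcongr
  have hα := hf₁.sum_apply_of_mem_support (o.degree_mem_support h₁)
  have hβ := hf₂.sum_apply_of_mem_support (o.degree_mem_support h₂)
  have hne : coeff (o.degree f₁) f₁ * coeff (o.degree f₂) f₂ ≠ 0 :=
    mul_ne_zero (o.leadingCoeff_ne_zero_iff.2 h₁) (o.leadingCoeff_ne_zero_iff.2 h₂)
  have hv : ∀ f : Poly3 k, f ≠ 0 → f.IsHomogeneous d → coeff (Finsupp.single 0 d) f = 0 →
      o.degree f 0 ≠ d := by
    intro f hf hfd hfc h0
    have h5 := hfd.sum_apply_of_mem_support (o.degree_mem_support hf)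
    refine o.leadingCoeff_ne_zero_iff.2 hf ?_
    rw [MonomialOrder.leadingCoeff, ← hfc]
    congr 1
    ext i
    fin_cases i <;> simp <;> omega
  have v1 := hv f₁ h₁ hf₁ hc₁
  have v2 := hv f₂ h₂ hf₂ hc₂
  simp only [hε] at e1
  generalize hα' : o.degree f₁ = α at *
  generalize hβ' : o.degree f₂ = β at *
  have e2 : κ = ((α 0 * (β 1 - β 2) - α 1 * (β 0 - β 2) + α 2 * (β 0 - β 1) : ℤ) : k) := by
    refine mul_right_cancel₀ hne ?_
    push_cast at e1 ⊢
    linear_combination e1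
  rcases hκ with hκ | hκ
  · rw [hκ] at e2
    obtain ⟨c, hc⟩ := eq_C_mul_X_two_pow hf₂ (by
      have := eq_single_of_det hd (a0 := α 0) (a1 := α 1) (a2 := α 2) (b0 := β 0) (b1 := β 1)
        (b2 := β 2) (by omega) (by omega) (by omega) (by omega) (by omega) (by omega) (by omega)
        (by omega) (by omega) (by omega) (by exact_mod_cast e2.symm)
      change o.degree f₂ 2 = d
      rw [hβ']
      omega)
    exact ⟨c, Or.inr hc⟩
  · rw [hκ] at e2
    obtain ⟨c, hc⟩ := eq_C_mul_X_two_pow hf₁ (by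
      have h7 : (α 0 * (β 1 - β 2) - α 1 * (β 0 - β 2) + α 2 * (β 0 - β 1) : ℤ) =
          - (d : ℤ) ^ 2 := by
        exact_mod_cast e2.symm
      have := eq_single_of_det hd (b0 := α 0) (b1 := α 1) (b2 := α 2) (a0 := β 0) (a1 := β 1)
        (a2 := β 2) (by omega) (by omega) (by omega) (by omega) (by omega) (by omega) (by omega)
        (by omega) (by omega) (by omega) (by linear_combination -h7)
      change o.degree f₁ 2 = d
      rw [hα']
      omega)
    exact ⟨c, Or.inl hc⟩

end LeadingMonomials

section SingularCubics

variable {k : Type*} [Field k] {d : ℕ} {Φ : Hom3 k}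

theorem aeval_algHom_apply {R : Type*} [CommRing R] [Algebra k R] (Φ : Hom3 k) (ν : Fin 3 → R)
    (T : Poly3 k) : aeval (fun i => aeval ν (Φ (X i))) T = aeval ν (Φ T) :=
  (DFunLike.congr_fun (aeval_unique ((aeval ν).comp Φ)) T).symm

theorem eval_aeval_polynomial (ν : Fin 3 → Polynomial k) (t : k) (T : Poly3 k) :
    (aeval ν T).eval t = eval (fun i => (ν i).eval t) T := by
  induction T using MvPolynomial.induction_on with
  | C a => simp
  | add p q hp hq => simp [hp, hq]
  | mul_X p i hp => simp [hp]

theorem IsRegularMap.exists_eval_aeval_ne_zero (hr : IsRegularMap Φ) {ν : Fin 3 → Polynomial k}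
    {t : k} (h : ∃ i, (ν i).eval t ≠ 0) : ∃ i, (aeval ν (Φ (X i))).eval t ≠ 0 := by
  simp only [eval_aeval_polynomial]
  refine hr _ fun h0 => ?_
  obtain ⟨i, hi⟩ := h
  exact hi (congrFun h0 i)

theorem IsRegularMap.exists_coeff_aeval_ne_zero (hr : IsRegularMap Φ) (hΦ : IsFormMap Φ d)
    {ν : Fin 3 → Polynomial k} {a : ℕ} (hν : ∀ i, (ν i).natDegree ≤ a)
    (h : ∃ i, (ν i).coeff a ≠ 0) : ∃ i, (aeval ν (Φ (X i))).coeff (a * d) ≠ 0 := by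
  obtain ⟨i, hi⟩ := hr (fun i => (ν i).coeff a) fun h0 => by
    obtain ⟨i, hi⟩ := h
    exact hi (congrFun h0 i)
  refine ⟨i, ?_⟩
  rwa [(natDegree_aeval_le_and_coeff (hΦ i) hν).2, ← RingHom.coe_coe (aeval _),
    coe_aeval_eq_eval]

theorem pderiv_zero_of_dropFirst {g : Poly3 k} (hg : dropFirst k g = g) : pderiv 0 g = 0 := by
  rw [← hg, derivation_algHom_apply, Fin.sum_univ_three]
  simp [dropFirst_X]

theorem apply_zero_of_dropFirst {g : Poly3 k} [CharZero k] (hg : dropFirst k g = g)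
    {m : Fin 3 →₀ ℕ} (hm : m ∈ g.support) : m 0 = 0 := by
  have h := coeff_X_mul_pderiv 0 g m
  rw [pderiv_zero_of_dropFirst hg, mul_zero, coeff_zero, eq_comm, mul_eq_zero] at h
  exact_mod_cast h.resolve_right (mem_support_iff.1 hm)

theorem coeff_aeval_dropFirst {g : Poly3 k} {n : ℕ} (hgn : g.IsHomogeneous n)
    {u : Polynomial k} (hu : u.natDegree ≤ 1) :
    (aeval ![0, 1, u] g).natDegree ≤ n ∧
      (aeval ![0, 1, u] g).coeff n = eval ![0, 0, u.coeff 1] g := by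
  have h := natDegree_aeval_le_and_coeff hgn (f := ![0, 1, u]) (a := 1) (by
    intro i
    fin_cases i
    · simp
    · simp
    · exact hu)
  rw [one_mul] at h
  refine ⟨h.1, h.2.trans ?_⟩
  rw [← coe_aeval_eq_eval]
  refine congrArg (fun v => aeval v g) (funext fun i => ?_)
  fin_cases i <;> simp [Polynomial.coeff_one]

theorem false_of_cuspidal_cubic [IsAlgClosed k] [CharZero k] (hd : 2 ≤ d) (hΦ : IsFormMap Φ d)
    (hr : IsRegularMap Φ) {g : Poly3 k} (hg : dropFirst k g = g) (hg3 : g.IsHomogeneous 3)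
    (hg2 : eval (Pi.single 2 1) g ≠ 0) {c κ : k}
    (hP : Φ (X 0 * X 1 ^ 2 + g) = C c * (X 0 * X 1 ^ 2 + g) ^ d)
    (hJ : jacobian ![X 0 * X 1 ^ 2 + g, Φ (X 1), Φ (X 2)] = C κ * Φ (X 1 ^ 2)) : False := by
  set G := aeval ![0, 1, (Polynomial.X : Polynomial k)] g with hG
  set ν : Fin 3 → Polynomial k := ![-G, 1, Polynomial.X] with hν
  have hGd := coeff_aeval_dropFirst hg3 (u := (Polynomial.X : Polynomial k)) (by simp)
  rw [← hG] at hGd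
  have hνg : aeval ν g = G := by
    rw [aeval_of_dropFirst_mul hg hg3 (a := 1) (u := 1) (v := Polynomial.X) (by simp [hν])
      (by simp [hν]), one_pow, one_mul]
  have hνP : aeval ν (X 0 * X 1 ^ 2 + g) = 0 := by
    rw [map_add, hνg]
    simp [hν]
  have hPh : (X 0 * X 1 ^ 2 + g).IsHomogeneous 3 :=
    ((isHomogeneous_X k 0).mul ((isHomogeneous_X k 1).pow 2)).add hg3
  have hp : pderiv 0 (X 0 * X 1 ^ 2 + g) = X 1 ^ 2 := by
    rw [map_add, pderiv_zero_of_dropFirst hg]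
    simp [pderiv_X]
  have hw := wronskian_of_curve hPh hνP (hΦ 1) (hΦ 2)
  have hf : aeval ν (Φ (X 0 * X 1 ^ 2 + g)) = 0 := by
    rw [hP, map_mul, map_pow, hνP, zero_pow (by omega), mul_zero]
  rw [map_add, map_add, ← aeval_algHom_apply Φ ν g] at hf
  refine false_of_cuspidal hd hg hg3 (f := fun i => aeval ν (Φ (X i))) (κ := κ) ?_ hg2 ?_
    (fun t => hr.exists_eval_aeval_ne_zero ⟨1, by simp [hν]⟩)
    (hr.exists_coeff_aeval_ne_zero hΦ (a := 3) (fun i => ?_) ⟨0, ?_⟩)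
  · simpa using hf
  · rw [hp, hJ] at hw
    simpa [hν, Polynomial.C_eq_algebraMap] using hw
  · fin_cases i
    · simpa [hν] using hGd.1
    · simp [hν]
    · simp [hν]
  · have h2 : (![0, 0, 1] : Fin 3 → k) = Pi.single 2 1 := by
      ext i; fin_cases i <;> simp
    simpa [hν, hGd.2, h2] using hg2

theorem vecCons_eq {R : Type*} (f : Fin 3 → R) : ![f 0, f 1, f 2] = f :=
  funext fun i => by fin_cases i <;> rfl

/-- Symmetric form of `nodal_of_wronskian`. -/
theorem nodal_of_wronskian' [IsAlgClosed k] [CharZero k] (hd : 2 ≤ d) {g : Poly3 k}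
    (hg : dropFirst k g = g) (hg3 : g.IsHomogeneous 3) {f : Fin 3 → Polynomial k} {κ : k}
    (hf : f 0 * (f 1 * f 2) + aeval f g = 0) (hg1 : eval (Pi.single 1 1) g ≠ 0)
    (hg2 : eval (Pi.single 2 1) g ≠ 0)
    (hw : (d : Polynomial k) * Polynomial.X * (f 1 * Polynomial.derivative (f 2) -
      Polynomial.derivative (f 1) * f 2) = Polynomial.C κ * (f 1 * f 2))
    (hz : ∀ t, ∃ i, (f i).eval t ≠ 0) (hfd : (f 0).natDegree ≤ 3 * d)
    (hc : ∃ i, (f i).coeff (3 * d) ≠ 0) :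
    (κ = d ^ 2 ∨ κ = -d ^ 2) ∧ (f 1).eval 0 = 0 ∧ (f 2).eval 0 = 0 := by
  have h1 : f 1 ≠ 0 := fun h1 => by
    refine false_of_eq_zero (by omega) h1 (eq_zero_of_aeval_eq_zero hg hg3 (i := 2) (by decide) hg2
      (by simpa [h1] using hf) fun j hj0 hj2 => ?_) hz hc
    obtain rfl : j = 1 := by omega
    exact h1
  have h2 : f 2 ≠ 0 := fun h2 => by
    refine h1 (eq_zero_of_aeval_eq_zero hg hg3 (i := 1) (by decide) hg1
      (by simpa [h2] using hf) fun j hj0 hj1 => ?_)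
    obtain rfl : j = 2 := by omega
    exact h2
  have hz' : ∀ t, (f 1).eval t = 0 → (f 2).eval t = 0 → (f 0).eval t ≠ 0 := fun t ht1 ht2 => by
    obtain ⟨i, hi⟩ := hz t
    fin_cases i
    · exact hi
    · exact absurd ht1 hi
    · exact absurd ht2 hi
  rw [Fin.exists_fin_succ, Fin.exists_fin_succ, Fin.exists_fin_succ] at hc
  simp only [IsEmpty.exists_iff, or_false] at hc
  rcases le_total (f 1).natDegree (f 2).natDegree with hab | hab
  · obtain ⟨h3, h4⟩ := nodal_of_wronskian hd hg hg3 hab h1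
      (by rw [vecCons_eq, hf]) hg1 hg2 hw hz' hfd hc
    exact ⟨Or.inl h3, h4⟩
  · let s : Hom3 k := aeval ![X 0, X 2, X 1]
    have hs : ∀ {R : Type _} [CommRing R] [Algebra k R] (v : Fin 3 → R) (T : Poly3 k),
        aeval v (s T) = aeval ![v 0, v 2, v 1] T := fun v T => by
      rw [← aeval_algHom_apply]
      refine congrArg (fun v => aeval v T) (funext fun i => ?_)
      fin_cases i <;> simp [s]
    have hs' : ∀ (v : Fin 3 → k) (T : Poly3 k), eval v (s T) = eval ![v 0, v 2, v 1] T :=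
      fun v T => by
        rw [eval_algHom_apply]
        refine congrArg (fun v => eval v T) (funext fun i => ?_)
        fin_cases i <;> simp [s]
    have hsg : dropFirst k (s g) = s g := by
      conv_rhs => rw [← hg]
      rw [← AlgHom.comp_apply, ← AlgHom.comp_apply]
      congr 1
      refine MvPolynomial.algHom_ext fun i => ?_
      fin_cases i <;> simp [s, dropFirst_X]
    obtain ⟨h3, h4, h5⟩ := nodal_of_wronskian (g := s g) (κ := -κ) (c := f 0) hd hsg
      (by
        have : IsFormMap s 1 := fun i => by
          fin_cases i <;> simp [s, isHomogeneous_X]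
        simpa using this.apply hg3) hab h2
      (by
        rw [hs, ← hf, mul_comm (f 2)]
        congr 2
        exact congrArg (fun v => aeval v) (vecCons_eq f))
      (by
        rw [hs']
        convert hg2 using 3
        ext i; fin_cases i <;> simp)
      (by
        rw [hs']
        convert hg1 using 3
        ext i; fin_cases i <;> simp)
      (by
        rw [map_neg]
        linear_combination -hw) (fun t ha hb => hz' t hb ha) hfd (hc.imp_right Or.symm)
    exact ⟨Or.inr (by rw [← h3, neg_neg]), h5, h4⟩

theorem X_two_dvd_jacobian {T : Fin 3 → Poly3 k} (hd : 2 ≤ d) {i : Fin 3} {c : k}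
    (h : T i = C c * X 2 ^ d) : X 2 ∣ jacobian T := by
  have hp : ∀ j, X 2 ∣ pderiv j (T i) := fun j => by
    rw [h, pderiv_C_mul, pderiv_pow]
    exact (((dvd_pow_self _ (by omega)).mul_left _).mul_right _).mul_left _
  rw [jacobian, Matrix.det_apply']
  refine Finset.dvd_sum fun σ _ => Dvd.dvd.mul_left ?_ _
  refine (hp (σ.symm i)).trans ?_
  simpa using Finset.dvd_prod_of_mem (fun j => pderiv j (T (σ j))) (Finset.mem_univ (σ.symm i))

theorem false_of_nodal_cubic [IsAlgClosed k] [CharZero k] (hd : 2 ≤ d) (hΦ : IsFormMap Φ d)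
    (hr : IsRegularMap Φ) {g : Poly3 k} (hg : dropFirst k g = g) (hg3 : g.IsHomogeneous 3)
    (hg1 : eval (Pi.single 1 1) g ≠ 0) (hg2 : eval (Pi.single 2 1) g ≠ 0) {c κ : k}
    (hP : Φ (X 0 * X 1 * X 2 + g) = C c * (X 0 * X 1 * X 2 + g) ^ d)
    (hJ : jacobian ![X 0 * X 1 * X 2 + g, Φ (X 1), Φ (X 2)] = C κ * Φ (X 1 * X 2))
    (hX : ¬ X 2 ∣ jacobian fun i => Φ (X i)) : False := by
  set G := aeval ![0, 1, (Polynomial.X : Polynomial k)] g with hG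
  set ν : Fin 3 → Polynomial k := ![-G, Polynomial.X, Polynomial.X ^ 2] with hν
  have hGd := coeff_aeval_dropFirst hg3 (u := (Polynomial.X : Polynomial k)) (by simp)
  rw [← hG] at hGd
  have hG0 : G.eval 0 = eval (Pi.single 1 1) g := by
    rw [hG, eval_aeval_polynomial]
    congr 2
    ext i
    fin_cases i <;> simp
  have hνg : aeval ν g = Polynomial.X ^ 3 * G := by
    rw [aeval_of_dropFirst_mul hg hg3 (a := Polynomial.X) (u := 1) (v := Polynomial.X)
      (by simp [hν]) (by simp [hν, sq])]
  have hνP : aeval ν (X 0 * X 1 * X 2 + g) = 0 := by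
    rw [map_add, hνg]
    simp [hν]
    ring
  have hPh : (X 0 * X 1 * X 2 + g).IsHomogeneous 3 :=
    (((isHomogeneous_X k 0).mul (isHomogeneous_X k 1)).mul (isHomogeneous_X k 2)).add hg3
  have hp : pderiv 0 (X 0 * X 1 * X 2 + g) = X 1 * X 2 := by
    rw [map_add, pderiv_zero_of_dropFirst hg]
    simp [pderiv_X]
    ring
  have hw := wronskian_of_curve hPh hνP (hΦ 1) (hΦ 2)
  have hf : aeval ν (Φ (X 0 * X 1 * X 2 + g)) = 0 := by
    rw [hP, map_mul, map_pow, hνP, zero_pow (by omega), mul_zero]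
  rw [map_add, map_add, ← aeval_algHom_apply Φ ν g] at hf
  have h0 : ∀ t, ∃ i, (ν i).eval t ≠ 0 := fun t => by
    by_cases ht : t = 0
    · exact ⟨0, by simpa [hν, ht, hG0] using hg1⟩
    · exact ⟨1, by simpa [hν] using ht⟩
  have hνd : ∀ i, (ν i).natDegree ≤ 3 := fun i => by
    fin_cases i
    · simpa [hν] using hGd.1
    · simp [hν]
    · simp [hν]
  obtain ⟨hκ, z1, z2⟩ := nodal_of_wronskian' hd hg hg3 (f := fun i => aeval ν (Φ (X i))) (κ := κ)
    (by simpa [mul_assoc] using hf) hg1 hg2 (by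
      rw [hp, hJ] at hw
      have hX2 : (Polynomial.X : Polynomial k) ^ 2 ≠ 0 := pow_ne_zero 2 Polynomial.X_ne_zero
      refine mul_left_cancel₀ hX2 ?_
      simp only [map_mul, aeval_X, algHom_C, Polynomial.algebraMap_apply,
        Algebra.algebraMap_self, RingHom.id_apply] at hw
      simp only [hν, cons_val_one, cons_val, Polynomial.derivative_X,
        Polynomial.derivative_X_pow] at hw
      simp at hw
      rw [show (Polynomial.C (2 : k)) = 2 from map_ofNat _ 2] at hw
      linear_combination hw) (fun t => hr.exists_eval_aeval_ne_zero (h0 t))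
    (by simpa using (natDegree_aeval_le_and_coeff (hΦ 0) hνd).1)
    (hr.exists_coeff_aeval_ne_zero hΦ (a := 3) hνd ⟨0, by
      have h2 : (![0, 0, 1] : Fin 3 → k) = Pi.single 2 1 := by
        ext i; fin_cases i <;> simp
      simpa [hν, hGd.2, h2] using hg2⟩)
  have hcoeff : ∀ i, (aeval ν (Φ (X i))).eval 0 = 0 → coeff (Finsupp.single 0 d) (Φ (X i)) = 0 := by
    intro i hi
    rw [eval_aeval_polynomial] at hi
    have h1 : (fun i => (ν i).eval 0) = fun i => -G.eval 0 * Pi.single (M := fun _ => k) 0 1 i := by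
      ext i; fin_cases i <;> simp [hν]
    rw [h1, ← coe_aeval_eq_eval, RingHom.coe_coe, aeval_mul_left_of_isHomogeneous (hΦ i), hG0,
      ← RingHom.coe_coe (aeval _), coe_aeval_eq_eval, (hΦ i).eval_piSingle] at hi
    exact (mul_eq_zero.1 hi).resolve_left (pow_ne_zero _ (neg_ne_zero.2 hg1))
  have hne := hr.ne_zero (by omega) hΦ
  rw [map_mul] at hJ
  obtain ⟨c', h | h⟩ := exists_eq_X_two_pow (by omega) (hΦ 1) (hΦ 2) (hne 1) (hne 2) (hcoeff 1 z1)
    (hcoeff 2 z2) (fun m hm => apply_zero_of_dropFirst hg hm) hκ hJ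
  · exact hX (X_two_dvd_jacobian hd (i := 1) h)
  · exact hX (X_two_dvd_jacobian hd (i := 2) h)

end SingularCubics

section SingularCubic

variable {k : Type*} [Field k] {d : ℕ} {Φ : Hom3 k}

/-- A curve which is totally invariant under `Φ` carries an invariant logarithmic form. -/
theorem exists_jacobian_eq_of_apply [CharZero k] [IsAlgClosed k] (hd : 2 ≤ d)
    (hΦ : IsFormMap Φ d) (hr : IsRegularMap Φ) {P : Poly3 k} (hP : Irreducible P)
    (hP3 : P.IsHomogeneous 3) {c : k} (h : Φ P = C c * P ^ d) :
    (∃ κ, jacobian ![P, Φ (X 1), Φ (X 2)] = C κ * Φ (pderiv 0 P)) ∧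
      ∃ c', jacobian (fun i => Φ (X i)) = C c' * P ^ (d - 1) := by
  obtain ⟨c', hc'⟩ := IsHomogeneous.eq_C_of_dvd (by simpa using hP3.pow (d - 1))
    hΦ.isHomogeneous_jacobian (hΦ.pow_dvd_jacobian (by omega) hr hP3 hP hP (by omega) h)
  refine ⟨⟨c' / (c * d), ?_⟩, c', hc'⟩
  have hJ := hΦ.jacobian_ne_zero (by omega) hr
  have hc : c ≠ 0 := by
    rintro rfl
    rw [C_0, zero_mul] at h
    exact hP.ne_zero (eq_zero_of_algHom_eq_zero hJ hP3 h)
  have hcd : c * d ≠ 0 := mul_ne_zero hc (Nat.cast_ne_zero.2 (by omega))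
  have h1 := jacobian_comp Φ ![P, X 1, X 2]
  have h2 : jacobian ![P, X 1, X 2] = pderiv 0 P := by
    rw [jacobian_eq]; simp [pderiv_X]
  have h3 : jacobian (fun i => Φ (![P, X 1, X 2] i)) =
      C (c * d) * P ^ (d - 1) * jacobian ![P, Φ (X 1), Φ (X 2)] := by
    rw [jacobian_eq, jacobian_eq]
    simp only [cons_val_zero, cons_val_one, cons_val, h, pderiv_C_mul, pderiv_pow, map_mul,
      map_natCast]
    ring
  rw [h2, h3, hc'] at h1
  have h4 : C (c' / (c * d)) * C (c * d) = (C c' : Poly3 k) := by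
    rw [← map_mul, div_mul_cancel₀ _ hcd]
  refine mul_left_cancel₀ (mul_ne_zero (C_ne_zero.2 hcd) (pow_ne_zero (d - 1) hP.ne_zero)) ?_
  rw [h1, ← h4]
  ring

theorem X_dvd_of_dropFirst [Infinite k] {g : Poly3 k} {n : ℕ} (hg : dropFirst k g = g)
    (hgn : g.IsHomogeneous n) {i j : Fin 3} (hij : i ≠ j) (hi : i ≠ 0) (hj : j ≠ 0)
    (h : eval (Pi.single i 1) g = 0) : X j ∣ g := by
  refine X_dvd_of_forall_eval fun v hv => ?_
  have h1 : eval v g = eval (fun l => v i * Pi.single (M := fun _ => k) i 1 l) g := by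
    rw [← coe_aeval_eq_eval, ← coe_aeval_eq_eval, RingHom.coe_coe, RingHom.coe_coe,
      aeval_of_dropFirst hg,
      aeval_of_dropFirst hg (fun l => v i * Pi.single (M := fun _ => k) i 1 l)]
    refine congrArg (fun v => aeval v g) (funext fun l => ?_)
    by_cases hl : l = 0
    · simp [hl]
    · by_cases hli : l = i
      · simp [hli]
      · obtain rfl : l = j := by omega
        simp [hv, hli]
  rw [h1, ← coe_aeval_eq_eval, RingHom.coe_coe, aeval_mul_left_of_isHomogeneous hgn,
    ← RingHom.coe_coe (aeval _), coe_aeval_eq_eval, h, mul_zero]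

theorem not_X_dvd {P : Poly3 k} (hP : Irreducible P) (hP3 : P.IsHomogeneous 3) (i : Fin 3) :
    ¬ X i ∣ P := by
  rintro ⟨T, rfl⟩
  rcases hP.isUnit_or_isUnit rfl with h | h
  · exact (X_prime (i := i)).not_isUnit h
  · obtain ⟨c, -, rfl⟩ := MvPolynomial.exists_C_of_isUnit h
    have h1 : (X i * C c : Poly3 k).IsHomogeneous (1 + 0) :=
      (isHomogeneous_X k i).mul (isHomogeneous_C _ c)
    have := h1.inj_right hP3 hP.ne_zero
    omega

theorem false_of_node [CharZero k] [IsAlgClosed k] (hd : 2 ≤ d) (hΦ : IsFormMap Φ d)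
    (hr : IsRegularMap Φ) {g : Poly3 k} (hg : dropFirst k g = g) (hg3 : g.IsHomogeneous 3)
    (hP : Irreducible (X 0 * X 1 * X 2 + g)) {c : k}
    (h : Φ (X 0 * X 1 * X 2 + g) = C c * (X 0 * X 1 * X 2 + g) ^ d) : False := by
  have hP3 : (X 0 * X 1 * X 2 + g).IsHomogeneous 3 :=
    (((isHomogeneous_X k 0).mul (isHomogeneous_X k 1)).mul (isHomogeneous_X k 2)).add hg3
  obtain ⟨⟨κ, hκ⟩, c', hc'⟩ := exists_jacobian_eq_of_apply hd hΦ hr hP hP3 h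
  refine false_of_nodal_cubic hd hΦ hr hg hg3 (fun h0 => ?_) (fun h0 => ?_) h (κ := κ) ?_ ?_
  · refine not_X_dvd hP hP3 2 (dvd_add (dvd_mul_left _ _) ?_)
    exact X_dvd_of_dropFirst hg hg3 (i := 1) (by decide) (by decide) (by decide) h0
  · refine not_X_dvd hP hP3 1 (dvd_add ((dvd_mul_left _ _).mul_right _) ?_)
    exact X_dvd_of_dropFirst hg hg3 (i := 2) (by decide) (by decide) (by decide) h0
  · rw [hκ, map_add, pderiv_zero_of_dropFirst hg]
    simp [pderiv_X]
    left; ring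
  · intro hX
    have hc0 : c' ≠ 0 := by
      rintro rfl
      exact hΦ.jacobian_ne_zero (by omega) hr (by simpa using hc')
    rw [hc', ((IsUnit.mk0 _ hc0).map C).dvd_mul_left] at hX
    exact not_X_dvd hP hP3 2 (X_prime.dvd_of_dvd_pow hX)

theorem false_of_cusp [CharZero k] [IsAlgClosed k] (hd : 2 ≤ d) (hΦ : IsFormMap Φ d)
    (hr : IsRegularMap Φ) {g : Poly3 k} (hg : dropFirst k g = g) (hg3 : g.IsHomogeneous 3)
    (hP : Irreducible (X 0 * X 1 ^ 2 + g)) {c : k}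
    (h : Φ (X 0 * X 1 ^ 2 + g) = C c * (X 0 * X 1 ^ 2 + g) ^ d) : False := by
  have hP3 : (X 0 * X 1 ^ 2 + g).IsHomogeneous 3 :=
    ((isHomogeneous_X k 0).mul ((isHomogeneous_X k 1).pow 2)).add hg3
  obtain ⟨⟨κ, hκ⟩, -⟩ := exists_jacobian_eq_of_apply hd hΦ hr hP hP3 h
  refine false_of_cuspidal_cubic hd hΦ hr hg hg3 (fun h0 => ?_) h (κ := κ) ?_
  · refine not_X_dvd hP hP3 1 (dvd_add ((dvd_pow_self _ two_ne_zero).mul_left _) ?_)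
    exact X_dvd_of_dropFirst hg hg3 (i := 2) (by decide) (by decide) (by decide) h0
  · rw [hκ, map_add, pderiv_zero_of_dropFirst hg]
    simp [pderiv_X]

/-- Linear changes of coordinates fixing the point `(1, 0, 0)` and the line `X₀ = 0`. -/
theorem exists_isLin_block {t a b a' b' : k} (ht : t ≠ 0) (h : a * b' - b * a' ≠ 0) :
    ∃ l : Poly3 k ≃ₐ[k] Poly3 k, IsLin l ∧ l (X 0) = C t * X 0 ∧
      l (X 1) = C a * X 1 + C b * X 2 ∧ l (X 2) = C a' * X 1 + C b' * X 2 ∧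
      ∀ g, dropFirst k g = g → dropFirst k (l g) = l g ∧ dropFirst k (l.symm g) = l.symm g := by
  obtain ⟨l, hl, hl'⟩ := exists_isLin_of_det_ne_zero (M := !![t, 0, 0; 0, a, b; 0, a', b'])
    (by simpa [det_fin_three, mul_assoc, ← mul_sub, ht] using h)
  have h0 : l (X 0) = C t * X 0 := by rw [hl']; simp [Fin.sum_univ_three]
  have h1 : l (X 1) = C a * X 1 + C b * X 2 := by rw [hl']; simp [Fin.sum_univ_three]
  have h2 : l (X 2) = C a' * X 1 + C b' * X 2 := by rw [hl']; simp [Fin.sum_univ_three]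
  have hcomm : ∀ T, dropFirst k (l T) = l (dropFirst k T) := by
    intro T
    refine DFunLike.congr_fun (f := (dropFirst k).comp (l : Hom3 k))
      (g := (l : Hom3 k).comp (dropFirst k)) (MvPolynomial.algHom_ext fun i => ?_) T
    fin_cases i <;> simp [h0, h1, h2, dropFirst_X]
  refine ⟨l, hl, h0, h1, h2, fun g hg => ⟨by rw [hcomm, hg], l.injective ?_⟩⟩
  rw [← hcomm, AlgEquiv.apply_symm_apply, hg]

theorem exists_eq_of_dropFirst {L : Poly3 k} (hL : L.IsHomogeneous 1) (h : dropFirst k L = L) :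
    ∃ a b, L = C a * X 1 + C b * X 2 := by
  obtain ⟨a, rfl⟩ := exists_eq_sum_of_isHomogeneous_one hL
  refine ⟨a 1, a 2, ?_⟩
  conv_lhs => rw [← h]
  simp [Fin.sum_univ_three, dropFirst_X]

theorem not_irreducible_of_dropFirst [CharZero k] [IsAlgClosed k] {g : Poly3 k}
    (hg : dropFirst k g = g) (hg3 : g.IsHomogeneous 3) : ¬ Irreducible g := by
  intro hgi
  obtain ⟨v, hv, hv0, hvg⟩ := exists_common_zero (isHomogeneous_X k 0) hg3 one_pos (by norm_num)
  rw [eval_X] at hv0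
  obtain ⟨a, b, hab⟩ : ∃ a b : k, v 1 * b - a * v 2 ≠ 0 := by
    by_cases h1 : v 1 = 0
    · refine ⟨-1, 0, fun h2 => hv ?_⟩
      ext i
      fin_cases i
      · exact hv0
      · exact h1
      · simpa using h2
    · exact ⟨0, 1, by simpa using h1⟩
  obtain ⟨l, hl, l0, l1, l2, hlg⟩ := exists_isLin_block one_ne_zero hab
  have hl1 : eval (Pi.single 1 1) (l g) = 0 := by
    rw [← hvg]
    refine (eval_algHom_apply (l : Hom3 k) _ g).trans (congrArg (fun v => eval v g) (funext ?_))
    intro i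
    fin_cases i <;> simp [l0, l1, l2, hv0]
  exact not_X_dvd ((MulEquiv.irreducible_iff l).2 hgi) (hl.apply hg3) 2
    (X_dvd_of_dropFirst (hlg g hg).1 (hl.apply hg3) (by decide) (by decide) (by decide) hl1)

theorem dropFirst_dropFirst (T : Poly3 k) : dropFirst k (dropFirst k T) = dropFirst k T := by
  refine DFunLike.congr_fun (f := (dropFirst k).comp (dropFirst k)) (g := dropFirst k)
    (MvPolynomial.algHom_ext fun i => ?_) T
  rw [AlgHom.comp_apply, dropFirst_X]
  split_ifs with hi
  · exact map_zero _
  · rw [dropFirst_X, if_neg hi]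

theorem isHomogeneous_dropFirst {T : Poly3 k} {n : ℕ} (hT : T.IsHomogeneous n) :
    (dropFirst k T).IsHomogeneous n := by
  have h : IsFormMap (dropFirst k) 1 := fun i => by
    rw [dropFirst_X]
    split_ifs
    · exact isHomogeneous_zero _ _ _
    · exact isHomogeneous_X _ _
  simpa using h.apply hT

theorem X_zero_dvd_sub_dropFirst [Infinite k] (T : Poly3 k) : X 0 ∣ T - dropFirst k T := by
  refine X_dvd_of_forall_eval fun v hv => ?_
  rw [map_sub, eval_algHom_apply, sub_eq_zero]
  refine congrArg (fun v => eval v T) (funext fun i => ?_)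
  rw [dropFirst_X]
  split_ifs with hi <;> simp [hi, hv]

theorem eval_pderiv_of_dropFirst {g : Poly3 k} {n : ℕ} (hg : dropFirst k g = g)
    (hgn : g.IsHomogeneous n) (hn : 2 ≤ n) (i : Fin 3) : eval (Pi.single 0 1) (pderiv i g) = 0 := by
  have h := derivation_algHom_apply (pderiv i) (dropFirst k) g
  have h0 : ∀ j, eval (Pi.single 0 1) (dropFirst k (pderiv j g)) = 0 := fun j => by
    rw [eval_algHom_apply]
    refine eval_zero_of_isHomogeneous hgn.pderiv (by omega) (funext fun l => ?_)
    rw [dropFirst_X]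
    split_ifs with hl <;> simp [hl]
  rw [hg] at h
  rw [h, map_sum]
  exact Finset.sum_eq_zero fun j _ => by rw [map_mul, h0, zero_mul]

/-- A singular cubic, written in coordinates centred at a singular point. -/
theorem exists_eq_of_singular [CharZero k] [IsAlgClosed k] {P : Poly3 k} (hP : P.IsHomogeneous 3)
    (hs : ∀ i, eval (Pi.single 0 1) (pderiv i P) = 0) :
    ∃ L M g : Poly3 k, L.IsHomogeneous 1 ∧ M.IsHomogeneous 1 ∧ g.IsHomogeneous 3 ∧
      dropFirst k L = L ∧ dropFirst k M = M ∧ dropFirst k g = g ∧ P = X 0 * (L * M) + g := by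
  have hg := dropFirst_dropFirst P
  have hg3 := isHomogeneous_dropFirst hP
  obtain ⟨U, hU⟩ := X_zero_dvd_sub_dropFirst P
  rcases eq_or_ne (P - dropFirst k P) 0 with h0 | h0
  · refine ⟨0, 0, dropFirst k P, isHomogeneous_zero _ _ _, isHomogeneous_zero _ _ _, hg3,
      map_zero _, map_zero _, hg, ?_⟩
    linear_combination h0
  obtain ⟨U', hU', hU2, -⟩ := (isHomogeneous_X k 0).exists_mul_eq (hP.sub hg3) h0 ⟨U, hU⟩
  obtain ⟨a, b, c, p, q, r, hU''⟩ := exists_eq_of_isHomogeneous_two hU2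
  have hPU : P = X 0 * U' + dropFirst k P := by linear_combination hU'
  have he : ∀ i, eval (Pi.single 0 1) (pderiv i (X 0 * U')) = 0 := fun i => by
    have := hs i
    rwa [hPU, map_add, map_add, eval_pderiv_of_dropFirst hg hg3 (by norm_num), add_zero] at this
  have ha := he 0
  have hb := he 1
  have hp := he 2
  rw [hU''] at ha hb hp
  simp [pderiv_X] at ha hb hp
  have ha' : a = 0 := by
    have : (3 : k) * a = 0 := by linear_combination ha
    simpa using this
  obtain ⟨A, B, hA, hB, hAB⟩ := exists_mul_eq_binary c q r
  obtain ⟨l, hl, hl'⟩ := exists_isLin_monomial (t := fun _ => (1 : k)) (fun _ => one_ne_zero)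
    (finRotate 3)
  have hl0 : l (X 0) = X 1 := by simpa using hl' 0
  have hl1 : l (X 1) = X 2 := by simpa using hl' 1
  refine ⟨dropFirst k (l A), dropFirst k (l B), dropFirst k P,
    isHomogeneous_dropFirst (hl.apply hA),
    isHomogeneous_dropFirst (hl.apply hB), hg3, dropFirst_dropFirst _, dropFirst_dropFirst _, hg,
    ?_⟩
  rw [← map_mul, ← map_mul, ← hAB]
  conv_lhs => rw [hPU, hU'']
  simp [hl0, hl1, algEquiv_C, dropFirst_X, ha', hb, hp]

theorem false_of_singular_cubic_zero [CharZero k] [IsAlgClosed k] (hd : 2 ≤ d)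
    (hΦ : IsFormMap Φ d) (hr : IsRegularMap Φ) {P : Poly3 k} (hP : Irreducible P)
    (hP3 : P.IsHomogeneous 3) (hs : ∀ i, eval (Pi.single 0 1) (pderiv i P) = 0) {c : k}
    (h : Φ P = C c * P ^ d) : False := by
  obtain ⟨L, M, g, hL, hM, hg3, hL', hM', hg, rfl⟩ := exists_eq_of_singular hP3 hs
  obtain ⟨a, b, rfl⟩ := exists_eq_of_dropFirst hL hL'
  obtain ⟨a', b', rfl⟩ := exists_eq_of_dropFirst hM hM'
  have hLM : (C a * X 1 + C b * X 2) * (C a' * X 1 + C b' * X 2) ≠ (0 : Poly3 k) := by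
    intro h0
    rw [h0, mul_zero, zero_add] at hP
    exact not_irreducible_of_dropFirst hg hg3 hP
  by_cases hdet : a * b' - b * a' = 0
  · obtain ⟨t, ht0, ht⟩ : ∃ t : k, t ≠ 0 ∧ (C a' * X 1 + C b' * X 2 : Poly3 k) =
        C t * (C a * X 1 + C b * X 2) := by
      by_cases ha : a = 0
      · have hb : b ≠ 0 := fun hb => hLM (by simp [ha, hb])
        have ha' : a' = 0 := by simpa [ha, hb] using hdet
        have hb' : b' ≠ 0 := fun hb' => hLM (by simp [ha', hb'])
        refine ⟨b' / b, div_ne_zero hb' hb, ?_⟩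
        rw [ha, ha', ← div_mul_cancel₀ b' hb, map_mul, div_mul_cancel₀ b' hb]
        simp [mul_assoc]
      · have hb' : b' = b * a' / a := by field_simp; linear_combination hdet
        have ha' : a' ≠ 0 := fun ha' => hLM (by simp [hb', ha'])
        refine ⟨a' / a, div_ne_zero ha' ha, ?_⟩
        have h1 : C (a' / a) * C a = (C a' : Poly3 k) := by
          rw [← map_mul, div_mul_cancel₀ _ ha]
        have h2 : C (a' / a) * C b = (C b' : Poly3 k) := by
          rw [← map_mul, hb']; congr 1; ring
        linear_combination -X 1 * h1 - X 2 * h2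
    obtain ⟨x, y, hxy⟩ : ∃ x y : k, a * y - b * x ≠ 0 := by
      by_cases ha : a = 0
      · refine ⟨1, 0, fun h0 => hLM ?_⟩
        have hb : b = 0 := by simpa using h0
        simp [ha, hb]
      · exact ⟨0, 1, by simpa using ha⟩
    obtain ⟨l, hl, l0, l1, l2, hlg⟩ := exists_isLin_block ht0 hxy
    have hlP : X 0 * ((C a * X 1 + C b * X 2) * (C a' * X 1 + C b' * X 2)) + g =
        l (X 0 * X 1 ^ 2 + l.symm g) := by
      rw [map_add, map_mul, map_pow, l0, l1, ht, AlgEquiv.apply_symm_apply]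
      ring
    rw [hlP] at hP h
    refine false_of_cusp hd (hΦ.conj hl.symm hl.symm) (hr.conj hl.symm) (hlg g hg).2
      (hl.symm.apply hg3) ((MulEquiv.irreducible_iff l).1 hP) (c := c) ?_
    rw [Hom3.conj_apply, AlgEquiv.symm_symm, h, map_mul, map_pow, algEquiv_C,
      AlgEquiv.symm_apply_apply]
  · obtain ⟨l, hl, l0, l1, l2, hlg⟩ := exists_isLin_block one_ne_zero hdet
    have hlP : X 0 * ((C a * X 1 + C b * X 2) * (C a' * X 1 + C b' * X 2)) + g =
        l (X 0 * X 1 * X 2 + l.symm g) := by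
      rw [map_add, map_mul, map_mul, l0, l1, l2, AlgEquiv.apply_symm_apply, C_1]
      ring
    rw [hlP] at hP h
    refine false_of_node hd (hΦ.conj hl.symm hl.symm) (hr.conj hl.symm) (hlg g hg).2
      (hl.symm.apply hg3) ((MulEquiv.irreducible_iff l).1 hP) (c := c) ?_
    rw [Hom3.conj_apply, AlgEquiv.symm_symm, h, map_mul, map_pow, algEquiv_C,
      AlgEquiv.symm_apply_apply]

/-- An irreducible singular cubic is not totally invariant under an endomorphism of the plane. -/
theorem false_of_singular_cubic [CharZero k] [IsAlgClosed k] (hd : 2 ≤ d)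
    (hΦ : IsFormMap Φ d) (hr : IsRegularMap Φ) {P : Poly3 k} (hP : Irreducible P)
    (hP3 : P.IsHomogeneous 3) {p : Fin 3 → k} (hp : p ≠ 0) (hs : ∀ i, eval p (pderiv i P) = 0)
    {c : k} (h : Φ P = C c * P ^ d) : False := by
  obtain ⟨l, hl, hlp⟩ := exists_isLin_eval hp 0
  refine false_of_singular_cubic_zero hd (hΦ.conj hl hl) (hr.conj hl)
    ((MulEquiv.irreducible_iff l).2 hP) (hl.apply hP3) (fun i => ?_) (c := c) ?_
  · have h1 : pderiv i (l P) = _ := derivation_algHom_apply (pderiv i) (l : Hom3 k) P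
    rw [h1, map_sum]
    refine Finset.sum_eq_zero fun j _ => ?_
    rw [map_mul, AlgEquiv.coe_toAlgHom, hlp, hs, zero_mul]
  · rw [Hom3.conj_apply, AlgEquiv.symm_apply_apply, h, map_mul, map_pow, algEquiv_C]

end SingularCubic

section Main

variable {k : Type*} [Field k] {d : ℕ} {Φ Γ η κ : Hom3 k} {e e' : ℕ} {A B : Poly3 k}

theorem exists_ne_ne (i j : Fin 3) : ∃ l, l ≠ i ∧ l ≠ j := by
  revert i j
  decide

theorem mul_eval_pderiv_eq_zero {T : Poly3 k} {p : Fin 3 → k} {i j l : Fin 3} (hij : i ≠ j)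
    (hli : l ≠ i) (hlj : l ≠ j)
    (h : eval p (jacobian ![T, C (p j) * X l - C (p l) * X j, X j]) = 0) :
    p j * eval p (pderiv i T) = 0 := by
  rw [jacobian_eq] at h
  simp only [cons_val_zero, cons_val_one, cons_val, map_sub, map_add, map_mul, pderiv_C_mul,
    pderiv_X, eval_C] at h
  fin_cases i <;> fin_cases j <;> fin_cases l <;>
    first
    | exact absurd rfl hij
    | exact absurd rfl hli
    | exact absurd rfl hlj
    | simpa [Pi.single_apply, mul_comm] using h

/-- The point to which `κ` contracts a cubic is a singular point of the cubic on the other side. -/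
theorem BirConj.eval_pderiv_eq_zero [IsAlgClosed k] [CharZero k] (h : BirConj d Φ Γ η κ e e' A B)
    {P Q : Fin 1 → Poly3 k} (hP : FactorBasis A P fun _ => 3) (hQ : FactorBasis B Q fun _ => 3)
    {p : Fin 3 → k} (hp : p ≠ 0) (hp' : ∀ i j, Q 0 ∣ C (p i) * κ (X j) - C (p j) * κ (X i))
    (i : Fin 3) : eval p (pderiv i (P 0)) = 0 := by
  have he' : 0 < e' := Nat.pos_of_mul_pos_left h.pos
  obtain ⟨b, N, hb, hN, hN', -⟩ := h.symm.exists_exponents hQ hP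
  have hN0 : N 0 0 = e' := by
    have := hN' 0
    rw [Fin.sum_univ_one] at this
    omega
  have hκP : κ (P 0) = C (b 0) * Q 0 ^ e' := by rw [hN, Fin.prod_univ_one, hN0]
  obtain ⟨c, n, hc, hJ, hn⟩ := h.symm.exists_jacobian_eq hQ
  obtain rfl : n = e' - 1 := by omega
  have hQ0 := (hQ.irr 0).ne_zero
  have key : ∀ i j, eval p (jacobian ![P 0, C (p i) * X j - C (p j) * X i, X i]) = 0 := by
    intro i j
    have hT : (jacobian ![P 0, C (p i) * X j - C (p j) * X i, X i]).IsHomogeneous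
        (3 - 1 + (1 - 1) + (1 - 1)) :=
      isHomogeneous_jacobian (hP.hom 0)
        (((isHomogeneous_X k j).C_mul _).sub ((isHomogeneous_X k i).C_mul _)) (isHomogeneous_X k i)
    rw [← h.symm.dvd_apply_iff (hQ.irr 0) hp hp' hT]
    obtain ⟨R, hR⟩ := hp' i j
    have h1 := jacobian_comp κ ![P 0, C (p i) * X j - C (p j) * X i, X i]
    have h2 : (fun l => κ (![P 0, C (p i) * X j - C (p j) * X i, X i] l)) =
        ![C (b 0) * Q 0 ^ e', Q 0 * R, κ (X i)] := by
      ext1 l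
      fin_cases l
      · exact hκP
      · rw [← hR]; simp
      · rfl
    have h3 : jacobian ![C (b 0) * Q 0 ^ e', Q 0 * R, κ (X i)] =
        Q 0 ^ (e' - 1) * (Q 0 * (C (b 0) * (e' : Poly3 k) * jacobian ![Q 0, R, κ (X i)])) := by
      rw [jacobian_eq, jacobian_eq]
      simp only [cons_val_zero, cons_val_one, cons_val, pderiv_pow, Derivation.leibniz,
        pderiv_C, smul_eq_mul]
      ring
    rw [h2, h3, hJ] at h1
    generalize jacobian ![Q 0, R, κ (X i)] = u at h1
    generalize κ (jacobian ![P 0, C (p i) * X j - C (p j) * X i, X i]) = w at h1 ⊢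
    have h4 : Q 0 * (C (b 0) * (e' : Poly3 k) * u) = C c * w :=
      mul_left_cancel₀ (pow_ne_zero (e' - 1) hQ0) (h1.trans (by ring))
    exact (((IsUnit.mk0 _ hc).map C).dvd_mul_left).1 ⟨_, h4.symm⟩
  have hoff : ∀ i j, i ≠ j → p j * eval p (pderiv i (P 0)) = 0 := by
    intro i j hij
    obtain ⟨l, hli, hlj⟩ := exists_ne_ne i j
    exact mul_eval_pderiv_eq_zero hij hli hlj (key j l)
  obtain ⟨m, hm⟩ := Function.ne_iff.1 hp
  have hne : ∀ i, i ≠ m → eval p (pderiv i (P 0)) = 0 := fun i hi =>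
    (mul_eq_zero.1 (hoff i m hi)).resolve_left hm
  by_cases hi : i = m
  · subst hi
    have h0 : eval p (P 0) = 0 := by
      rw [← h.symm.dvd_apply_iff (hQ.irr 0) hp hp' (hP.hom 0), hκP]
      exact (dvd_pow_self _ he'.ne').mul_left _
    have h1 := congrArg (eval p) (hP.hom 0).sum_X_mul_pderiv
    rw [map_nsmul, h0, nsmul_zero, map_sum, Finset.sum_eq_single i] at h1
    · rw [map_mul, eval_X] at h1
      exact (mul_eq_zero.1 h1).resolve_left hm
    · intro j _ hj
      rw [map_mul, hne j hj, mul_zero]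
    · simp
  · exact hne i hi

theorem BirConj.false_of_cubic [IsAlgClosed k] [CharZero k] (h : BirConj d Φ Γ η κ e e' A B)
    {P Q : Fin 1 → Poly3 k} (hP : FactorBasis A P fun _ => 3) (hQ : FactorBasis B Q fun _ => 3) :
    False := by
  obtain ⟨p, hp, hp'⟩ := h.symm.exists_point (hQ.irr 0) (hQ.dvd 0)
  have hd := h.two_le
  obtain ⟨σ, m, c, hσ⟩ := hP.exists_permutesFactors (by omega) h.formΦ h.regΦ h.apply_A
  refine false_of_singular_cubic hd h.formΦ h.regΦ (hP.irr 0) (hP.hom 0) hp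
    (h.eval_pderiv_eq_zero hP hQ hp hp') (c := c 0) ?_
  have hm : m 0 = d := by have := hσ.deg 0; omega
  rw [hσ.apply, hm, Subsingleton.elim (σ 0) 0]

theorem FactorBasis.degree_dvd {n : ℕ} {P : Fin 1 → Poly3 k} {δ : Fin 1 → ℕ}
    (hP : FactorBasis A P δ) (hA : A.IsHomogeneous n) (hA0 : A ≠ 0) : δ 0 ∣ n := by
  obtain ⟨c, m, hc, hm⟩ := hP.eq_prod hA0 fun _ _ h => h
  have := hP.isHomogeneous_prod c m
  rw [← hm] at this
  rw [hA.inj_right this hA0, Fin.sum_univ_one]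
  exact dvd_mul_right _ _

theorem FactorBasis.degree_cases [IsAlgClosed k] [CharZero k] {ι : Type*} [Fintype ι]
    {P : ι → Poly3 k} {δ : ι → ℕ} (hP : FactorBasis A P δ) (hd : 2 ≤ d) (hΦ : IsFormMap Φ d)
    (hr : IsRegularMap Φ) (hA : Φ A = A ^ d) :
    ∑ i, δ i ≤ 3 ∧ ∀ i, δ i = 1 ∨ δ i = 3 := by
  obtain ⟨σ, m, c, hσ⟩ := hP.exists_permutesFactors (by omega) hΦ hr hA
  have hs := hσ.sum_le hP hd hΦ hr
  refine ⟨hs, fun i => ?_⟩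
  have h1 := hP.pos i
  have h2 := hσ.ne_two hP hd hΦ hr i
  have h3 := Finset.single_le_sum (f := δ) (fun _ _ => Nat.zero_le _) (Finset.mem_univ i)
  omega

theorem FactorBasis.degree_eq_one [IsAlgClosed k] [CharZero k] {ι : Type*} [Fintype ι]
    {P : ι → Poly3 k} {δ : ι → ℕ} (hP : FactorBasis A P δ) (hd : 2 ≤ d) (hΦ : IsFormMap Φ d)
    (hr : IsRegularMap Φ) (hA : Φ A = A ^ d) (hι : 2 ≤ Fintype.card ι) : δ = fun _ => 1 := by
  classical
  obtain ⟨h1, h2⟩ := hP.degree_cases hd hΦ hr hA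
  ext i
  refine (h2 i).resolve_right fun h3 => ?_
  obtain ⟨j, hj⟩ := Fintype.exists_ne_of_one_lt_card (by omega) i
  have h4 := Finset.sum_le_sum_of_subset (f := δ) (Finset.subset_univ {i, j})
  rw [Finset.sum_pair hj.symm] at h4
  have := hP.pos j
  omega

theorem BirConj.eq_of_single_factor [IsAlgClosed k] [CharZero k] (h : BirConj d Φ Γ η κ e e' A B)
    {P Q : Fin 1 → Poly3 k} {δ ε : Fin 1 → ℕ} (hP : FactorBasis A P δ) (hQ : FactorBasis B Q ε)
    (hee : e = e') (hδ : δ 0 = 3) : ε 0 ≠ 1 := by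
  intro hε
  obtain ⟨b, N, hb, hN, hN', -⟩ := h.exists_exponents hP hQ
  have h1 := hN' 0
  rw [Fin.sum_univ_one, hδ, hε, mul_one] at h1
  have h2 := hP.degree_dvd h.isHomogeneous_A h.A_ne_zero
  rw [hδ, ← hee] at h2
  have h3 := h.pos
  rw [← hee] at h3
  have h4 : 3 ∣ e * e := Dvd.dvd.mul_right ⟨_, h1.symm⟩ e
  omega

theorem BirConj.false_of_single_factor [IsAlgClosed k] [CharZero k]
    (h : BirConj d Φ Γ η κ e e' A B) (he : 2 ≤ e) {P Q : Fin 1 → Poly3 k} {δ ε : Fin 1 → ℕ}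
    (hP : FactorBasis A P δ) (hQ : FactorBasis B Q ε) : False := by
  have hee : e = e' := le_antisymm (h.le_degree hP) (h.symm.le_degree hQ)
  obtain ⟨-, h1⟩ := hP.degree_cases h.two_le h.formΦ h.regΦ h.apply_A
  obtain ⟨-, h2⟩ := hQ.degree_cases h.two_le h.formΓ h.regΓ h.symm.apply_A
  have eq : ∀ {δ : Fin 1 → ℕ} {n}, δ 0 = n → δ = fun _ => n := fun h =>
    funext fun i => by rw [Subsingleton.elim i 0, h]
  rcases h1 0 with h1 | h1 <;> rcases h2 0 with h2 | h2
  · exact h.false_of_line he (eq h1 ▸ hP) (eq h2 ▸ hQ)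
  · exact h.symm.eq_of_single_factor hQ hP hee.symm h2 h1
  · exact h.eq_of_single_factor hP hQ hee h1 h2
  · exact h.false_of_cubic (eq h1 ▸ hP) (eq h2 ▸ hQ)

theorem BirConj.linConj [IsAlgClosed k] [CharZero k] (h : BirConj d Φ Γ η κ e e' A B) :
    LinConj Φ Γ := by
  by_cases he1 : e = 1
  · subst he1
    exact h.linConj_of_eq_one
  have he : 2 ≤ e := by
    have := Nat.pos_of_mul_pos_right h.pos
    omega
  obtain ⟨r, P, δ, hP⟩ := exists_factorBasis h.isHomogeneous_A h.A_ne_zero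
  obtain ⟨r', Q, ε, hQ⟩ := exists_factorBasis h.symm.isHomogeneous_A h.symm.A_ne_zero
  obtain rfl : r' = r := le_antisymm (by simpa using h.card_le hP hQ)
    (by simpa using h.symm.card_le hQ hP)
  have hδ := hP.degree_eq_one h.two_le h.formΦ h.regΦ h.apply_A
  have hε := hQ.degree_eq_one h.two_le h.formΓ h.regΓ h.symm.apply_A
  have hr : r' ≤ 3 := by
    have h1 := (hP.degree_cases h.two_le h.formΦ h.regΦ h.apply_A).1
    have h2 : r' ≤ ∑ i, δ i := by
      simpa using Finset.card_nsmul_le_sum Finset.univ δ 1 fun i _ => hP.pos i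
    omega
  rw [Fintype.card_fin] at hδ hε
  interval_cases r'
  · obtain ⟨c, n, hc, hn⟩ := hP.eq_prod h.A_ne_zero fun _ _ h => h
    rw [Fin.prod_univ_zero, mul_one] at hn
    have h1 := h.isHomogeneous_A.inj_right (hn ▸ isHomogeneous_C _ c) h.A_ne_zero
    have h2 := h.pos
    have h3 : e * e' = 1 := by omega
    exact absurd (Nat.eq_one_of_mul_eq_one_right h3) he1
  · exact (h.false_of_single_factor he hP hQ).elim
  · exact h.linConj_of_two he (hδ le_rfl ▸ hP) (hε le_rfl ▸ hQ)
  · exact h.linConj_of_three (hδ (by norm_num) ▸ hP) (hε (by norm_num) ▸ hQ)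

end Main

section Final

variable {k : Type*} [Field k]

theorem LinConj.exists_matrix {F G : Fin 3 → Poly3 k}
    (h : LinConj (aeval F : Hom3 k) (aeval G)) :
    ∃ (M : GL (Fin 3) k) (c : kˣ), ∀ v : Fin 3 → k,
      (M : Matrix (Fin 3) (Fin 3) k).mulVec (fun i => eval v (F i)) =
        (c : k) • fun i => eval ((M : Matrix (Fin 3) (Fin 3) k).mulVec v) (G i) := by
  obtain ⟨l, hl, e⟩ := h
  have key : ∀ m : Poly3 k ≃ₐ[k] Poly3 k, IsLin m →
      ∃ M : Matrix (Fin 3) (Fin 3) k, (m : Hom3 k) = linHom M := by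
    intro m hm
    choose M hM using fun i => exists_eq_sum_of_isHomogeneous_one (hm.form i)
    exact ⟨Matrix.of M, MvPolynomial.algHom_ext fun i => by rw [hM, linHom_X]; rfl⟩
  obtain ⟨M, hM⟩ := key l hl
  obtain ⟨N, hN⟩ := key l.symm hl.symm
  have inj : ∀ A : Matrix (Fin 3) (Fin 3) k, linHom A = AlgHom.id k _ → A = 1 := by
    intro A hA
    ext i j
    have := congrArg (fun T => coeff (Finsupp.single j 1) T) (DFunLike.congr_fun hA (X i))
    simp only [linHom_X, coeff_sum, coeff_C_mul, AlgHom.id_apply, coeff_X,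
      Finsupp.single_left_inj one_ne_zero] at this
    simpa [Finsupp.single_left_inj one_ne_zero, Matrix.one_apply] using this
  have h1 : M * N = 1 := inj _ <| by
    rw [← linHom_comp, ← hM, ← hN]
    ext1 i; simp
  have h2 : N * M = 1 := inj _ <| by
    rw [← linHom_comp, ← hM, ← hN]
    ext1 i; simp
  have hlT : ∀ T, l T = linHom M T := fun T => DFunLike.congr_fun hM T
  refine ⟨⟨M, N, h1, h2⟩, 1, fun v => ?_⟩
  funext i
  have hi := congrArg (eval v) (e (X i))
  rw [hlT, hlT, eval_algHom_apply (linHom M), linHom_X, map_sum, map_sum, aeval_X] at hi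
  simp only [linHom_X, map_sum, map_mul, eval_C, eval_X, Hom3.map_C, aeval_X] at hi
  rw [Units.val_one, one_smul]
  exact hi

end Final

/-- **Theorem A** (Cantat–Xie). If two endomorphisms of `ℙ²` of degree `d ≥ 2` over an
algebraically closed field of characteristic zero are conjugate by a birational self-map
(equivalently, their pullback actions on the function field `k(x,y)` are conjugate by a
`k`-algebra automorphism), then they are conjugate by a linear automorphism of `ℙ²`. -/
theorem birational_conjugacy_implies_linear_conjugacy
    (k : Type*) [Field k] [IsAlgClosed k] [CharZero k]
    (d : ℕ) (hd : 2 ≤ d)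
    (F G : Fin 3 → MvPolynomial (Fin 3) k)
    (hFhom : ∀ i, (F i).IsHomogeneous d) (hGhom : ∀ i, (G i).IsHomogeneous d)
    (hFnz : ∀ v : Fin 3 → k, v ≠ 0 → ∃ i, eval v (F i) ≠ 0)
    (hGnz : ∀ v : Fin 3 → k, v ≠ 0 → ∃ i, eval v (G i) ≠ 0)
    -- the pullback endomorphisms `f₁*`, `f₂*` of the function field `k(x,y)`
    (fstar₁ fstar₂ :
      FractionRing (MvPolynomial (Fin 2) k) →ₐ[k] FractionRing (MvPolynomial (Fin 2) k))
    (hf₁x : fstar₁ (algebraMap (MvPolynomial (Fin 2) k) _ (X 0)) =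
      algebraMap (MvPolynomial (Fin 2) k) _ (aeval ![X 0, X 1, 1] (F 0)) /
        algebraMap (MvPolynomial (Fin 2) k) _ (aeval ![X 0, X 1, 1] (F 2)))
    (hf₁y : fstar₁ (algebraMap (MvPolynomial (Fin 2) k) _ (X 1)) =
      algebraMap (MvPolynomial (Fin 2) k) _ (aeval ![X 0, X 1, 1] (F 1)) /
        algebraMap (MvPolynomial (Fin 2) k) _ (aeval ![X 0, X 1, 1] (F 2)))
    (hf₂x : fstar₂ (algebraMap (MvPolynomial (Fin 2) k) _ (X 0)) =
      algebraMap (MvPolynomial (Fin 2) k) _ (aeval ![X 0, X 1, 1] (G 0)) /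
        algebraMap (MvPolynomial (Fin 2) k) _ (aeval ![X 0, X 1, 1] (G 2)))
    (hf₂y : fstar₂ (algebraMap (MvPolynomial (Fin 2) k) _ (X 1)) =
      algebraMap (MvPolynomial (Fin 2) k) _ (aeval ![X 0, X 1, 1] (G 1)) /
        algebraMap (MvPolynomial (Fin 2) k) _ (aeval ![X 0, X 1, 1] (G 2)))
    -- a birational self-map of `ℙ²`, i.e. a `k`-algebra automorphism `φ` of `k(x,y)`,
    -- conjugating `f₁` to `f₂`: `f₁* ∘ φ = φ ∘ f₂*`
    (φ : FractionRing (MvPolynomial (Fin 2) k) ≃ₐ[k] FractionRing (MvPolynomial (Fin 2) k))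
    (hconj : ∀ u, fstar₁ (φ u) = φ (fstar₂ u)) :
    -- conclusion: `f₁` and `f₂` are conjugate by a linear automorphism of `ℙ²`
    ∃ (M : GL (Fin 3) k) (c : kˣ), ∀ v : Fin 3 → k,
      (M : Matrix (Fin 3) (Fin 3) k).mulVec (fun i => eval v (F i)) =
        (c : k) • fun i => eval ((M : Matrix (Fin 3) (Fin 3) k).mulVec v) (G i) := by
  have act : ∀ {ψ : FractionRing (MvPolynomial (Fin 2) k) →ₐ[k]
      FractionRing (MvPolynomial (Fin 2) k)} {P : Fin 3 → MvPolynomial (Fin 3) k},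
      (∀ i, (P i).IsHomogeneous d) → (∀ v : Fin 3 → k, v ≠ 0 → ∃ i, eval v (P i) ≠ 0) →
      ψ (algebraMap (MvPolynomial (Fin 2) k) _ (X 0)) =
        algebraMap (MvPolynomial (Fin 2) k) _ (aeval ![X 0, X 1, 1] (P 0)) /
          algebraMap (MvPolynomial (Fin 2) k) _ (aeval ![X 0, X 1, 1] (P 2)) →
      ψ (algebraMap (MvPolynomial (Fin 2) k) _ (X 1)) =
        algebraMap (MvPolynomial (Fin 2) k) _ (aeval ![X 0, X 1, 1] (P 1)) /
          algebraMap (MvPolynomial (Fin 2) k) _ (aeval ![X 0, X 1, 1] (P 2)) →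
      IsFormMap (aeval P : Hom3 k) d ∧ IsRegularMap (aeval P : Hom3 k) ∧
        ActsBy ψ (aeval P : Hom3 k) := by
    intro ψ P hP hr h0 h1
    have hf : IsFormMap (aeval P : Hom3 k) d := fun i => by rw [aeval_X]; exact hP i
    have hr' : IsRegularMap (aeval P : Hom3 k) := fun v hv => by simpa only [aeval_X] using hr v hv
    have h2 : dehomogenize k ((aeval P : Hom3 k) (X 2)) ≠ 0 := fun h =>
      IsRegularMap.ne_zero (by omega) hf hr' 2 (dehomogenize_eq_zero (hf 2) h)
    refine ⟨hf, hr', h2, fun i => ?_⟩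
    fin_cases i
    · simpa [dehomogenize_apply] using h0
    · simpa [dehomogenize_apply] using h1
    · exact ((congrArg ψ dehomogenize_X_two).trans (map_one ψ)).trans (div_self h2).symm
  obtain ⟨f1, r1, a1⟩ := act hFhom hFnz hf₁x hf₁y
  obtain ⟨f2, r2, a2⟩ := act hGhom hGnz hf₂x hf₂y
  obtain ⟨η, κ, e, e', A, B, h⟩ := exists_birConj hd f1 f2 r1 r2 φ a1 a2 hconj
  exact h.linConj.exists_matrix
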